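/- Let M₀ = (Q₀, Γ, Δ₀) be a complete deterministic reversible Turing machine and M its decorated symmetrized version (state set Q = Q₀ × {d_→,d_←} × G with G = {0,…,5}). Assume: (i) the moving-head action T_{M₀} : X → X of M₀ has infinite order; (ii) there exist constants C, C' > 0 such that the movement function of M₀ satisfies m(n) ≤ C·log n + C' for all n ≥ 1; and (iii) there exist p ≥ 1 and K > 0 such that for every ℓ ≥ 2 and every n ∈ ℕ, the permutation of C_ℓ (over states Q and alphabet Γ) that applies (T_{ℓ,M})^n to configurations whose head has duck d_→ and fixes all other configurations belongs to G_ℓ with word norm at most K·ℓ^p. Then there exists K' > 0 such that for all n ≥ 2, the automorphism (f_M)^n belongs to the finitely generated group G_* ≤ Aut(Σ^ℤ) with word norm at most K'·((log n)^{p+1} + (log n)²). -/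

import Mathlib

/-- The word norm of `g` with respect to the generating set `F`:
the least `n` such that `g` is a product of `n` elements of `F ∪ F⁻¹`. -/
noncomputable def wordNorm {G : Type*} [Group G] (F : Set G) (g : G) : ℕ :=
  sInf {n : ℕ | ∃ w : List G, w.length = n ∧ (∀ x ∈ w, x ∈ F ∨ x⁻¹ ∈ F) ∧ w.prod = g}
/-! ### Turing machine symbols and local step functions -/

/-- Tape/head symbols: a plain tape letter, or a head `(q, a)` on top of letter `a`. -/
abbrev TSym (Q Γ : Type) : Type := Γ ⊕ (Q × Γ)

/-- The tape letter carried by a cell (under the head if the cell carries the head). -/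
def tapeLetter {Q Γ : Type} : TSym Q Γ → Γ
  | Sum.inl a => a
  | Sum.inr (_, a) => a

/-- A complete deterministic machine is given by a head-step function: at `(q, a)` it either
rewrites the head in place (`.inl (q', b)`, a matching transition), or moves in direction
`δ ∈ {+1, -1}` into state `q'` (`.inr (δ, q')`, a move transition). -/
abbrev HeadStep (Q Γ : Type) : Type := Q → Γ → ((Q × Γ) ⊕ (ℤ × Q))

/-- If the symbol `s` carries a head about to move in direction `d`, the state in which the
head arrives; `none` otherwise. -/
def arrivesAs {Q Γ : Type} (δ : HeadStep Q Γ) (s : TSym Q Γ) (d : ℤ) : Option Q :=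
  match s with
  | Sum.inl _ => none
  | Sum.inr (q, a) =>
    match δ q a with
    | Sum.inl _ => none
    | Sum.inr (d', q') => if d' = d then some q' else none

/-- The local rule of the moving-head dynamics: the new symbol of a cell, given the symbols
`l, c, r` of its left neighbour, itself, and its right neighbour. -/
def localStep {Q Γ : Type} (δ : HeadStep Q Γ) (l c r : TSym Q Γ) : TSym Q Γ :=
  match c with
  | Sum.inr (q, a) =>
    (match δ q a with
     | Sum.inl qb => Sum.inr qb
     | Sum.inr _ => Sum.inl a)
  | Sum.inl a =>
    (match arrivesAs δ l 1 with
     | some q' => Sum.inr (q', a)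
     | none =>
       match arrivesAs δ r (-1) with
       | some q' => Sum.inr (q', a)
       | none => Sum.inl a)

/-- The moving-head action of a complete deterministic machine on bi-infinite tapes. -/
def stepZ {Q Γ : Type} (δ : HeadStep Q Γ) (x : ℤ → TSym Q Γ) : ℤ → TSym Q Γ :=
  fun i => localStep δ (x (i - 1)) (x i) (x (i + 1))

/-- The action of a complete deterministic machine on cyclic tapes of length `ℓ`. -/
def stepC {Q Γ : Type} (δ : HeadStep Q Γ) (ℓ : ℕ) (w : ZMod ℓ → TSym Q Γ) :
    ZMod ℓ → TSym Q Γ :=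
  fun i => localStep δ (w (i - 1)) (w i) (w (i + 1))

/-- A configuration has at most one head. -/
def AtMostOneHeadZ {Q Γ : Type} (x : ℤ → TSym Q Γ) : Prop :=
  ∀ i j : ℤ, (x i).isRight = true → (x j).isRight = true → i = j

/-- A cyclic configuration has at most one head. -/
def AtMostOneHeadC {Q Γ : Type} {ℓ : ℕ} (w : ZMod ℓ → TSym Q Γ) : Prop :=
  ∀ i j : ZMod ℓ, (w i).isRight = true → (w j).isRight = true → i = j

/-! ### The SMART machine -/

/-- The four arrows `▶, ◀, ▷, ◁` (filled right/left, hollow right/left). -/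
inductive Arrow : Type
  | rf  -- ▶ (filled right)
  | lf  -- ◀ (filled left)
  | rh  -- ▷ (hollow right)
  | lh  -- ◁ (hollow left)
deriving DecidableEq

/-- The SMART state set `Q̊`: an arrow with a subscript in `{1,2}`; the subscript `b`
is represented by the `Fin 2` value `b - 1`. -/
abbrev SQ : Type := Arrow × Fin 2

/-- The SMART tape alphabet `{0,1,2}`. -/
abbrev Letter : Type := Fin 3

/-- The head-step function of the SMART machine.  States `q₂` (second component `1`) are
move states; states `q₁` (second component `0`) are matching states. -/
def smartStep : HeadStep SQ Letter := fun q a =>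
  if q.2 = 1 then
    match q.1 with
    | .rf => Sum.inr (1, (.rf, 0))   -- (▶₂, +1, ▶₁)
    | .lf => Sum.inr (-1, (.lf, 0))  -- (◀₂, −1, ◀₁)
    | .rh => Sum.inr (1, (.rh, 0))   -- (▷₂, +1, ▷₁)
    | .lh => Sum.inr (-1, (.lh, 0))  -- (◁₂, −1, ◁₁)
  else
    match q.1 with
    | .rf => Sum.inl (if a = 0 then ((.lf, 1), 1) else if a = 1 then ((.lh, 1), 1) else ((.lh, 1), 2))
    | .lf => Sum.inl (if a = 0 then ((.rf, 1), 1) else if a = 1 then ((.rh, 1), 1) else ((.rh, 1), 2))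
    | .rh => Sum.inl (if a = 0 then ((.rf, 1), 2) else if a = 1 then ((.rf, 1), 0) else ((.lh, 1), 0))
    | .lh => Sum.inl (if a = 0 then ((.lf, 1), 2) else if a = 1 then ((.lf, 1), 0) else ((.rh, 1), 0))

/-! ### The group `G_ℓ` of Turing machine instructions on cyclic tapes -/

/-- Cyclic configurations of length `ℓ` with at most one head. -/
abbrev CConf (Q Γ : Type) (ℓ : ℕ) : Type :=
  {w : ZMod ℓ → TSym Q Γ // AtMostOneHeadC w}

/-- The pointwise action on symbols of a permutation `g` of head symbols. -/
def gateApply {Q Γ : Type} (g : Equiv.Perm (Q × Γ)) : TSym Q Γ → TSym Q Γ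
  | Sum.inl a => Sum.inl a
  | Sum.inr h => Sum.inr (g h)

/-- `π` is the unary gate `π_g`: it applies `g` to the head symbol (if a head is present)
and fixes all other cells. -/
def IsUnaryGate {Q Γ : Type} {ℓ : ℕ} (g : Equiv.Perm (Q × Γ))
    (π : Equiv.Perm (CConf Q Γ ℓ)) : Prop :=
  ∀ w : CConf Q Γ ℓ, ∀ i : ZMod ℓ, (π w).1 i = gateApply g (w.1 i)

/-- `π` is the state-dependent right move `ρ_q`: it moves a head in state `q` one position
to the right (mod `ℓ`), leaving its tape letter behind and picking up the next cell's
letter, and fixes configurations whose head is not in state `q`. -/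
def IsMoveGate {Q Γ : Type} [DecidableEq Q] {ℓ : ℕ} (q : Q)
    (π : Equiv.Perm (CConf Q Γ ℓ)) : Prop :=
  ∀ w : CConf Q Γ ℓ,
    ((∀ i a, w.1 i ≠ Sum.inr (q, a)) → π w = w) ∧
    (∀ i a, w.1 i = Sum.inr (q, a) →
      ∀ j : ZMod ℓ, (π w).1 j =
        if j = i + 1 then Sum.inr (q, tapeLetter (w.1 (i + 1)))
        else if j = i then Sum.inl a
        else w.1 j)

/-- The generating set of the group `G_ℓ` of Turing machine instructions: all unary gates
`π_g` and all state-dependent moves `ρ_q`. -/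
def TMGens (Q Γ : Type) [DecidableEq Q] (ℓ : ℕ) : Set (Equiv.Perm (CConf Q Γ ℓ)) :=
  {π | (∃ g, IsUnaryGate g π) ∨ (∃ q, IsMoveGate q π)}

/-! ### Turing machines as transition tables -/

/-- A transition of a Turing machine: a move transition `(q, δ, q')` or a matching
transition `(q, a, q', b)`. -/
abbrev Transition (Q Γ : Type) : Type := (Q × ℤ × Q) ⊕ (Q × Γ × Q × Γ)

/-- A Turing machine: a transition table whose move transitions have direction `±1`. -/
structure TMach (Q Γ : Type) where
  Δ : Set (Transition Q Γ)
  dir_mem : ∀ q δ q', Sum.inl (q, δ, q') ∈ Δ → δ = 1 ∨ δ = -1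

/-- The transition `t` applies to a head in state `q` reading letter `a`. -/
def TransApplies {Q Γ : Type} (q : Q) (a : Γ) : Transition Q Γ → Prop
  | Sum.inl (p, _, _) => p = q
  | Sum.inr (p, b, _, _) => p = q ∧ b = a

/-- The machine is complete deterministic: exactly one transition applies at each
`(q, a)`. -/
def CompleteDet {Q Γ : Type} (M : TMach Q Γ) : Prop :=
  ∀ q a, ∃! t, t ∈ M.Δ ∧ TransApplies q a t

/-- The reverse of a transition. -/
def revTrans {Q Γ : Type} : Transition Q Γ → Transition Q Γ
  | Sum.inl (q, δ, q') => Sum.inl (q', -δ, q)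
  | Sum.inr (q, a, q', b) => Sum.inr (q', b, q, a)

/-- The reverse machine `M⁻¹`; `M` is *reversible* if both `M` and `M⁻¹` are complete
deterministic. -/
def TMach.reverse {Q Γ : Type} (M : TMach Q Γ) : TMach Q Γ where
  Δ := revTrans '' M.Δ
  dir_mem := by
    rintro q δ q' ⟨t, ht, he⟩
    rcases t with ⟨p, d, p'⟩ | t
    · simp only [revTrans, Sum.inl.injEq, Prod.mk.injEq] at he
      obtain ⟨-, hd, -⟩ := he
      have := M.dir_mem p d p' ht
      omega
    · simp [revTrans] at he

/-- The head-step function of a complete deterministic machine, extracted from its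
transition table. -/
noncomputable def transFun {Q Γ : Type} (M : TMach Q Γ) (h : CompleteDet M) :
    HeadStep Q Γ := fun q a =>
  match (h q a).choose with
  | Sum.inl (_, δ, q') => Sum.inr (δ, q')
  | Sum.inr (_, _, q', b) => Sum.inl (q', b)

/-- The decorated state set: `Q = Q₀ × D × G` with duck `D = {d_→, d_←}` (as `Fin 2`,
`0 ↦ d_→`) and ghost `G = {0,…,5} ≃ {+1,−1} × {0,1,2}` (as `Bool × Fin 3`). -/
abbrev DecQ (Q₀ : Type) : Type := Q₀ × Fin 2 × (Bool × Fin 3)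

/-- The head-step function of the decorated symmetrized version `M` of `M₀`: it acts as
`M₀` on duck `d_→` and as `M₀⁻¹` on duck `d_←`, carrying duck and ghost unchanged. -/
noncomputable def decSymStep {Q₀ Γ : Type} (M₀ : TMach Q₀ Γ) (h₁ : CompleteDet M₀)
    (h₂ : CompleteDet M₀.reverse) : HeadStep (DecQ Q₀) Γ := fun q a =>
  match (if q.2.1 = 0 then transFun M₀ h₁ q.1 a else transFun M₀.reverse h₂ q.1 a) with
  | Sum.inl (q', b) => Sum.inl ((q', q.2), b)
  | Sum.inr (d, q') => Sum.inr (d, (q', q.2))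

/-- The sign component of the ghost of a decorated state. -/
def decSgn {Q₀ : Type} (q : DecQ Q₀) : Bool := q.2.2.1

/-- Replacing the sign component of the ghost of a decorated state. -/
def decSetSgn {Q₀ : Type} (q : DecQ Q₀) (s : Bool) : DecQ Q₀ := (q.1, q.2.1, (s, q.2.2.2))

/-! ### Conveyor belts -/

/-- The conveyor-belt alphabet `Σ = (Γ²×{±1}) ⊔ ((Q×Γ)×Γ) ⊔ (Γ×(Q×Γ))`: a headless cell
with top letter, bottom letter and conveyor bit (`true = +1`), or a cell carrying a head on
the top resp. bottom track. -/
inductive BSym (Q Γ : Type) : Type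
  | belt (a b : Γ) (s : Bool)
  | top (q : Q) (a : Γ) (b : Γ)
  | bot (a : Γ) (q : Q) (b : Γ)

namespace BSym

variable {Q Γ : Type}

/-- Whether the cell carries a head. -/
def isHead : BSym Q Γ → Bool
  | .belt _ _ _ => false
  | _ => true

/-- The top-track tape letter of a cell. -/
def topLetter : BSym Q Γ → Γ
  | .belt a _ _ => a
  | .top _ a _ => a
  | .bot a _ _ => a

/-- The bottom-track tape letter of a cell. -/
def botLetter : BSym Q Γ → Γ
  | .belt _ b _ => b
  | .top _ _ b => b
  | .bot _ _ b => b

/-- The cell is in `Γ²×{+1}` or carries a head. -/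
def plusOrHead : BSym Q Γ → Bool
  | .belt _ _ s => s
  | _ => true

/-- The cell is in `Γ²×{−1}` or carries a head. -/
def minusOrHead : BSym Q Γ → Bool
  | .belt _ _ s => !s
  | _ => true

/-- The top-track symbol of a cell, as a cell of a (cyclic) Turing machine tape. -/
def topSym : BSym Q Γ → TSym Q Γ
  | .belt a _ _ => Sum.inl a
  | .top q a _ => Sum.inr (q, a)
  | .bot a _ _ => Sum.inl a

/-- The bottom-track symbol of a cell, as a cell of a (cyclic) Turing machine tape. -/
def botSym : BSym Q Γ → TSym Q Γ
  | .belt _ b _ => Sum.inl b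
  | .top _ _ b => Sum.inl b
  | .bot _ q b => Sum.inr (q, b)

end BSym

variable {Q Γ : Type}

/-- The configuration `x` is cut between positions `i` and `i+1`. -/
def cutAfter (x : ℤ → BSym Q Γ) (i : ℤ) : Prop :=
  BSym.minusOrHead (x i) = true ∧ BSym.plusOrHead (x (i + 1)) = true

/-- `[s, e]` is a (finite) block of the configuration `x`. -/
def IsBlock (x : ℤ → BSym Q Γ) (s e : ℤ) : Prop :=
  s ≤ e ∧ cutAfter x (s - 1) ∧ cutAfter x e ∧ ∀ j : ℤ, s ≤ j → j < e → ¬ cutAfter x j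

/-- The block `[s, e]` of `x` contains a head. -/
def BlockHasHead (x : ℤ → BSym Q Γ) (s e : ℤ) : Prop :=
  ∃ j : ℤ, s ≤ j ∧ j ≤ e ∧ BSym.isHead (x j) = true

/-- Every position of `x` lies in a finite block. -/
def AllFiniteBlocks (x : ℤ → BSym Q Γ) : Prop :=
  ∀ i : ℤ, ∃ s e : ℤ, IsBlock x s e ∧ s ≤ i ∧ i ≤ e

/-- The cyclic tape obtained by unfolding the block `[s, e]` of `x` into its conveyor belt
of length `2(e−s+1)`: the word of top components followed by the reversed word of bottom
components. -/
def unfoldBlock (x : ℤ → BSym Q Γ) (s e : ℤ) :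
    ZMod (2 * (e - s + 1).toNat) → TSym Q Γ :=
  fun t =>
    if t.val < (e - s + 1).toNat then BSym.topSym (x (s + (t.val : ℤ)))
    else BSym.botSym (x (e - ((t.val - (e - s + 1).toNat : ℕ) : ℤ)))

/-- `y` is obtained from `x` by applying the `n`-th power of the machine with head-step
function `δ` to the conveyor belt of every head-containing block, refolding with conveyor
bits `+1` left of the head and `−1` right of it, and fixing head-free blocks. -/
def ActsAsBeltPower (δ : HeadStep Q Γ) (n : ℕ) (x y : ℤ → BSym Q Γ) : Prop :=
  ∀ s e : ℤ, IsBlock x s e →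
    (¬ BlockHasHead x s e → ∀ j : ℤ, s ≤ j → j ≤ e → y j = x j) ∧
    (BlockHasHead x s e →
      IsBlock y s e ∧
      unfoldBlock y s e =
        (stepC δ (2 * (e - s + 1).toNat))^[n] (unfoldBlock x s e) ∧
      (∀ j k : ℤ, s ≤ j → j ≤ e → s ≤ k → k ≤ e → BSym.isHead (y k) = true →
        ∀ a b : Γ, ∀ sg : Bool, y j = BSym.belt a b sg → (sg = true ↔ j < k)))

/-! ### The generators of the group of Turing machine instructions on conveyor belts -/

/-- Application of a permutation of head symbols to a cell (both tracks). -/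
def beltGateApply (g : Equiv.Perm (Q × Γ)) : BSym Q Γ → BSym Q Γ
  | .belt a b s => .belt a b s
  | .top q a b => .top (g (q, a)).1 (g (q, a)).2 b
  | .bot a q b => .bot a (g (q, b)).1 (g (q, b)).2

/-- Application of a permutation of head symbols to heads on the top track only. -/
def beltGateApplyUp (g : Equiv.Perm (Q × Γ)) : BSym Q Γ → BSym Q Γ
  | .belt a b s => .belt a b s
  | .top q a b => .top (g (q, a)).1 (g (q, a)).2 b
  | .bot a q b => .bot a q b

/-- Application of a permutation of head symbols to heads on the bottom track only. -/
def beltGateApplyDown (g : Equiv.Perm (Q × Γ)) : BSym Q Γ → BSym Q Γ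
  | .belt a b s => .belt a b s
  | .top q a b => .top q a b
  | .bot a q b => .bot a (g (q, b)).1 (g (q, b)).2

/-- `π` is the automorphism `f_g`, applying `g` to every head symbol. -/
def IsBeltGate (g : Equiv.Perm (Q × Γ)) (π : Equiv.Perm (ℤ → BSym Q Γ)) : Prop :=
  ∀ x i, π x i = beltGateApply g (x i)

/-- `π` is the automorphism `f_g^up`. -/
def IsBeltGateUp (g : Equiv.Perm (Q × Γ)) (π : Equiv.Perm (ℤ → BSym Q Γ)) : Prop :=
  ∀ x i, π x i = beltGateApplyUp g (x i)

/-- `π` is the automorphism `f_g^down`. -/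
def IsBeltGateDown (g : Equiv.Perm (Q × Γ)) (π : Equiv.Perm (ℤ → BSym Q Γ)) : Prop :=
  ∀ x i, π x i = beltGateApplyDown g (x i)

/-- Auxiliary: the cell is a top-track head in state `q` (about to move rightwards). -/
def fromLeftTop [DecidableEq Q] (q : Q) : BSym Q Γ → Bool
  | .top p _ _ => decide (p = q)
  | _ => false

/-- Auxiliary: the cell is a bottom-track head in state `q` (about to move leftwards). -/
def fromRightBot [DecidableEq Q] (q : Q) : BSym Q Γ → Bool
  | .bot _ p _ => decide (p = q)
  | _ => false

/-- The local rule of `ρ_q`: every head in state `q` moves one step forward along the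
cyclic tape of its own conveyor belt (rightwards on the top track, wrapping at the
block ends, leftwards on the bottom track). -/
def beltMoveFun [DecidableEq Q] (q : Q) (x : ℤ → BSym Q Γ) (i : ℤ) : BSym Q Γ :=
  match x i with
  | .top p a b =>
      if p = q then
        (if BSym.plusOrHead (x (i + 1)) = true then .bot a q b else .belt a b true)
      else .top p a b
  | .bot a p b =>
      if p = q then
        (if BSym.minusOrHead (x (i - 1)) = true then .top q a b else .belt a b false)
      else .bot a p b
  | .belt a b sg =>
      if sg = false ∧ fromLeftTop q (x (i - 1)) = true then .top q a b
      else if sg = true ∧ fromRightBot q (x (i + 1)) = true then .bot a q b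
      else .belt a b sg

/-- `π` is the automorphism `ρ_q`. -/
def IsBeltMove [DecidableEq Q] (q : Q) (π : Equiv.Perm (ℤ → BSym Q Γ)) : Prop :=
  ∀ x i, π x i = beltMoveFun q x i

/-- The generating set of the group `G` of Turing machine instructions on conveyor
belts. -/
def BeltGens (Q Γ : Type) [DecidableEq Q] : Set (Equiv.Perm (ℤ → BSym Q Γ)) :=
  {π | (∃ g, IsBeltGate g π) ∨ (∃ g, IsBeltGateUp g π) ∨ (∃ g, IsBeltGateDown g π) ∨
    (∃ q, IsBeltMove q π)}

/-- The sign of a cell: its conveyor bit if headless, else the sign component of the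
head's ghost (extracted by `sgn`). -/
def beltSign (sgn : Q → Bool) : BSym Q Γ → Bool
  | .belt _ _ s => s
  | .top q _ _ => sgn q
  | .bot _ q _ => sgn q

/-- The local rule of the automorphism `θ`, moving all heads one step to the right while
leaving all signs in place (`setSgn q s` replaces the sign component of the ghost of `q`
by `s`). -/
def thetaFun (sgn : Q → Bool) (setSgn : Q → Bool → Q) (x : ℤ → BSym Q Γ) (i : ℤ) :
    BSym Q Γ :=
  match x (i - 1) with
  | .top p _ _ =>
      .top (setSgn p (beltSign sgn (x i))) (BSym.topLetter (x i)) (BSym.botLetter (x i))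
  | .bot _ p _ =>
      .bot (BSym.topLetter (x i)) (setSgn p (beltSign sgn (x i))) (BSym.botLetter (x i))
  | .belt _ _ _ =>
      .belt (BSym.topLetter (x i)) (BSym.botLetter (x i)) (beltSign sgn (x i))

/-- `π` is the automorphism `θ`. -/
def IsTheta (sgn : Q → Bool) (setSgn : Q → Bool → Q)
    (π : Equiv.Perm (ℤ → BSym Q Γ)) : Prop :=
  ∀ x i, π x i = thetaFun sgn setSgn x i

/-- The generating set of the group `G_* = ⟨G ∪ {θ}⟩`. -/
def BeltGensStar (Q Γ : Type) [DecidableEq Q] (sgn : Q → Bool) (setSgn : Q → Bool → Q) :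
    Set (Equiv.Perm (ℤ → BSym Q Γ)) :=
  BeltGens Q Γ ∪ {π | IsTheta sgn setSgn π}

set_option linter.unusedSectionVars false
set_option linter.unusedVariables false
set_option linter.unusedSimpArgs false

namespace BD

/-! ### Words of bounded length -/

section NB
open scoped commutatorElement
variable {G : Type*} [Group G]

/-- `g` is a product of at most `c` elements of `F ∪ F⁻¹`. -/
def NB (F : Set G) (g : G) (c : ℕ) : Prop :=
  ∃ w : List G, w.length ≤ c ∧ (∀ x ∈ w, x ∈ F ∨ x⁻¹ ∈ F) ∧ w.prod = g

variable {F : Set G}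

theorem NB.one (c : ℕ) : NB F (1 : G) c := ⟨[], by simp⟩

theorem NB.of_mem {g : G} (h : g ∈ F) : NB F g 1 := ⟨[g], by simp [h]⟩

theorem NB.mono {g : G} {c c' : ℕ} (h : NB F g c) (hc : c ≤ c') : NB F g c' := by
  obtain ⟨w, h1, h2, h3⟩ := h
  exact ⟨w, h1.trans hc, h2, h3⟩

theorem NB.mul {g g' : G} {c c' : ℕ} (h : NB F g c) (h' : NB F g' c') :
    NB F (g * g') (c + c') := by
  obtain ⟨w, h1, h2, h3⟩ := h
  obtain ⟨w', h1', h2', h3'⟩ := h'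
  refine ⟨w ++ w', by simp; omega, ?_, by simp [h3, h3']⟩
  intro x hx
  rcases List.mem_append.1 hx with hx | hx
  · exact h2 x hx
  · exact h2' x hx

theorem NB.inv {g : G} {c : ℕ} (h : NB F g c) : NB F g⁻¹ c := by
  obtain ⟨w, h1, h2, h3⟩ := h
  refine ⟨(w.map (·⁻¹)).reverse, by simpa, ?_, by rw [← h3, List.prod_inv_reverse]⟩
  intro x hx
  simp only [List.mem_reverse, List.mem_map] at hx
  obtain ⟨y, hy, rfl⟩ := hx
  simpa using (h2 y hy).symm

theorem NB.conj {g u : G} {c b : ℕ} (h : NB F g c) (hu : NB F u b) :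
    NB F (u * g * u⁻¹) (c + 2 * b) :=
  ((hu.mul h).mul hu.inv).mono (by omega)

theorem NB.conj' {g u : G} {c b : ℕ} (h : NB F g c) (hu : NB F u b) :
    NB F (u⁻¹ * g * u) (c + 2 * b) :=
  ((hu.inv.mul h).mul hu).mono (by omega)

theorem NB.comm {g u : G} {c b : ℕ} (h : NB F g c) (hu : NB F u b) :
    NB F ⁅g, u⁆ (2 * c + 2 * b) := by
  rw [commutatorElement_def]
  exact (((h.mul hu).mul h.inv).mul hu.inv).mono (by omega)

theorem NB.pow {g : G} {c : ℕ} (h : NB F g c) (k : ℕ) : NB F (g ^ k) (k * c) := by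
  induction k with
  | zero => simpa using NB.one 0
  | succ k ih => rw [pow_succ]; exact (ih.mul h).mono (by ring_nf; omega)

theorem NB.zpow {g : G} {c : ℕ} (h : NB F g c) (k : ℤ) : NB F (g ^ k) (k.natAbs * c) := by
  rcases Int.natAbs_eq k with hk | hk
  · have := h.pow k.natAbs
    rwa [← zpow_natCast, ← hk] at this
  · have := (h.pow k.natAbs).inv
    rwa [← zpow_natCast, ← zpow_neg, ← hk] at this

theorem NB.list_prod {l : List G} {c : ℕ} (h : ∀ g ∈ l, NB F g c) :
    NB F l.prod (l.length * c) := by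
  induction l with
  | nil => simpa using NB.one 0
  | cons a l ih =>
    rw [List.prod_cons]
    refine ((h a (by simp)).mul (ih fun g hg => h g (by simp [hg]))).mono ?_
    simp only [List.length_cons]; ring_nf; omega

/-- Substituting words for letters. -/
theorem NB.trans {F' : Set G} {g : G} {c b : ℕ} (h : NB F g c) (hF : ∀ x ∈ F, NB F' x b) :
    NB F' g (c * b) := by
  obtain ⟨w, h1, h2, rfl⟩ := h
  refine (NB.list_prod (c := b) fun x hx => ?_).mono (Nat.mul_le_mul_right _ h1)
  rcases h2 x hx with h | h
  · exact hF x h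
  · simpa using (hF _ h).inv

theorem NB.map_conj {F' : Set G} {g : G} {c : ℕ} (h : NB F g c) (σ : G)
    (hF : ∀ x ∈ F, NB F' (σ * x * σ⁻¹) 1) : NB F' (σ * g * σ⁻¹) c := by
  obtain ⟨w, h1, h2, rfl⟩ := h
  have : σ * w.prod * σ⁻¹ = (w.map (fun x => σ * x * σ⁻¹)).prod := by
    clear h1 h2
    induction w with
    | nil => simp
    | cons a l ih => simp only [List.prod_cons, List.map_cons, ← ih]; group
  rw [this]
  refine (NB.list_prod (c := 1) fun x hx => ?_).mono (by simpa using h1)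
  simp only [List.mem_map] at hx
  obtain ⟨y, hy, rfl⟩ := hx
  rcases h2 y hy with h | h
  · exact hF y h
  · have := (hF _ h).inv
    simpa [mul_assoc] using this

theorem NB.mem_closure {g : G} {c : ℕ} (h : NB F g c) : g ∈ Subgroup.closure F := by
  obtain ⟨w, -, h2, rfl⟩ := h
  refine Subgroup.list_prod_mem _ fun x hx => ?_
  rcases h2 x hx with h | h
  · exact Subgroup.subset_closure h
  · simpa using inv_mem (Subgroup.subset_closure h)

theorem NB.wordNorm_le {g : G} {c : ℕ} (h : NB F g c) : wordNorm F g ≤ c := by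
  obtain ⟨w, h1, h2, h3⟩ := h
  have : wordNorm F g ≤ w.length := Nat.sInf_le ⟨w, rfl, h2, h3⟩
  exact this.trans h1

theorem exists_NB_of_mem_closure {g : G} (h : g ∈ Subgroup.closure F) : ∃ c, NB F g c := by
  induction h using Subgroup.closure_induction with
  | mem x hx => exact ⟨1, NB.of_mem hx⟩
  | one => exact ⟨0, NB.one 0⟩
  | mul x y _ _ hx hy =>
    obtain ⟨a, ha⟩ := hx
    obtain ⟨b, hb⟩ := hy
    exact ⟨_, ha.mul hb⟩
  | inv x _ hx =>
    obtain ⟨a, ha⟩ := hx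
    exact ⟨_, ha.inv⟩

theorem NB_wordNorm_of_mem_closure {g : G} (h : g ∈ Subgroup.closure F) :
    NB F g (wordNorm F g) := by
  obtain ⟨c, w, -, h2, h3⟩ := exists_NB_of_mem_closure h
  obtain ⟨w', h1', h2', h3'⟩ := Nat.sInf_mem (s := {n : ℕ | ∃ w : List G, w.length = n ∧
    (∀ x ∈ w, x ∈ F ∨ x⁻¹ ∈ F) ∧ w.prod = g}) ⟨_, w, rfl, h2, h3⟩
  exact ⟨w', h1'.le, h2', h3'⟩

/-- The product `∏_{t<m} u^{-t} X_t u^t`. -/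
def sweep (u : G) (X : ℕ → G) : ℕ → G
  | 0 => 1
  | m + 1 => sweep u X m * ((u ^ m)⁻¹ * X m * u ^ m)

theorem NB.sweep {u : G} {X : ℕ → G} {b c : ℕ} (hu : NB F u b) (hX : ∀ t, NB F (X t) c) (m : ℕ) :
    NB F (sweep u X m) (m * (2 * b + c)) := by
  have key : ∀ m, NB F (BD.sweep u X m * (u ^ m)⁻¹) (m * (b + c)) := by
    intro m
    induction m with
    | zero => simpa [BD.sweep] using NB.one 0
    | succ m ih =>
      have : BD.sweep u X (m + 1) * (u ^ (m + 1))⁻¹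
          = (BD.sweep u X m * (u ^ m)⁻¹) * (X m * u⁻¹) := by
        simp only [BD.sweep, pow_succ]; group
      rw [this]
      exact (ih.mul ((hX m).mul hu.inv)).mono (by ring_nf; omega)
  have := (key m).mul (hu.pow m)
  rw [inv_mul_cancel_right] at this
  exact this.mono (by ring_nf; omega)

end NB

/-! ### Cells, symmetries and generators -/

abbrev Cf (Q₀ Γ : Type) : Type := ℤ → BSym (DecQ Q₀) Γ

section Cells
variable {Q₀ Γ : Type}

/-- Flipping the sign of the ghost. -/
def flipQ (q : DecQ Q₀) : DecQ Q₀ := (q.1, q.2.1, (!q.2.2.1, q.2.2.2))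

@[simp] theorem flipQ_flipQ (q : DecQ Q₀) : flipQ (flipQ q) = q := by
  simp [flipQ]

theorem flipQ_inj {p q : DecQ Q₀} : flipQ p = flipQ q ↔ p = q :=
  ⟨fun h => by simpa using congrArg flipQ h, fun h => h ▸ rfl⟩

def cellRefl : BSym (DecQ Q₀) Γ → BSym (DecQ Q₀) Γ
  | .belt a b s => .belt a b (!s)
  | .top q a b => .top (flipQ q) a b
  | .bot a q b => .bot a (flipQ q) b

def cellSwap : BSym (DecQ Q₀) Γ → BSym (DecQ Q₀) Γ
  | .belt a b s => .belt b a s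
  | .top q a b => .bot b q a
  | .bot a q b => .top q b a

@[simp] theorem cellRefl_cellRefl (c : BSym (DecQ Q₀) Γ) : cellRefl (cellRefl c) = c := by
  cases c <;> simp [cellRefl]

@[simp] theorem cellSwap_cellSwap (c : BSym (DecQ Q₀) Γ) : cellSwap (cellSwap c) = c := by
  cases c <;> simp [cellSwap]

@[simp] theorem plusOrHead_cellRefl (c : BSym (DecQ Q₀) Γ) :
    (cellRefl c).plusOrHead = c.minusOrHead := by cases c <;> simp [cellRefl, BSym.plusOrHead, BSym.minusOrHead]

@[simp] theorem minusOrHead_cellRefl (c : BSym (DecQ Q₀) Γ) :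
    (cellRefl c).minusOrHead = c.plusOrHead := by cases c <;> simp [cellRefl, BSym.plusOrHead, BSym.minusOrHead]

@[simp] theorem plusOrHead_cellSwap (c : BSym (DecQ Q₀) Γ) :
    (cellSwap c).plusOrHead = c.plusOrHead := by cases c <;> simp [cellSwap, BSym.plusOrHead]

@[simp] theorem minusOrHead_cellSwap (c : BSym (DecQ Q₀) Γ) :
    (cellSwap c).minusOrHead = c.minusOrHead := by cases c <;> simp [cellSwap, BSym.minusOrHead]

/-- Left-right reflection (flipping all signs). -/
def reflP : Equiv.Perm (Cf Q₀ Γ) where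
  toFun x i := cellRefl (x (-i))
  invFun x i := cellRefl (x (-i))
  left_inv x := by funext i; simp
  right_inv x := by funext i; simp

/-- Exchange of the two tracks. -/
def swapP : Equiv.Perm (Cf Q₀ Γ) where
  toFun x i := cellSwap (x i)
  invFun x i := cellSwap (x i)
  left_inv x := by funext i; simp
  right_inv x := by funext i; simp

theorem reflP_apply (x : Cf Q₀ Γ) (i : ℤ) : reflP x i = cellRefl (x (-i)) := rfl
theorem swapP_apply (x : Cf Q₀ Γ) (i : ℤ) : swapP x i = cellSwap (x i) := rfl

@[simp] theorem reflP_reflP (x : Cf Q₀ Γ) : reflP (reflP x) = x := by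
  funext i; simp [reflP_apply]

@[simp] theorem swapP_swapP (x : Cf Q₀ Γ) : swapP (swapP x) = x := by
  funext i; simp [swapP_apply]

theorem reflP_inv : (reflP : Equiv.Perm (Cf Q₀ Γ))⁻¹ = reflP := rfl
theorem swapP_inv : (swapP : Equiv.Perm (Cf Q₀ Γ))⁻¹ = swapP := rfl

/-! Gates -/

theorem beltGateApply_symm (g : Equiv.Perm (DecQ Q₀ × Γ)) (c : BSym (DecQ Q₀) Γ) :
    beltGateApply g⁻¹ (beltGateApply g c) = c := by
  cases c <;> simp [beltGateApply]

theorem beltGateApplyUp_symm (g : Equiv.Perm (DecQ Q₀ × Γ)) (c : BSym (DecQ Q₀) Γ) :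
    beltGateApplyUp g⁻¹ (beltGateApplyUp g c) = c := by
  cases c <;> simp [beltGateApplyUp]

theorem beltGateApplyDown_symm (g : Equiv.Perm (DecQ Q₀ × Γ)) (c : BSym (DecQ Q₀) Γ) :
    beltGateApplyDown g⁻¹ (beltGateApplyDown g c) = c := by
  cases c <;> simp [beltGateApplyDown]

def gateP (g : Equiv.Perm (DecQ Q₀ × Γ)) : Equiv.Perm (Cf Q₀ Γ) where
  toFun x i := beltGateApply g (x i)
  invFun x i := beltGateApply g⁻¹ (x i)
  left_inv x := by funext i; exact beltGateApply_symm g _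
  right_inv x := by funext i; simpa using beltGateApply_symm g⁻¹ (x i)

def gateUpP (g : Equiv.Perm (DecQ Q₀ × Γ)) : Equiv.Perm (Cf Q₀ Γ) where
  toFun x i := beltGateApplyUp g (x i)
  invFun x i := beltGateApplyUp g⁻¹ (x i)
  left_inv x := by funext i; exact beltGateApplyUp_symm g _
  right_inv x := by funext i; simpa using beltGateApplyUp_symm g⁻¹ (x i)

def gateDownP (g : Equiv.Perm (DecQ Q₀ × Γ)) : Equiv.Perm (Cf Q₀ Γ) where
  toFun x i := beltGateApplyDown g (x i)
  invFun x i := beltGateApplyDown g⁻¹ (x i)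
  left_inv x := by funext i; exact beltGateApplyDown_symm g _
  right_inv x := by funext i; simpa using beltGateApplyDown_symm g⁻¹ (x i)

variable [DecidableEq Q₀]

theorem beltMoveFun_refl (q : DecQ Q₀) (x : Cf Q₀ Γ) :
    beltMoveFun (flipQ q) (reflP (beltMoveFun q x)) = reflP x := by
  funext j
  obtain ⟨i, rfl⟩ : ∃ i, j = -i := ⟨-j, by simp⟩
  have e1 : -(-i + 1) = i - 1 := by ring
  have e2 : -(-i - 1) = i + 1 := by ring
  unfold beltMoveFun
  simp only [reflP_apply, neg_neg, e1, e2, sub_add_cancel, add_sub_cancel_right]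
  rcases hi : x i with ⟨a, b, s⟩ | ⟨p, a, b⟩ | ⟨a, p, b⟩ <;>
  rcases hl : x (i - 1) with ⟨a', b', s'⟩ | ⟨p', a', b'⟩ | ⟨a', p', b'⟩ <;>
  rcases hr : x (i + 1) with ⟨a'', b'', s''⟩ | ⟨p'', a'', b''⟩ | ⟨a'', p'', b''⟩ <;>
  simp only [cellRefl, fromLeftTop, fromRightBot, BSym.plusOrHead, BSym.minusOrHead] <;>
  grind [flipQ_inj]

def moveP (q : DecQ Q₀) : Equiv.Perm (Cf Q₀ Γ) where
  toFun x := beltMoveFun q x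
  invFun x := reflP (beltMoveFun (flipQ q) (reflP x))
  left_inv x := by simp [beltMoveFun_refl]
  right_inv x := by
    have := beltMoveFun_refl (flipQ q) (reflP x)
    simpa using this

theorem moveP_apply (q : DecQ Q₀) (x : Cf Q₀ Γ) (i : ℤ) : moveP q x i = beltMoveFun q x i := rfl
theorem moveP_inv (q : DecQ Q₀) : (moveP q : Equiv.Perm (Cf Q₀ Γ))⁻¹ = reflP * moveP (flipQ q) * reflP :=
  Equiv.ext fun _ => rfl

end Cells
section Theta
variable {Q₀ Γ : Type}

abbrev Core (Q₀ : Type) : Type := Q₀ × Fin 2 × Fin 3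

/-- The head of a cell: its track (`true` for top) and its state without the ghost sign. -/
def hd : BSym (DecQ Q₀) Γ → Option (Bool × Core Q₀)
  | .belt _ _ _ => none
  | .top q _ _ => some (true, (q.1, q.2.1, q.2.2.2))
  | .bot _ q _ => some (false, (q.1, q.2.1, q.2.2.2))

/-- The sign of a cell. -/
abbrev sg (c : BSym (DecQ Q₀) Γ) : Bool := beltSign decSgn c

/-- The cell with given letters, sign and head. -/
def mkCell (a b : Γ) (s : Bool) : Option (Bool × Core Q₀) → BSym (DecQ Q₀) Γ
  | none => .belt a b s
  | some (true, c) => .top (c.1, c.2.1, (s, c.2.2)) a b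
  | some (false, c) => .bot a (c.1, c.2.1, (s, c.2.2)) b

@[simp] theorem mkCell_eta (c : BSym (DecQ Q₀) Γ) :
    mkCell c.topLetter c.botLetter (sg c) (hd c) = c := by
  cases c <;> rfl

@[simp] theorem topLetter_mkCell (a b : Γ) (s : Bool) (h : Option (Bool × Core Q₀)) :
    (mkCell a b s h).topLetter = a := by
  rcases h with _ | ⟨_ | _, c⟩ <;> rfl

@[simp] theorem botLetter_mkCell (a b : Γ) (s : Bool) (h : Option (Bool × Core Q₀)) :
    (mkCell a b s h).botLetter = b := by
  rcases h with _ | ⟨_ | _, c⟩ <;> rfl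

@[simp] theorem sg_mkCell (a b : Γ) (s : Bool) (h : Option (Bool × Core Q₀)) :
    sg (mkCell a b s h) = s := by
  rcases h with _ | ⟨_ | _, c⟩ <;> rfl

@[simp] theorem hd_mkCell (a b : Γ) (s : Bool) (h : Option (Bool × Core Q₀)) :
    hd (mkCell a b s h) = h := by
  rcases h with _ | ⟨_ | _, c⟩ <;> rfl

theorem cell_ext {c c' : BSym (DecQ Q₀) Γ} (h1 : c.topLetter = c'.topLetter)
    (h2 : c.botLetter = c'.botLetter) (h3 : sg c = sg c') (h4 : hd c = hd c') : c = c' := by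
  rw [← mkCell_eta c, ← mkCell_eta c', h1, h2, h3, h4]

def thetaP : Equiv.Perm (Cf Q₀ Γ) where
  toFun x i := mkCell (x i).topLetter (x i).botLetter (sg (x i)) (hd (x (i - 1)))
  invFun x i := mkCell (x i).topLetter (x i).botLetter (sg (x i)) (hd (x (i + 1)))
  left_inv x := by funext i; simp
  right_inv x := by funext i; simp

theorem isTheta_thetaP : IsTheta decSgn decSetSgn (thetaP : Equiv.Perm (Cf Q₀ Γ)) := by
  intro x i
  change mkCell (x i).topLetter (x i).botLetter (sg (x i)) (hd (x (i - 1))) = _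
  unfold thetaFun
  rcases x (i - 1) with _ | _ | _ <;> rfl

theorem isHead_iff (c : BSym (DecQ Q₀) Γ) : c.isHead = true ↔ hd c ≠ none := by
  cases c <;> simp [BSym.isHead, hd]

theorem plusOrHead_iff (c : BSym (DecQ Q₀) Γ) : c.plusOrHead = true ↔ hd c ≠ none ∨ sg c = true := by
  cases c <;> simp [BSym.plusOrHead, hd, beltSign]

theorem minusOrHead_iff (c : BSym (DecQ Q₀) Γ) : c.minusOrHead = true ↔ hd c ≠ none ∨ sg c = false := by
  cases c <;> simp [BSym.minusOrHead, hd, beltSign]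

@[simp] theorem sg_cellRefl (c : BSym (DecQ Q₀) Γ) : sg (cellRefl c) = !sg c := by
  cases c <;> rfl
@[simp] theorem hd_cellRefl (c : BSym (DecQ Q₀) Γ) : hd (cellRefl c) = hd c := by
  cases c <;> rfl
@[simp] theorem topLetter_cellRefl (c : BSym (DecQ Q₀) Γ) : (cellRefl c).topLetter = c.topLetter := by
  cases c <;> rfl
@[simp] theorem botLetter_cellRefl (c : BSym (DecQ Q₀) Γ) : (cellRefl c).botLetter = c.botLetter := by
  cases c <;> rfl
@[simp] theorem sg_cellSwap (c : BSym (DecQ Q₀) Γ) : sg (cellSwap c) = sg c := by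
  cases c <;> rfl
@[simp] theorem hd_cellSwap (c : BSym (DecQ Q₀) Γ) :
    hd (cellSwap c) = (hd c).map (Prod.map not id) := by
  cases c <;> rfl
@[simp] theorem topLetter_cellSwap (c : BSym (DecQ Q₀) Γ) : (cellSwap c).topLetter = c.botLetter := by
  cases c <;> rfl
@[simp] theorem botLetter_cellSwap (c : BSym (DecQ Q₀) Γ) : (cellSwap c).botLetter = c.topLetter := by
  cases c <;> rfl

theorem thetaP_apply (x : Cf Q₀ Γ) (i : ℤ) :
    thetaP x i = mkCell (x i).topLetter (x i).botLetter (sg (x i)) (hd (x (i - 1))) := rfl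
theorem thetaP_inv_apply (x : Cf Q₀ Γ) (i : ℤ) :
    (thetaP⁻¹ : Equiv.Perm (Cf Q₀ Γ)) x i =
      mkCell (x i).topLetter (x i).botLetter (sg (x i)) (hd (x (i + 1))) := rfl

theorem refl_theta : (reflP * thetaP * reflP : Equiv.Perm (Cf Q₀ Γ)) = thetaP⁻¹ := by
  ext x i : 2
  simp only [Equiv.Perm.mul_apply, thetaP_inv_apply, reflP_apply, thetaP_apply, neg_neg]
  apply cell_ext <;> simp [show -(-i - 1) = i + 1 by ring]

theorem swap_theta : (swapP * thetaP * swapP : Equiv.Perm (Cf Q₀ Γ)) = thetaP := by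
  ext x i : 2
  simp only [Equiv.Perm.mul_apply, swapP_apply, thetaP_apply]
  apply cell_ext <;> simp
  rcases hd (x (i - 1)) with _ | ⟨_ | _, c⟩ <;> rfl

variable [DecidableEq Q₀]

/-- Conjugating a head-symbol permutation by the ghost sign flip. -/
def flipE : Equiv.Perm (DecQ Q₀ × Γ) where
  toFun h := (flipQ h.1, h.2)
  invFun h := (flipQ h.1, h.2)
  left_inv h := by simp
  right_inv h := by simp

theorem refl_gate (g : Equiv.Perm (DecQ Q₀ × Γ)) :
    (reflP * gateP g * reflP : Equiv.Perm (Cf Q₀ Γ)) = gateP (flipE * g * flipE) := by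
  ext x i : 2
  change cellRefl (beltGateApply g (cellRefl (x (- -i)))) = beltGateApply _ (x i)
  rw [neg_neg]
  cases x i <;> simp [cellRefl, beltGateApply, flipE]

theorem refl_gateUp (g : Equiv.Perm (DecQ Q₀ × Γ)) :
    (reflP * gateUpP g * reflP : Equiv.Perm (Cf Q₀ Γ)) = gateUpP (flipE * g * flipE) := by
  ext x i : 2
  change cellRefl (beltGateApplyUp g (cellRefl (x (- -i)))) = beltGateApplyUp _ (x i)
  rw [neg_neg]
  cases x i <;> simp [cellRefl, beltGateApplyUp, flipE]

theorem refl_gateDown (g : Equiv.Perm (DecQ Q₀ × Γ)) :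
    (reflP * gateDownP g * reflP : Equiv.Perm (Cf Q₀ Γ)) = gateDownP (flipE * g * flipE) := by
  ext x i : 2
  change cellRefl (beltGateApplyDown g (cellRefl (x (- -i)))) = beltGateApplyDown _ (x i)
  rw [neg_neg]
  cases x i <;> simp [cellRefl, beltGateApplyDown, flipE]

theorem swap_gate (g : Equiv.Perm (DecQ Q₀ × Γ)) :
    (swapP * gateP g * swapP : Equiv.Perm (Cf Q₀ Γ)) = gateP g := by
  ext x i : 2
  change cellSwap (beltGateApply g (cellSwap (x i))) = beltGateApply _ (x i)
  cases x i <;> simp [cellSwap, beltGateApply]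

theorem swap_gateUp (g : Equiv.Perm (DecQ Q₀ × Γ)) :
    (swapP * gateUpP g * swapP : Equiv.Perm (Cf Q₀ Γ)) = gateDownP g := by
  ext x i : 2
  change cellSwap (beltGateApplyUp g (cellSwap (x i))) = beltGateApplyDown _ (x i)
  cases x i <;> simp [cellSwap, beltGateApplyUp, beltGateApplyDown]

theorem swap_gateDown (g : Equiv.Perm (DecQ Q₀ × Γ)) :
    (swapP * gateDownP g * swapP : Equiv.Perm (Cf Q₀ Γ)) = gateUpP g := by
  ext x i : 2
  change cellSwap (beltGateApplyDown g (cellSwap (x i))) = beltGateApplyUp _ (x i)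
  cases x i <;> simp [cellSwap, beltGateApplyUp, beltGateApplyDown]

theorem refl_move (q : DecQ Q₀) :
    (reflP * moveP q * reflP : Equiv.Perm (Cf Q₀ Γ)) = (moveP (flipQ q))⁻¹ := by
  rw [moveP_inv, flipQ_flipQ]

theorem swap_move (q : DecQ Q₀) :
    (swapP * moveP q * swapP : Equiv.Perm (Cf Q₀ Γ)) = (moveP q)⁻¹ := by
  rw [moveP_inv]
  ext x i : 2
  change cellSwap (beltMoveFun q (swapP x) i) = cellRefl (beltMoveFun (flipQ q) (reflP x) (-i))
  unfold beltMoveFun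
  have e1 : -(-i + 1) = i - 1 := by ring
  have e2 : -(-i - 1) = i + 1 := by ring
  obtain ⟨c, hc⟩ : ∃ c, x i = c := ⟨_, rfl⟩
  obtain ⟨l, hl⟩ : ∃ c, x (i - 1) = c := ⟨_, rfl⟩
  obtain ⟨r, hr⟩ : ∃ c, x (i + 1) = c := ⟨_, rfl⟩
  simp only [reflP_apply, swapP_apply, neg_neg, e1, e2, hc, hl, hr]
  clear hc hl hr
  rcases c with ⟨a, b, s⟩ | ⟨p, a, b⟩ | ⟨a, p, b⟩ <;>
  rcases l with ⟨a', b', s'⟩ | ⟨p', a', b'⟩ | ⟨a', p', b'⟩ <;>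
  rcases r with ⟨a'', b'', s''⟩ | ⟨p'', a'', b''⟩ | ⟨a'', p'', b''⟩ <;>
  simp only [cellRefl, cellSwap, fromLeftTop, fromRightBot, BSym.plusOrHead, BSym.minusOrHead] <;>
  grind [flipQ_inj, flipQ_flipQ]

/-! Generating sets -/

abbrev SGen (Q₀ Γ : Type) [DecidableEq Q₀] : Set (Equiv.Perm (Cf Q₀ Γ)) :=
  BeltGensStar (DecQ Q₀) Γ decSgn decSetSgn

theorem mem_SGen_cases {π : Equiv.Perm (Cf Q₀ Γ)} (h : π ∈ SGen Q₀ Γ) :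
    (∃ g, π = gateP g) ∨ (∃ g, π = gateUpP g) ∨ (∃ g, π = gateDownP g) ∨ (∃ q, π = moveP q) ∨
      π = thetaP := by
  rcases h with (⟨g, h⟩ | ⟨g, h⟩ | ⟨g, h⟩ | ⟨q, h⟩) | h
  · exact .inl ⟨g, Equiv.ext fun x => funext fun i => h x i⟩
  · exact .inr (.inl ⟨g, Equiv.ext fun x => funext fun i => h x i⟩)
  · exact .inr (.inr (.inl ⟨g, Equiv.ext fun x => funext fun i => h x i⟩))
  · exact .inr (.inr (.inr (.inl ⟨q, Equiv.ext fun x => funext fun i => h x i⟩)))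
  · refine .inr (.inr (.inr (.inr (Equiv.ext fun x => funext fun i => ?_))))
    exact (h x i).trans (isTheta_thetaP x i).symm

theorem gateP_mem (g : Equiv.Perm (DecQ Q₀ × Γ)) : gateP g ∈ SGen Q₀ Γ :=
  .inl (.inl ⟨g, fun _ _ => rfl⟩)
theorem gateUpP_mem (g : Equiv.Perm (DecQ Q₀ × Γ)) : gateUpP g ∈ SGen Q₀ Γ :=
  .inl (.inr (.inl ⟨g, fun _ _ => rfl⟩))
theorem gateDownP_mem (g : Equiv.Perm (DecQ Q₀ × Γ)) : gateDownP g ∈ SGen Q₀ Γ :=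
  .inl (.inr (.inr (.inl ⟨g, fun _ _ => rfl⟩)))
theorem moveP_mem (q : DecQ Q₀) : moveP q ∈ SGen Q₀ Γ :=
  .inl (.inr (.inr (.inr ⟨q, fun _ _ => rfl⟩)))
theorem thetaP_mem : thetaP ∈ SGen Q₀ Γ := .inr isTheta_thetaP

theorem NB.refl_SGen {g : Equiv.Perm (Cf Q₀ Γ)} {c : ℕ} (h : NB (SGen Q₀ Γ) g c) :
    NB (SGen Q₀ Γ) (reflP * g * reflP⁻¹) c := by
  refine h.map_conj _ fun x hx => ?_
  rw [reflP_inv]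
  rcases mem_SGen_cases hx with ⟨g, rfl⟩ | ⟨g, rfl⟩ | ⟨g, rfl⟩ | ⟨q, rfl⟩ | rfl
  · rw [refl_gate]; exact NB.of_mem (gateP_mem _)
  · rw [refl_gateUp]; exact NB.of_mem (gateUpP_mem _)
  · rw [refl_gateDown]; exact NB.of_mem (gateDownP_mem _)
  · rw [refl_move]; exact (NB.of_mem (moveP_mem _)).inv
  · rw [refl_theta]; exact (NB.of_mem thetaP_mem).inv

theorem NB.swap_SGen {g : Equiv.Perm (Cf Q₀ Γ)} {c : ℕ} (h : NB (SGen Q₀ Γ) g c) :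
    NB (SGen Q₀ Γ) (swapP * g * swapP⁻¹) c := by
  refine h.map_conj _ fun x hx => ?_
  rw [swapP_inv]
  rcases mem_SGen_cases hx with ⟨g, rfl⟩ | ⟨g, rfl⟩ | ⟨g, rfl⟩ | ⟨q, rfl⟩ | rfl
  · rw [swap_gate]; exact NB.of_mem (gateP_mem _)
  · rw [swap_gateUp]; exact NB.of_mem (gateDownP_mem _)
  · rw [swap_gateDown]; exact NB.of_mem (gateUpP_mem _)
  · rw [swap_move]; exact (NB.of_mem (moveP_mem _)).inv
  · rw [swap_theta]; exact NB.of_mem thetaP_mem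

end Theta
section Loc
variable {Q₀ Γ : Type}

/-- Cuts occur arbitrarily far in both directions. -/
def Fine (x : Cf Q₀ Γ) : Prop :=
  (∀ N : ℤ, ∃ t, N ≤ t ∧ cutAfter x t) ∧ (∀ N : ℤ, ∃ t, t ≤ N ∧ cutAfter x t)

theorem cutAfter_refl (x : Cf Q₀ Γ) (t : ℤ) : cutAfter (reflP x) t ↔ cutAfter x (-t - 1) := by
  unfold cutAfter
  rw [reflP_apply, reflP_apply, minusOrHead_cellRefl, plusOrHead_cellRefl, and_comm]
  simp [show -(t + 1) = -t - 1 by ring]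

theorem cutAfter_swap (x : Cf Q₀ Γ) (t : ℤ) : cutAfter (swapP x) t ↔ cutAfter x t := by
  unfold cutAfter
  simp [swapP_apply]

theorem Fine.refl {x : Cf Q₀ Γ} (h : Fine x) : Fine (reflP x) := by
  refine ⟨fun N => ?_, fun N => ?_⟩
  · obtain ⟨t, h1, h2⟩ := h.2 (-N - 1)
    exact ⟨-t - 1, by omega, by rw [cutAfter_refl]; simpa using h2⟩
  · obtain ⟨t, h1, h2⟩ := h.1 (-N - 1)
    exact ⟨-t - 1, by omega, by rw [cutAfter_refl]; simpa using h2⟩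

theorem Fine.swap {x : Cf Q₀ Γ} (h : Fine x) : Fine (swapP x) := by
  simpa [Fine, cutAfter_swap] using h

/-- Existence of a cut between a cell that is `−` or a head and a later one that is `+` or a
head. -/
theorem exists_cut (x : Cf Q₀ Γ) {i j : ℤ} (hij : i < j) (hi : (x i).minusOrHead = true)
    (hj : (x j).plusOrHead = true) : ∃ t, i ≤ t ∧ t < j ∧ cutAfter x t := by
  by_contra hcon
  push Not at hcon
  have key : ∀ n : ℕ, i + n < j → (x (i + n)).minusOrHead = true := by
    intro n
    induction n with
    | zero => intro _; simpa using hi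
    | succ n ih =>
      intro hn
      have h1 := ih (by push_cast at hn; omega)
      have h2 := hcon (i + n) (by omega) (by push_cast at hn; omega)
      unfold cutAfter at h2
      have h3 : ¬ (x (i + n + 1)).plusOrHead = true := fun h => h2 ⟨h1, h⟩
      push_cast
      rw [← add_assoc]
      revert h3
      cases x (i + n + 1) <;> simp [BSym.plusOrHead, BSym.minusOrHead]
  have h1 := key (j - i - 1).toNat (by omega)
  have e : i + ((j - i - 1).toNat : ℤ) = j - 1 := by omega
  rw [e] at h1
  exact hcon (j - 1) (by omega) (by omega) ⟨h1, by simpa using hj⟩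

theorem fine_iff (x : Cf Q₀ Γ) : Fine x ↔
    (∀ N : ℤ, ∃ i, N ≤ i ∧ (x i).plusOrHead = true) ∧ (∀ N : ℤ, ∃ i, N ≤ i ∧ (x i).minusOrHead = true) ∧
    (∀ N : ℤ, ∃ i, i ≤ N ∧ (x i).plusOrHead = true) ∧ (∀ N : ℤ, ∃ i, i ≤ N ∧ (x i).minusOrHead = true) := by
  constructor
  · rintro ⟨h1, h2⟩
    refine ⟨fun N => ?_, fun N => ?_, fun N => ?_, fun N => ?_⟩
    · obtain ⟨t, ht, hc⟩ := h1 N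
      exact ⟨t + 1, by omega, hc.2⟩
    · obtain ⟨t, ht, hc⟩ := h1 N
      exact ⟨t, by omega, hc.1⟩
    · obtain ⟨t, ht, hc⟩ := h2 (N - 1)
      exact ⟨t + 1, by omega, hc.2⟩
    · obtain ⟨t, ht, hc⟩ := h2 N
      exact ⟨t, by omega, hc.1⟩
  · rintro ⟨h1, h2, h3, h4⟩
    constructor
    · intro N
      obtain ⟨i, hi, hm⟩ := h2 N
      obtain ⟨j, hj, hp⟩ := h1 (i + 1)
      obtain ⟨t, ht, -, hc⟩ := exists_cut x (by omega) hm hp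
      exact ⟨t, by omega, hc⟩
    · intro N
      obtain ⟨j, hj, hp⟩ := h3 N
      obtain ⟨i, hi, hm⟩ := h4 (j - 1)
      obtain ⟨t, ht, htj, hc⟩ := exists_cut x (by omega) hm hp
      exact ⟨t, by omega, hc⟩

theorem fine_of_allFiniteBlocks {x : Cf Q₀ Γ} (h : AllFiniteBlocks x) : Fine x := by
  constructor
  · intro N
    obtain ⟨s, e, hb, h1, h2⟩ := h N
    exact ⟨e, h2, hb.2.2.1⟩
  · intro N
    obtain ⟨s, e, hb, h1, h2⟩ := h N
    exact ⟨s - 1, by omega, hb.2.1⟩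

theorem Fine.exists_block {x : Cf Q₀ Γ} (h : Fine x) (i : ℤ) :
    ∃ s e : ℤ, IsBlock x s e ∧ s ≤ i ∧ i ≤ e := by
  classical
  obtain ⟨t1, h1, c1⟩ := h.1 i
  obtain ⟨t2, h2, c2⟩ := h.2 (i - 1)
  have hP : ∃ n : ℕ, cutAfter x (i + n) := ⟨(t1 - i).toNat, by
    rwa [show i + ((t1 - i).toNat : ℤ) = t1 by omega]⟩
  have hP' : ∃ n : ℕ, cutAfter x (i - 1 - n) := ⟨(i - 1 - t2).toNat, by
    rwa [show i - 1 - ((i - 1 - t2).toNat : ℤ) = t2 by omega]⟩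
  refine ⟨i - Nat.find hP', i + Nat.find hP, ⟨by omega, ?_, Nat.find_spec hP, ?_⟩, by omega, by omega⟩
  · have := Nat.find_spec hP'
    rwa [show i - (Nat.find hP' : ℤ) - 1 = i - 1 - Nat.find hP' by ring]
  · intro j hj1 hj2 hc
    rcases le_or_gt i j with hij | hij
    · refine Nat.find_min hP (m := (j - i).toNat) (by omega) ?_
      rwa [show i + ((j - i).toNat : ℤ) = j by omega]
    · refine Nat.find_min hP' (m := (i - 1 - j).toNat) (by omega) ?_
      rwa [show i - 1 - ((i - 1 - j).toNat : ℤ) = j by omega]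

/-- `t` is a boundary of `I`. -/
def Bd (I : Set ℤ) (t : ℤ) : Prop := (t ∈ I ∧ t + 1 ∉ I) ∨ (t ∉ I ∧ t + 1 ∈ I)

/-- `x` and `y` agree on `I` and both have walls at all boundaries of `I`. -/
def Rel (W : Cf Q₀ Γ → ℤ → Prop) (I : Set ℤ) (x y : Cf Q₀ Γ) : Prop :=
  (∀ i ∈ I, x i = y i) ∧ ∀ t, Bd I t → W x t ∧ W y t

/-- Local maps: they preserve fineness, walls, and agreement within walls. -/
structure IsLoc (W : Cf Q₀ Γ → ℤ → Prop) (g : Cf Q₀ Γ → Cf Q₀ Γ) : Prop where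
  fine : ∀ x, Fine x → Fine (g x)
  wall : ∀ x t, Fine x → W x t → W (g x) t
  agree : ∀ I x y, Fine x → Fine y → Rel W I x y → ∀ i ∈ I, g x i = g y i

theorem IsLoc.rel {W : Cf Q₀ Γ → ℤ → Prop} {g : Cf Q₀ Γ → Cf Q₀ Γ} (h : IsLoc W g) {I : Set ℤ}
    {x y : Cf Q₀ Γ} (hx : Fine x) (hy : Fine y) (hr : Rel W I x y) : Rel W I (g x) (g y) :=
  ⟨h.agree I x y hx hy hr, fun t ht =>
    ⟨h.wall x t hx (hr.2 t ht).1, h.wall y t hy (hr.2 t ht).2⟩⟩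

theorem IsLoc.comp {W : Cf Q₀ Γ → ℤ → Prop} {g g' : Cf Q₀ Γ → Cf Q₀ Γ} (h : IsLoc W g)
    (h' : IsLoc W g') : IsLoc W (fun x => g (g' x)) where
  fine x hx := h.fine _ (h'.fine _ hx)
  wall x t hx hw := h.wall _ _ (h'.fine _ hx) (h'.wall _ _ hx hw)
  agree I x y hx hy hr := h.agree I _ _ (h'.fine _ hx) (h'.fine _ hy) (h'.rel hx hy hr)

/-- The group of permutations that are local together with their inverse. -/
def LocG (W : Cf Q₀ Γ → ℤ → Prop) : Subgroup (Equiv.Perm (Cf Q₀ Γ)) where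
  carrier := {g | IsLoc W g ∧ IsLoc W (g⁻¹ : Equiv.Perm (Cf Q₀ Γ))}
  one_mem' := ⟨⟨fun _ h => h, fun _ _ _ h => h, fun _ _ _ _ _ h => h.1⟩,
    ⟨fun _ h => h, fun _ _ _ h => h, fun _ _ _ _ _ h => h.1⟩⟩
  mul_mem' := fun {a b} ha hb => ⟨ha.1.comp hb.1, by
    rw [mul_inv_rev]; exact hb.2.comp ha.2⟩
  inv_mem' := fun {a} ha => ⟨ha.2, by rw [inv_inv]; exact ha.1⟩

theorem mem_LocG {W : Cf Q₀ Γ → ℤ → Prop} {g : Equiv.Perm (Cf Q₀ Γ)} :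
    g ∈ LocG W ↔ IsLoc W g ∧ IsLoc W (g⁻¹ : Equiv.Perm (Cf Q₀ Γ)) := Iff.rfl

/-- Compatibility of a wall notion with the symmetries. -/
structure SymW (W : Cf Q₀ Γ → ℤ → Prop) : Prop where
  refl : ∀ x t, W (reflP x) t ↔ W x (-t - 1)
  swap : ∀ x t, W (swapP x) t ↔ W x t

theorem Rel.refl {W : Cf Q₀ Γ → ℤ → Prop} (hW : SymW W) {I : Set ℤ} {x y : Cf Q₀ Γ} (h : Rel W I x y) :
    Rel W {i | -i ∈ I} (reflP x) (reflP y) := by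
  refine ⟨fun i hi => by rw [reflP_apply, reflP_apply, h.1 _ hi], fun t ht => ?_⟩
  rw [hW.refl, hW.refl]
  refine h.2 _ ?_
  unfold Bd at ht ⊢
  simp only [Set.mem_ofPred_eq, sub_add_cancel, show -(t + 1) = -t - 1 by ring] at ht ⊢
  tauto

theorem Rel.swap {W : Cf Q₀ Γ → ℤ → Prop} (hW : SymW W) {I : Set ℤ} {x y : Cf Q₀ Γ} (h : Rel W I x y) :
    Rel W I (swapP x) (swapP y) := by
  refine ⟨fun i hi => by rw [swapP_apply, swapP_apply, h.1 _ hi], fun t ht => ?_⟩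
  rw [hW.swap, hW.swap]
  exact h.2 _ ht

theorem IsLoc.refl {W : Cf Q₀ Γ → ℤ → Prop} (hW : SymW W) {g : Cf Q₀ Γ → Cf Q₀ Γ} (h : IsLoc W g) :
    IsLoc W (fun x => reflP (g (reflP x))) where
  fine x hx := (h.fine _ hx.refl).refl
  wall x t hx hw := by
    rw [hW.refl]
    refine h.wall _ _ hx.refl ?_
    rw [hW.refl]
    simpa using hw
  agree I x y hx hy hr i hi := by
    rw [reflP_apply, reflP_apply]
    rw [h.agree _ _ _ hx.refl hy.refl (hr.refl hW) (-i) (by simpa using hi)]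

theorem IsLoc.swap {W : Cf Q₀ Γ → ℤ → Prop} (hW : SymW W) {g : Cf Q₀ Γ → Cf Q₀ Γ} (h : IsLoc W g) :
    IsLoc W (fun x => swapP (g (swapP x))) where
  fine x hx := (h.fine _ hx.swap).swap
  wall x t hx hw := by
    rw [hW.swap]
    refine h.wall _ _ hx.swap ?_
    rwa [hW.swap]
  agree I x y hx hy hr i hi := by
    rw [swapP_apply, swapP_apply]
    rw [h.agree _ _ _ hx.swap hy.swap (hr.swap hW) i hi]

theorem LocG_refl {W : Cf Q₀ Γ → ℤ → Prop} (hW : SymW W) {g : Equiv.Perm (Cf Q₀ Γ)} (h : g ∈ LocG W) :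
    reflP * g * reflP⁻¹ ∈ LocG W :=
  ⟨h.1.refl hW, h.2.refl hW⟩

theorem LocG_swap {W : Cf Q₀ Γ → ℤ → Prop} (hW : SymW W) {g : Equiv.Perm (Cf Q₀ Γ)} (h : g ∈ LocG W) :
    swapP * g * swapP⁻¹ ∈ LocG W :=
  ⟨h.1.swap hW, h.2.swap hW⟩

/-! Good walls -/

def isPl (c : BSym (DecQ Q₀) Γ) : Prop := hd c = none ∧ sg c = true
def isMi (c : BSym (DecQ Q₀) Γ) : Prop := hd c = none ∧ sg c = false

def Rst (x : Cf Q₀ Γ) (u : ℤ) : Prop := isPl (x u) ∧ isMi (x (u + 1)) ∧ isMi (x (u + 2))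
def Len (x : Cf Q₀ Γ) (u : ℤ) : Prop := isMi (x u) ∧ isPl (x (u - 1)) ∧ isPl (x (u - 2))

/-- Good walls: cuts that cannot be affected by the wall-toggling rules. -/
def GW (x : Cf Q₀ Γ) (t : ℤ) : Prop := cutAfter x t ∧ ¬ Rst x (t + 1) ∧ ¬ Len x t

theorem isPl_cellRefl (c : BSym (DecQ Q₀) Γ) : isPl (cellRefl c) ↔ isMi c := by simp [isPl, isMi]
theorem isMi_cellRefl (c : BSym (DecQ Q₀) Γ) : isMi (cellRefl c) ↔ isPl c := by simp [isPl, isMi]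
theorem isPl_cellSwap (c : BSym (DecQ Q₀) Γ) : isPl (cellSwap c) ↔ isPl c := by simp [isPl]
theorem isMi_cellSwap (c : BSym (DecQ Q₀) Γ) : isMi (cellSwap c) ↔ isMi c := by simp [isMi]

theorem symW_cut : SymW (cutAfter : Cf Q₀ Γ → ℤ → Prop) := ⟨cutAfter_refl, cutAfter_swap⟩

theorem symW_GW : SymW (GW : Cf Q₀ Γ → ℤ → Prop) where
  refl x t := by
    simp only [GW, cutAfter_refl, Rst, Len, reflP_apply, isPl_cellRefl, isMi_cellRefl,
      show -(t + 1) = -t - 1 by ring, show -(t + 1 + 1) = -t - 1 - 1 by ring,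
      show -(t + 1 + 2) = -t - 1 - 2 by ring, show -t - 1 + 1 = -t by ring,
      show -t - 1 + 2 = -(t - 1) by ring, show -(t - 2) = -t + 2 by ring, show -(t - 1) = -t + 1 by ring]
    tauto
  swap x t := by
    simp only [GW, cutAfter_swap, Rst, Len, swapP_apply, isPl_cellSwap, isMi_cellSwap]

/-! Cellwise maps -/

/-- Cellwise maps fixing headless cells and preserving heads are local. -/
theorem isLoc_cellwise {W : Cf Q₀ Γ → ℤ → Prop} (f : BSym (DecQ Q₀) Γ → BSym (DecQ Q₀) Γ)
    (hp : ∀ c, (f c).plusOrHead = c.plusOrHead) (hm : ∀ c, (f c).minusOrHead = c.minusOrHead)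
    (hW : ∀ x t, W x t → W (fun i => f (x i)) t) : IsLoc W (fun x i => f (x i)) where
  fine x hx := by simpa only [Fine, cutAfter, hp, hm] using hx
  wall x t _ hw := hW x t hw
  agree I x y _ _ hr i hi := by simp only [hr.1 i hi]

theorem isPl_iff (c : BSym (DecQ Q₀) Γ) : isPl c ↔ c.minusOrHead = false := by
  cases c <;> simp [isPl, hd, beltSign, BSym.minusOrHead]
theorem isMi_iff (c : BSym (DecQ Q₀) Γ) : isMi c ↔ c.plusOrHead = false := by
  cases c <;> simp [isMi, hd, beltSign, BSym.plusOrHead]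

theorem cellwise_mem_LocG (g : Equiv.Perm (Cf Q₀ Γ)) (f f' : BSym (DecQ Q₀) Γ → BSym (DecQ Q₀) Γ)
    (hg : ∀ x i, g x i = f (x i)) (hg' : ∀ x i, (g⁻¹ : Equiv.Perm (Cf Q₀ Γ)) x i = f' (x i))
    (hp : ∀ c, (f c).plusOrHead = c.plusOrHead) (hm : ∀ c, (f c).minusOrHead = c.minusOrHead)
    (hp' : ∀ c, (f' c).plusOrHead = c.plusOrHead) (hm' : ∀ c, (f' c).minusOrHead = c.minusOrHead) :
    g ∈ LocG cutAfter ∧ g ∈ LocG GW := by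
  have e : (g : Cf Q₀ Γ → Cf Q₀ Γ) = fun x i => f (x i) := by funext x i; exact hg x i
  have e' : ((g⁻¹ : Equiv.Perm (Cf Q₀ Γ)) : Cf Q₀ Γ → Cf Q₀ Γ) = fun x i => f' (x i) := by
    funext x i; exact hg' x i
  simp only [mem_LocG, e, e']
  refine ⟨⟨?_, ?_⟩, ⟨?_, ?_⟩⟩ <;> apply isLoc_cellwise <;> try assumption
  · intro x t hw; simpa only [cutAfter, hp, hm] using hw
  · intro x t hw; simpa only [cutAfter, hp', hm'] using hw
  · intro x t hw; simpa only [GW, Rst, Len, isPl_iff, isMi_iff, cutAfter, hp, hm] using hw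
  · intro x t hw; simpa only [GW, Rst, Len, isPl_iff, isMi_iff, cutAfter, hp', hm'] using hw

theorem gateP_loc (g : Equiv.Perm (DecQ Q₀ × Γ)) :
    (gateP g : Equiv.Perm (Cf Q₀ Γ)) ∈ LocG cutAfter ∧ gateP g ∈ LocG GW :=
  cellwise_mem_LocG _ (beltGateApply g) (beltGateApply g⁻¹) (fun _ _ => rfl) (fun _ _ => rfl)
    (by rintro (_ | _ | _) <;> rfl) (by rintro (_ | _ | _) <;> rfl)
    (by rintro (_ | _ | _) <;> rfl) (by rintro (_ | _ | _) <;> rfl)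

theorem gateUpP_loc (g : Equiv.Perm (DecQ Q₀ × Γ)) :
    (gateUpP g : Equiv.Perm (Cf Q₀ Γ)) ∈ LocG cutAfter ∧ gateUpP g ∈ LocG GW :=
  cellwise_mem_LocG _ (beltGateApplyUp g) (beltGateApplyUp g⁻¹) (fun _ _ => rfl) (fun _ _ => rfl)
    (by rintro (_ | _ | _) <;> rfl) (by rintro (_ | _ | _) <;> rfl)
    (by rintro (_ | _ | _) <;> rfl) (by rintro (_ | _ | _) <;> rfl)

theorem gateDownP_loc (g : Equiv.Perm (DecQ Q₀ × Γ)) :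
    (gateDownP g : Equiv.Perm (Cf Q₀ Γ)) ∈ LocG cutAfter ∧ gateDownP g ∈ LocG GW :=
  cellwise_mem_LocG _ (beltGateApplyDown g) (beltGateApplyDown g⁻¹) (fun _ _ => rfl) (fun _ _ => rfl)
    (by rintro (_ | _ | _) <;> rfl) (by rintro (_ | _ | _) <;> rfl)
    (by rintro (_ | _ | _) <;> rfl) (by rintro (_ | _ | _) <;> rfl)

/-! Moves -/
variable [DecidableEq Q₀]

theorem beltMoveFun_cut (q : DecQ Q₀) (x : Cf Q₀ Γ) (t : ℤ) (h : cutAfter x t) :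
    cutAfter (beltMoveFun q x) t := by
  obtain ⟨h1, h2⟩ := h
  unfold cutAfter beltMoveFun
  rw [add_sub_cancel_right]
  revert h1 h2
  obtain ⟨c, hc⟩ : ∃ c, x t = c := ⟨_, rfl⟩
  obtain ⟨r, hr⟩ : ∃ c, x (t + 1) = c := ⟨_, rfl⟩
  obtain ⟨l, hl⟩ : ∃ c, x (t - 1) = c := ⟨_, rfl⟩
  obtain ⟨r', hr'⟩ : ∃ c, x (t + 1 + 1) = c := ⟨_, rfl⟩
  simp only [hc, hr, hl, hr']
  clear hc hr hl hr'
  rcases c with ⟨a, b, s⟩ | ⟨p, a, b⟩ | ⟨a, p, b⟩ <;>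
  rcases r with ⟨a'', b'', s''⟩ | ⟨p'', a'', b''⟩ | ⟨a'', p'', b''⟩ <;>
  simp only [fromLeftTop, fromRightBot, BSym.plusOrHead, BSym.minusOrHead] <;>
  grind

theorem beltMoveFun_agree (q : DecQ Q₀) (I : Set ℤ) (x y : Cf Q₀ Γ) (h : Rel cutAfter I x y)
    (i : ℤ) (hi : i ∈ I) : beltMoveFun q x i = beltMoveFun q y i := by
  have h0 := h.1 i hi
  have hr : x (i + 1) = y (i + 1) ∨ (cutAfter x i ∧ cutAfter y i) := by
    by_cases h' : i + 1 ∈ I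
    · exact .inl (h.1 _ h')
    · exact .inr (h.2 i (.inl ⟨hi, h'⟩))
  have hl : x (i - 1) = y (i - 1) ∨ (cutAfter x (i - 1) ∧ cutAfter y (i - 1)) := by
    by_cases h' : i - 1 ∈ I
    · exact .inl (h.1 _ h')
    · exact .inr (h.2 (i - 1) (.inr ⟨h', by simpa using hi⟩))
  unfold cutAfter at hr hl
  rw [sub_add_cancel] at hl
  unfold beltMoveFun
  revert hr hl
  obtain ⟨c, hc⟩ : ∃ c, y i = c := ⟨_, rfl⟩
  obtain ⟨r, hr⟩ : ∃ c, x (i + 1) = c := ⟨_, rfl⟩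
  obtain ⟨l, hl⟩ : ∃ c, x (i - 1) = c := ⟨_, rfl⟩
  obtain ⟨r', hr'⟩ : ∃ c, y (i + 1) = c := ⟨_, rfl⟩
  obtain ⟨l', hl'⟩ : ∃ c, y (i - 1) = c := ⟨_, rfl⟩
  simp only [h0, hc, hr, hl, hr', hl']
  clear h0 hc hr hl hr' hl'
  rcases c with ⟨a, b, s⟩ | ⟨p, a, b⟩ | ⟨a, p, b⟩ <;>
  simp only [BSym.plusOrHead, BSym.minusOrHead] <;>
  grind

/-- If a moved configuration is headless `+` at `u`, then either it was so before, or a head left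
`u` to the right. -/
theorem isPl_beltMoveFun (q : DecQ Q₀) (x : Cf Q₀ Γ) (u : ℤ) (h : isPl (beltMoveFun q x u)) :
    isPl (x u) ∨ hd (beltMoveFun q x (u + 1)) ≠ none := by
  revert h
  unfold beltMoveFun
  rw [add_sub_cancel_right]
  obtain ⟨c, hc⟩ : ∃ c, x u = c := ⟨_, rfl⟩
  obtain ⟨r, hr⟩ : ∃ c, x (u + 1) = c := ⟨_, rfl⟩
  simp only [hc, hr]
  rcases c with ⟨a, b, s⟩ | ⟨p, a, b⟩ | ⟨a, p, b⟩ <;>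
  rcases r with ⟨a'', b'', s''⟩ | ⟨p'', a'', b''⟩ | ⟨a'', p'', b''⟩ <;>
  simp only [fromLeftTop, fromRightBot, BSym.plusOrHead, BSym.minusOrHead, isPl] <;>
  grind [hd, beltSign]

theorem isMi_beltMoveFun (q : DecQ Q₀) (x : Cf Q₀ Γ) (u : ℤ) (h : isMi (beltMoveFun q x u)) :
    isMi (x u) ∨ hd (beltMoveFun q x (u - 1)) ≠ none := by
  revert h
  unfold beltMoveFun
  rw [sub_add_cancel]
  obtain ⟨c, hc⟩ : ∃ c, x u = c := ⟨_, rfl⟩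
  obtain ⟨r, hr⟩ : ∃ c, x (u - 1) = c := ⟨_, rfl⟩
  simp only [hc, hr]
  rcases c with ⟨a, b, s⟩ | ⟨p, a, b⟩ | ⟨a, p, b⟩ <;>
  rcases r with ⟨a'', b'', s''⟩ | ⟨p'', a'', b''⟩ | ⟨a'', p'', b''⟩ <;>
  simp only [fromLeftTop, fromRightBot, BSym.plusOrHead, BSym.minusOrHead, isMi] <;>
  grind [hd, beltSign]

theorem Rst_beltMoveFun (q : DecQ Q₀) (x : Cf Q₀ Γ) (u : ℤ) (h : Rst (beltMoveFun q x) u) :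
    Rst x u := by
  obtain ⟨h1, h2, h3⟩ := h
  refine ⟨(isPl_beltMoveFun q x u h1).resolve_right (by simp [h2.1]),
    (isMi_beltMoveFun q x _ h2).resolve_right (by simp [h1.1]),
    (isMi_beltMoveFun q x _ h3).resolve_right ?_⟩
  rw [show u + 2 - 1 = u + 1 by ring]; simp [h2.1]

theorem Len_beltMoveFun (q : DecQ Q₀) (x : Cf Q₀ Γ) (u : ℤ) (h : Len (beltMoveFun q x) u) :
    Len x u := by
  obtain ⟨h1, h2, h3⟩ := h
  refine ⟨(isMi_beltMoveFun q x u h1).resolve_right (by simp [h2.1]),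
    (isPl_beltMoveFun q x _ h2).resolve_right (by simp [h1.1]),
    (isPl_beltMoveFun q x _ h3).resolve_right ?_⟩
  rw [show u - 2 + 1 = u - 1 by ring]; simp [h2.1]

theorem fine_beltMoveFun (q : DecQ Q₀) {x : Cf Q₀ Γ} (h : Fine x) : Fine (beltMoveFun q x) := by
  refine ⟨fun N => ?_, fun N => ?_⟩
  · obtain ⟨t, h1, h2⟩ := h.1 N
    exact ⟨t, h1, beltMoveFun_cut q x t h2⟩
  · obtain ⟨t, h1, h2⟩ := h.2 N
    exact ⟨t, h1, beltMoveFun_cut q x t h2⟩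

theorem Rel.cut {I : Set ℤ} {x y : Cf Q₀ Γ} (h : Rel GW I x y) : Rel cutAfter I x y :=
  ⟨h.1, fun t ht => ⟨(h.2 t ht).1.1, (h.2 t ht).2.1⟩⟩

theorem moveP_isLoc_cut (q : DecQ Q₀) : IsLoc cutAfter (moveP q : Equiv.Perm (Cf Q₀ Γ)) where
  fine _ hx := fine_beltMoveFun q hx
  wall x t _ h := beltMoveFun_cut q x t h
  agree I x y _ _ h := beltMoveFun_agree q I x y h

theorem moveP_isLoc_GW (q : DecQ Q₀) : IsLoc GW (moveP q : Equiv.Perm (Cf Q₀ Γ)) where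
  fine _ hx := fine_beltMoveFun q hx
  wall x t _ h := ⟨beltMoveFun_cut q x t h.1, fun h' => h.2.1 (Rst_beltMoveFun q x _ h'),
    fun h' => h.2.2 (Len_beltMoveFun q x _ h')⟩
  agree I x y _ _ h := beltMoveFun_agree q I x y h.cut

theorem moveP_loc (q : DecQ Q₀) :
    (moveP q : Equiv.Perm (Cf Q₀ Γ)) ∈ LocG cutAfter ∧
      (moveP q : Equiv.Perm (Cf Q₀ Γ)) ∈ LocG GW := by
  refine ⟨⟨moveP_isLoc_cut q, ?_⟩, ⟨moveP_isLoc_GW q, ?_⟩⟩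
  · exact (moveP_isLoc_cut (flipQ q)).refl symW_cut
  · exact (moveP_isLoc_GW (flipQ q)).refl symW_GW

end Loc
section Belt
variable {Q₀ Γ : Type}

/-- The address (cell and track) of position `k` on the conveyor belt of the block of length `L`
starting at `s`. -/
def addr (s L k : ℤ) : ℤ × Bool :=
  if k % (2 * L) < L then (s + k % (2 * L), true) else (s + 2 * L - 1 - k % (2 * L), false)

theorem addr_add_period (s L k : ℤ) : addr s L (k + 2 * L) = addr s L k := by
  simp [addr]

theorem addr_emod (s L k : ℤ) : addr s L (k % (2 * L)) = addr s L k := by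
  simp [addr]

theorem addr_congr (s L : ℤ) {k k' : ℤ} (h : k % (2 * L) = k' % (2 * L)) :
    addr s L k = addr s L k' := by
  simp [addr, h]

theorem emod_succ {k m : ℤ} (hm : 0 < m) :
    (k + 1) % m = if k % m + 1 = m then 0 else k % m + 1 := by
  have h1 := Int.emod_nonneg k hm.ne'
  have h2 := Int.emod_lt_of_pos k hm
  rw [← Int.emod_add_emod]
  split_ifs with h
  · rw [h, Int.emod_self]
  · exact Int.emod_eq_of_lt (by omega) (by omega)

theorem addr_fst_mem {s L : ℤ} (hL : 1 ≤ L) (k : ℤ) :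
    s ≤ (addr s L k).1 ∧ (addr s L k).1 ≤ s + L - 1 := by
  have h1 := Int.emod_nonneg k (show 2 * L ≠ 0 by omega)
  have h2 := Int.emod_lt_of_pos k (show 0 < 2 * L by omega)
  unfold addr
  split_ifs with h <;> constructor <;> simp only <;> omega

theorem addr_of_top {s L r : ℤ} (h0 : 0 ≤ r) (h1 : r < L) : addr s L r = (s + r, true) := by
  rw [addr, Int.emod_eq_of_lt h0 (by omega), if_pos h1]

theorem addr_of_bot {s L r : ℤ} (h0 : L ≤ r) (h1 : r < 2 * L) :
    addr s L r = (s + 2 * L - 1 - r, false) := by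
  rw [addr, Int.emod_eq_of_lt (by omega) h1, if_neg (by omega)]

theorem addr_inj {s L k k' : ℤ} (hL : 1 ≤ L) (h : addr s L k = addr s L k') :
    k % (2 * L) = k' % (2 * L) := by
  have h1 := Int.emod_nonneg k (show 2 * L ≠ 0 by omega)
  have h2 := Int.emod_nonneg k' (show 2 * L ≠ 0 by omega)
  unfold addr at h
  split_ifs at h <;> simp at h <;> omega

/-- The configuration with a single head, at address `a`, whose block is `[s, e]`, with conveyor bits
`ε` outside the block. -/
def scfg (s e : ℤ) (ε : ℤ → Bool) (Λ : ℤ × Bool → Γ) (a : ℤ × Bool) (q : DecQ Q₀) : Cf Q₀ Γ := fun j =>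
  if j = a.1 then
    (if a.2 then .top q (Λ (j, true)) (Λ (j, false)) else .bot (Λ (j, true)) q (Λ (j, false)))
  else .belt (Λ (j, true)) (Λ (j, false)) (if s ≤ j ∧ j ≤ e then decide (j < a.1) else ε j)

/-- The configuration with a single head at position `k` of the conveyor belt of the block of length
`L` starting at `s`. -/
def cfg (s L : ℤ) (ε : ℤ → Bool) (Λ : ℤ × Bool → Γ) (k : ℤ) (q : DecQ Q₀) : Cf Q₀ Γ :=
  scfg s (s + L - 1) ε Λ (addr s L k) q

/-- The bits outside the block are compatible with its boundaries, and change cofinally. -/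
structure Val (s L : ℤ) (ε : ℤ → Bool) : Prop where
  one_le : 1 ≤ L
  left : ε (s - 1) = false
  right : ε (s + L) = true
  cof : ∀ (b : Bool) (N : ℤ), (∃ j, N ≤ j ∧ ε j = b) ∧ (∃ j, j ≤ N ∧ ε j = b)

theorem cfg_congr (s L : ℤ) (ε : ℤ → Bool) (Λ : ℤ × Bool → Γ) {k k' : ℤ} (q : DecQ Q₀)
    (h : k % (2 * L) = k' % (2 * L)) : cfg s L ε Λ k q = cfg s L ε Λ k' q := by
  rw [cfg, cfg, addr_congr s L h]

/-- The sign of the headless cells of `scfg`. -/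
def bit (s e : ℤ) (ε : ℤ → Bool) (i j : ℤ) : Bool := if s ≤ j ∧ j ≤ e then decide (j < i) else ε j

theorem hd_scfg (s e : ℤ) (ε : ℤ → Bool) (Λ : ℤ × Bool → Γ) (a : ℤ × Bool) (q : DecQ Q₀) (j : ℤ) :
    hd (scfg s e ε Λ a q j) = if j = a.1 then some (a.2, (q.1, q.2.1, q.2.2.2)) else none := by
  unfold scfg
  rcases a with ⟨i, _ | _⟩ <;> by_cases h : j = i <;> simp [h, hd]

theorem sg_scfg (s e : ℤ) (ε : ℤ → Bool) (Λ : ℤ × Bool → Γ) (a : ℤ × Bool) (q : DecQ Q₀) (j : ℤ) :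
    sg (scfg s e ε Λ a q j) = if j = a.1 then q.2.2.1 else bit s e ε a.1 j := by
  unfold scfg bit
  rcases a with ⟨i, _ | _⟩ <;> by_cases h : j = i <;> simp [h, sg, beltSign, decSgn]

theorem topLetter_scfg (s e : ℤ) (ε : ℤ → Bool) (Λ : ℤ × Bool → Γ) (a : ℤ × Bool) (q : DecQ Q₀) (j : ℤ) :
    (scfg s e ε Λ a q j).topLetter = Λ (j, true) := by
  unfold scfg
  rcases a with ⟨i, _ | _⟩ <;> by_cases h : j = i <;> simp [h, BSym.topLetter]

theorem botLetter_scfg (s e : ℤ) (ε : ℤ → Bool) (Λ : ℤ × Bool → Γ) (a : ℤ × Bool) (q : DecQ Q₀) (j : ℤ) :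
    (scfg s e ε Λ a q j).botLetter = Λ (j, false) := by
  unfold scfg
  rcases a with ⟨i, _ | _⟩ <;> by_cases h : j = i <;> simp [h, BSym.botLetter]

/-- A configuration is determined by its heads, signs and letters. -/
theorem eq_scfg_iff {x : Cf Q₀ Γ} {s e : ℤ} {ε : ℤ → Bool} {Λ : ℤ × Bool → Γ} {a : ℤ × Bool} {q : DecQ Q₀} :
    x = scfg s e ε Λ a q ↔ ∀ j, (x j).topLetter = Λ (j, true) ∧ (x j).botLetter = Λ (j, false) ∧
      hd (x j) = (if j = a.1 then some (a.2, (q.1, q.2.1, q.2.2.2)) else none) ∧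
      sg (x j) = if j = a.1 then q.2.2.1 else bit s e ε a.1 j := by
  constructor
  · rintro rfl j
    exact ⟨topLetter_scfg .., botLetter_scfg .., hd_scfg .., sg_scfg ..⟩
  · intro h
    funext j
    obtain ⟨h1, h2, h3, h4⟩ := h j
    exact cell_ext (by rw [h1, topLetter_scfg]) (by rw [h2, botLetter_scfg])
      (by rw [h4, sg_scfg]) (by rw [h3, hd_scfg])

theorem scfg_gate (g : Equiv.Perm (DecQ Q₀ × Γ)) (s e : ℤ) (ε : ℤ → Bool) (Λ : ℤ × Bool → Γ)
    (a : ℤ × Bool) (q : DecQ Q₀) :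
    gateP g (scfg s e ε Λ a q) =
      scfg s e ε (Function.update Λ a (g (q, Λ a)).2) a (g (q, Λ a)).1 := by
  funext j
  show beltGateApply g _ = _
  rcases a with ⟨i, _ | _⟩ <;> by_cases h : j = i <;>
    simp [scfg, h, beltGateApply, Function.update_apply]

theorem scfg_gateUp (g : Equiv.Perm (DecQ Q₀ × Γ)) (s e : ℤ) (ε : ℤ → Bool) (Λ : ℤ × Bool → Γ)
    (i : ℤ) (b : Bool) (q : DecQ Q₀) :
    gateUpP g (scfg s e ε Λ (i, b) q) =
      if b then gateP g (scfg s e ε Λ (i, b) q) else scfg s e ε Λ (i, b) q := by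
  funext j
  cases b
  · show beltGateApplyUp g _ = _
    by_cases h : j = i <;> simp [scfg, h, beltGateApplyUp]
  · show beltGateApplyUp g _ = beltGateApply g _
    by_cases h : j = i <;> simp [scfg, h, beltGateApplyUp, beltGateApply]

theorem Val.fine {s L : ℤ} {ε : ℤ → Bool} (hv : Val s L ε) (Λ : ℤ × Bool → Γ) (k : ℤ) (q : DecQ Q₀) :
    Fine (cfg s L ε Λ k q) := by
  have hm := addr_fst_mem (s := s) hv.one_le k
  have key : ∀ j, (j < s ∨ s + L - 1 < j) → hd (cfg s L ε Λ k q j) = none ∧ sg (cfg s L ε Λ k q j) = ε j := by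
    intro j hj
    rw [cfg, hd_scfg, sg_scfg, if_neg (by omega), if_neg (by omega), bit, if_neg (by omega)]
    exact ⟨rfl, rfl⟩
  rw [fine_iff]
  simp only [plusOrHead_iff, minusOrHead_iff]
  refine ⟨fun N => ?_, fun N => ?_, fun N => ?_, fun N => ?_⟩
  · obtain ⟨j, h1, h2⟩ := (hv.cof true (max N (s + L))).1
    exact ⟨j, by omega, .inr (by rw [(key j (by omega)).2, h2])⟩
  · obtain ⟨j, h1, h2⟩ := (hv.cof false (max N (s + L))).1
    exact ⟨j, by omega, .inr (by rw [(key j (by omega)).2, h2])⟩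
  · obtain ⟨j, h1, h2⟩ := (hv.cof true (min N (s - 1))).2
    exact ⟨j, by omega, .inr (by rw [(key j (by omega)).2, h2])⟩
  · obtain ⟨j, h1, h2⟩ := (hv.cof false (min N (s - 1))).2
    exact ⟨j, by omega, .inr (by rw [(key j (by omega)).2, h2])⟩

section Move
variable [DecidableEq Q₀]

theorem scfg_move_ne {q q' : DecQ Q₀} (h : q ≠ q') (s e : ℤ) (ε : ℤ → Bool) (Λ : ℤ × Bool → Γ)
    (a : ℤ × Bool) : moveP q' (scfg s e ε Λ a q) = scfg s e ε Λ a q := by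
  have key : ∀ j, fromLeftTop q' (scfg s e ε Λ a q j) = false ∧
      fromRightBot q' (scfg s e ε Λ a q j) = false := by
    intro j
    unfold scfg
    split_ifs <;> simp [fromLeftTop, fromRightBot, h]
  funext j
  rw [moveP_apply, beltMoveFun]
  simp only [key]
  rcases a with ⟨i, _ | _⟩ <;> by_cases hj : j = i <;> simp [scfg, hj, h]

theorem scfg_move_top {s e i : ℤ} (hs : s ≤ i) (he : i < e) (q : DecQ Q₀) (ε : ℤ → Bool)
    (Λ : ℤ × Bool → Γ) : moveP q (scfg s e ε Λ (i, true) q) = scfg s e ε Λ (i + 1, true) q := by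
  funext j
  rw [moveP_apply, beltMoveFun]
  simp only [scfg]
  by_cases h1 : j = i
  · subst h1
    simp [BSym.plusOrHead, show s ≤ j + 1 by omega, show j + 1 ≤ e by omega, hs, he.le]
  · by_cases h2 : j = i + 1
    · subst h2
      simp [fromLeftTop, show s ≤ i + 1 by omega, show i + 1 ≤ e by omega]
    · have h3 : ¬ j - 1 = i := by omega
      simp only [h1, h2, h3, if_false, if_true, fromLeftTop]
      have h4 : fromRightBot q (if j + 1 = i then (BSym.top q (Λ (j+1, true)) (Λ (j+1, false)))
        else .belt (Λ (j+1, true)) (Λ (j+1, false)) (if s ≤ j+1 ∧ j+1 ≤ e then decide (j+1 < i) else ε (j+1))) = false := by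
        split_ifs <;> rfl
      simp only [h4]
      simp only [Bool.false_eq_true, and_false, if_false]
      congr 1
      split_ifs <;> simp; omega

theorem scfg_move_topEnd {s e : ℤ} (hs : s ≤ e) (q : DecQ Q₀) {ε : ℤ → Bool} (h : ε (e + 1) = true)
    (Λ : ℤ × Bool → Γ) : moveP q (scfg s e ε Λ (e, true) q) = scfg s e ε Λ (e, false) q := by
  funext j
  rw [moveP_apply, beltMoveFun]
  simp only [scfg]
  by_cases h1 : j = e
  · subst h1
    simp [BSym.plusOrHead, h]
  · by_cases h2 : j = e + 1
    · subst h2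
      simp [fromLeftTop, fromRightBot, h, show ¬ e + 1 + 1 = e by omega]
    · have h3 : ¬ j - 1 = e := by omega
      simp only [h1, h2, h3, if_false, if_true, fromLeftTop]
      have h4 : fromRightBot q (if j + 1 = e then (BSym.top q (Λ (j+1, true)) (Λ (j+1, false)))
        else .belt (Λ (j+1, true)) (Λ (j+1, false)) (if s ≤ j+1 ∧ j+1 ≤ e then decide (j+1 < e) else ε (j+1))) = false := by
        split_ifs <;> rfl
      simp only [h4]
      simp

theorem scfg_move_bot {s e i : ℤ} (hs : s < i) (he : i ≤ e) (q : DecQ Q₀) (ε : ℤ → Bool)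
    (Λ : ℤ × Bool → Γ) : moveP q (scfg s e ε Λ (i, false) q) = scfg s e ε Λ (i - 1, false) q := by
  funext j
  rw [moveP_apply, beltMoveFun]
  simp only [scfg]
  by_cases h1 : j = i
  · subst h1
    simp [BSym.minusOrHead, show s ≤ j - 1 by omega, show j - 1 ≤ e by omega, hs.le, he,
      show ¬ j = j - 1 by omega, show ¬ j < j - 1 by omega]
  · by_cases h2 : j = i - 1
    · subst h2
      simp [fromLeftTop, fromRightBot, show s ≤ i - 1 by omega, show i - 1 ≤ e by omega]
    · have h3 : ¬ j + 1 = i := by omega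
      simp only [h1, h2, h3, if_false, if_true, fromRightBot]
      have h4 : fromLeftTop q (if j - 1 = i then (BSym.bot (Λ (j-1, true)) q (Λ (j-1, false)))
        else .belt (Λ (j-1, true)) (Λ (j-1, false)) (if s ≤ j-1 ∧ j-1 ≤ e then decide (j-1 < i) else ε (j-1))) = false := by
        split_ifs <;> rfl
      simp only [Bool.false_eq_true, if_false, h4, and_false]
      congr 1
      split_ifs <;> simp; omega

theorem scfg_move_botEnd {s e : ℤ} (hs : s ≤ e) (q : DecQ Q₀) {ε : ℤ → Bool} (h : ε (s - 1) = false)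
    (Λ : ℤ × Bool → Γ) : moveP q (scfg s e ε Λ (s, false) q) = scfg s e ε Λ (s, true) q := by
  funext j
  rw [moveP_apply, beltMoveFun]
  simp only [scfg]
  by_cases h1 : j = s
  · subst h1
    simp [BSym.minusOrHead, h]
  · by_cases h2 : j = s - 1
    · subst h2
      simp [fromLeftTop, fromRightBot, h, show ¬ s - 1 - 1 = s by omega]
    · have h3 : ¬ j + 1 = s := by omega
      simp only [h1, h2, h3, if_false, if_true, fromRightBot]
      have h4 : fromLeftTop q (if j - 1 = s then (BSym.bot (Λ (j-1, true)) q (Λ (j-1, false)))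
        else .belt (Λ (j-1, true)) (Λ (j-1, false)) (if s ≤ j-1 ∧ j-1 ≤ e then decide (j-1 < s) else ε (j-1))) = false := by
        split_ifs <;> rfl
      simp only [Bool.false_eq_true, if_false, h4, and_false]

theorem cfg_move {s L : ℤ} {ε : ℤ → Bool} (hv : Val s L ε) (Λ : ℤ × Bool → Γ) (k : ℤ) (q q' : DecQ Q₀) :
    moveP q' (cfg s L ε Λ k q) = cfg s L ε Λ (if q = q' then k + 1 else k) q := by
  have hL := hv.one_le
  split_ifs with h
  · subst h
    have h1 := Int.emod_nonneg k (show 2 * L ≠ 0 by omega)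
    have h2 := Int.emod_lt_of_pos k (show 0 < 2 * L by omega)
    have h3 := emod_succ (k := k) (show 0 < 2 * L by omega)
    unfold cfg addr
    rw [h3]
    by_cases c1 : k % (2 * L) + 1 = 2 * L
    · rw [if_pos c1, if_neg (by omega), if_pos (by omega),
        show s + 2 * L - 1 - k % (2 * L) = s by omega, add_zero]
      exact scfg_move_botEnd (by omega) q hv.left Λ
    · rw [if_neg c1]
      by_cases c2 : k % (2 * L) + 1 < L
      · rw [if_pos (by omega), if_pos c2, ← add_assoc]
        exact scfg_move_top (by omega) (by omega) q ε Λ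
      · rw [if_neg c2]
        by_cases c3 : k % (2 * L) < L
        · rw [if_pos c3, show s + k % (2 * L) = s + L - 1 by omega,
            show s + 2 * L - 1 - (k % (2 * L) + 1) = s + L - 1 by omega]
          exact scfg_move_topEnd (by omega) q (by rw [show s + L - 1 + 1 = s + L by ring]; exact hv.right) Λ
        · rw [if_neg c3, show s + 2 * L - 1 - (k % (2 * L) + 1) = s + 2 * L - 1 - k % (2 * L) - 1 by ring]
          exact scfg_move_bot (by omega) (by omega) q ε Λ
  · exact scfg_move_ne h ..

variable [Fintype Q₀]

/-- The move of all heads, regardless of their state. -/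
noncomputable def rhoP : Equiv.Perm (Cf Q₀ Γ) :=
  ((Finset.univ : Finset (DecQ Q₀)).toList.map fun q => (moveP q : Equiv.Perm (Cf Q₀ Γ))).prod

theorem cfg_moves {s L : ℤ} {ε : ℤ → Bool} (hv : Val s L ε) (Λ : ℤ × Bool → Γ) (k : ℤ) (q : DecQ Q₀)
    (l : List (DecQ Q₀)) (hl : l.Nodup) :
    (l.map fun q => (moveP q : Equiv.Perm (Cf Q₀ Γ))).prod (cfg s L ε Λ k q) =
      cfg s L ε Λ (if q ∈ l then k + 1 else k) q := by
  induction l with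
  | nil => simp
  | cons q' l ih =>
    rw [List.nodup_cons] at hl
    rw [List.map_cons, List.prod_cons, Equiv.Perm.mul_apply, ih hl.2, cfg_move hv]
    congr 1
    by_cases h : q = q'
    · subst h
      simp [hl.1]
    · simp [h]

theorem cfg_rho {s L : ℤ} {ε : ℤ → Bool} (hv : Val s L ε) (Λ : ℤ × Bool → Γ) (k : ℤ) (q : DecQ Q₀) :
    rhoP (cfg s L ε Λ k q) = cfg s L ε Λ (k + 1) q := by
  rw [rhoP, cfg_moves hv Λ k q _ (Finset.nodup_toList _)]
  simp

theorem cfg_rho_zpow {s L : ℤ} {ε : ℤ → Bool} (hv : Val s L ε) (Λ : ℤ × Bool → Γ) (k j : ℤ) (q : DecQ Q₀) :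
    (rhoP ^ j : Equiv.Perm (Cf Q₀ Γ)) (cfg s L ε Λ k q) = cfg s L ε Λ (k + j) q := by
  induction j using Int.induction_on generalizing k with
  | zero => simp
  | succ n ih => rw [zpow_add_one, Equiv.Perm.mul_apply, cfg_rho hv, ih]; congr 1; ring
  | pred n ih =>
    rw [zpow_sub_one, Equiv.Perm.mul_apply]
    have : (rhoP : Equiv.Perm (Cf Q₀ Γ))⁻¹ (cfg s L ε Λ k q) = cfg s L ε Λ (k - 1) q := by
      rw [Equiv.Perm.inv_eq_iff_eq, cfg_rho hv]; congr 1; ring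
    rw [this, ih]; congr 1; ring

theorem rhoP_loc : (rhoP : Equiv.Perm (Cf Q₀ Γ)) ∈ LocG cutAfter ∧
    (rhoP : Equiv.Perm (Cf Q₀ Γ)) ∈ LocG GW := by
  constructor <;> refine Subgroup.list_prod_mem _ ?_ <;> intro g hg <;> rw [List.mem_map] at hg <;>
    obtain ⟨q, -, rfl⟩ := hg
  · exact (moveP_loc q).1
  · exact (moveP_loc q).2

theorem rhoP_NB : ∃ c, NB (SGen Q₀ Γ) (rhoP : Equiv.Perm (Cf Q₀ Γ)) c := by
  refine ⟨_, NB.list_prod (c := 1) ?_⟩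
  intro g hg
  rw [List.mem_map] at hg
  obtain ⟨q, -, rfl⟩ := hg
  exact NB.of_mem (moveP_mem q)

end Move
end Belt
section Transfer
variable {Q₀ Γ : Type}

/-- A fine configuration with a unique head in a known block is one of the `cfg`. -/
theorem exists_cfg_of_block {x : Cf Q₀ Γ} (hx : Fine x) {s e i : ℤ} (hb : IsBlock x s e) (hs : s ≤ i)
    (he : i ≤ e) (hi : hd (x i) ≠ none) (hu : ∀ j, j ≠ i → hd (x j) = none) :
    ∃ ε Λ k q, Val s (e - s + 1) ε ∧ x = cfg s (e - s + 1) ε Λ k q := by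
  obtain ⟨hse, hc1, hc2, hnc⟩ := hb
  have hbit : ∀ j, s ≤ j → j ≤ e → j ≠ i → sg (x j) = decide (j < i) := by
    intro j h1 h2 h3
    rcases lt_or_gt_of_ne h3 with h | h
    · by_contra hcon
      have hm : (x j).minusOrHead = true := by
        rw [minusOrHead_iff]; right; simpa [h] using hcon
      obtain ⟨t, t1, t2, t3⟩ := exists_cut x h hm ((plusOrHead_iff _).2 (.inl hi))
      exact hnc t (by omega) (by omega) t3
    · by_contra hcon
      have hm : (x j).plusOrHead = true := by
        rw [plusOrHead_iff]; right; simpa [h.not_gt] using hcon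
      obtain ⟨t, t1, t2, t3⟩ := exists_cut x h ((minusOrHead_iff _).2 (.inl hi)) hm
      exact hnc t (by omega) (by omega) t3
  have hpl : ∀ j, j ≠ i → (x j).plusOrHead = true → sg (x j) = true := by
    intro j h1 h2
    simpa [plusOrHead_iff, hu j h1] using h2
  have hmi : ∀ j, j ≠ i → (x j).minusOrHead = true → sg (x j) = false := by
    intro j h1 h2
    simpa [minusOrHead_iff, hu j h1] using h2
  obtain ⟨f1, f2, f3, f4⟩ := (fine_iff x).1 hx
  have hv : Val s (e - s + 1) (fun j => sg (x j)) := by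
    refine ⟨by omega, hmi _ (by omega) hc1.1, ?_, ?_⟩
    · rw [show s + (e - s + 1) = e + 1 by ring]
      exact hpl _ (by omega) hc2.2
    · rintro (_ | _) N
      · obtain ⟨j, h1, h2⟩ := f2 (max N (i + 1))
        obtain ⟨j', h1', h2'⟩ := f4 (min N (i - 1))
        exact ⟨⟨j, by omega, hmi j (by omega) h2⟩, ⟨j', by omega, hmi j' (by omega) h2'⟩⟩
      · obtain ⟨j, h1, h2⟩ := f1 (max N (i + 1))
        obtain ⟨j', h1', h2'⟩ := f3 (min N (i - 1))
        exact ⟨⟨j, by omega, hpl j (by omega) h2⟩, ⟨j', by omega, hpl j' (by omega) h2'⟩⟩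
  obtain ⟨⟨b, c⟩, hbc⟩ := Option.ne_none_iff_exists'.1 hi
  have hk : ∃ k, addr s (e - s + 1) k = (i, b) := by
    cases b
    · refine ⟨e + (e + 1) - i - s, ?_⟩
      rw [addr_of_bot (by omega) (by omega)]
      congr 1; ring
    · refine ⟨i - s, ?_⟩
      rw [addr_of_top (by omega) (by omega)]
      congr 1; ring
  obtain ⟨k, hk⟩ := hk
  refine ⟨_, fun a => if a.2 then (x a.1).topLetter else (x a.1).botLetter, k,
    (c.1, c.2.1, (sg (x i), c.2.2)), hv, ?_⟩
  rw [cfg, eq_scfg_iff, hk]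
  intro j
  refine ⟨rfl, rfl, ?_, ?_⟩
  · split_ifs with h
    · subst h; exact hbc
    · exact hu j h
  · simp only
    split_ifs with h
    · subst h; rfl
    · unfold bit
      split_ifs with h2
      · exact hbit j h2.1 (by omega) h
      · rfl

theorem exists_cfg {x : Cf Q₀ Γ} (hx : Fine x) {i : ℤ} (hi : hd (x i) ≠ none)
    (hu : ∀ j, j ≠ i → hd (x j) = none) :
    ∃ s L ε Λ k q, Val s L ε ∧ x = cfg s L ε Λ k q := by
  obtain ⟨s, e, hb, h1, h2⟩ := hx.exists_block i
  obtain ⟨ε, Λ, k, q, hv, h⟩ := exists_cfg_of_block hx hb h1 h2 hi hu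
  exact ⟨s, _, ε, Λ, k, q, hv, h⟩

/-- The filling of the outside of `I` with headless cells of alternating sign. -/
def fill (I : Set ℤ) [DecidablePred (· ∈ I)] (i₀ l r : ℤ) (x : Cf Q₀ Γ) : Cf Q₀ Γ := fun j =>
  if j ∈ I then x j else mkCell (x j).topLetter (x j).botLetter
    (if i₀ < j then decide ((j - r) % 2 = 1) else decide ((l - j) % 2 = 0)) none

open Classical in
/-- Isolation: the outside of a convex set bounded by walls can be replaced by headless cells. -/
theorem exists_isolated {x : Cf Q₀ Γ} (hx : Fine x) {I : Set ℤ} (hI : I.OrdConnected) {i₀ : ℤ} (h0 : i₀ ∈ I)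
    (hw : ∀ t, Bd I t → cutAfter x t) :
    ∃ y, Fine y ∧ (∀ j ∈ I, x j = y j) ∧ (∀ j ∉ I, hd (y j) = none) ∧
      (∀ t, Bd I t → cutAfter y t) ∧ ((∀ t, Bd I t → GW x t) → ∀ t, Bd I t → GW y t) := by
  have hord : ∀ a b c, a ∈ I → c ∈ I → a ≤ b → b ≤ c → b ∈ I := fun a b c ha hc h1 h2 =>
    hI.out ha hc ⟨h1, h2⟩
  obtain ⟨r, hr⟩ : ∃ r, ∀ t ∈ I, t + 1 ∉ I → t = r := by
    by_cases h : ∃ r ∈ I, r + 1 ∉ I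
    · obtain ⟨r, h1, h2⟩ := h
      refine ⟨r, fun t h3 h4 => ?_⟩
      by_contra hne
      rcases lt_or_gt_of_ne hne with h | h
      · exact h4 (hord t _ r h3 h1 (by omega) (by omega))
      · exact h2 (hord r _ t h1 h3 (by omega) (by omega))
    · exact ⟨0, fun t h1 h2 => (h ⟨t, h1, h2⟩).elim⟩
  obtain ⟨l, hl⟩ : ∃ l, ∀ t, t ∉ I → t + 1 ∈ I → t + 1 = l := by
    by_cases h : ∃ t, t ∉ I ∧ t + 1 ∈ I
    · obtain ⟨t', h1, h2⟩ := h
      refine ⟨t' + 1, fun t h3 h4 => ?_⟩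
      by_contra hne
      rcases lt_or_gt_of_ne hne with h | h
      · exact h1 (hord (t + 1) _ _ h4 h2 (by omega) (by omega))
      · exact h3 (hord (t' + 1) _ (t + 1) h2 h4 (by omega) (by omega))
    · exact ⟨0, fun t h1 h2 => (h ⟨t, h1, h2⟩).elim⟩
  set y := fill I i₀ l (r : ℤ) x with hy
  have hin : ∀ j ∈ I, y j = x j := fun j hj => if_pos hj
  have hout : ∀ j ∉ I, hd (y j) = none ∧
      sg (y j) = (if i₀ < j then decide ((j - r) % 2 = 1) else decide ((l - j) % 2 = 0)) := by
    intro j hj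
    simp only [hy, fill, if_neg hj, hd_mkCell, sg_mkCell]
    trivial
  -- cells near the right boundary
  have right : ∀ t ∈ I, t + 1 ∉ I → i₀ ≤ t ∧ (∀ n : ℕ, 1 ≤ n → t + n ∉ I) ∧ t = r := by
    intro t h1 h2
    have h3 : i₀ ≤ t := by
      by_contra hcon
      exact h2 (hord t _ i₀ h1 h0 (by omega) (by omega))
    exact ⟨h3, fun n hn h4 => h2 (hord t _ _ h1 h4 (by omega) (by omega)), hr t h1 h2⟩
  have left : ∀ t, t ∉ I → t + 1 ∈ I → t + 1 ≤ i₀ ∧ (∀ n : ℕ, t - n ∉ I) ∧ t + 1 = l := by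
    intro t h1 h2
    have h3 : t + 1 ≤ i₀ := by
      by_contra hcon
      exact h1 (hord i₀ _ (t + 1) h0 h2 (by omega) (by omega))
    exact ⟨h3, fun n h4 => h1 (hord _ _ (t + 1) h4 h2 (by omega) (by omega)), hl t h1 h2⟩
  have yr : ∀ t ∈ I, t + 1 ∉ I → isPl (y (t + 1)) ∧ isMi (y (t + 2)) ∧ isPl (y (t + 3)) := by
    intro t h1 h2
    obtain ⟨h3, h4, rfl⟩ := right t h1 h2
    have a1 := hout (t + 1) h2
    have a2 := hout (t + 2) (by simpa using h4 2 (by norm_num))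
    have a3 := hout (t + 3) (by simpa using h4 3 (by norm_num))
    rw [if_pos (by omega)] at a1 a2 a3
    refine ⟨⟨a1.1, ?_⟩, ⟨a2.1, ?_⟩, ⟨a3.1, ?_⟩⟩
    · rw [a1.2, decide_eq_true_eq]; omega
    · rw [a2.2, decide_eq_false_iff_not]; omega
    · rw [a3.2, decide_eq_true_eq]; omega
  have yl : ∀ t, t ∉ I → t + 1 ∈ I → isMi (y t) ∧ isPl (y (t - 1)) ∧ isMi (y (t - 2)) := by
    intro t h1 h2
    obtain ⟨h3, h4, h5⟩ := left t h1 h2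
    have a1 := hout t h1
    have a2 := hout (t - 1) (by simpa using h4 1)
    have a3 := hout (t - 2) (by simpa using h4 2)
    rw [if_neg (by omega)] at a1 a2 a3
    refine ⟨⟨a1.1, ?_⟩, ⟨a2.1, ?_⟩, ⟨a3.1, ?_⟩⟩
    · rw [a1.2, decide_eq_false_iff_not]; omega
    · rw [a2.2, decide_eq_true_eq]; omega
    · rw [a3.2, decide_eq_false_iff_not]; omega
  have hcut : ∀ t, Bd I t → cutAfter y t := by
    rintro t ht
    have hc := hw t ht
    rcases ht with ⟨h1, h2⟩ | ⟨h1, h2⟩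
    · refine ⟨?_, ?_⟩
      · rw [hin t h1]; exact hc.1
      · rw [plusOrHead_iff]; exact .inr (yr t h1 h2).1.2
    · refine ⟨?_, ?_⟩
      · rw [minusOrHead_iff]; exact .inr (yl t h1 h2).1.2
      · rw [hin _ h2]; exact hc.2
  have nor : ∀ c : BSym (DecQ Q₀) Γ, isPl c → isMi c → False := by
    rintro c ⟨-, h1⟩ ⟨-, h2⟩
    rw [h1] at h2
    exact Bool.noConfusion h2
  refine ⟨y, ?_, fun j hj => (hin j hj).symm, fun j hj => (hout j hj).1, hcut, ?_⟩
  · obtain ⟨f1, f2, f3, f4⟩ := (fine_iff x).1 hx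
    have hR : (∀ j, i₀ ≤ j → j ∈ I) ∨ ∃ j₀, i₀ ≤ j₀ ∧ ∀ j, j₀ ≤ j → j ∉ I := by
      by_cases h : ∀ j, i₀ ≤ j → j ∈ I
      · exact .inl h
      · push Not at h
        obtain ⟨j₀, h1, h2⟩ := h
        exact .inr ⟨j₀, h1, fun j hj hj' => h2 (hord i₀ _ j h0 hj' h1 hj)⟩
    have hL : (∀ j, j ≤ i₀ → j ∈ I) ∨ ∃ j₀, j₀ ≤ i₀ ∧ ∀ j, j ≤ j₀ → j ∉ I := by
      by_cases h : ∀ j, j ≤ i₀ → j ∈ I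
      · exact .inl h
      · push Not at h
        obtain ⟨j₀, h1, h2⟩ := h
        exact .inr ⟨j₀, h1, fun j hj hj' => h2 (hord j _ i₀ hj' h0 hj h1)⟩
    have sR : ∀ j₀, i₀ ≤ j₀ → (∀ j, j₀ ≤ j → j ∉ I) → ∀ (N : ℤ) (b : Bool), ∃ j, N ≤ j ∧ sg (y j) = b := by
      intro j₀ h1 h2 N b
      have h3 : ∀ j, max N (j₀ + 1) ≤ j → sg (y j) = decide ((j - r) % 2 = 1) := by
        intro j hj
        rw [(hout j (h2 j (by omega))).2, if_pos (by omega)]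
      by_cases h4 : decide ((max N (j₀ + 1) - r) % 2 = 1) = b
      · exact ⟨_, le_max_left _ _, (h3 _ le_rfl).trans h4⟩
      · refine ⟨max N (j₀ + 1) + 1, by omega, (h3 _ (by omega)).trans ?_⟩
        cases b <;> simp at h4 ⊢ <;> omega
    have sL : ∀ j₀, j₀ ≤ i₀ → (∀ j, j ≤ j₀ → j ∉ I) → ∀ (N : ℤ) (b : Bool), ∃ j, j ≤ N ∧ sg (y j) = b := by
      intro j₀ h1 h2 N b
      have h3 : ∀ j, j ≤ min N j₀ → sg (y j) = decide ((l - j) % 2 = 0) := by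
        intro j hj
        rw [(hout j (h2 j (by omega))).2, if_neg (by omega)]
      by_cases h4 : decide ((l - min N j₀) % 2 = 0) = b
      · exact ⟨_, min_le_left _ _, (h3 _ le_rfl).trans h4⟩
      · refine ⟨min N j₀ - 1, by omega, (h3 _ (by omega)).trans ?_⟩
        cases b <;> simp at h4 ⊢ <;> omega
    rw [fine_iff]
    refine ⟨fun N => ?_, fun N => ?_, fun N => ?_, fun N => ?_⟩
    · rcases hR with h | ⟨j₀, h1, h2⟩
      · obtain ⟨j, h1, h2⟩ := f1 (max N i₀)
        exact ⟨j, by omega, by rw [hin j (h j (by omega))]; exact h2⟩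
      · obtain ⟨j, h3, h4⟩ := sR j₀ h1 h2 N true
        exact ⟨j, h3, (plusOrHead_iff _).2 (.inr h4)⟩
    · rcases hR with h | ⟨j₀, h1, h2⟩
      · obtain ⟨j, h1, h2⟩ := f2 (max N i₀)
        exact ⟨j, by omega, by rw [hin j (h j (by omega))]; exact h2⟩
      · obtain ⟨j, h3, h4⟩ := sR j₀ h1 h2 N false
        exact ⟨j, h3, (minusOrHead_iff _).2 (.inr h4)⟩
    · rcases hL with h | ⟨j₀, h1, h2⟩
      · obtain ⟨j, h1, h2⟩ := f3 (min N i₀)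
        exact ⟨j, by omega, by rw [hin j (h j (by omega))]; exact h2⟩
      · obtain ⟨j, h3, h4⟩ := sL j₀ h1 h2 N true
        exact ⟨j, h3, (plusOrHead_iff _).2 (.inr h4)⟩
    · rcases hL with h | ⟨j₀, h1, h2⟩
      · obtain ⟨j, h1, h2⟩ := f4 (min N i₀)
        exact ⟨j, by omega, by rw [hin j (h j (by omega))]; exact h2⟩
      · obtain ⟨j, h3, h4⟩ := sL j₀ h1 h2 N false
        exact ⟨j, h3, (minusOrHead_iff _).2 (.inr h4)⟩
  · intro hg t ht
    obtain ⟨hgc, hgR, hgL⟩ := hg t ht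
    refine ⟨hcut t ht, ?_, ?_⟩
    · rintro ⟨p1, p2, p3⟩
      rcases ht with ⟨h1, h2⟩ | ⟨h1, h2⟩
      · exact nor _ (yr t h1 h2).2.2 (by rwa [show t + 3 = t + 1 + 2 by ring])
      · by_cases h3 : t + 1 + 1 ∈ I
        · by_cases h4 : t + 1 + 2 ∈ I
          · rw [hin _ h2] at p1
            rw [hin _ h3] at p2
            rw [hin _ h4] at p3
            exact hgR ⟨p1, p2, p3⟩
          · have := (yr (t + 1 + 1) h3 (by rwa [show t + 1 + 1 + 1 = t + 1 + 2 by ring])).1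
            rw [show t + 1 + 1 + 1 = t + 1 + 2 by ring] at this
            exact nor _ this p3
        · exact nor _ (yr (t + 1) h2 h3).1 p2
    · rintro ⟨p1, p2, p3⟩
      rcases ht with ⟨h1, h2⟩ | ⟨h1, h2⟩
      · by_cases h3 : t - 1 ∈ I
        · by_cases h4 : t - 2 ∈ I
          · rw [hin _ h1] at p1
            rw [hin _ h3] at p2
            rw [hin _ h4] at p3
            exact hgL ⟨p1, p2, p3⟩
          · exact nor _ p3 (yl (t - 2) h4 (by rwa [show t - 2 + 1 = t - 1 by ring])).1
        · exact nor _ p2 (yl (t - 1) h3 (by rwa [show t - 1 + 1 = t by ring])).1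
      · exact nor _ p3 (yl t h1 h2).2.2

theorem exists_last_cut (x : Cf Q₀ Γ) {i j : ℤ} (hij : i < j) (hi : (x i).minusOrHead = true)
    (hj : (x j).plusOrHead = true) :
    ∃ t, i ≤ t ∧ t < j ∧ cutAfter x t ∧ ∀ u, t < u → u < j → ¬ (x u).minusOrHead = true := by
  obtain ⟨t, ⟨h1, h2, h3⟩, h4⟩ := Int.exists_greatest_of_bdd
    (P := fun t => i ≤ t ∧ t < j ∧ cutAfter x t) ⟨j, fun z hz => hz.2.1.le⟩ (exists_cut x hij hi hj)
  refine ⟨t, h1, h2, h3, fun u hu1 hu2 hm => ?_⟩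
  obtain ⟨t', a1, a2, a3⟩ := exists_cut x hu2 hm hj
  have := h4 t' ⟨by omega, a2, a3⟩
  omega

/-- Two heads are always separated by a good wall. -/
theorem exists_good_wall (x : Cf Q₀ Γ) {i j : ℤ} (hij : i < j) (hi : hd (x i) ≠ none)
    (hj : hd (x j) ≠ none) : ∃ t, i ≤ t ∧ t < j ∧ GW x t := by
  by_contra hcon
  push Not at hcon
  have nor : ∀ c : BSym (DecQ Q₀) Γ, isPl c → isMi c → False := by
    rintro c ⟨-, h1⟩ ⟨-, h2⟩
    rw [h1] at h2
    exact Bool.noConfusion h2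
  have him := (minusOrHead_iff _).2 (.inl hi : _ ∨ sg (x i) = false)
  have step : ∀ j', i < j' → (x j').plusOrHead = true → (¬ isPl (x j') ∨ ¬ isMi (x (j' + 1))) →
      ¬ isMi (x j') → ∃ t, i ≤ t ∧ t < j' ∧ cutAfter x t ∧ ¬ Rst x (t + 1) := by
    intro j' h1 h2 h3 h4
    obtain ⟨t, a1, a2, a3, a4⟩ := exists_last_cut x h1 him h2
    refine ⟨t, a1, a2, a3, ?_⟩
    rintro ⟨p1, p2, p3⟩
    by_cases e1 : t + 1 = j'
    · rw [e1] at p1 p2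
      tauto
    · by_cases e2 : t + 1 + 1 = j'
      · rw [e2] at p2; exact h4 p2
      · exact a4 (t + 1 + 1) (by omega) (by omega) ((minusOrHead_iff _).2 (.inr p2.2))
  have key : ∀ n : ℕ, ∀ t, i ≤ t → t < i + n → t < j → cutAfter x t → Rst x (t + 1) := by
    intro n
    induction n with
    | zero => intro t h1 h2; omega
    | succ n ih =>
      intro t h1 h2 h3 h4
      by_contra hR
      have hL : Len x t := by
        by_contra hL
        exact hcon t h1 h3 ⟨h4, hR, hL⟩
      obtain ⟨p1, p2, p3⟩ := hL
      have e0 : i ≠ t := by rintro rfl; exact hi p1.1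
      have e1 : i ≠ t - 1 := by rintro rfl; exact hi p2.1
      have e2 : i ≠ t - 2 := by rintro rfl; exact hi p3.1
      obtain ⟨t', a1, a2, a3, a4⟩ := step (t - 2) (by omega) ((plusOrHead_iff _).2 (.inr p3.2))
        (.inr fun h => nor _ p2 (by rwa [show t - 2 + 1 = t - 1 by ring] at h)) (fun h => nor _ p3 h)
      exact a4 (ih t' a1 (by push_cast at h2; omega) (by omega) a3)
  obtain ⟨t, a1, a2, a3, a4⟩ := step j hij ((plusOrHead_iff _).2 (.inl hj)) (.inl fun h => hj h.1)
    (fun h => hj h.1)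
  exact a4 (key (t - i + 1).toNat t a1 (by omega) a2 a3)

/-- Isolation of a block: the block may be viewed inside a configuration without other heads. -/
theorem exists_block_isolated {x : Cf Q₀ Γ} (hx : Fine x) {s e : ℤ} (hb : IsBlock x s e) :
    ∃ y, Fine y ∧ (∀ j, s ≤ j → j ≤ e → x j = y j) ∧ (∀ j, ¬ (s ≤ j ∧ j ≤ e) → hd (y j) = none) ∧
      IsBlock y s e ∧ ∀ g ∈ LocG (cutAfter : Cf Q₀ Γ → ℤ → Prop), ∀ j, s ≤ j → j ≤ e → g x j = g y j := by
  have hbd : ∀ t, Bd (Set.Icc s e) t ↔ (t = s - 1 ∨ t = e) := by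
    have := hb.1
    intro t
    simp only [Bd, Set.mem_Icc]
    omega
  obtain ⟨y, h1, h2, h3, h4, -⟩ := exists_isolated hx (I := Set.Icc s e) Set.ordConnected_Icc
    (i₀ := s) ⟨le_rfl, hb.1⟩ (by
      intro t ht
      rcases (hbd t).1 ht with rfl | rfl
      · exact hb.2.1
      · exact hb.2.2.1)
  refine ⟨y, h1, fun j a b => h2 j ⟨a, b⟩, h3, ⟨hb.1, h4 _ ((hbd _).2 (.inl rfl)),
    h4 _ ((hbd _).2 (.inr rfl)), ?_⟩, ?_⟩
  · intro j a b hc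
    refine hb.2.2.2 j a b ?_
    unfold cutAfter at hc ⊢
    rwa [h2 j ⟨a, by omega⟩, h2 (j + 1) ⟨by omega, by omega⟩]
  · intro g hg j a b
    refine hg.1.agree (Set.Icc s e) x y hx h1 ⟨h2, fun t ht => ⟨?_, h4 t ht⟩⟩ j ⟨a, b⟩
    rcases (hbd t).1 ht with rfl | rfl
    · exact hb.2.1
    · exact hb.2.2.1

/-- Isolation of a component of the good walls. -/
theorem exists_component_isolated {x : Cf Q₀ Γ} (hx : Fine x) {s e : ℤ} (hb : IsBlock x s e) :
    ∃ y, Fine y ∧ (∀ j, s ≤ j → j ≤ e → x j = y j) ∧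
      (∀ i j, hd (y i) ≠ none → hd (y j) ≠ none → i = j) ∧
      IsBlock y s e ∧ ∀ g ∈ LocG (GW : Cf Q₀ Γ → ℤ → Prop), ∀ j, s ≤ j → j ≤ e → g x j = g y j := by
  set I : Set ℤ := {j | ∀ t, (s ≤ t ∧ t < j ∨ j ≤ t ∧ t < s) → ¬ GW x t} with hI
  have hmem : ∀ j, j ∈ I ↔ ∀ t, (s ≤ t ∧ t < j ∨ j ≤ t ∧ t < s) → ¬ GW x t := fun j => Iff.rfl
  have hoc : I.OrdConnected := by
    refine ⟨fun a ha c hc b hb t ht hg => ?_⟩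
    have b1 := hb.1
    have b2 := hb.2
    rcases ht with ht | ht
    · exact hc t (.inl (by omega)) hg
    · exact ha t (.inr (by omega)) hg
  have hs : s ∈ I := by intro t ht; omega
  have hbd : ∀ t, Bd I t → GW x t := by
    intro t ht
    by_contra hg
    simp only [Bd, hmem] at ht
    rcases ht with ⟨h1, h2⟩ | ⟨h2, h1⟩
    · refine h2 fun u hu => ?_
      by_cases e : u = t
      · rwa [e]
      · exact h1 u (by omega)
    · refine h2 fun u hu => ?_
      by_cases e : u = t
      · rwa [e]
      · exact h1 u (by omega)
  have hsub : ∀ j, s ≤ j → j ≤ e → j ∈ I := by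
    intro j a b t ht hg
    exact hb.2.2.2 t (by omega) (by omega) hg.1
  obtain ⟨y, h1, h2, h3, h4, h5⟩ := exists_isolated hx hoc hs (fun t ht => (hbd t ht).1)
  have hrel : Rel GW I x y := ⟨h2, fun t ht => ⟨hbd t ht, h5 hbd t ht⟩⟩
  have hone : ∀ i j, hd (y i) ≠ none → hd (y j) ≠ none → i < j → False := by
    intro i j hi hj hij
    have iI : i ∈ I := by by_contra h; exact hi (h3 i h)
    have jI : j ∈ I := by by_contra h; exact hj (h3 j h)
    rw [← h2 i iI] at hi
    rw [← h2 j jI] at hj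
    obtain ⟨t, t1, t2, t3⟩ := exists_good_wall x hij hi hj
    rcases le_or_gt s t with h | h
    · exact jI t (.inl ⟨h, t2⟩) t3
    · exact iI t (.inr ⟨t1, h⟩) t3
  refine ⟨y, h1, fun j a b => h2 j (hsub j a b), ?_, ?_, ?_⟩
  · intro i j hi hj
    by_contra hne
    rcases lt_or_gt_of_ne hne with h | h
    · exact hone i j hi hj h
    · exact hone j i hj hi h
  · refine ⟨hb.1, ?_, ?_, ?_⟩
    · by_cases h : s - 1 ∈ I
      · have := hb.2.1
        unfold cutAfter at this ⊢
        rw [← h2 _ h, ← h2 (s - 1 + 1) (by rwa [sub_add_cancel])]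
        exact this
      · exact h4 _ (.inr ⟨h, by rwa [sub_add_cancel]⟩)
    · by_cases h : e + 1 ∈ I
      · have := hb.2.2.1
        unfold cutAfter at this ⊢
        rw [← h2 _ h, ← h2 e (hsub e hb.1 le_rfl)]
        exact this
      · exact h4 _ (.inl ⟨hsub e hb.1 le_rfl, h⟩)
    · intro j a b hc
      refine hb.2.2.2 j a b ?_
      unfold cutAfter at hc ⊢
      rwa [h2 j (hsub j a (by omega)), h2 (j + 1) (hsub _ (by omega) (by omega))]
  · intro g hg j a b
    exact hg.1.agree I x y hx h1 hrel j (hsub j a b)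

end Transfer
section Ctrl
open scoped commutatorElement
variable {Q₀ Γ : Type} [DecidableEq Q₀] [Fintype Q₀]

/-- Ducks and ghosts. -/
abbrev PP : Type := Fin 2 × (Bool × Fin 3)

/-- A permutation of ducks and ghosts as a permutation of head symbols. -/
def liftP (h : Equiv.Perm PP) : Equiv.Perm (DecQ Q₀ × Γ) where
  toFun z := ((z.1.1, h z.1.2), z.2)
  invFun z := ((z.1.1, h.symm z.1.2), z.2)
  left_inv z := by simp
  right_inv z := by simp

/-- The gate of a permutation of ducks and ghosts. -/
def gt (h : Equiv.Perm PP) : Equiv.Perm (Cf Q₀ Γ) := gateP (liftP h)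
def gtUp (h : Equiv.Perm PP) : Equiv.Perm (Cf Q₀ Γ) := gateUpP (liftP h)

theorem cfg_gt (h : Equiv.Perm PP) (s L : ℤ) (ε : ℤ → Bool) (Λ : ℤ × Bool → Γ) (k : ℤ) (q : DecQ Q₀) :
    gt h (cfg s L ε Λ k q) = cfg s L ε Λ k (q.1, h q.2) := by
  rw [cfg, gt, scfg_gate]
  simp [liftP, cfg]

theorem cfg_gtUp (h : Equiv.Perm PP) (s L : ℤ) (ε : ℤ → Bool) (Λ : ℤ × Bool → Γ) (k : ℤ) (q : DecQ Q₀) :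
    gtUp h (cfg s L ε Λ k q) = cfg s L ε Λ k (q.1, (if k % (2 * L) < L then h else 1) q.2) := by
  rw [cfg, gtUp, addr]
  split_ifs with h1
  · rw [scfg_gateUp, if_pos rfl, scfg_gate]
    simp [liftP, cfg, addr, h1]
  · rw [scfg_gateUp]
    simp [liftP, cfg, addr, h1]

/-- The basic letters. -/
def BG (Q₀ Γ : Type) [DecidableEq Q₀] [Fintype Q₀] : Set (Equiv.Perm (Cf Q₀ Γ)) :=
  {π | (∃ g, π = gateP g) ∨ (∃ g, π = gateUpP g) ∨ (∃ g, π = gateDownP g) ∨ (∃ q, π = moveP q) ∨ π = rhoP}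

theorem BG_loc {π : Equiv.Perm (Cf Q₀ Γ)} (h : π ∈ BG Q₀ Γ) : π ∈ LocG cutAfter ∧ π ∈ LocG GW := by
  rcases h with ⟨g, rfl⟩ | ⟨g, rfl⟩ | ⟨g, rfl⟩ | ⟨q, rfl⟩ | rfl
  · exact gateP_loc g
  · exact gateUpP_loc g
  · exact gateDownP_loc g
  · exact moveP_loc q
  · exact rhoP_loc

theorem NB.mem_subgroup {G : Type*} [Group G] {F : Set G} {g : G} {c : ℕ} (h : NB F g c) {H : Subgroup G}
    (hF : F ⊆ H) : g ∈ H := (Subgroup.closure_le H).2 hF h.mem_closure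

theorem NB.subset {G : Type*} [Group G] {F F' : Set G} {g : G} {c : ℕ} (h : NB F g c) (hF : F ⊆ F') :
    NB F' g c := by
  have := h.trans (F' := F') (b := 1) fun x hx => NB.of_mem (hF hx)
  rwa [mul_one] at this

/-- `E` applies `f L k` to the ducks and ghosts, depending on the block length and the position. -/
def IsCtrl (E : Equiv.Perm (Cf Q₀ Γ)) (f : ℤ → ℤ → Equiv.Perm PP) : Prop :=
  ∀ s L ε Λ k q, Val s L ε → E (cfg s L ε Λ k q) = cfg s L ε Λ k (q.1, f L k q.2)

theorem IsCtrl.one : IsCtrl (1 : Equiv.Perm (Cf Q₀ Γ)) 1 := fun s L ε Λ k q _ => rfl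

theorem IsCtrl.mul {E E' : Equiv.Perm (Cf Q₀ Γ)} {f f' : ℤ → ℤ → Equiv.Perm PP} (h : IsCtrl E f)
    (h' : IsCtrl E' f') : IsCtrl (E * E') (f * f') := by
  intro s L ε Λ k q hv
  rw [Equiv.Perm.mul_apply, h' _ _ _ _ _ _ hv, h _ _ _ _ _ _ hv]
  rfl

theorem IsCtrl.inv {E : Equiv.Perm (Cf Q₀ Γ)} {f : ℤ → ℤ → Equiv.Perm PP} (h : IsCtrl E f) :
    IsCtrl E⁻¹ f⁻¹ := by
  intro s L ε Λ k q hv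
  rw [Equiv.Perm.inv_eq_iff_eq, h _ _ _ _ _ _ hv]
  simp

theorem IsCtrl.comm {E E' : Equiv.Perm (Cf Q₀ Γ)} {f f' : ℤ → ℤ → Equiv.Perm PP} (h : IsCtrl E f)
    (h' : IsCtrl E' f') : IsCtrl ⁅E, E'⁆ ⁅f, f'⁆ := by
  rw [commutatorElement_def, commutatorElement_def]
  exact ((h.mul h').mul h.inv).mul h'.inv

theorem IsCtrl.shift {E : Equiv.Perm (Cf Q₀ Γ)} {f : ℤ → ℤ → Equiv.Perm PP} (h : IsCtrl E f) (j : ℤ) :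
    IsCtrl (rhoP ^ j * E * (rhoP ^ j)⁻¹) (fun L k => f L (k - j)) := by
  intro s L ε Λ k q hv
  rw [Equiv.Perm.mul_apply, Equiv.Perm.mul_apply, ← zpow_neg, cfg_rho_zpow hv, h _ _ _ _ _ _ hv,
    cfg_rho_zpow hv]
  congr 1; ring

theorem IsCtrl.congr {E : Equiv.Perm (Cf Q₀ Γ)} {f f' : ℤ → ℤ → Equiv.Perm PP} (h : IsCtrl E f)
    (hf : ∀ L k, 1 ≤ L → f L k = f' L k) : IsCtrl E f' := by
  intro s L ε Λ k q hv
  rw [h _ _ _ _ _ _ hv, hf _ _ hv.one_le]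

theorem isCtrl_gt (h : Equiv.Perm PP) : IsCtrl (gt h : Equiv.Perm (Cf Q₀ Γ)) (fun _ _ => h) :=
  fun s L ε Λ k q _ => cfg_gt ..

open Classical in
/-- The permutation `h` controlled by the condition `χ`. -/
noncomputable def ctl (χ : ℤ → ℤ → Prop) (h : Equiv.Perm PP) : ℤ → ℤ → Equiv.Perm PP :=
  fun L k => if χ L k then h else 1

variable {F : Set (Equiv.Perm (Cf Q₀ Γ))}

/-- `h` controlled by `χ` has norm at most `c`. -/
def C1 (F : Set (Equiv.Perm (Cf Q₀ Γ))) (χ : ℤ → ℤ → Prop) (h : Equiv.Perm PP) (c : ℕ) : Prop :=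
  ∃ E, NB F E c ∧ IsCtrl E (ctl χ h)

theorem C1.mono {χ : ℤ → ℤ → Prop} {h : Equiv.Perm PP} {c c' : ℕ} (hE : C1 F χ h c) (hc : c ≤ c') :
    C1 F χ h c' := by
  obtain ⟨E, h1, h2⟩ := hE
  exact ⟨E, h1.mono hc, h2⟩

theorem C1.congr {χ χ' : ℤ → ℤ → Prop} {h : Equiv.Perm PP} {c : ℕ} (hE : C1 F χ h c)
    (hχ : ∀ L k, 1 ≤ L → (χ L k ↔ χ' L k)) : C1 F χ' h c := by
  obtain ⟨E, h1, h2⟩ := hE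
  refine ⟨E, h1, h2.congr fun L k hL => ?_⟩
  by_cases a : χ L k
  · simp [ctl, a, (hχ L k hL).1 a]
  · simp [ctl, a, mt (hχ L k hL).2 a]

theorem C1.mul {χ : ℤ → ℤ → Prop} {h h' : Equiv.Perm PP} {c c' : ℕ} (hE : C1 F χ h c) (hE' : C1 F χ h' c') :
    C1 F χ (h * h') (c + c') := by
  obtain ⟨E, h1, h2⟩ := hE
  obtain ⟨E', h1', h2'⟩ := hE'
  refine ⟨E * E', h1.mul h1', (h2.mul h2').congr fun L k _ => ?_⟩
  simp only [ctl, Pi.mul_apply]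
  split_ifs <;> simp

theorem C1.inv {χ : ℤ → ℤ → Prop} {h : Equiv.Perm PP} {c : ℕ} (hE : C1 F χ h c) : C1 F χ h⁻¹ c := by
  obtain ⟨E, h1, h2⟩ := hE
  refine ⟨E⁻¹, h1.inv, h2.inv.congr fun L k _ => ?_⟩
  simp only [ctl, Pi.inv_apply]
  split_ifs <;> simp

theorem C1.of_NB {χ : ℤ → ℤ → Prop} {S : Set (Equiv.Perm PP)} {h : Equiv.Perm PP} {n c : ℕ} (hh : NB S h n)
    (hS : ∀ x ∈ S, C1 F χ x c) : C1 F χ h (n * c) := by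
  obtain ⟨w, hw, h1, rfl⟩ := hh
  refine C1.mono (c := w.length * c) ?_ (Nat.mul_le_mul_right _ hw)
  clear hw
  induction w with
  | nil =>
    refine ⟨1, NB.one _, IsCtrl.one.congr fun L k _ => ?_⟩
    simp [ctl]
  | cons x w ih =>
    rw [List.prod_cons, List.length_cons, add_mul, one_mul, add_comm]
    refine C1.mul ?_ (ih fun y hy => h1 y (List.mem_cons_of_mem _ hy))
    rcases h1 x List.mem_cons_self with h | h
    · exact hS x h
    · simpa using (hS _ h).inv

theorem C1.comm {χ χ' : ℤ → ℤ → Prop} {h h' : Equiv.Perm PP} {c c' : ℕ} (hE : C1 F χ h c) (hE' : C1 F χ' h' c') :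
    C1 F (fun L k => χ L k ∧ χ' L k) ⁅h, h'⁆ (2 * c + 2 * c') := by
  obtain ⟨E, h1, h2⟩ := hE
  obtain ⟨E', h1', h2'⟩ := hE'
  refine ⟨⁅E, E'⁆, h1.comm h1', (h2.comm h2').congr fun L k _ => ?_⟩
  simp only [ctl, commutatorElement_def, Pi.mul_apply, Pi.inv_apply]
  by_cases a : χ L k <;> by_cases b : χ' L k <;> simp [a, b]

theorem BG_gt (h : Equiv.Perm PP) : gt h ∈ BG Q₀ Γ := .inl ⟨_, rfl⟩
theorem BG_rho : rhoP ∈ BG Q₀ Γ := .inr (.inr (.inr (.inr rfl)))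

theorem C1.gate (hF : BG Q₀ Γ ⊆ F) (h : Equiv.Perm PP) : C1 F (fun _ _ => True) h 1 :=
  ⟨gt h, NB.of_mem (hF (BG_gt h)), (isCtrl_gt h).congr fun L k _ => by simp [ctl]⟩

theorem C1.conj_gate (hF : BG Q₀ Γ ⊆ F) {χ : ℤ → ℤ → Prop} {h : Equiv.Perm PP} {c : ℕ} (hE : C1 F χ h c)
    (g : Equiv.Perm PP) : C1 F χ (g * h * g⁻¹) (c + 2) := by
  obtain ⟨E, h1, h2⟩ := hE
  refine ⟨gt g * E * (gt g)⁻¹, (h1.conj (NB.of_mem (hF (BG_gt g)))).mono (by omega),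
    (((isCtrl_gt g).mul h2).mul (isCtrl_gt g).inv).congr fun L k _ => ?_⟩
  simp only [ctl, Pi.mul_apply, Pi.inv_apply]
  split_ifs <;> simp

theorem NB_rho (hF : BG Q₀ Γ ⊆ F) (j : ℤ) : NB F (rhoP ^ j) j.natAbs := by
  have := NB.zpow (NB.of_mem (hF BG_rho)) j
  rwa [mul_one] at this

theorem C1.shift (hF : BG Q₀ Γ ⊆ F) {χ : ℤ → ℤ → Prop} {h : Equiv.Perm PP} {c : ℕ} (hE : C1 F χ h c) (j : ℤ) :
    C1 F (fun L k => χ L (k - j)) h (c + 2 * j.natAbs) := by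
  obtain ⟨E, h1, h2⟩ := hE
  exact ⟨_, h1.conj (NB_rho hF j), h2.shift j⟩

/-! The fixed permutations -/

abbrev dbl : Equiv.Perm PP :=
  Equiv.swap (0, false, 0) (1, false, 0) * Equiv.swap (0, true, 0) (1, true, 0)
abbrev tri₁ : Equiv.Perm PP :=
  Equiv.swap (0, false, 0) (1, false, 0) * Equiv.swap (1, false, 0) (0, false, 1)
abbrev tri₂ : Equiv.Perm PP :=
  Equiv.swap (1, false, 0) (0, false, 1) * Equiv.swap (1, false, 0) (0, false, 0)

theorem comm_tri_dbl : ⁅tri₁, dbl⁆ = tri₂ := by decide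

theorem dbl_mul_self : dbl * dbl = 1 := by decide

theorem isThreeCycle_tri₁ : tri₁.IsThreeCycle := by
  have := Equiv.Perm.isThreeCycle_swap_mul_swap_same (a := ((1, false, 0) : PP)) (b := (0, false, 0))
    (c := (0, false, 1)) (by decide) (by decide) (by decide)
  rwa [Equiv.swap_comm (1, false, 0) (0, false, 0)] at this

theorem isThreeCycle_tri₂ : tri₂.IsThreeCycle :=
  Equiv.Perm.isThreeCycle_swap_mul_swap_same (by decide) (by decide) (by decide)

theorem dbl_mem : dbl ∈ alternatingGroup PP := by
  rw [Equiv.Perm.mem_alternatingGroup]; decide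

theorem exists_tri_bound : ∃ A : ℕ, ∀ h ∈ alternatingGroup PP,
    NB {x : Equiv.Perm PP | ∃ g, x = g * tri₂ * g⁻¹} h A := by
  classical
  have : ∀ h : Equiv.Perm PP, ∃ A, h ∈ alternatingGroup PP →
      NB {x : Equiv.Perm PP | ∃ g, x = g * tri₂ * g⁻¹} h A := by
    intro h
    by_cases hh : h ∈ alternatingGroup PP
    · have h2 : h ∈ Subgroup.closure {x : Equiv.Perm PP | ∃ g, x = g * tri₂ * g⁻¹} := by
        rw [← Equiv.Perm.closure_three_cycles_eq_alternating] at hh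
        refine Subgroup.closure_mono ?_ hh
        intro x hx
        have : IsConj tri₂ x := by
          rw [Equiv.Perm.isConj_iff_cycleType_eq, isThreeCycle_tri₂.cycleType, Equiv.Perm.IsThreeCycle.cycleType hx]
        obtain ⟨g, hg⟩ := isConj_iff.1 this
        exact ⟨g, hg.symm⟩
      obtain ⟨c, hc⟩ := exists_NB_of_mem_closure h2
      exact ⟨c, fun _ => hc⟩
    · exact ⟨0, fun h => (hh h).elim⟩
  choose A hA using this
  refine ⟨∑ h, A h, fun h hh => (hA h hh).mono (Finset.single_le_sum (f := A) (fun _ _ => Nat.zero_le _) (Finset.mem_univ h))⟩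

/-- A bound for the number of conjugates of `tri₂` needed to write an even permutation. -/
noncomputable def Atri : ℕ := exists_tri_bound.choose
theorem Atri_spec : ∀ h ∈ alternatingGroup PP,
    NB {x : Equiv.Perm PP | ∃ g, x = g * tri₂ * g⁻¹} h Atri := exists_tri_bound.choose_spec

/-- All even permutations, controlled by `χ`, have norm at most `c`. -/
def CB (F : Set (Equiv.Perm (Cf Q₀ Γ))) (χ : ℤ → ℤ → Prop) (c : ℕ) : Prop :=
  ∀ h ∈ alternatingGroup PP, C1 F χ h c

theorem CB.mono {χ : ℤ → ℤ → Prop} {c c' : ℕ} (hE : CB F χ c) (hc : c ≤ c') : CB F χ c' :=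
  fun h hh => (hE h hh).mono hc

theorem CB.congr {χ χ' : ℤ → ℤ → Prop} {c : ℕ} (hE : CB F χ c)
    (hχ : ∀ L k, 1 ≤ L → (χ L k ↔ χ' L k)) : CB F χ' c := fun h hh => (hE h hh).congr hχ

theorem CB.of_tri (hF : BG Q₀ Γ ⊆ F) {χ : ℤ → ℤ → Prop} {c : ℕ} (hE : C1 F χ tri₂ c) :
    CB F χ (Atri * (c + 2)) := by
  intro h hh
  refine C1.of_NB (Atri_spec h hh) ?_
  rintro _ ⟨g, rfl⟩
  exact hE.conj_gate hF g

theorem CB.of_dbl (hF : BG Q₀ Γ ⊆ F) {χ : ℤ → ℤ → Prop} {c : ℕ} (hE : C1 F χ dbl c) :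
    CB F χ (Atri * (2 * c + 4)) := by
  have h := (C1.gate hF tri₁).comm hE
  rw [comm_tri_dbl] at h
  exact ((CB.of_tri hF h).congr fun L k _ => by simp).mono (Nat.mul_le_mul_left _ (by omega))

theorem CB.and (hF : BG Q₀ Γ ⊆ F) {χ χ' : ℤ → ℤ → Prop} {c c' : ℕ} (hE : CB F χ c) (hE' : C1 F χ' dbl c') :
    CB F (fun L k => χ L k ∧ χ' L k) (Atri * (2 * c + 2 * c' + 2)) := by
  have h := (hE tri₁ isThreeCycle_tri₁.mem_alternatingGroup).comm hE'
  rw [comm_tri_dbl] at h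
  exact CB.of_tri hF h

theorem CB.not (hF : BG Q₀ Γ ⊆ F) {χ : ℤ → ℤ → Prop} {c : ℕ} (hE : CB F χ c) :
    CB F (fun L k => ¬ χ L k) (c + 1) := by
  intro h hh
  obtain ⟨E, h1, h2⟩ := (hE h hh).inv
  refine ⟨E * gt h, h1.mul (NB.of_mem (hF (BG_gt h))), (h2.mul (isCtrl_gt h)).congr fun L k _ => ?_⟩
  simp only [ctl, Pi.mul_apply]
  split_ifs <;> simp_all

theorem CB.shift (hF : BG Q₀ Γ ⊆ F) {χ : ℤ → ℤ → Prop} {c : ℕ} (hE : CB F χ c) (j : ℤ) :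
    CB F (fun L k => χ L (k - j)) (c + 2 * j.natAbs) := fun h hh => (hE h hh).shift hF j

theorem CB.or_disjoint {χ χ' : ℤ → ℤ → Prop} {c c' : ℕ} (hE : CB F χ c) (hE' : CB F χ' c')
    (hd : ∀ L k, 1 ≤ L → χ L k → χ' L k → False) : CB F (fun L k => χ L k ∨ χ' L k) (c + c') := by
  intro h hh
  obtain ⟨E, h1, h2⟩ := hE h hh
  obtain ⟨E', h1', h2'⟩ := hE' h hh
  refine ⟨E * E', h1.mul h1', (h2.mul h2').congr fun L k hL => ?_⟩
  have := hd L k hL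
  simp only [ctl, Pi.mul_apply]
  by_cases a : χ L k <;> by_cases b : χ' L k <;> simp [a, b]
  exact (this a b).elim

theorem CB.false (c : ℕ) : CB F (fun _ _ => False) c := by
  intro h _
  exact ⟨1, NB.one _, IsCtrl.one.congr fun L k _ => by simp [ctl]⟩

/-- The head is on the top track. -/
def Top (L k : ℤ) : Prop := k % (2 * L) < L

theorem CB.top (hF : BG Q₀ Γ ⊆ F) : CB F Top 1 := by
  intro h _
  refine ⟨gtUp h, NB.of_mem (hF (.inr (.inl ⟨_, rfl⟩))), ?_⟩
  intro s L ε Λ k q hv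
  rw [cfg_gtUp]
  simp only [ctl, Top]
  congr

end Ctrl
section Kappa
open scoped commutatorElement
variable {Q₀ Γ : Type} [DecidableEq Q₀] [Fintype Q₀]

/-- Maps fixing all headless configurations. -/
def HFix (Q₀ Γ : Type) : Subgroup (Equiv.Perm (Cf Q₀ Γ)) where
  carrier := {g | ∀ x, (∀ j, hd (x j) = none) → g x = x}
  one_mem' := fun _ _ => rfl
  mul_mem' := fun {f g} hf hg x hx => by rw [Equiv.Perm.mul_apply, hg x hx, hf x hx]
  inv_mem' := fun {g} hg x hx => by rw [Equiv.Perm.inv_eq_iff_eq, hg x hx]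

theorem mem_HFix {g : Equiv.Perm (Cf Q₀ Γ)} : g ∈ HFix Q₀ Γ ↔ ∀ x, (∀ j, hd (x j) = none) → g x = x := Iff.rfl

theorem exists_belt_of_hd {c : BSym (DecQ Q₀) Γ} (h : hd c = none) : ∃ a b s, c = .belt a b s := by
  cases c with
  | belt a b s => exact ⟨a, b, s, rfl⟩
  | top => simp [hd] at h
  | bot => simp [hd] at h

theorem BG_HFix {π : Equiv.Perm (Cf Q₀ Γ)} (h : π ∈ BG Q₀ Γ) : π ∈ HFix Q₀ Γ := by
  have hmove : ∀ q, (moveP q : Equiv.Perm (Cf Q₀ Γ)) ∈ HFix Q₀ Γ := by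
    intro q x hx
    funext j
    obtain ⟨a, b, s, h1⟩ := exists_belt_of_hd (hx j)
    obtain ⟨a2, b2, s2, h2⟩ := exists_belt_of_hd (hx (j - 1))
    obtain ⟨a3, b3, s3, h3⟩ := exists_belt_of_hd (hx (j + 1))
    rw [moveP_apply, beltMoveFun, h1, h2, h3]
    simp [fromLeftTop, fromRightBot]
  rcases h with ⟨g, rfl⟩ | ⟨g, rfl⟩ | ⟨g, rfl⟩ | ⟨q, rfl⟩ | rfl
  · intro x hx
    funext j
    obtain ⟨a, b, s, h1⟩ := exists_belt_of_hd (hx j)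
    show beltGateApply g (x j) = _
    rw [h1]; rfl
  · intro x hx
    funext j
    obtain ⟨a, b, s, h1⟩ := exists_belt_of_hd (hx j)
    show beltGateApplyUp g (x j) = _
    rw [h1]; rfl
  · intro x hx
    funext j
    obtain ⟨a, b, s, h1⟩ := exists_belt_of_hd (hx j)
    show beltGateApplyDown g (x j) = _
    rw [h1]; rfl
  · exact hmove q
  · refine Subgroup.list_prod_mem _ ?_
    intro g hg
    rw [List.mem_map] at hg
    obtain ⟨q, -, rfl⟩ := hg
    exact hmove q

/-- The lane swap `a ↔ b` on ducks in `Δ`. -/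
def lsw (a b : Fin 3) (Δ : Fin 2 → Bool) : Equiv.Perm PP where
  toFun z := (z.1, z.2.1, if Δ z.1 then Equiv.swap a b z.2.2 else z.2.2)
  invFun z := (z.1, z.2.1, if Δ z.1 then Equiv.swap a b z.2.2 else z.2.2)
  left_inv z := by by_cases h : Δ z.1 <;> simp [h]
  right_inv z := by by_cases h : Δ z.1 <;> simp [h]

theorem lsw_inv (a b : Fin 3) (Δ : Fin 2 → Bool) : (lsw a b Δ)⁻¹ = lsw a b Δ := rfl

def lswHalf (a b : Fin 3) (Δ : Fin 2 → Bool) : Equiv.Perm PP where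
  toFun z := (z.1, z.2.1, if Δ z.1 && z.2.1 then Equiv.swap a b z.2.2 else z.2.2)
  invFun z := (z.1, z.2.1, if Δ z.1 && z.2.1 then Equiv.swap a b z.2.2 else z.2.2)
  left_inv z := by cases h : (Δ z.1 && z.2.1) <;> simp [h]
  right_inv z := by cases h : (Δ z.1 && z.2.1) <;> simp [h]

/-- The sign flip of the ghosts of given ducks and lane. -/
def sgnFlip (f : Fin 2 → Fin 3 → Bool) : Equiv.Perm PP where
  toFun z := (z.1, xor z.2.1 (f z.1 z.2.2), z.2.2)
  invFun z := (z.1, xor z.2.1 (f z.1 z.2.2), z.2.2)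
  left_inv z := by simp
  right_inv z := by simp

theorem lsw_mem (a b : Fin 3) (Δ : Fin 2 → Bool) : lsw a b Δ ∈ alternatingGroup PP := by
  have : lsw a b Δ = lswHalf a b Δ * (sgnFlip (fun _ _ => true) * lswHalf a b Δ * (sgnFlip (fun _ _ => true))⁻¹) := by
    ext1 ⟨d, s, g⟩
    show (d, s, _) = (d, _, _)
    cases h : Δ d <;> cases s <;> simp [h, lswHalf, sgnFlip]
  rw [Equiv.Perm.mem_alternatingGroup, this, map_mul, map_mul, map_mul, map_inv, mul_inv_cancel_comm,
    Int.units_mul_self]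

/-- The lane swap on the states without sign. -/
def cmu (a b : Fin 3) (Δ : Fin 2 → Bool) (c : Core Q₀) : Core Q₀ :=
  (c.1, c.2.1, if Δ c.2.1 then Equiv.swap a b c.2.2 else c.2.2)

theorem hd_gate_lift (h : Equiv.Perm PP) (c : BSym (DecQ Q₀) Γ) :
    (beltGateApply (liftP h) c).topLetter = c.topLetter ∧ (beltGateApply (liftP h) c).botLetter = c.botLetter := by
  cases c <;> simp [beltGateApply, BSym.topLetter, BSym.botLetter, liftP]

/-- The condition that the three cells to the right belong to the same block. -/
def Right3 (L k : ℤ) : Prop := ((Top L k ∧ Top L (k - -1)) ∧ Top L (k - -2)) ∧ Top L (k - -3)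

theorem right3_iff {L k : ℤ} (hL : 1 ≤ L) : Right3 L k ↔ k % (2 * L) + 3 < L := by
  have h1 := Int.emod_nonneg k (show 2 * L ≠ 0 by omega)
  have h2 := Int.emod_lt_of_pos k (show 0 < 2 * L by omega)
  have e : ∀ j, (k - j) % (2 * L) = (k % (2 * L) - j) % (2 * L) := fun j => by rw [Int.emod_sub_emod]
  simp only [Right3, Top, e]
  generalize k % (2 * L) = r at *
  constructor
  · rintro ⟨⟨⟨h3, h4⟩, h5⟩, h6⟩
    by_contra hcon
    have : r - -1 = L ∨ r - -2 = L ∨ r - -3 = L := by omega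
    rcases this with h | h | h
    · rw [h, Int.emod_eq_of_lt (by omega) (by omega)] at h4; omega
    · rw [h, Int.emod_eq_of_lt (by omega) (by omega)] at h5; omega
    · rw [h, Int.emod_eq_of_lt (by omega) (by omega)] at h6; omega
  · intro h
    refine ⟨⟨⟨by omega, ?_⟩, ?_⟩, ?_⟩ <;> rw [Int.emod_eq_of_lt (by omega) (by omega)] <;> omega

/-- The condition, in terms of cells, that the three cells to the right belong to the same block. -/
def actS (x : Cf Q₀ Γ) (j : ℤ) : Prop :=
  (∃ c, hd (x j) = some (true, c)) ∧ isMi (x (j + 1)) ∧ isMi (x (j + 2)) ∧ isMi (x (j + 3))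

theorem exists_addr {s L : ℤ} (hL : 1 ≤ L) (k : ℤ) :
    (0 ≤ k % (2 * L) ∧ k % (2 * L) < L ∧ addr s L k = (s + k % (2 * L), true)) ∨
    (L ≤ k % (2 * L) ∧ k % (2 * L) < 2 * L ∧ addr s L k = (s + 2 * L - 1 - k % (2 * L), false)) := by
  have h1 := Int.emod_nonneg k (show 2 * L ≠ 0 by omega)
  have h2 := Int.emod_lt_of_pos k (show 0 < 2 * L by omega)
  by_cases h : k % (2 * L) < L
  · exact .inl ⟨h1, h, by simp [addr, h]⟩
  · exact .inr ⟨by omega, h2, by simp [addr, h]⟩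

theorem actS_cfg {s L : ℤ} {ε : ℤ → Bool} (hv : Val s L ε) (Λ : ℤ × Bool → Γ) (k : ℤ) (q : DecQ Q₀) :
    actS (cfg s L ε Λ k q) (addr s L k).1 ↔ Right3 L k := by
  have hL := hv.one_le
  have hm := addr_fst_mem (s := s) hL k
  rw [right3_iff hL]
  unfold actS isMi
  simp only [cfg, hd_scfg, sg_scfg]
  have hr := hv.right
  rcases exists_addr (s := s) hL k with ⟨h1, h2, h3⟩ | ⟨h1, h2, h3⟩
  · rw [h3]
    simp only [bit]
    set r := k % (2 * L)
    by_cases h : r + 3 < L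
    · have e : ∀ d, 1 ≤ d → d ≤ 3 → s ≤ s + r + d ∧ s + r + d ≤ s + L - 1 := fun d _ _ => by omega
      simp [h, e]
    · simp only [h, iff_false]
      rintro ⟨-, ⟨-, h5⟩, ⟨-, h6⟩, -, h7⟩
      rw [if_neg (by omega)] at h5 h6 h7
      have : r + 1 = L ∨ r + 2 = L ∨ r + 3 = L := by omega
      rcases this with h | h | h
      · rw [if_neg (by omega), show s + r + 1 = s + L by omega, hr] at h5; simp at h5
      · rw [if_neg (by omega), show s + r + 2 = s + L by omega, hr] at h6; simp at h6
      · rw [if_neg (by omega), show s + r + 3 = s + L by omega, hr] at h7; simp at h7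
  · rw [h3]
    constructor
    · rintro ⟨⟨c, hc⟩, -⟩
      simp at hc
    · intro h; omega

open Classical in
/-- The rule of the controlled lane swap on fine configurations. -/
theorem rule_of_ctrl {S : Equiv.Perm (Cf Q₀ Γ)} {h : Equiv.Perm PP} (h1 : S ∈ LocG cutAfter) (h2 : S ∈ HFix Q₀ Γ)
    (h3 : IsCtrl S (ctl Right3 h)) {x : Cf Q₀ Γ} (hx : Fine x) (j : ℤ) :
    S x j = if actS x j then beltGateApply (liftP h) (x j) else x j := by
  obtain ⟨s, e, hb, hs, he⟩ := hx.exists_block j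
  obtain ⟨y, hy, hxy, hout, hby, hloc⟩ := exists_block_isolated hx hb
  rw [hloc S h1 j hs he, hxy j hs he]
  by_cases hhead : ∃ i, hd (y i) ≠ none
  swap
  · push Not at hhead
    rw [h2 y hhead, if_neg]
    rintro ⟨⟨c, hc⟩, -⟩
    rw [hxy j hs he, hhead j] at hc
    simp at hc
  obtain ⟨i, hi⟩ := hhead
  have hin : s ≤ i ∧ i ≤ e := by by_contra hcon; exact hi (hout i hcon)
  have huniq : ∀ i', hd (y i') ≠ none → i' = i := by
    intro i' hi'
    by_contra hne
    have hin' : s ≤ i' ∧ i' ≤ e := by by_contra hcon; exact hi' (hout i' hcon)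
    rcases lt_or_gt_of_ne hne with hlt | hlt
    · obtain ⟨t, t1, t2, t3⟩ := exists_cut y hlt ((minusOrHead_iff _).2 (.inl hi')) ((plusOrHead_iff _).2 (.inl hi))
      exact hby.2.2.2 t (by omega) (by omega) t3
    · obtain ⟨t, t1, t2, t3⟩ := exists_cut y hlt ((minusOrHead_iff _).2 (.inl hi)) ((plusOrHead_iff _).2 (.inl hi'))
      exact hby.2.2.2 t (by omega) (by omega) t3
  obtain ⟨ε, Λ, k, q, hv, rfl⟩ := exists_cfg_of_block hy hby hin.1 hin.2 hi
    (fun j hj => by by_contra hcon; exact hj (huniq j hcon))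
  set L := e - s + 1
  rw [h3 _ _ _ _ _ _ hv]
  have hia : i = (addr s L k).1 := by
    by_contra hcon
    simp [cfg, hd_scfg, hcon] at hi
  by_cases hji : j = i
  · have hact : actS x j ↔ actS (cfg s L ε Λ k q) j := by
      have hp := (plusOrHead_iff _).1 hb.2.2.1.2
      have hp' := (plusOrHead_iff _).1 hby.2.2.1.2
      have f : ∀ u : Cf Q₀ Γ, (hd (u (e + 1)) ≠ none ∨ sg (u (e + 1)) = true) → ¬ isMi (u (e + 1)) := by
        rintro u h ⟨h1, h2⟩
        rcases h with h | h
        · exact h h1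
        · rw [h] at h2; simp at h2
      have f1 := f _ hp
      have f2 := f _ hp'
      unfold actS
      rw [hxy j hs he]
      by_cases e1 : j + 1 ≤ e
      swap
      · rw [show j + 1 = e + 1 by omega]; simp [f1, f2]
      rw [hxy (j + 1) (by omega) e1]
      by_cases e2 : j + 2 ≤ e
      swap
      · rw [show j + 2 = e + 1 by omega]; simp [f1, f2]
      rw [hxy (j + 2) (by omega) e2]
      by_cases e3 : j + 3 ≤ e
      swap
      · rw [show j + 3 = e + 1 by omega]; simp [f1, f2]
      rw [hxy (j + 3) (by omega) e3]
    rw [hji, hia] at hact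
    have hiff := hact.trans (actS_cfg hv Λ k q)
    rw [hji, hia]
    by_cases hR : Right3 L k
    · rw [if_pos (hiff.2 hR)]
      simp only [ctl, if_pos hR, cfg]
      rcases hq : addr s L k with ⟨i', _ | _⟩ <;> simp [scfg, beltGateApply, liftP]
    · rw [if_neg (fun h => hR (hiff.1 h))]
      simp [ctl, if_neg hR, cfg]
  · rw [if_neg]
    · simp only [cfg, scfg]
      rw [← hia, if_neg hji, if_neg hji]
    · rintro ⟨⟨c, hc⟩, -⟩
      rw [hxy j hs he] at hc
      exact hji (huniq j (by simp [hc]))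

end Kappa
section Kappa
open scoped commutatorElement
variable {Q₀ Γ : Type} [DecidableEq Q₀] [Fintype Q₀]

/-- The states whose right neighbour carries a wall. -/
def cM (b : Fin 3) (Δ : Fin 2 → Bool) (c : Core Q₀) : Bool := Δ c.2.1 && decide (c.2.2 = b)

/-- Whether a head is a top head with a wall to the right. -/
def oM (b : Fin 3) (Δ : Fin 2 → Bool) : Option (Bool × Core Q₀) → Bool
  | some (true, c) => cM b Δ c
  | _ => false

def phiP (b : Fin 3) (Δ : Fin 2 → Bool) : Equiv.Perm (Cf Q₀ Γ) :=
  thetaP⁻¹ * gtUp (sgnFlip fun d g => Δ d && decide (g = b)) * thetaP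

theorem phiP_apply (b : Fin 3) (Δ : Fin 2 → Bool) (x : Cf Q₀ Γ) (j : ℤ) :
    phiP b Δ x j = mkCell (x j).topLetter (x j).botLetter (xor (sg (x j)) (oM b Δ (hd (x (j - 1))))) (hd (x j)) := by
  have key : ∀ (u v : Γ) (s : Bool) (o : Option (Bool × Core Q₀)),
      beltGateApplyUp (liftP (sgnFlip fun d g => Δ d && decide (g = b))) (mkCell u v s o) =
        mkCell u v (xor s (oM b Δ o)) o := by
    intro u v s o
    rcases o with _ | ⟨_ | _, c⟩ <;> simp [mkCell, beltGateApplyUp, oM, liftP, sgnFlip, cM]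
  have key' : ∀ i, gtUp (sgnFlip fun d g => Δ d && decide (g = b)) (thetaP x) i =
      mkCell (x i).topLetter (x i).botLetter (xor (sg (x i)) (oM b Δ (hd (x (i - 1))))) (hd (x (i - 1))) := by
    intro i
    show beltGateApplyUp _ (thetaP x i) = _
    rw [thetaP_apply, key]
  show (thetaP⁻¹ : Equiv.Perm (Cf Q₀ Γ)) (gtUp (sgnFlip fun d g => Δ d && decide (g = b)) (thetaP x)) j = _
  rw [thetaP_inv_apply, key', key']
  simp

theorem phiP_inv (b : Fin 3) (Δ : Fin 2 → Bool) : (phiP b Δ : Equiv.Perm (Cf Q₀ Γ))⁻¹ = phiP b Δ := by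
  refine inv_eq_of_mul_eq_one_left ?_
  ext x j : 2
  rw [Equiv.Perm.mul_apply, phiP_apply]
  simp [phiP_apply]

/-- Signs changing only next to heads preserve fineness. -/
theorem Fine.of_sign_change {x y : Cf Q₀ Γ} (hx : Fine x) (h1 : ∀ j, hd (y j) = none ↔ hd (x j) = none)
    (h2 : ∀ j, sg (y j) ≠ sg (x j) → hd (x (j - 1)) ≠ none) : Fine y := by
  have hp : ∀ j, (x j).plusOrHead = true → (y j).plusOrHead = true ∨
      ((y (j - 1)).plusOrHead = true ∧ (y (j - 1)).minusOrHead = true) := by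
    intro j hj
    rw [plusOrHead_iff] at hj
    simp only [plusOrHead_iff, minusOrHead_iff, ne_eq, h1]
    by_cases h : sg (y j) = sg (x j)
    · left; rwa [h]
    · right; exact ⟨.inl (h2 j h), .inl (h2 j h)⟩
  have hm : ∀ j, (x j).minusOrHead = true → (y j).minusOrHead = true ∨
      ((y (j - 1)).plusOrHead = true ∧ (y (j - 1)).minusOrHead = true) := by
    intro j hj
    rw [minusOrHead_iff] at hj
    simp only [plusOrHead_iff, minusOrHead_iff, ne_eq, h1]
    by_cases h : sg (y j) = sg (x j)
    · left; rwa [h]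
    · right; exact ⟨.inl (h2 j h), .inl (h2 j h)⟩
  rw [fine_iff] at hx ⊢
  obtain ⟨a1, a2, a3, a4⟩ := hx
  refine ⟨fun N => ?_, fun N => ?_, fun N => ?_, fun N => ?_⟩
  · obtain ⟨i, hi, h⟩ := a1 (N + 1)
    rcases hp i h with h | h
    · exact ⟨i, by omega, h⟩
    · exact ⟨i - 1, by omega, h.1⟩
  · obtain ⟨i, hi, h⟩ := a2 (N + 1)
    rcases hm i h with h | h
    · exact ⟨i, by omega, h⟩
    · exact ⟨i - 1, by omega, h.2⟩
  · obtain ⟨i, hi, h⟩ := a3 N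
    rcases hp i h with h | h
    · exact ⟨i, by omega, h⟩
    · exact ⟨i - 1, by omega, h.1⟩
  · obtain ⟨i, hi, h⟩ := a4 N
    rcases hm i h with h | h
    · exact ⟨i, by omega, h⟩
    · exact ⟨i - 1, by omega, h.2⟩

theorem Fine.phi {x : Cf Q₀ Γ} (hx : Fine x) (b : Fin 3) (Δ : Fin 2 → Bool) : Fine (phiP b Δ x) := by
  refine hx.of_sign_change (fun j => by simp [phiP_apply]) fun j hj h => hj ?_
  simp [phiP_apply, h, oM]

/-- The head at `j` toggles the wall to its right. -/
def act (a b : Fin 3) (Δ : Fin 2 → Bool) (x : Cf Q₀ Γ) (j : ℤ) : Prop :=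
  ∃ c, hd (x j) = some (true, c) ∧ cmu a b Δ c ≠ c ∧ hd (x (j + 1)) = none ∧ sg (x (j + 1)) = cM b Δ c ∧
    isMi (x (j + 2)) ∧ isMi (x (j + 3))

open Classical in
/-- The rule of the wall toggle. -/
def KRule (a b : Fin 3) (Δ : Fin 2 → Bool) (g : Cf Q₀ Γ → Cf Q₀ Γ) : Prop :=
  ∀ x, Fine x → ∀ j, (g x j).topLetter = (x j).topLetter ∧ (g x j).botLetter = (x j).botLetter ∧
    hd (g x j) = (if act a b Δ x j then (hd (x j)).map (Prod.map id (cmu a b Δ)) else hd (x j)) ∧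
    sg (g x j) = if act a b Δ x (j - 1) then !sg (x j) else sg (x j)

theorem cM_cmu {a b : Fin 3} (hab : a ≠ b) (Δ : Fin 2 → Bool) (c : Core Q₀) :
    cM b Δ (cmu a b Δ c) = if cmu a b Δ c = c then cM b Δ c else !cM b Δ c := by
  obtain ⟨q, d, g⟩ := c
  simp only [cM, cmu]
  cases hd : Δ d
  · simp
  · simp only [if_true, Bool.true_and, Prod.mk.injEq, true_and]
    have key : ∀ a b g : Fin 3, a ≠ b → decide ((Equiv.swap a b) g = b) =
        if (Equiv.swap a b) g = g then decide (g = b) else !decide (g = b) := by decide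
    exact key a b g hab

theorem cell_hd_lift (a b : Fin 3) (Δ : Fin 2 → Bool) (c : BSym (DecQ Q₀) Γ) :
    hd (beltGateApply (liftP (lsw a b Δ)) c) = (hd c).map (Prod.map id (cmu a b Δ)) ∧
    sg (beltGateApply (liftP (lsw a b Δ)) c) = sg c := by
  cases c <;> simp [beltGateApply, hd, liftP, lsw, cmu, sg, beltSign, decSgn]

theorem krule_of_ctrl {a b : Fin 3} (hab : a ≠ b) {Δ : Fin 2 → Bool} {S : Equiv.Perm (Cf Q₀ Γ)} (h1 : S ∈ LocG cutAfter)
    (h2 : S ∈ HFix Q₀ Γ) (h3 : IsCtrl S (ctl Right3 (lsw a b Δ))) :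
    KRule a b Δ (phiP b Δ * S * phiP b Δ : Equiv.Perm (Cf Q₀ Γ)) := by
  classical
  intro x hx j
  have hy := hx.phi b Δ
  set y := phiP b Δ x with hyd
  have hyj : ∀ i, (y i).topLetter = (x i).topLetter ∧ (y i).botLetter = (x i).botLetter ∧ hd (y i) = hd (x i) ∧
      sg (y i) = xor (sg (x i)) (oM b Δ (hd (x (i - 1)))) := by
    intro i; rw [hyd, phiP_apply]; simp
  have hact : ∀ i, (actS y i ∧ (∃ c, hd (x i) = some (true, c) ∧ cmu a b Δ c ≠ c)) ↔ act a b Δ x i := by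
    intro i
    unfold actS act isMi
    simp only [(hyj _).2.2.1, (hyj _).2.2.2, show i + 1 - 1 = i by ring, show i + 2 - 1 = i + 1 by ring,
      show i + 3 - 1 = i + 2 by ring]
    constructor
    · rintro ⟨⟨-, ⟨b1, b2⟩, ⟨b3, b4⟩, b5, b6⟩, c, hc, hc'⟩
      refine ⟨c, hc, hc', b1, ?_, ⟨b3, ?_⟩, b5, ?_⟩
      · simpa [hc, oM] using b2
      · simpa [b1, oM] using b4
      · simpa [b3, oM] using b6
    · rintro ⟨c, hc, hc', b1, b2, ⟨b3, b4⟩, b5, b6⟩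
      exact ⟨⟨⟨c, hc⟩, ⟨b1, by simp [hc, oM, b2]⟩, ⟨b3, by simp [b1, oM, b4]⟩, b5, by simp [b3, oM, b6]⟩, c, hc, hc'⟩
  have hz : ∀ i, (S y i).topLetter = (x i).topLetter ∧ (S y i).botLetter = (x i).botLetter ∧
      hd (S y i) = (if act a b Δ x i then (hd (x i)).map (Prod.map id (cmu a b Δ)) else hd (x i)) ∧
      sg (S y i) = sg (y i) := by
    intro i
    rw [rule_of_ctrl h1 h2 h3 hy i]
    by_cases hA : actS y i
    · rw [if_pos hA, (cell_hd_lift a b Δ _).1, (cell_hd_lift a b Δ _).2, (hd_gate_lift _ _).1, (hd_gate_lift _ _).2,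
        (hyj i).1, (hyj i).2.1, (hyj i).2.2.1]
      refine ⟨rfl, rfl, ?_, rfl⟩
      by_cases hB : act a b Δ x i
      · rw [if_pos hB]
      · rw [if_neg hB]
        obtain ⟨c, hc⟩ := hA.1
        rw [(hyj i).2.2.1] at hc
        rw [hc]
        by_contra hne
        exact hB ((hact i).1 ⟨hA, c, hc, fun h => hne (by simp [h])⟩)
    · rw [if_neg hA, if_neg (fun hB => hA ((hact i).2 hB).1)]
      exact ⟨(hyj i).1, (hyj i).2.1, (hyj i).2.2.1, rfl⟩
  show (phiP b Δ (S y) j).topLetter = _ ∧ (phiP b Δ (S y) j).botLetter = _ ∧ hd (phiP b Δ (S y) j) = _ ∧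
    sg (phiP b Δ (S y) j) = _
  rw [phiP_apply, topLetter_mkCell, botLetter_mkCell, hd_mkCell, sg_mkCell]
  refine ⟨(hz j).1, (hz j).2.1, (hz j).2.2.1, ?_⟩
  rw [(hz j).2.2.2, (hz (j - 1)).2.2.1, (hyj j).2.2.2]
  by_cases hB : act a b Δ x (j - 1)
  · rw [if_pos hB, if_pos hB]
    obtain ⟨c, hc, hc', -⟩ := hB
    simp only [hc, Option.map_some, Prod.map, id, oM, cM_cmu hab, hc', if_false]
    cases sg (x j) <;> cases cM b Δ c <;> rfl
  · rw [if_neg hB, if_neg hB]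
    simp

variable {a b : Fin 3} {Δ : Fin 2 → Bool} {g : Cf Q₀ Γ → Cf Q₀ Γ}

theorem KRule.hd_none (h : KRule a b Δ g) {x : Cf Q₀ Γ} (hx : Fine x) (j : ℤ) :
    hd (g x j) = none ↔ hd (x j) = none := by
  rw [(h x hx j).2.2.1]
  split_ifs <;> simp

theorem KRule.sg_of (h : KRule a b Δ g) {x : Cf Q₀ Γ} (hx : Fine x) {j : ℤ} (hj : ¬ act a b Δ x (j - 1)) :
    sg (g x j) = sg (x j) := by
  rw [(h x hx j).2.2.2, if_neg hj]

theorem not_act_of_GW {x : Cf Q₀ Γ} {t i : ℤ} (h : GW x t) (h1 : i ≤ t) (h2 : t ≤ i + 2) : ¬ act a b Δ x i := by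
  rintro ⟨c, hc, -, n1, s1, ⟨n2, s2⟩, n3, s3⟩
  obtain ⟨⟨hm, hp⟩, hR, hL⟩ := h
  rw [plusOrHead_iff] at hp
  have : t = i ∨ t = i + 1 ∨ t = i + 2 := by omega
  rcases this with rfl | rfl | rfl
  · refine hR ⟨⟨n1, by simpa [n1] using hp⟩, ⟨?_, ?_⟩, ?_, ?_⟩
    · rwa [show t + 1 + 1 = t + 2 by ring]
    · rwa [show t + 1 + 1 = t + 2 by ring]
    · rwa [show t + 1 + 2 = t + 3 by ring]
    · rwa [show t + 1 + 2 = t + 3 by ring]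
  · rw [show i + 1 + 1 = i + 2 by ring] at hp
    simp [n2, s2] at hp
  · rw [show i + 2 + 1 = i + 3 by ring] at hp
    simp [n3, s3] at hp

theorem not_act_of_none {x : Cf Q₀ Γ} {i : ℤ} (h : hd (x i) = none) : ¬ act a b Δ x i := by
  rintro ⟨c, hc, -⟩
  rw [h] at hc; simp at hc

theorem KRule.isLoc (h : KRule a b Δ g) : IsLoc GW g where
  fine x hx := hx.of_sign_change (h.hd_none hx) fun j hj hn => hj (h.sg_of hx (not_act_of_none hn))
  wall x t hx hw := by
    have hcut : ∀ j, sg (g x j) = sg (x j) → ((g x j).plusOrHead = true ↔ (x j).plusOrHead = true) ∧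
        ((g x j).minusOrHead = true ↔ (x j).minusOrHead = true) := by
      intro j hj
      simp only [plusOrHead_iff, minusOrHead_iff, ne_eq, h.hd_none hx, hj, and_self]
    have st := h.sg_of hx (j := t) (not_act_of_GW hw (by omega) (by omega))
    have st1 := h.sg_of hx (j := t + 1) (not_act_of_GW hw (by omega) (by omega))
    have stm := h.sg_of hx (j := t - 1) (not_act_of_GW hw (by omega) (by omega))
    have hn := fun j => (h.hd_none hx j).1
    refine ⟨⟨(hcut _ st).2.2 hw.1.1, (hcut _ st1).1.2 hw.1.2⟩, ?_, ?_⟩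
    · rintro ⟨⟨n1, s1⟩, ⟨n2, s2⟩, n3, s3⟩
      have a2 := h.sg_of hx (j := t + 1 + 1) (not_act_of_none (by simpa using hn _ n1))
      have a3 := h.sg_of hx (j := t + 1 + 2) (not_act_of_none (by
        rw [show t + 1 + 2 - 1 = t + 1 + 1 by ring]; exact hn _ n2))
      exact hw.2.1 ⟨⟨hn _ n1, st1 ▸ s1⟩, ⟨hn _ n2, a2 ▸ s2⟩, hn _ n3, a3 ▸ s3⟩
    · rintro ⟨⟨n1, s1⟩, ⟨n2, s2⟩, n3, s3⟩
      refine hw.2.2 ⟨⟨hn _ n1, st ▸ s1⟩, ⟨hn _ n2, stm ▸ s2⟩, hn _ n3, ?_⟩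
      rw [← s3]
      refine (h.sg_of hx ?_).symm
      rintro ⟨c, hc, -, -, -, ⟨-, hs⟩, -⟩
      rw [show t - 2 - 1 + 2 = t - 1 by ring, ← stm, s2] at hs
      simp at hs
  agree I x y hx hy hr i hi := by
    have key : ∀ i ∈ I, (act a b Δ x i ↔ act a b Δ y i) := by
      intro i hi
      by_cases h1 : i + 1 ∈ I
      swap
      · have := hr.2 i (.inl ⟨hi, h1⟩)
        simp [not_act_of_GW this.1 (le_refl _) (by omega), not_act_of_GW this.2 (le_refl _) (by omega)]
      by_cases h2 : i + 2 ∈ I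
      swap
      · have := hr.2 (i + 1) (.inl ⟨h1, by rwa [show i + 1 + 1 = i + 2 by ring]⟩)
        simp [not_act_of_GW this.1 (i := i) (by omega) (by omega), not_act_of_GW this.2 (i := i) (by omega) (by omega)]
      by_cases h3 : i + 3 ∈ I
      swap
      · have := hr.2 (i + 2) (.inl ⟨h2, by rwa [show i + 2 + 1 = i + 3 by ring]⟩)
        simp [not_act_of_GW this.1 (i := i) (by omega) (by omega), not_act_of_GW this.2 (i := i) (by omega) (by omega)]
      simp only [act, hr.1 _ hi, hr.1 _ h1, hr.1 _ h2, hr.1 _ h3]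
    have key' : act a b Δ x (i - 1) ↔ act a b Δ y (i - 1) := by
      by_cases h1 : i - 1 ∈ I
      · exact key _ h1
      · have := hr.2 (i - 1) (.inr ⟨h1, by simpa using hi⟩)
        simp [not_act_of_GW this.1 (i := i - 1) (by omega) (by omega), not_act_of_GW this.2 (i := i - 1) (by omega) (by omega)]
    obtain ⟨x1, x2, x3, x4⟩ := h x hx i
    obtain ⟨y1, y2, y3, y4⟩ := h y hy i
    refine cell_ext ?_ ?_ ?_ ?_
    · rw [x1, y1, hr.1 i hi]
    · rw [x2, y2, hr.1 i hi]
    · rw [x4, y4, hr.1 i hi]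
      by_cases hA : act a b Δ x (i - 1)
      · rw [if_pos hA, if_pos (key'.1 hA)]
      · rw [if_neg hA, if_neg (mt key'.2 hA)]
    · rw [x3, y3, hr.1 i hi]
      by_cases hA : act a b Δ x i
      · rw [if_pos hA, if_pos ((key i hi).1 hA)]
      · rw [if_neg hA, if_neg (mt (key i hi).2 hA)]

/-- Existence of the wall toggles. -/
theorem exists_kappa (a b : Fin 3) (hab : a ≠ b) (Δ : Fin 2 → Bool) : ∃ (κ : Equiv.Perm (Cf Q₀ Γ)),
    KRule a b Δ κ ∧ KRule a b Δ (κ⁻¹ : Equiv.Perm (Cf Q₀ Γ)) ∧ κ ∈ HFix Q₀ Γ ∧ ∃ c, NB (SGen Q₀ Γ) κ c := by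
  have hF := Set.Subset.refl (BG Q₀ Γ)
  have hd := fun j => (CB.top hF).shift hF j dbl dbl_mem
  obtain ⟨S, h1, h2⟩ := (((CB.top hF).and hF (hd (-1))).and hF (hd (-2))).and hF (hd (-3)) _ (lsw_mem a b Δ)
  have hloc : S ∈ LocG cutAfter := h1.mem_subgroup fun x hx => (BG_loc hx).1
  have hfix : S ∈ HFix Q₀ Γ := h1.mem_subgroup fun x hx => BG_HFix hx
  have h2' : IsCtrl S (ctl Right3 (lsw a b Δ)) := h2
  have h2i : IsCtrl S⁻¹ (ctl Right3 (lsw a b Δ)) := h2'.inv.congr fun L k _ => by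
    simp only [ctl, Pi.inv_apply]
    split_ifs
    · exact lsw_inv a b Δ
    · simp
  have hphi : phiP b Δ ∈ HFix Q₀ Γ := by
    intro x hx
    funext j
    rw [phiP_apply]
    simp [hx (j - 1), oM]
  refine ⟨phiP b Δ * S * phiP b Δ, krule_of_ctrl hab hloc hfix h2', ?_, mul_mem (mul_mem hphi hfix) hphi, ?_⟩
  · rw [show (phiP b Δ * S * phiP b Δ : Equiv.Perm (Cf Q₀ Γ))⁻¹ = phiP b Δ * S⁻¹ * phiP b Δ by
      rw [mul_inv_rev, mul_inv_rev, phiP_inv, mul_assoc]]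
    exact krule_of_ctrl hab (inv_mem hloc) (inv_mem hfix) h2i
  · obtain ⟨cr, hcr⟩ := rhoP_NB (Q₀ := Q₀) (Γ := Γ)
    have hS : NB (SGen Q₀ Γ) S _ := h1.trans (b := cr + 1) fun x hx => by
      rcases hx with ⟨g, rfl⟩ | ⟨g, rfl⟩ | ⟨g, rfl⟩ | ⟨q, rfl⟩ | rfl
      · exact (NB.of_mem (gateP_mem g)).mono (by omega)
      · exact (NB.of_mem (gateUpP_mem g)).mono (by omega)
      · exact (NB.of_mem (gateDownP_mem g)).mono (by omega)
      · exact (NB.of_mem (moveP_mem q)).mono (by omega)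
      · exact hcr.mono (by omega)
    have hp : NB (SGen Q₀ Γ) (phiP b Δ : Equiv.Perm (Cf Q₀ Γ)) _ :=
      ((NB.of_mem thetaP_mem).inv.mul (NB.of_mem (gateUpP_mem _))).mul (NB.of_mem thetaP_mem)
    exact ⟨_, (hp.mul hS).mul hp⟩

end Kappa
section KCfg
open scoped commutatorElement
variable {Q₀ Γ : Type} [DecidableEq Q₀] [Fintype Q₀]

theorem cfg_refl {s L : ℤ} (hL : 1 ≤ L) (ε : ℤ → Bool) (Λ : ℤ × Bool → Γ) (k : ℤ) (q : DecQ Q₀) :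
    reflP (cfg s L ε Λ k q) =
      cfg (-(s + L - 1)) L (fun j => !ε (-j)) (fun z => Λ (-z.1, z.2)) (L - 1 - k) (flipQ q) := by
  have ha : addr (-(s + L - 1)) L (L - 1 - k) = (-(addr s L k).1, (addr s L k).2) := by
    have e : (L - 1 - k) % (2 * L) = (L - 1 - k % (2 * L)) % (2 * L) := by simp
    rw [← addr_emod, e, addr_emod]
    rcases exists_addr (s := s) hL k with ⟨h1, h2, h3⟩ | ⟨h1, h2, h3⟩
    · rw [h3, addr_of_top (by omega) (by omega)]
      simp; ring
    · rw [h3, ← addr_add_period, addr_of_bot (by omega) (by omega)]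
      simp; ring
  unfold cfg
  rw [eq_scfg_iff, ha]
  intro j
  rw [reflP_apply]
  simp only [topLetter_cellRefl, botLetter_cellRefl, hd_cellRefl, sg_cellRefl, topLetter_scfg, botLetter_scfg,
    hd_scfg, sg_scfg, true_and]
  by_cases h : -j = (addr s L k).1
  · have h' : j = -(addr s L k).1 := by omega
    simp [h', flipQ]
  · have h' : j ≠ -(addr s L k).1 := by omega
    simp only [h, h', if_false, true_and, bit]
    by_cases h2 : s ≤ -j ∧ -j ≤ s + L - 1
    · rw [if_pos h2, if_pos (by omega)]
      by_cases h3 : -j < (addr s L k).1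
      · simp [h3]; omega
      · simp [h3]; omega
    · rw [if_neg h2, if_neg (by omega)]

theorem cfg_swap {s L : ℤ} (hL : 1 ≤ L) (ε : ℤ → Bool) (Λ : ℤ × Bool → Γ) (k : ℤ) (q : DecQ Q₀) :
    swapP (cfg s L ε Λ k q) = cfg s L ε (fun z => Λ (z.1, !z.2)) (-1 - k) q := by
  have ha : addr s L (-1 - k) = ((addr s L k).1, !(addr s L k).2) := by
    have e : (-1 - k) % (2 * L) = (-1 - k % (2 * L)) % (2 * L) := by simp
    rw [← addr_emod, e, addr_emod, ← addr_add_period]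
    rcases exists_addr (s := s) hL k with ⟨h1, h2, h3⟩ | ⟨h1, h2, h3⟩
    · rw [h3, addr_of_bot (by omega) (by omega)]
      simp; ring
    · rw [h3, addr_of_top (by omega) (by omega)]
      simp; ring
  unfold cfg
  rw [eq_scfg_iff, ha]
  intro j
  rw [swapP_apply]
  simp only [topLetter_cellSwap, botLetter_cellSwap, hd_cellSwap, sg_cellSwap, topLetter_scfg, botLetter_scfg,
    hd_scfg, sg_scfg, true_and, Bool.not_true, Bool.not_false]
  by_cases h : j = (addr s L k).1 <;> simp [h]

theorem Val.refl {s L : ℤ} {ε : ℤ → Bool} (hv : Val s L ε) : Val (-(s + L - 1)) L (fun j => !ε (-j)) where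
  one_le := hv.one_le
  left := by
    have := hv.right
    simp only [Bool.not_eq_false']
    rw [← this]; congr 1; ring
  right := by
    have := hv.left
    simp only [Bool.not_eq_true']
    rw [← this]; congr 1; ring
  cof b N := by
    obtain ⟨⟨j, h1, h2⟩, -⟩ := hv.cof (!b) (-N)
    obtain ⟨-, ⟨j', h3, h4⟩⟩ := hv.cof (!b) (-N)
    exact ⟨⟨-j', by omega, by simp [h4]⟩, ⟨-j, by omega, by simp [h2]⟩⟩

variable {a b : Fin 3} {Δ : Fin 2 → Bool} {g : Cf Q₀ Γ → Cf Q₀ Γ}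

theorem KRule.fix (h : KRule a b Δ g) {x : Cf Q₀ Γ} (hx : Fine x) (hn : ∀ j, ¬ act a b Δ x j) : g x = x := by
  funext j
  obtain ⟨h1, h2, h3, h4⟩ := h x hx j
  rw [if_neg (hn _)] at h3 h4
  exact cell_ext h1 h2 h4 h3

/-- The state without sign. -/
def core (q : DecQ Q₀) : Core Q₀ := (q.1, q.2.1, q.2.2.2)

theorem act_cfg {s L : ℤ} {ε : ℤ → Bool} (hv : Val s L ε) {Λ : ℤ × Bool → Γ} {k : ℤ} {q : DecQ Q₀} {j : ℤ}
    (h : act a b Δ (cfg s L ε Λ k q) j) : k % (2 * L) < L ∧ cmu a b Δ (core q) ≠ core q ∧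
      (cM b Δ (core q) = true → k % (2 * L) = L - 1) ∧ (cM b Δ (core q) = false → k % (2 * L) + 3 < L) ∧
      j = s + k % (2 * L) := by
  have hL := hv.one_le
  obtain ⟨c, h1, h2, h3, h4, h5, h6⟩ := h
  have hj : j = (addr s L k).1 := by
    by_contra hcon
    simp [cfg, hd_scfg, hcon] at h1
  have hc : (addr s L k).2 = true ∧ c = core q := by
    simp only [cfg, hd_scfg, hj, if_true, Option.some.injEq, Prod.mk.injEq] at h1
    exact ⟨h1.1, h1.2.symm⟩
  obtain ⟨hc1, rfl⟩ := hc
  rcases exists_addr (s := s) hL k with ⟨r1, r2, r3⟩ | ⟨r1, r2, r3⟩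
  swap
  · rw [r3] at hc1; simp at hc1
  rw [r3] at hj
  simp only at hj
  refine ⟨r2, h2, fun hM => ?_, fun hM => ?_, hj⟩
  · rw [hM] at h4
    by_contra hne
    simp only [cfg, sg_scfg, r3, bit, hj] at h4
    rw [if_neg (by omega), if_pos (by omega)] at h4
    simp at h4
  · rw [← right3_iff hL, ← actS_cfg hv Λ k q]
    rw [hM] at h4
    rw [r3]
    simp only
    rw [← hj]
    exact ⟨⟨_, h1⟩, ⟨h3, h4⟩, h5, h6⟩

theorem KRule.cfg_fix (h : KRule a b Δ g) {s L : ℤ} {ε : ℤ → Bool} (hv : Val s L ε) (Λ : ℤ × Bool → Γ) {k : ℤ}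
    {q : DecQ Q₀} (hc : k % (2 * L) < L → Δ q.2.1 = true → (q.2.2.2 = b → k % (2 * L) ≠ L - 1) ∧
      (q.2.2.2 ≠ b → q.2.2.2 = a → ¬ k % (2 * L) + 3 < L)) :
    g (cfg s L ε Λ k q) = cfg s L ε Λ k q := by
  refine h.fix (hv.fine Λ k q) fun j hj => ?_
  obtain ⟨h1, h2, h3, h4, -⟩ := act_cfg hv hj
  have hΔ : Δ q.2.1 = true := by
    by_contra hcon
    simp [cmu, core, hcon] at h2
  obtain ⟨h5, h6⟩ := hc h1 hΔ
  by_cases hb : q.2.2.2 = b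
  · exact h5 hb (h3 (by simp [cM, core, hΔ, hb]))
  · have ha : q.2.2.2 = a := by
      by_contra ha
      simp [cmu, core, hΔ, Equiv.swap_apply_of_ne_of_ne ha hb] at h2
    exact h6 hb ha (h4 (by simp [cM, core, hb]))

/-- The outside bits after the right part has been cut off at belt position `k`. -/
def cutR (s L k : ℤ) (ε : ℤ → Bool) : ℤ → Bool := fun j =>
  if s + k < j ∧ j < s + L then decide (j = s + k + 1) else ε j

theorem Val.cutR {s L : ℤ} {ε : ℤ → Bool} (hv : Val s L ε) {k : ℤ} (h0 : 0 ≤ k) (h1 : k + 1 < L) :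
    Val s (k + 1) (cutR s L k ε) where
  one_le := by omega
  left := by rw [BD.cutR, if_neg (by omega)]; exact hv.left
  right := by rw [BD.cutR, if_pos (by omega)]; simp; omega
  cof b N := by
    obtain ⟨⟨j, a1, a2⟩, -⟩ := hv.cof b (max N (s + L))
    obtain ⟨-, ⟨j', a3, a4⟩⟩ := hv.cof b (min N (s - 1))
    refine ⟨⟨j, by omega, ?_⟩, ⟨j', by omega, ?_⟩⟩ <;> rw [BD.cutR, if_neg (by omega)] <;> assumption

theorem KRule.cfg_act (hab : a ≠ b) (h : KRule a b Δ g) {s L : ℤ} {ε : ℤ → Bool} (hv : Val s L ε) (Λ : ℤ × Bool → Γ) {k : ℤ}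
    {q : DecQ Q₀} (h0 : 0 ≤ k) (h1 : k + 3 < L) (hΔ : Δ q.2.1 = true) (ha : q.2.2.2 = a) :
    g (cfg s L ε Λ k q) = cfg s (k + 1) (cutR s L k ε) Λ k (q.1, q.2.1, (q.2.2.1, b)) := by
  have hL := hv.one_le
  have hk : k % (2 * L) = k := Int.emod_eq_of_lt h0 (by omega)
  have hcm : cmu a b Δ (core q) ≠ core q := by simp [cmu, core, hΔ, ha, hab.symm]
  have hact : ∀ j, act a b Δ (cfg s L ε Λ k q) j ↔ j = s + k := by
    intro j
    constructor
    · intro hj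
      have := (act_cfg hv hj).2.2.2.2
      rwa [hk] at this
    · rintro rfl
      have := (actS_cfg hv Λ k q).2 ((right3_iff hL).2 (by omega))
      rw [addr_of_top h0 (by omega)] at this
      obtain ⟨⟨c, hc⟩, ⟨m1, m2⟩, m3, m4⟩ := this
      have hc' : c = core q := by
        simp only [cfg, hd_scfg, addr_of_top (s := s) h0 (show k < L by omega)] at hc
        simp at hc
        exact hc.symm
      subst hc'
      exact ⟨_, hc, hcm, m1, by rw [m2]; simp [cM, core, ha, hab], m3, m4⟩
  conv_rhs => unfold cfg
  rw [eq_scfg_iff]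
  intro j
  obtain ⟨e1, e2, e3, e4⟩ := h _ (hv.fine Λ k q) j
  simp only [hact] at e3 e4
  rw [e1, e2, e3, e4]
  simp only [cfg, topLetter_scfg, botLetter_scfg, hd_scfg, sg_scfg, addr_of_top (s := s) h0 (show k < L by omega),
    addr_of_top (s := s) h0 (show k < k + 1 by omega), true_and]
  by_cases hj : j = s + k
  · subst hj
    simp [cmu, hΔ, ha]
  · simp only [hj, if_false, true_and, bit, BD.cutR]
    by_cases c1 : j - 1 = s + k
    · have : j = s + k + 1 := by omega
      subst this
      rw [if_pos (by omega), if_pos (by omega), if_neg (by omega), if_pos (by omega)]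
      simp
    · rw [if_neg c1]
      by_cases c2 : s ≤ j ∧ j ≤ s + L - 1
      · rw [if_pos c2]
        by_cases c3 : j < s + k
        · rw [if_pos (by omega)]
        · rw [if_neg (by omega), if_pos (by omega)]
          simp; omega
      · rw [if_neg c2, if_neg (by omega), if_neg (by omega)]

end KCfg
section Kap
variable {Q₀ Γ : Type} [DecidableEq Q₀] [Fintype Q₀]

open Classical in
/-- The wall toggle to the right of the head. -/
noncomputable def kap (a b : Fin 3) (Δ : Fin 2 → Bool) : Equiv.Perm (Cf Q₀ Γ) :=
  if h : a ≠ b then (exists_kappa a b h Δ).choose else 1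

theorem kap_spec {a b : Fin 3} (hab : a ≠ b) (Δ : Fin 2 → Bool) : KRule a b Δ (kap a b Δ : Equiv.Perm (Cf Q₀ Γ)) ∧
    KRule a b Δ ((kap a b Δ)⁻¹ : Equiv.Perm (Cf Q₀ Γ)) ∧ kap a b Δ ∈ HFix Q₀ Γ ∧
    ∃ c, NB (SGen Q₀ Γ) (kap a b Δ) c := by
  rw [kap, dif_pos hab]
  exact (exists_kappa a b hab Δ).choose_spec

/-- The wall toggle to the left of the head. -/
noncomputable def kam (a b : Fin 3) (Δ : Fin 2 → Bool) : Equiv.Perm (Cf Q₀ Γ) := reflP * kap a b Δ * reflP⁻¹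

/-- The letters used to build the words. -/
inductive LGm : Equiv.Perm (Cf Q₀ Γ) → Prop
  | base {π} : π ∈ BG Q₀ Γ → LGm π
  | kap {a b : Fin 3} (hab : a ≠ b) (Δ : Fin 2 → Bool) : LGm (kap a b Δ)
  | refl {π} : LGm π → LGm (reflP * π * reflP⁻¹)
  | swap {π} : LGm π → LGm (swapP * π * swapP⁻¹)

def LG (Q₀ Γ : Type) [DecidableEq Q₀] [Fintype Q₀] : Set (Equiv.Perm (Cf Q₀ Γ)) := {π | LGm π}

theorem BG_LG : BG Q₀ Γ ⊆ LG Q₀ Γ := fun _ h => .base h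
theorem kap_LG {a b : Fin 3} (hab : a ≠ b) (Δ : Fin 2 → Bool) : kap a b Δ ∈ LG Q₀ Γ := .kap hab Δ
theorem kam_LG {a b : Fin 3} (hab : a ≠ b) (Δ : Fin 2 → Bool) : kam a b Δ ∈ LG Q₀ Γ := .refl (.kap hab Δ)

theorem exists_LG_bound : ∃ c, ∀ π ∈ LG Q₀ Γ, NB (SGen Q₀ Γ) π c := by
  obtain ⟨cr, hcr⟩ := rhoP_NB (Q₀ := Q₀) (Γ := Γ)
  have h : ∀ z : (Fin 3 × Fin 3) × (Fin 2 → Bool), ∃ c, z.1.1 ≠ z.1.2 → NB (SGen Q₀ Γ) (kap z.1.1 z.1.2 z.2) c := by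
    intro z
    by_cases hz : z.1.1 ≠ z.1.2
    · obtain ⟨c, hc⟩ := (kap_spec (Q₀ := Q₀) (Γ := Γ) hz z.2).2.2.2
      exact ⟨c, fun _ => hc⟩
    · exact ⟨0, fun h => (hz h).elim⟩
  choose A hA using h
  refine ⟨cr + 1 + ∑ z : (Fin 3 × Fin 3) × (Fin 2 → Bool), A z, fun π hπ => ?_⟩
  induction hπ with
  | base h =>
    rcases h with ⟨g, rfl⟩ | ⟨g, rfl⟩ | ⟨g, rfl⟩ | ⟨q, rfl⟩ | rfl
    · exact (NB.of_mem (gateP_mem g)).mono (by omega)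
    · exact (NB.of_mem (gateUpP_mem g)).mono (by omega)
    · exact (NB.of_mem (gateDownP_mem g)).mono (by omega)
    · exact (NB.of_mem (moveP_mem q)).mono (by omega)
    · exact hcr.mono (by omega)
  | @kap a b hab Δ =>
    refine (hA ((a, b), Δ) hab).mono ?_
    have := Finset.single_le_sum (f := A) (fun _ _ => Nat.zero_le _) (Finset.mem_univ ((a, b), Δ))
    omega
  | refl _ ih => exact ih.refl_SGen
  | swap _ ih => exact ih.swap_SGen

theorem hd_none_refl {x : Cf Q₀ Γ} (h : ∀ j, hd (x j) = none) : ∀ j, hd (reflP x j) = none := by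
  intro j; rw [reflP_apply, hd_cellRefl, h]

theorem LG_loc {π : Equiv.Perm (Cf Q₀ Γ)} (h : π ∈ LG Q₀ Γ) : π ∈ LocG GW := by
  induction h with
  | base h => exact (BG_loc h).2
  | kap hab Δ => exact ⟨(kap_spec hab Δ).1.isLoc, (kap_spec hab Δ).2.1.isLoc⟩
  | refl _ ih => exact LocG_refl symW_GW ih
  | swap _ ih => exact LocG_swap symW_GW ih

theorem LG_HFix {π : Equiv.Perm (Cf Q₀ Γ)} (h : π ∈ LG Q₀ Γ) : π ∈ HFix Q₀ Γ := by
  induction h with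
  | base h => exact BG_HFix h
  | kap hab Δ => exact (kap_spec hab Δ).2.2.1
  | refl _ ih =>
    intro x hx
    rw [Equiv.Perm.mul_apply, Equiv.Perm.mul_apply, reflP_inv, ih _ (hd_none_refl hx), reflP_reflP]
  | swap _ ih =>
    intro x hx
    rw [Equiv.Perm.mul_apply, Equiv.Perm.mul_apply, swapP_inv, ih, swapP_swapP]
    intro j; simp [swapP_apply, hd_cellSwap, hx]

theorem NB.refl_LG {g : Equiv.Perm (Cf Q₀ Γ)} {c : ℕ} (h : NB (LG Q₀ Γ) g c) :
    NB (LG Q₀ Γ) (reflP * g * reflP⁻¹) c := h.map_conj _ fun x hx => NB.of_mem (.refl hx)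

theorem NB.swap_LG {g : Equiv.Perm (Cf Q₀ Γ)} {c : ℕ} (h : NB (LG Q₀ Γ) g c) :
    NB (LG Q₀ Γ) (swapP * g * swapP⁻¹) c := h.map_conj _ fun x hx => NB.of_mem (.swap hx)

theorem KRule.unique {a b : Fin 3} {Δ : Fin 2 → Bool} {g g' : Cf Q₀ Γ → Cf Q₀ Γ} (h : KRule a b Δ g)
    (h' : KRule a b Δ g') {x : Cf Q₀ Γ} (hx : Fine x) : g x = g' x := by
  funext j
  obtain ⟨h1, h2, h3, h4⟩ := h x hx j
  obtain ⟨h1', h2', h3', h4'⟩ := h' x hx j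
  exact cell_ext (h1.trans h1'.symm) (h2.trans h2'.symm) (h4.trans h4'.symm) (h3.trans h3'.symm)

variable {a b : Fin 3} {Δ : Fin 2 → Bool}

theorem kap_inv_apply (hab : a ≠ b) {x : Cf Q₀ Γ} (hx : Fine x) : (kap a b Δ)⁻¹ x = kap a b Δ x :=
  (kap_spec hab Δ).2.1.unique (kap_spec hab Δ).1 hx

theorem kap_kap (hab : a ≠ b) {x : Cf Q₀ Γ} (hx : Fine x) : kap a b Δ (kap a b Δ x) = x := by
  rw [← Equiv.Perm.eq_inv_iff_eq, kap_inv_apply hab hx]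

theorem kam_apply (x : Cf Q₀ Γ) : kam a b Δ x = reflP (kap a b Δ (reflP x)) := rfl

theorem kam_kam (hab : a ≠ b) {x : Cf Q₀ Γ} (hx : Fine x) : kam a b Δ (kam a b Δ x) = x := by
  rw [kam_apply, kam_apply, reflP_reflP, kap_kap hab hx.refl, reflP_reflP]

theorem kap_fix (hab : a ≠ b) {s L : ℤ} {ε : ℤ → Bool} (hv : Val s L ε) (Λ : ℤ × Bool → Γ) {k : ℤ}
    {q : DecQ Q₀} (hc : k % (2 * L) < L → Δ q.2.1 = true → (q.2.2.2 = b → k % (2 * L) ≠ L - 1) ∧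
      (q.2.2.2 = a → ¬ k % (2 * L) + 3 < L)) :
    kap a b Δ (cfg s L ε Λ k q) = cfg s L ε Λ k q :=
  (kap_spec hab Δ).1.cfg_fix hv Λ fun h1 h2 => ⟨(hc h1 h2).1, fun _ => (hc h1 h2).2⟩

theorem kap_act (hab : a ≠ b) {s L : ℤ} {ε : ℤ → Bool} (hv : Val s L ε) (Λ : ℤ × Bool → Γ) {k : ℤ}
    {q : DecQ Q₀} (h0 : 0 ≤ k) (h1 : k + 3 < L) (hΔ : Δ q.2.1 = true) (ha : q.2.2.2 = a) :
    kap a b Δ (cfg s L ε Λ k q) = cfg s (k + 1) (cutR s L k ε) Λ k (q.1, q.2.1, (q.2.2.1, b)) :=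
  (kap_spec hab Δ).1.cfg_act hab hv Λ h0 h1 hΔ ha

/-- The outside bits after the left part has been cut off at belt position `k`. -/
def cutL (s k : ℤ) (ε : ℤ → Bool) : ℤ → Bool := fun j =>
  if s ≤ j ∧ j < s + k then decide (j ≠ s + k - 1) else ε j

theorem Val.cutL {s L : ℤ} {ε : ℤ → Bool} (hv : Val s L ε) {k : ℤ} (h0 : 0 < k) (h1 : k < L) :
    Val (s + k) (L - k) (cutL s k ε) where
  one_le := by omega
  left := by rw [BD.cutL, if_pos (by omega)]; simp
  right := by
    rw [BD.cutL, if_neg (by omega), ← hv.right]; congr 1; ring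
  cof b N := by
    obtain ⟨⟨j, a1, a2⟩, -⟩ := hv.cof b (max N (s + L))
    obtain ⟨-, ⟨j', a3, a4⟩⟩ := hv.cof b (min N (s - 1))
    refine ⟨⟨j, by omega, ?_⟩, ⟨j', by omega, ?_⟩⟩ <;> rw [BD.cutL, if_neg (by omega)] <;> assumption

theorem kam_act (hab : a ≠ b) {s L : ℤ} {ε : ℤ → Bool} (hv : Val s L ε) (Λ : ℤ × Bool → Γ) {k : ℤ}
    {q : DecQ Q₀} (h0 : 3 ≤ k) (h1 : k < L) (hΔ : Δ q.2.1 = true) (ha : q.2.2.2 = a) :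
    kam a b Δ (cfg s L ε Λ k q) = cfg (s + k) (L - k) (cutL s k ε) Λ 0 (q.1, q.2.1, (q.2.2.1, b)) := by
  rw [kam_apply, cfg_refl hv.one_le, kap_act (q := flipQ q) hab hv.refl _ (by omega) (by omega) hΔ ha, cfg_refl (by omega)]
  rw [show -(-(s + L - 1) + (L - 1 - k + 1) - 1) = s + k by ring, show L - 1 - k + 1 = L - k by ring,
    show L - k - 1 - (L - 1 - k) = 0 by ring]
  congr 1
  · funext j
    simp only [BD.cutR, BD.cutL]
    by_cases c : s ≤ j ∧ j < s + k
    · rw [if_pos c, if_pos (by omega)]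
      simp only [Bool.not_eq_eq_eq_not, ← decide_not, decide_eq_decide]
      omega
    · rw [if_neg c, if_neg (by omega)]
      simp
  · simp
  · simp [flipQ]

theorem refl_emod {L : ℤ} (hL : 1 ≤ L) (k : ℤ) :
    (k % (2 * L) < L ∧ (L - 1 - k) % (2 * L) = L - 1 - k % (2 * L)) ∨
    (L ≤ k % (2 * L) ∧ (L - 1 - k) % (2 * L) = 3 * L - 1 - k % (2 * L)) := by
  have h1 := Int.emod_nonneg k (show 2 * L ≠ 0 by omega)
  have h2 := Int.emod_lt_of_pos k (show 0 < 2 * L by omega)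
  have e : (L - 1 - k) % (2 * L) = (L - 1 - k % (2 * L)) % (2 * L) := by simp
  rw [e]
  generalize k % (2 * L) = r at *
  by_cases h : r < L
  · exact .inl ⟨h, Int.emod_eq_of_lt (by omega) (by omega)⟩
  · refine .inr ⟨by omega, ?_⟩
    rw [← Int.add_emod_right, Int.emod_eq_of_lt (by omega) (by omega)]; ring

theorem kam_fix (hab : a ≠ b) {s L : ℤ} {ε : ℤ → Bool} (hv : Val s L ε) (Λ : ℤ × Bool → Γ) {k : ℤ}
    {q : DecQ Q₀} (hc : k % (2 * L) < L → Δ q.2.1 = true → (q.2.2.2 = b → k % (2 * L) ≠ 0) ∧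
      (q.2.2.2 = a → ¬ 3 ≤ k % (2 * L))) :
    kam a b Δ (cfg s L ε Λ k q) = cfg s L ε Λ k q := by
  have hL := hv.one_le
  rw [kam_apply]
  conv_rhs => rw [← reflP_reflP (cfg s L ε Λ k q)]
  congr 1
  rw [cfg_refl hL]
  refine kap_fix hab hv.refl _ fun h1 h2 => ?_
  have h3 := Int.emod_nonneg k (show 2 * L ≠ 0 by omega)
  have h4 := Int.emod_lt_of_pos k (show 0 < 2 * L by omega)
  rcases refl_emod hL k with ⟨h5, h6⟩ | ⟨h5, h6⟩
  · rw [h6]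
    refine ⟨fun h => ?_, fun h => ?_⟩
    · have := (hc h5 h2).1 h; omega
    · have := (hc h5 h2).2 h; omega
  · omega

/-! Gates that ignore lanes commute with the toggles. -/

/-- A permutation of ducks and signs. -/
def dsP (γ : Equiv.Perm (Fin 2 × Bool)) : Equiv.Perm PP where
  toFun z := ((γ (z.1, z.2.1)).1, (γ (z.1, z.2.1)).2, z.2.2)
  invFun z := ((γ.symm (z.1, z.2.1)).1, (γ.symm (z.1, z.2.1)).2, z.2.2)
  left_inv z := by simp
  right_inv z := by simp

theorem gt_apply (h : Equiv.Perm PP) (x : Cf Q₀ Γ) (j : ℤ) : gt h x j = beltGateApply (liftP h) (x j) := rfl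

theorem sg_gt_of_none (h : Equiv.Perm PP) {c : BSym (DecQ Q₀) Γ} (hc : hd c = none) :
    beltGateApply (liftP h) c = c := by
  cases c <;> simp_all [beltGateApply, hd]

theorem act_gt_imp (γ : Equiv.Perm (Fin 2 × Bool)) (x : Cf Q₀ Γ) (j : ℤ)
    (h : act a b (fun _ => true) x j) : act a b (fun _ => true) (gt (dsP γ) x) j := by
  obtain ⟨c, h1, h2, h3, h4, h5, h6⟩ := h
  simp only [act, gt_apply]
  rw [sg_gt_of_none _ h3, sg_gt_of_none _ h5.1, sg_gt_of_none _ h6.1]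
  obtain ⟨q, d, g⟩ := c
  cases hx : x j with
  | belt => simp [hx, hd] at h1
  | bot => simp [hx, hd] at h1
  | top p u v =>
    simp only [hx, hd, Option.some.injEq, Prod.mk.injEq, true_and] at h1
    refine ⟨_, rfl, ?_, h3, ?_, h5, h6⟩
    · simp only [cmu, ne_eq, Prod.mk.injEq, true_and, if_true] at h2 ⊢
      simpa [liftP, dsP, h1] using h2
    · rw [h4]; simp [cM, liftP, dsP, h1]

theorem gt_inv (h : Equiv.Perm PP) : (gt h : Equiv.Perm (Cf Q₀ Γ))⁻¹ = gt h⁻¹ := rfl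

theorem act_gt (γ : Equiv.Perm (Fin 2 × Bool)) (x : Cf Q₀ Γ) (j : ℤ) :
    act a b (fun _ => true) (gt (dsP γ) x) j ↔ act a b (fun _ => true) x j := by
  refine ⟨fun h => ?_, act_gt_imp γ x j⟩
  have := act_gt_imp γ⁻¹ _ _ h
  have e : gt (dsP γ⁻¹) (gt (dsP γ) x) = x := by
    show gt (dsP γ)⁻¹ (gt (dsP γ) x) = x
    rw [← gt_inv, Equiv.Perm.inv_def, Equiv.symm_apply_apply]
  rwa [e] at this

theorem Fine.gt {x : Cf Q₀ Γ} (hx : Fine x) (h : Equiv.Perm PP) : Fine (BD.gt h x) :=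
  (BG_loc (BG_gt h)).1.1.fine x hx

theorem KRule.gt_comm {g : Cf Q₀ Γ → Cf Q₀ Γ} (h : KRule a b (fun _ => true) g) (γ : Equiv.Perm (Fin 2 × Bool))
    {x : Cf Q₀ Γ} (hx : Fine x) : g (gt (dsP γ) x) = gt (dsP γ) (g x) := by
  funext j
  obtain ⟨h1, h2, h3, h4⟩ := h x hx j
  obtain ⟨h1', h2', h3', h4'⟩ := h _ (hx.gt (dsP γ)) j
  classical
  rw [if_congr (act_gt γ x j) rfl rfl] at h3'
  rw [if_congr (act_gt γ x (j - 1)) rfl rfl] at h4'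
  simp only [gt_apply] at h1' h2' h3' h4'
  rw [(hd_gate_lift _ _).1] at h1'
  rw [(hd_gate_lift _ _).2] at h2'
  by_cases hn : hd (x j) = none
  · have hn' : hd (g x j) = none := (h.hd_none hx j).2 hn
    rw [gt_apply, sg_gt_of_none _ hn']
    rw [sg_gt_of_none _ hn] at h3' h4'
    exact cell_ext (h1'.trans h1.symm) (h2'.trans h2.symm) (h4'.trans h4.symm) (h3'.trans h3.symm)
  · have hna : ¬ act a b (fun _ => true) x (j - 1) := by
      rintro ⟨c, -, -, hc, -⟩
      rw [sub_add_cancel] at hc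
      exact hn hc
    rw [if_neg hna] at h4 h4'
    rw [gt_apply]
    refine cell_ext ?_ ?_ ?_ ?_
    · rw [h1', (hd_gate_lift _ _).1, h1]
    · rw [h2', (hd_gate_lift _ _).2, h2]
    · rw [h4']
      cases hx : x j <;> cases hy : g x j <;> simp only [hx, hy] at h3 h4 hn ⊢ <;>
        split_ifs at h3 <;> simp_all [hd, sg, beltSign, beltGateApply, liftP, dsP, decSgn, cmu]
    · rw [h3']
      cases hx : x j <;> cases hy : g x j <;> simp only [hx, hy] at h3 h4 hn ⊢ <;>
        split_ifs at h3 ⊢ <;> simp_all [hd, sg, beltSign, beltGateApply, liftP, dsP, decSgn, cmu]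

/-- The configurations with exactly one head. -/
def OH (x : Cf Q₀ Γ) : Prop := ∃ s L ε Λ k q, Val s L ε ∧ x = cfg s L ε Λ k q

theorem OH.fine {x : Cf Q₀ Γ} (h : OH x) : Fine x := by
  obtain ⟨s, L, ε, Λ, k, q, hv, rfl⟩ := h
  exact hv.fine Λ k q

theorem OH.gt {x : Cf Q₀ Γ} (hx : OH x) (h : Equiv.Perm PP) : OH (BD.gt h x) := by
  obtain ⟨s, L, ε, Λ, k, q, hv, rfl⟩ := hx
  rw [cfg_gt]
  exact ⟨_, _, _, _, _, _, hv, rfl⟩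

theorem OH.refl {x : Cf Q₀ Γ} (hx : OH x) : OH (reflP x) := by
  obtain ⟨s, L, ε, Λ, k, q, hv, rfl⟩ := hx
  rw [cfg_refl hv.one_le]
  exact ⟨_, _, _, _, _, _, hv.refl, rfl⟩

theorem OH.of_hd {x y : Cf Q₀ Γ} (hx : OH x) (hy : Fine y) (h : ∀ j, hd (y j) = none ↔ hd (x j) = none) : OH y := by
  obtain ⟨s, L, ε, Λ, k, q, hv, rfl⟩ := hx
  refine exists_cfg hy (i := (addr s L k).1) ?_ ?_
  · rw [ne_eq, h]; simp [cfg, hd_scfg]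
  · intro j hj; rw [h]; simp [cfg, hd_scfg, hj]

/-- The permutations of one-head configurations commuting with the gates on ducks and signs. -/
structure CG (U : Equiv.Perm (Cf Q₀ Γ)) : Prop where
  oh : ∀ x, OH x → OH (U x)
  comm : ∀ γ x, OH x → U (gt (dsP γ) x) = gt (dsP γ) (U x)

theorem CG.mul {U V : Equiv.Perm (Cf Q₀ Γ)} (h : CG U) (h' : CG V) : CG (U * V) where
  oh x hx := h.oh _ (h'.oh x hx)
  comm γ x hx := by
    rw [Equiv.Perm.mul_apply, h'.comm γ x hx, h.comm γ _ (h'.oh x hx)]; rfl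

theorem CG.kap (hab : a ≠ b) : CG (kap a b (fun _ => true) : Equiv.Perm (Cf Q₀ Γ)) where
  oh x hx := hx.of_hd ((kap_spec hab _).1.isLoc.fine x hx.fine) ((kap_spec hab _).1.hd_none hx.fine)
  comm γ x hx := (kap_spec hab _).1.gt_comm γ hx.fine

theorem CG.kap_inv (hab : a ≠ b) : CG ((BD.kap a b (fun _ => true))⁻¹ : Equiv.Perm (Cf Q₀ Γ)) where
  oh x hx := hx.of_hd ((kap_spec hab _).2.1.isLoc.fine x hx.fine) ((kap_spec hab _).2.1.hd_none hx.fine)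
  comm γ x hx := (kap_spec hab _).2.1.gt_comm γ hx.fine

/-- The sign flip. -/
def sflip : Equiv.Perm (Fin 2 × Bool) := Equiv.prodCongr (Equiv.refl _) Equiv.boolNot

theorem refl_gt (γ : Equiv.Perm (Fin 2 × Bool)) {x : Cf Q₀ Γ} (hx : OH x) :
    reflP (gt (dsP γ) x) = gt (dsP (sflip * γ * sflip)) (reflP x) := by
  obtain ⟨s, L, ε, Λ, k, q, hv, rfl⟩ := hx
  rw [cfg_gt, cfg_refl hv.one_le, cfg_refl hv.one_le, cfg_gt]
  congr 1
  simp [flipQ, dsP, sflip]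

theorem CG.refl {U : Equiv.Perm (Cf Q₀ Γ)} (h : CG U) : CG (reflP * U * reflP⁻¹) where
  oh x hx := (h.oh _ hx.refl).refl
  comm γ x hx := by
    have e : sflip * (sflip * γ * sflip) * sflip = γ := by
      have : sflip * sflip = 1 := by decide
      calc _ = (sflip * sflip) * γ * (sflip * sflip) := by group
        _ = γ := by rw [this]; simp
    rw [Equiv.Perm.mul_apply, Equiv.Perm.mul_apply, Equiv.Perm.mul_apply, Equiv.Perm.mul_apply, reflP_inv,
      refl_gt _ hx, h.comm _ _ hx.refl, refl_gt _ (h.oh _ hx.refl), e]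

theorem CG.rho (j : ℤ) : CG (rhoP ^ j : Equiv.Perm (Cf Q₀ Γ)) where
  oh x hx := by
    obtain ⟨s, L, ε, Λ, k, q, hv, rfl⟩ := hx
    rw [cfg_rho_zpow hv]
    exact ⟨_, _, _, _, _, _, hv, rfl⟩
  comm γ x hx := by
    obtain ⟨s, L, ε, Λ, k, q, hv, rfl⟩ := hx
    rw [cfg_gt, cfg_rho_zpow hv, cfg_rho_zpow hv, cfg_gt]

end Kap
section Parity

/-- A mod 2 combination of divisibility conditions detecting `m`. -/
theorem exists_dvd_detector {m : ℕ} (hm : 1 ≤ m) : ∃ b : ℕ → ZMod 2, ∀ n, 1 ≤ n →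
    (∑ t ∈ Finset.range (m + 1), if n ∣ t ∧ 1 ≤ t then b t else 0) = if n = m then 1 else 0 := by
  suffices h : ∀ i, i ≤ m → ∃ b : ℕ → ZMod 2, ∀ n, m - i < n →
      (∑ t ∈ Finset.range (m + 1), if n ∣ t ∧ 1 ≤ t then b t else 0) = if n = m then 1 else 0 by
    obtain ⟨b, hb⟩ := h m le_rfl
    exact ⟨b, fun n hn => hb n (by omega)⟩
  intro i
  induction i with
  | zero =>
    refine fun _ => ⟨0, fun n hn => ?_⟩
    rw [if_neg (by omega)]
    simp
  | succ i ih =>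
    intro hi
    obtain ⟨b, hb⟩ := ih (by omega)
    set j := m - i with hj
    set S := ∑ t ∈ Finset.range (m + 1), if j ∣ t ∧ 1 ≤ t then b t else 0 with hS
    obtain ⟨w, hw⟩ : ∃ w : ZMod 2, w = (if j = m then 1 else 0) - S := ⟨_, rfl⟩
    refine ⟨fun t => if t = j then b t + w else b t, fun n hn => ?_⟩
    have e : (∑ t ∈ Finset.range (m + 1), if n ∣ t ∧ 1 ≤ t then
        (if t = j then b t + w else b t) else 0) =
        (∑ t ∈ Finset.range (m + 1), if n ∣ t ∧ 1 ≤ t then b t else 0) +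
        ∑ t ∈ Finset.range (m + 1), if t = j then (if n ∣ j then w else 0) else 0 := by
      rw [← Finset.sum_add_distrib]
      refine Finset.sum_congr rfl fun t _ => ?_
      by_cases ht : t = j
      · rw [ht]
        have : 1 ≤ j := by omega
        by_cases hd : n ∣ j <;> simp [hd, this]
      · simp [ht]
    rw [e, Finset.sum_ite_eq' , if_pos (Finset.mem_range.2 (by omega))]
    by_cases hnj : n = j
    · subst hnj
      rw [if_pos dvd_rfl, ← hS, hw]; ring
    · have : ¬ n ∣ j := fun h => by have := Nat.le_of_dvd (by omega) h; omega
      rw [if_neg this, hb n (by omega), add_zero]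

theorem sweep_apply {α : Type*} {u γ : Equiv.Perm α} {X : ℕ → Equiv.Perm α} {S : Set α} (n : ℕ → ℕ)
    (hS : ∀ y ∈ S, γ y ∈ S) (m : ℕ) (h : ∀ t < m, ∀ y ∈ S, ((u ^ t)⁻¹ * X t * u ^ t) y = (γ ^ n t) y) :
    ∀ y ∈ S, sweep u X m y = (γ ^ ∑ t ∈ Finset.range m, n t) y := by
  have hp : ∀ i, ∀ y ∈ S, (γ ^ i) y ∈ S := by
    intro i
    induction i with
    | zero => simp
    | succ i ih => intro y hy; rw [pow_succ']; exact hS _ (ih y hy)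
  induction m with
  | zero => intro y _; simp [sweep]
  | succ m ih =>
    intro y hy
    rw [sweep, Equiv.Perm.mul_apply, h m (by omega) y hy, ih (fun t ht => h t (by omega)) _ (hp _ y hy),
      Finset.sum_range_succ, pow_add, Equiv.Perm.mul_apply]

theorem pow_of_invol {α : Type*} {γ : Equiv.Perm α} {y : α} (h : γ (γ y) = y) (n : ℕ) :
    (γ ^ n) y = if Odd n then γ y else y := by
  induction n with
  | zero => simp
  | succ n ih =>
    rw [pow_succ', Equiv.Perm.mul_apply, ih]
    by_cases hn : Odd n
    · simp [hn, h, Nat.odd_add_one]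
    · rw [if_neg hn, if_pos (Nat.odd_add_one.2 hn)]

theorem odd_sum_iff {ι : Type*} (s : Finset ι) (n : ι → ℕ) : Odd (∑ t ∈ s, n t) ↔ (∑ t ∈ s, (n t : ZMod 2)) = 1 := by
  rw [← Nat.cast_sum, ← Nat.not_even_iff_odd, ← ZMod.natCast_eq_zero_iff_even]
  generalize ((∑ t ∈ s, n t : ℕ) : ZMod 2) = z
  revert z; decide

end Parity

section Tests
open scoped commutatorElement
variable {Q₀ Γ : Type} [DecidableEq Q₀] [Fintype Q₀]
variable {F : Set (Equiv.Perm (Cf Q₀ Γ))}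

theorem top_and_iff {L k : ℤ} (hL : 1 ≤ L) : (Top L k ∧ ¬ Top L (k - 1)) ↔ k % (2 * L) = 0 := by
  have h1 := Int.emod_nonneg k (show 2 * L ≠ 0 by omega)
  have h2 := Int.emod_lt_of_pos k (show 0 < 2 * L by omega)
  simp only [Top]
  have e : (k - 1) % (2 * L) = (k % (2 * L) - 1) % (2 * L) := by simp
  rw [e]
  generalize k % (2 * L) = r at *
  by_cases h : r = 0
  · subst h
    rw [← Int.add_emod_right, Int.emod_eq_of_lt (by omega) (by omega)]
    omega
  · rw [Int.emod_eq_of_lt (by omega) (by omega)]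
    omega

theorem CB.pos0 (hF : BG Q₀ Γ ⊆ F) : CB F (fun L k => k % (2 * L) = 0) (Atri * 12) :=
  (((CB.top hF).and hF (((CB.top hF).not hF).shift hF 1 dbl dbl_mem)).congr
    fun L k hL => top_and_iff hL).mono (Nat.mul_le_mul_left _ (by decide))

/-- The exact length test at belt position zero. -/
theorem C1.len0 (hF : BG Q₀ Γ ⊆ F) {L : ℕ} (hL : 1 ≤ L) :
    ∃ χ : ℤ → ℤ → Prop, C1 F χ dbl ((L + 1) * (4 + Atri * 12)) ∧
      ∀ L' k : ℤ, 1 ≤ L' → k % (2 * L') = 0 → (χ L' k ↔ L' = L) := by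
  classical
  obtain ⟨b, hb⟩ := exists_dvd_detector hL
  obtain ⟨E, hE, hE'⟩ := CB.pos0 hF dbl dbl_mem
  let n : ℤ → ℤ → ℕ → ℕ := fun L' k t => if (b t = 1 ∧ 1 ≤ t) ∧ (k + 2 * t) % (2 * L') = 0 then 1 else 0
  refine ⟨fun L' k => Odd (∑ t ∈ Finset.range (L + 1), n L' k t), ⟨sweep (rhoP ^ 2)
    (fun t => if b t = 1 ∧ 1 ≤ t then E else 1) (L + 1), ?_, ?_⟩, ?_⟩
  · refine (NB.sweep (b := 2) (c := Atri * 12) ?_ (fun t => ?_) (L + 1)).mono le_rfl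
    · exact_mod_cast NB_rho hF 2
    · split_ifs
      · exact hE
      · exact NB.one _
  · intro s L' ε Λ k q hv
    have key := sweep_apply (u := rhoP ^ 2) (γ := gt dbl) (S := {y : Cf Q₀ Γ | ∃ q, y = cfg s L' ε Λ k q})
      (X := fun t => if b t = 1 ∧ 1 ≤ t then E else 1) (n L' k) ?_ (L + 1) ?_ _ ⟨q, rfl⟩
    · rw [key, pow_of_invol]
      · split_ifs with h
        · rw [cfg_gt]; simp [ctl, h]
        · simp [ctl, h]
      · rw [cfg_gt, cfg_gt]
        congr 1
        show (q.1, (dbl * dbl) q.2) = q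
        rw [dbl_mul_self]; rfl
    · rintro y ⟨q, rfl⟩
      exact ⟨_, cfg_gt ..⟩
    · rintro t - y ⟨q, rfl⟩
      have e1 : (rhoP ^ 2 : Equiv.Perm (Cf Q₀ Γ)) ^ t = rhoP ^ (2 * t : ℤ) := by
        rw [← pow_mul, ← zpow_natCast]; push_cast; rfl
      rw [e1, Equiv.Perm.mul_apply, Equiv.Perm.mul_apply, cfg_rho_zpow hv, ← zpow_neg]
      simp only [n]
      by_cases hc : b t = 1 ∧ 1 ≤ t
      · rw [if_pos hc, hE' _ _ _ _ _ _ hv, cfg_rho_zpow hv]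
        by_cases hd : (k + 2 * t) % (2 * L') = 0
        · rw [if_pos ⟨hc, hd⟩, pow_one, cfg_gt]
          simp [ctl, hd]
        · rw [if_neg (fun h => hd h.2)]
          simp [ctl, hd]
      · rw [if_neg hc, if_neg (fun h => hc h.1), Equiv.Perm.one_apply, cfg_rho_zpow hv]
        simp
  · intro L' k hL' hk
    show Odd (∑ t ∈ Finset.range (L + 1), n L' k t) ↔ _
    rw [odd_sum_iff]
    have e : (∑ t ∈ Finset.range (L + 1), (n L' k t : ZMod 2)) =
        ∑ t ∈ Finset.range (L + 1), if L'.toNat ∣ t ∧ 1 ≤ t then b t else 0 := by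
      refine Finset.sum_congr rfl fun t _ => ?_
      have hd : (k + 2 * t) % (2 * L') = 0 ↔ L'.toNat ∣ t := by
        rw [← Int.dvd_iff_emod_eq_zero, Int.dvd_add_right (Int.dvd_of_emod_eq_zero hk),
          mul_dvd_mul_iff_left two_ne_zero, ← Int.natCast_dvd_natCast, Int.toNat_of_nonneg (by omega)]
      simp only [n, hd]
      have hz : b t = 0 ∨ b t = 1 := by
        generalize b t = z; revert z; decide
      by_cases h1 : L'.toNat ∣ t <;> by_cases h2 : 1 ≤ t <;> rcases hz with h | h <;> simp [h1, h2, h]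
    rw [e, hb _ (by omega)]
    split_ifs with h
    · simp; omega
    · simp; omega

/-- The exact length and position test. -/
theorem CB.lenAt (hF : BG Q₀ Γ ⊆ F) : ∃ c, ∀ (L : ℕ), 1 ≤ L → ∀ (r : ℤ),
    CB F (fun L' k => L' = L ∧ (k - r) % (2 * L) = 0) (c * (L + r.natAbs)) := by
  refine ⟨Atri * (24 * Atri + 4 * (4 + Atri * 12) + 2) + 2, fun L hL r => ?_⟩
  obtain ⟨χ, h1, h2⟩ := C1.len0 hF hL
  refine ((((CB.pos0 hF).and hF h1).shift hF r).congr fun L' k hL' => ?_).mono ?_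
  · constructor
    · rintro ⟨h3, h4⟩
      have := (h2 _ _ hL' h3).1 h4
      subst this
      exact ⟨rfl, h3⟩
    · rintro ⟨rfl, h3⟩
      exact ⟨h3, (h2 _ _ hL' h3).2 rfl⟩
  · generalize Atri = A
    obtain ⟨l, rfl⟩ : ∃ l, L = l + 1 := ⟨L - 1, by omega⟩
    generalize r.natAbs = n
    have : (A * (24 * A + 4 * (4 + A * 12) + 2) + 2) * (l + 1 + n) =
      A * (2 * (A * 12) + 2 * ((l + 1 + 1) * (4 + A * 12)) + 2) + 2 * n +
      (l * (A * (24 * A + 2 * (4 + A * 12) + 2) + 2) + 2 + n * (A * (24 * A + 4 * (4 + A * 12) + 2))) := by ring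
    omega

end Tests
section Orbit
open scoped commutatorElement
variable {Q₀ Γ : Type} [DecidableEq Q₀] [Fintype Q₀]

/-- The permutations preserving the one-head configurations. -/
def OHG (Q₀ Γ : Type) [DecidableEq Q₀] [Fintype Q₀] : Subgroup (Equiv.Perm (Cf Q₀ Γ)) where
  carrier := {g | ∀ x, OH (g x) ↔ OH x}
  one_mem' := fun _ => Iff.rfl
  mul_mem' := fun {f g} hf hg x => (hf _).trans (hg x)
  inv_mem' := fun {g} hg x => by
    have := hg (g⁻¹ x)
    rw [Equiv.Perm.inv_def, Equiv.apply_symm_apply] at this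
    exact this.symm

theorem mem_OHG_of {g : Equiv.Perm (Cf Q₀ Γ)} (h : ∀ x, OH x → OH (g x)) (h' : ∀ x, OH x → OH (g⁻¹ x)) :
    g ∈ OHG Q₀ Γ := fun x => ⟨fun hx => by
      have := h' _ hx
      rwa [Equiv.Perm.inv_def, Equiv.symm_apply_apply] at this, h x⟩

theorem gt_OHG (h : Equiv.Perm PP) : gt h ∈ OHG Q₀ Γ :=
  mem_OHG_of (fun x hx => hx.gt h) fun x hx => by rw [gt_inv]; exact hx.gt _

/-- The right cut with lanes 0 and 1. -/
noncomputable def kp (Q₀ Γ : Type) [DecidableEq Q₀] [Fintype Q₀] : Equiv.Perm (Cf Q₀ Γ) := kap 0 1 (fun _ => true)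
/-- The left cut with lanes 0 and 2. -/
noncomputable def km (Q₀ Γ : Type) [DecidableEq Q₀] [Fintype Q₀] : Equiv.Perm (Cf Q₀ Γ) := kam 0 2 (fun _ => true)

theorem CG.kp : CG (kp Q₀ Γ) := CG.kap (by decide)
theorem CG.kp_inv : CG (BD.kp Q₀ Γ)⁻¹ := CG.kap_inv (by decide)
theorem CG.km : CG (km Q₀ Γ) := (CG.kap (by decide)).refl
theorem CG.km_inv : CG (BD.km Q₀ Γ)⁻¹ := by
  have : (BD.km Q₀ Γ)⁻¹ = reflP * (BD.kap 0 2 (fun _ => true))⁻¹ * reflP⁻¹ := by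
    rw [BD.km, kam]; group
  rw [this]; exact (CG.kap_inv (by decide)).refl

/-- The next-position map of the belt cut at the head. -/
noncomputable def Fr (Q₀ Γ : Type) [DecidableEq Q₀] [Fintype Q₀] : Equiv.Perm (Cf Q₀ Γ) :=
  kp Q₀ Γ * km Q₀ Γ * kp Q₀ Γ * rhoP

theorem kp_OHG : kp Q₀ Γ ∈ OHG Q₀ Γ := mem_OHG_of CG.kp.oh CG.kp_inv.oh
theorem km_OHG : km Q₀ Γ ∈ OHG Q₀ Γ := mem_OHG_of CG.km.oh CG.km_inv.oh
theorem rhoP_OHG : rhoP ∈ OHG Q₀ Γ :=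
  mem_OHG_of (by simpa using (CG.rho (Q₀ := Q₀) (Γ := Γ) 1).oh) (by simpa using (CG.rho (Q₀ := Q₀) (Γ := Γ) (-1)).oh)
theorem Fr_OHG : Fr Q₀ Γ ∈ OHG Q₀ Γ :=
  mul_mem (mul_mem (mul_mem kp_OHG km_OHG) kp_OHG) rhoP_OHG

theorem CG.Fr : CG (Fr Q₀ Γ) :=
  ((CG.kp.mul CG.km).mul CG.kp).mul (by simpa using CG.rho (Q₀ := Q₀) (Γ := Γ) 1)

theorem CG.pow {U : Equiv.Perm (Cf Q₀ Γ)} (h : CG U) (n : ℕ) : CG (U ^ n) := by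
  induction n with
  | zero => exact ⟨fun x hx => hx, fun γ x _ => rfl⟩
  | succ n ih => rw [pow_succ]; exact ih.mul h

theorem Fr_LG : NB (LG Q₀ Γ) (Fr Q₀ Γ) 4 :=
  (((NB.of_mem (kap_LG (by decide) _)).mul (NB.of_mem (kam_LG (by decide) _))).mul
    (NB.of_mem (kap_LG (by decide) _))).mul (NB.of_mem (BG_LG BG_rho))

def wl (q : DecQ Q₀) (l : Fin 3) : DecQ Q₀ := (q.1, q.2.1, (q.2.2.1, l))

/-- The orbit of the cut configuration. -/
def orb (s L : ℤ) (ε : ℤ → Bool) (Λ : ℤ × Bool → Γ) (k : ℤ) (q : DecQ Q₀) (j : ℤ) : Cf Q₀ Γ :=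
  if j < 2 * (k + 1) then cfg s (k + 1) (cutR s L k ε) Λ (k + j) (wl q 1)
  else cfg (s + k) (L - k) (cutL s k ε) Λ (j - 2 * (k + 1)) (wl q 2)

variable {s L : ℤ} {ε : ℤ → Bool} (hv : Val s L ε) (Λ : ℤ × Bool → Γ) {k : ℤ} {q : DecQ Q₀}

theorem orb_oh (hv : Val s L ε) (Λ : ℤ × Bool → Γ) (h0 : 3 ≤ k) (h1 : k + 3 < L) (j : ℤ) : OH (orb s L ε Λ k q j) := by
  rw [orb]
  split_ifs
  · exact ⟨_, _, _, _, _, _, hv.cutR (by omega) (by omega), rfl⟩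
  · exact ⟨_, _, _, _, _, _, hv.cutL (by omega) (by omega), rfl⟩

theorem kp_y (hv : Val s L ε) (Λ : ℤ × Bool → Γ) (h0 : 3 ≤ k) (h1 : k + 3 < L) (hl : q.2.2.2 = 0) :
    kp Q₀ Γ (cfg s L ε Λ k q) = orb s L ε Λ k q 0 := by
  rw [kp, kap_act (by decide) hv Λ (by omega) h1 rfl hl, orb, if_pos (by omega), add_zero]; rfl

theorem km_y (hv : Val s L ε) (Λ : ℤ × Bool → Γ) (h0 : 3 ≤ k) (h1 : k + 3 < L) (hl : q.2.2.2 = 0) :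
    km Q₀ Γ (cfg s L ε Λ k q) = orb s L ε Λ k q (2 * (k + 1)) := by
  rw [km, kam_act (by decide) hv Λ h0 (by omega) rfl hl, orb, if_neg (by omega), sub_self]; rfl

theorem kp_orb0 (hv : Val s L ε) (Λ : ℤ × Bool → Γ) (h0 : 3 ≤ k) (h1 : k + 3 < L) (hl : q.2.2.2 = 0) :
    kp Q₀ Γ (orb s L ε Λ k q 0) = cfg s L ε Λ k q := by
  rw [← kp_y hv Λ h0 h1 hl]; exact kap_kap (by decide) (hv.fine _ _ _)

theorem km_orb (hv : Val s L ε) (Λ : ℤ × Bool → Γ) (h0 : 3 ≤ k) (h1 : k + 3 < L) (hl : q.2.2.2 = 0) :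
    km Q₀ Γ (orb s L ε Λ k q (2 * (k + 1))) = cfg s L ε Λ k q := by
  rw [← km_y hv Λ h0 h1 hl]; exact kam_kam (by decide) (hv.fine _ _ _)

theorem emod_ne_of_window {M a b : ℤ} (h : a < b) (h' : b < a + M) : b % M ≠ a % M := by
  intro e
  obtain ⟨c, hc⟩ := Int.ModEq.dvd (show a ≡ b [ZMOD M] from e.symm)
  have h1 : 0 < M * c := by omega
  have h2 : M * c < M := by omega
  have hM : 0 < M := by omega
  have : 0 < c := by by_contra hn; nlinarith
  nlinarith

theorem kp_orb_fix (hv : Val s L ε) (Λ : ℤ × Bool → Γ) (h0 : 3 ≤ k) (h1 : k + 3 < L) {j : ℤ} (hj : 0 < j) :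
    kp Q₀ Γ (orb s L ε Λ k q j) = orb s L ε Λ k q j := by
  rw [orb]
  split_ifs with h
  · refine kap_fix (by decide) (hv.cutR (by omega) (by omega)) Λ fun _ _ => ⟨fun _ => ?_, fun h => ?_⟩
    · have := emod_ne_of_window (M := 2 * (k + 1)) (a := k) (b := k + j) (by omega) (by omega)
      rw [Int.emod_eq_of_lt (a := k) (by omega) (by omega)] at this
      omega
    · exact absurd h (show (1 : Fin 3) ≠ 0 by decide)
  · refine kap_fix (by decide) (hv.cutL (by omega) (by omega)) Λ fun _ _ => ⟨fun h => ?_, fun h => ?_⟩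
    · exact absurd h (show (2 : Fin 3) ≠ 1 by decide)
    · exact absurd h (show (2 : Fin 3) ≠ 0 by decide)

theorem km_orb_fix (hv : Val s L ε) (Λ : ℤ × Bool → Γ) (h0 : 3 ≤ k) (h1 : k + 3 < L) {j : ℤ} (hj : j ≠ 2 * (k + 1))
    (hj' : j < 2 * (L + 1)) :
    km Q₀ Γ (orb s L ε Λ k q j) = orb s L ε Λ k q j := by
  rw [orb]
  split_ifs with h
  · refine kam_fix (by decide) (hv.cutR (by omega) (by omega)) Λ fun _ _ => ⟨fun h => ?_, fun h => ?_⟩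
    · exact absurd h (show (1 : Fin 3) ≠ 2 by decide)
    · exact absurd h (show (1 : Fin 3) ≠ 0 by decide)
  · refine kam_fix (by decide) (hv.cutL (by omega) (by omega)) Λ fun _ _ => ⟨fun _ => ?_, fun h => ?_⟩
    · rw [Int.emod_eq_of_lt (by omega) (by omega)]; omega
    · exact absurd h (show (2 : Fin 3) ≠ 0 by decide)

theorem Fr_orb (hv : Val s L ε) (Λ : ℤ × Bool → Γ) (h0 : 3 ≤ k) (h1 : k + 3 < L) (hl : q.2.2.2 = 0) {j : ℤ}
    (hj0 : 0 ≤ j) (hj : j < 2 * (L + 1)) :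
    Fr Q₀ Γ (orb s L ε Λ k q j) = orb s L ε Λ k q ((j + 1) % (2 * (L + 1))) := by
  rw [Fr, Equiv.Perm.mul_apply, Equiv.Perm.mul_apply, Equiv.Perm.mul_apply]
  have hR := hv.cutR (k := k) (by omega) (by omega)
  have hL := hv.cutL (k := k) (by omega) (by omega)
  rcases lt_trichotomy (j + 1) (2 * (k + 1)) with h | h | h
  · have e : rhoP (orb s L ε Λ k q j) = orb s L ε Λ k q (j + 1) := by
      rw [orb, if_pos (by omega), cfg_rho hR, orb, if_pos h, add_assoc]
    rw [e, kp_orb_fix hv Λ h0 h1 (by omega), km_orb_fix hv Λ h0 h1 (by omega) (by omega),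
      kp_orb_fix hv Λ h0 h1 (by omega), Int.emod_eq_of_lt (by omega) (by omega)]
  · have e : rhoP (orb s L ε Λ k q j) = orb s L ε Λ k q 0 := by
      rw [orb, if_pos (by omega), cfg_rho hR, orb, if_pos (by omega)]
      apply cfg_congr
      rw [add_assoc, h, Int.add_emod_right, add_zero]
    rw [e, kp_orb0 hv Λ h0 h1 hl, km_y hv Λ h0 h1 hl, kp_orb_fix hv Λ h0 h1 (by omega),
      Int.emod_eq_of_lt (by omega) (by omega), h]
  · by_cases h' : j + 1 < 2 * (L + 1)
    · have e : rhoP (orb s L ε Λ k q j) = orb s L ε Λ k q (j + 1) := by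
        rw [orb, if_neg (by omega), cfg_rho hL, orb, if_neg (by omega)]
        congr 1; ring
      rw [e, kp_orb_fix hv Λ h0 h1 (by omega), km_orb_fix hv Λ h0 h1 (by omega) (by omega),
        kp_orb_fix hv Λ h0 h1 (by omega), Int.emod_eq_of_lt (by omega) (by omega)]
    · have e : rhoP (orb s L ε Λ k q j) = orb s L ε Λ k q (2 * (k + 1)) := by
        rw [orb, if_neg (by omega), cfg_rho hL, orb, if_neg (by omega)]
        apply cfg_congr
        rw [show j - 2 * (k + 1) + 1 = 2 * (L - k) by omega, Int.emod_self, sub_self, Int.zero_emod]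
      rw [e, kp_orb_fix hv Λ h0 h1 (by omega), km_orb hv Λ h0 h1 hl, kp_y hv Λ h0 h1 hl,
        show j + 1 = 2 * (L + 1) by omega, Int.emod_self]

theorem Fr_pow_orb (hv : Val s L ε) (Λ : ℤ × Bool → Γ) (h0 : 3 ≤ k) (h1 : k + 3 < L) (hl : q.2.2.2 = 0) (n : ℕ) :
    (Fr Q₀ Γ ^ n) (orb s L ε Λ k q 0) = orb s L ε Λ k q ((n : ℤ) % (2 * (L + 1))) := by
  induction n with
  | zero => simp
  | succ n ih =>
    rw [pow_succ', Equiv.Perm.mul_apply, ih, Fr_orb hv Λ h0 h1 hl (Int.emod_nonneg _ (by omega))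
      (Int.emod_lt_of_pos _ (by omega))]
    simp

abbrev alp : Equiv.Perm PP := Equiv.swap (0, true, 0) (1, true, 0) * Equiv.swap (1, true, 0) (1, false, 0)
abbrev bet : Equiv.Perm PP := Equiv.swap (0, false, 0) (0, true, 0) * Equiv.swap (1, false, 0) (1, true, 0)

theorem alp_mem : alp ∈ alternatingGroup PP := by
  rw [Equiv.Perm.mem_alternatingGroup]; decide

theorem bet_lane : ∀ z : PP, bet z = if z.2.2 = 0 then dsP sflip z else z := by decide
theorem alp_lane : ∀ z : PP, z.2.2 ≠ 0 → alp z = z := by decide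
theorem alp_lane0 : ∀ z : PP, z.2.2 = 0 → (alp z).2.2 = 0 ∧ (alp⁻¹ z).2.2 = 0 ∧ (bet z).2.2 = 0 ∧ (bet⁻¹ z).2.2 = 0 := by decide

/-- The marker test at the start of the orbit. -/
noncomputable def tau (Q₀ Γ : Type) [DecidableEq Q₀] [Fintype Q₀] : Equiv.Perm (Cf Q₀ Γ) :=
  kp Q₀ Γ * gt bet * (kp Q₀ Γ)⁻¹

theorem tau_OHG : tau Q₀ Γ ∈ OHG Q₀ Γ := mul_mem (mul_mem kp_OHG (gt_OHG _)) (inv_mem kp_OHG)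

theorem gt_bet_lane0 (hl : q.2.2.2 = 0) : gt bet (cfg s L ε Λ k q) = gt (dsP sflip) (cfg s L ε Λ k q) := by
  rw [cfg_gt, cfg_gt, bet_lane, if_pos hl]

theorem tau_orb0 (hv : Val s L ε) (Λ : ℤ × Bool → Γ) (h0 : 3 ≤ k) (h1 : k + 3 < L) (hl : q.2.2.2 = 0) :
    tau Q₀ Γ (orb s L ε Λ k q 0) = gt (dsP sflip) (orb s L ε Λ k q 0) := by
  rw [tau, Equiv.Perm.mul_apply, Equiv.Perm.mul_apply, ← kp_y hv Λ h0 h1 hl, Equiv.Perm.inv_def,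
    Equiv.symm_apply_apply, gt_bet_lane0 Λ hl, CG.kp.comm _ _ ⟨_, _, _, _, _, _, hv, rfl⟩]

theorem tau_orb (hv : Val s L ε) (Λ : ℤ × Bool → Γ) (h0 : 3 ≤ k) (h1 : k + 3 < L) {j : ℤ} (hj : 0 < j) :
    tau Q₀ Γ (orb s L ε Λ k q j) = orb s L ε Λ k q j := by
  have e : (kp Q₀ Γ)⁻¹ (orb s L ε Λ k q j) = orb s L ε Λ k q j := by
    rw [Equiv.Perm.inv_eq_iff_eq, kp_orb_fix hv Λ h0 h1 hj]
  have e' : gt bet (orb s L ε Λ k q j) = orb s L ε Λ k q j := by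
    rw [orb]
    split_ifs
    · rw [cfg_gt, bet_lane, if_neg (show (wl q 1).2.2.2 ≠ 0 from show (1 : Fin 3) ≠ 0 by decide)]
    · rw [cfg_gt, bet_lane, if_neg (show (wl q 2).2.2.2 ≠ 0 from show (2 : Fin 3) ≠ 0 by decide)]
  rw [tau, Equiv.Perm.mul_apply, Equiv.Perm.mul_apply, e, e', kp_orb_fix hv Λ h0 h1 hj]

theorem gt_sflip_sflip (x : Cf Q₀ Γ) : gt (dsP sflip) (gt (dsP sflip) x) = x := by
  have : (gt (dsP sflip) : Equiv.Perm (Cf Q₀ Γ))⁻¹ = gt (dsP sflip) := by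
    rw [gt_inv]; congr 1
  rw [← Equiv.Perm.eq_inv_iff_eq, this]

end Orbit
section Sigma
open scoped commutatorElement
variable {Q₀ Γ : Type} [DecidableEq Q₀] [Fintype Q₀]
variable {F : Set (Equiv.Perm (Cf Q₀ Γ))}

/-- Positions on the top track at distance at least three from the ends. -/
def Itr (L k : ℤ) : Prop := 3 ≤ k % (2 * L) ∧ k % (2 * L) + 3 < L

theorem CB.right (hF : BG Q₀ Γ ⊆ F) (n : ℕ) : ∃ c, CB F (fun L k => k % (2 * L) + n < L) c := by
  induction n with
  | zero => exact ⟨1, (CB.top hF).congr fun L k _ => by simp [Top]⟩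
  | succ n ih =>
    obtain ⟨c, hc⟩ := ih
    refine ⟨_, (hc.and hF (((CB.top hF).shift hF (-(n + 1 : ℕ))) dbl dbl_mem)).congr fun L k hL => ?_⟩
    have h1 := Int.emod_nonneg k (show 2 * L ≠ 0 by omega)
    have h2 := Int.emod_lt_of_pos k (show 0 < 2 * L by omega)
    have e : k % (2 * L) + n < L → (k - -((n + 1 : ℕ) : ℤ)) % (2 * L) = k % (2 * L) + (n + 1) := by
      intro h
      have : (k - -((n + 1 : ℕ) : ℤ)) % (2 * L) = (k % (2 * L) + (n + 1)) % (2 * L) := by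
        rw [Int.emod_add_emod, sub_neg_eq_add]; push_cast; rfl
      rw [this, Int.emod_eq_of_lt (by omega) (by omega)]
    simp only [Top]
    push_cast at e ⊢
    constructor
    · rintro ⟨h3, h4⟩
      rw [e h3] at h4; omega
    · intro h3
      refine ⟨by omega, ?_⟩
      rw [e (by omega)]; omega

theorem itr_iff {L k : ℤ} (hL : 1 ≤ L) : (k - 3) % (2 * L) + (6 : ℕ) < L ↔ Itr L k := by
  have h1 := Int.emod_nonneg (k - 3) (show 2 * L ≠ 0 by omega)
  have h2 := Int.emod_lt_of_pos (k - 3) (show 0 < 2 * L by omega)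
  have h3 := Int.emod_nonneg k (show 2 * L ≠ 0 by omega)
  have h4 := Int.emod_lt_of_pos k (show 0 < 2 * L by omega)
  constructor
  · intro h
    have e : k % (2 * L) = (k - 3) % (2 * L) + 3 := by
      have : k % (2 * L) = ((k - 3) % (2 * L) + 3) % (2 * L) := by simp
      rw [this, Int.emod_eq_of_lt (by omega) (by push_cast at h; omega)]
    rw [Itr, e]; push_cast at h; omega
  · rintro ⟨h5, h6⟩
    have e : (k - 3) % (2 * L) = k % (2 * L) - 3 := by
      have : (k - 3) % (2 * L) = (k % (2 * L) - 3) % (2 * L) := by simp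
      rw [this, Int.emod_eq_of_lt (by omega) (by omega)]
    rw [e]; push_cast; omega

theorem CB.itr (hF : BG Q₀ Γ ⊆ F) : ∃ c, CB F Itr c := by
  obtain ⟨c, hc⟩ := CB.right hF 6
  exact ⟨_, (hc.shift hF 3).congr fun L k hL => itr_iff hL⟩

theorem emod_two_mul {L : ℤ} (hL : 0 < L) (t : ℕ) : ((2 * t : ℕ) : ℤ) % (2 * L) = 0 ↔ L.toNat ∣ t := by
  rw [← Int.dvd_iff_emod_eq_zero]
  push_cast
  rw [mul_dvd_mul_iff_left two_ne_zero, ← Int.natCast_dvd_natCast, Int.toNat_of_nonneg (by omega)]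

/-- The length test in the interior, on lane zero. -/
theorem exists_Xi {L : ℕ} : ∃ Ξ : Equiv.Perm (Cf Q₀ Γ), NB (LG Q₀ Γ) Ξ (2 + (L + 2) * 19) ∧ Ξ ∈ OHG Q₀ Γ ∧
    ∀ s L' ε Λ k q, Val s L' ε → Itr L' k → q.2.2.2 = 0 →
      Ξ (cfg s L' ε Λ k q) = if L' = L then gt (dsP sflip) (cfg s L' ε Λ k q) else cfg s L' ε Λ k q := by
  classical
  obtain ⟨b, hb⟩ := exists_dvd_detector (m := L + 1) (by omega)
  have hkp : NB (LG Q₀ Γ) (kp Q₀ Γ) 1 := NB.of_mem (kap_LG (by decide) _)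
  have htau : NB (LG Q₀ Γ) (tau Q₀ Γ) 3 := (hkp.mul (NB.of_mem (BG_LG (BG_gt _)))).mul hkp.inv
  set X : ℕ → Equiv.Perm (Cf Q₀ Γ) := fun t => if b t = 1 ∧ 1 ≤ t then tau Q₀ Γ else 1 with hX
  have hXL : ∀ t, NB (LG Q₀ Γ) (X t) 3 := by
    intro t
    simp only [hX]
    split_ifs
    · exact htau
    · exact NB.one _
  have hsw : ∀ m, sweep (Fr Q₀ Γ ^ 2) X m ∈ OHG Q₀ Γ := by
    intro m
    induction m with
    | zero => exact one_mem _
    | succ m ih =>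
      have hu : (Fr Q₀ Γ ^ 2) ^ m ∈ OHG Q₀ Γ := pow_mem (pow_mem Fr_OHG _) _
      refine mul_mem ih (mul_mem (mul_mem (inv_mem hu) ?_) hu)
      simp only [hX]
      split_ifs
      · exact tau_OHG
      · exact one_mem _
  refine ⟨(kp Q₀ Γ)⁻¹ * sweep (Fr Q₀ Γ ^ 2) X (L + 2) * kp Q₀ Γ, ?_,
    mul_mem (mul_mem (inv_mem kp_OHG) (hsw _)) kp_OHG, ?_⟩
  · refine ((NB.sweep (b := 8) (c := 3) ?_ hXL (L + 2)).conj' hkp).mono (by omega)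
    have := Fr_LG (Q₀ := Q₀) (Γ := Γ)
    rw [pow_two]; exact this.mul this
  · intro s L' ε Λ k' q hv hI hl
    have hL := hv.one_le
    obtain ⟨k, hk⟩ : ∃ k, k = k' % (2 * L') := ⟨_, rfl⟩
    have ek : cfg s L' ε Λ k' q = cfg s L' ε Λ k q := by
      apply cfg_congr; rw [hk, Int.emod_emod_of_dvd _ dvd_rfl]
    rw [Itr, ← hk] at hI
    obtain ⟨h0, h1⟩ := hI
    rw [ek]
    let n : ℕ → ℕ := fun t => if (b t = 1 ∧ 1 ≤ t) ∧ (L' + 1).toNat ∣ t then 1 else 0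
    have key := sweep_apply (u := Fr Q₀ Γ ^ 2) (γ := gt (dsP sflip)) (X := X)
      (S := {y : Cf Q₀ Γ | ∃ q : DecQ Q₀, q.2.2.2 = 0 ∧ y = orb s L' ε Λ k q 0}) n ?_ (L + 2) ?_ _ ⟨q, hl, rfl⟩
    · rw [Equiv.Perm.mul_apply, Equiv.Perm.mul_apply, kp_y hv Λ h0 h1 hl, key, pow_of_invol (gt_sflip_sflip _)]
      have hodd : Odd (∑ t ∈ Finset.range (L + 2), n t) ↔ L' = L := by
        rw [odd_sum_iff]
        have e : (∑ t ∈ Finset.range (L + 2), (n t : ZMod 2)) =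
            ∑ t ∈ Finset.range (L + 1 + 1), if (L' + 1).toNat ∣ t ∧ 1 ≤ t then b t else 0 := by
          refine Finset.sum_congr rfl fun t _ => ?_
          simp only [n]
          have hz : b t = 0 ∨ b t = 1 := by
            generalize b t = z; revert z; decide
          by_cases h1 : (L' + 1).toNat ∣ t <;> by_cases h2 : 1 ≤ t <;> rcases hz with h | h <;> simp [h1, h2, h]
        rw [e, hb _ (by omega)]
        split_ifs with h
        · simp; omega
        · simp; omega
      rw [if_congr hodd rfl rfl, Equiv.Perm.inv_eq_iff_eq]
      split_ifs
      · rw [CG.kp.comm _ _ ⟨_, _, _, _, _, _, hv, rfl⟩, kp_y hv Λ h0 h1 hl]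
      · rw [kp_y hv Λ h0 h1 hl]
    · rintro y ⟨q, hl, rfl⟩
      refine ⟨(q.1, dsP sflip q.2), hl, ?_⟩
      rw [orb, if_pos (by omega), cfg_gt, orb, if_pos (by omega)]; rfl
    · rintro t - y ⟨q, hl, rfl⟩
      have cm := (CG.Fr (Q₀ := Q₀) (Γ := Γ)).pow (2 * t)
      rw [← pow_mul, Equiv.Perm.mul_apply, Equiv.Perm.mul_apply, Equiv.Perm.inv_eq_iff_eq]
      have ho := orb_oh (q := q) hv Λ h0 h1 0
      have hd := emod_two_mul (L := L' + 1) (by omega) t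
      have hp := Fr_pow_orb hv Λ h0 h1 hl (2 * t)
      simp only [n, hX]
      by_cases hc : b t = 1 ∧ 1 ≤ t
      · by_cases hdv : (L' + 1).toNat ∣ t
        · rw [if_pos hc, if_pos ⟨hc, hdv⟩, pow_one, cm.comm _ _ ho, hp, hd.2 hdv, tau_orb0 hv Λ h0 h1 hl]
        · rw [if_pos hc, if_neg (fun h => hdv h.2), pow_zero, Equiv.Perm.one_apply, hp, tau_orb hv Λ h0 h1]
          have := Int.emod_nonneg ((2 * t : ℕ) : ℤ) (show 2 * (L' + 1) ≠ 0 by omega)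
          have := mt hd.1 hdv
          omega
      · rw [if_neg hc, if_neg (fun h => hc h.1)]; simp

theorem dbl_lane : ∀ z : PP, z.2.2 ≠ 0 → dbl z = z := by decide
theorem dbl_lane0 : ∀ z : PP, z.2.2 = 0 → dbl z ≠ z := by decide
theorem comm_apply : ∀ z : PP, alp (bet (alp⁻¹ (bet⁻¹ z))) = dbl z := by decide

theorem cfg_q_inj {s L : ℤ} {ε : ℤ → Bool} {Λ : ℤ × Bool → Γ} {k : ℤ} {q q' : DecQ Q₀}
    (h : cfg s L ε Λ k q = cfg s L ε Λ k q') : q = q' := by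
  have := congrArg hd (congrFun h (addr s L k).1)
  have h2 := congrArg sg (congrFun h (addr s L k).1)
  simp only [cfg, hd_scfg, sg_scfg, if_true, Option.some.injEq, Prod.mk.injEq, true_and] at this h2
  obtain ⟨q, d, σ, g⟩ := q
  obtain ⟨q', d', σ', g'⟩ := q'
  simp_all

theorem C1.itrLen : ∃ c, ∀ L : ℕ, 1 ≤ L → C1 (LG Q₀ Γ) (fun L' k => L' = L ∧ Itr L' k) dbl (c * L) := by
  obtain ⟨c, hc⟩ := CB.itr (BG_LG (Q₀ := Q₀) (Γ := Γ))
  refine ⟨2 * c + 200, fun L hL => ?_⟩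
  obtain ⟨Ξ, h1, h2, h3⟩ := exists_Xi (Q₀ := Q₀) (Γ := Γ) (L := L)
  obtain ⟨C, h4, h5⟩ := hc alp alp_mem
  refine ⟨⁅C, Ξ⁆, (h4.comm h1).mono (by nlinarith), ?_⟩
  intro s L' ε Λ k q hv
  rw [commutatorElement_def]
  simp only [Equiv.Perm.mul_apply]
  by_cases hI : Itr L' k ∧ q.2.2.2 = 0
  · have hΞ : ∀ q : DecQ Q₀, q.2.2.2 = 0 →
        Ξ (cfg s L' ε Λ k q) = cfg s L' ε Λ k (q.1, (if L' = L then bet else 1) q.2) := by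
      intro q hq
      rw [h3 _ _ _ _ _ _ hv hI.1 hq]
      split_ifs
      · rw [cfg_gt, bet_lane, if_pos hq]
      · rfl
    have hΞ' : ∀ q : DecQ Q₀, q.2.2.2 = 0 →
        Ξ⁻¹ (cfg s L' ε Λ k q) = cfg s L' ε Λ k (q.1, (if L' = L then bet else 1)⁻¹ q.2) := by
      intro q hq
      rw [Equiv.Perm.inv_eq_iff_eq, hΞ]
      · simp
      · split_ifs
        · exact (alp_lane0 _ hq).2.2.2
        · exact hq
    have hl : ∀ z : PP, z.2.2 = 0 → (((if L' = (L : ℤ) then bet else 1) : Equiv.Perm PP)⁻¹ z).2.2 = 0 := by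
      intro z hz
      split_ifs
      · exact (alp_lane0 _ hz).2.2.2
      · exact hz
    rw [hΞ' q hI.2, h5.inv _ _ _ _ _ _ hv, hΞ, h5 _ _ _ _ _ _ hv]
    · simp only [ctl, hI.1, and_true, if_true, Pi.inv_apply]
      congr 2
      split_ifs
      · exact comm_apply q.2
      · simp
    · simp only [ctl, hI.1, if_true, Pi.inv_apply]
      exact (alp_lane0 _ (hl _ hI.2)).2.1
  · have hC : ∀ s L' ε Λ k q, Val s L' ε → ¬ (Itr L' k ∧ q.2.2.2 = 0) →
        C (cfg s L' ε Λ k q) = cfg s L' ε Λ k q := by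
      intro s L' ε Λ k q hv h
      rw [h5 _ _ _ _ _ _ hv]
      simp only [ctl]
      split_ifs with h6
      · rw [alp_lane _ (fun h7 => h ⟨h6, h7⟩)]
      · rfl
    have hR : (ctl (fun L' k => L' = (L : ℤ) ∧ Itr L' k) dbl) L' k q.2 = q.2 := by
      simp only [ctl]
      split_ifs with h6
      · exact dbl_lane _ fun h7 => hI ⟨h6.2, h7⟩
      · rfl
    rw [hR]
    have ho : OH (Ξ⁻¹ (cfg s L' ε Λ k q)) := ((inv_mem h2 : Ξ⁻¹ ∈ OHG Q₀ Γ) _).2 ⟨_, _, _, _, _, _, hv, rfl⟩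
    obtain ⟨s', L'', ε', Λ', k', q', hv', e⟩ := ho
    have hI' : ¬ (Itr L'' k' ∧ q'.2.2.2 = 0) := by
      intro h
      obtain ⟨q₂, hq₂, e'⟩ : ∃ q₂ : DecQ Q₀, q₂.2.2.2 = 0 ∧ cfg s L' ε Λ k q = cfg s' L'' ε' Λ' k' q₂ := by
        rw [Equiv.Perm.inv_eq_iff_eq, h3 _ _ _ _ _ _ hv' h.1 h.2] at e
        split_ifs at e
        · rw [cfg_gt] at e
          exact ⟨(q'.1, dsP sflip q'.2), h.2, e⟩
        · exact ⟨_, h.2, e⟩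
      obtain ⟨C', -, h6⟩ := hc dbl dbl_mem
      have a1 := h6 _ _ _ Λ k q hv
      have a2 := h6 _ _ _ Λ' k' q₂ hv'
      have a3 : ctl Itr dbl L' k q.2 = q.2 := by
        simp only [ctl]
        split_ifs with h7
        · exact dbl_lane _ fun h8 => hI ⟨h7, h8⟩
        · rfl
      rw [a3, e'] at a1
      rw [a1] at a2
      have := congrArg Prod.snd (cfg_q_inj a2)
      simp only [ctl, h.1, if_true] at this
      exact dbl_lane0 _ hq₂ this.symm
    have e2 : C⁻¹ (cfg s' L'' ε' Λ' k' q') = cfg s' L'' ε' Λ' k' q' := by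
      rw [Equiv.Perm.inv_eq_iff_eq, hC _ _ _ _ _ _ hv' hI']
    rw [e, e2, ← e, Equiv.Perm.inv_def, Equiv.apply_symm_apply, hC _ _ _ _ _ _ hv hI]

theorem CB.or_finset {ι : Type*} (R : Finset ι) {χ : ι → ℤ → ℤ → Prop} {c : ℕ} (h : ∀ r ∈ R, CB F (χ r) c)
    (hd : ∀ r ∈ R, ∀ r' ∈ R, ∀ L k, 1 ≤ L → χ r L k → χ r' L k → r = r') :
    CB F (fun L k => ∃ r ∈ R, χ r L k) (R.card * c) := by
  classical
  induction R using Finset.induction_on with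
  | empty => exact (CB.false _).congr fun L k _ => by simp
  | insert r R hr ih =>
    rw [Finset.card_insert_of_notMem hr, add_mul, one_mul, add_comm]
    refine ((h r (Finset.mem_insert_self _ _)).or_disjoint (ih (fun r' h' => h r' (Finset.mem_insert_of_mem h'))
      fun r1 h1 r2 h2 => hd r1 (Finset.mem_insert_of_mem h1) r2 (Finset.mem_insert_of_mem h2)) ?_).congr
      fun L k _ => by simp
    rintro L k hL h1 ⟨r', h2, h3⟩
    have := hd r (Finset.mem_insert_self _ _) r' (Finset.mem_insert_of_mem h2) L k hL h1 h3
    exact hr (this ▸ h2)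

/-- The exact length test. -/
theorem CB.len : ∃ c, ∀ L : ℕ, 1 ≤ L → CB (LG Q₀ Γ) (fun L' _ => L' = L) (c * L) := by
  classical
  have hF := BG_LG (Q₀ := Q₀) (Γ := Γ)
  obtain ⟨c, hc⟩ := C1.itrLen (Q₀ := Q₀) (Γ := Γ)
  obtain ⟨c', hc'⟩ := CB.lenAt hF
  refine ⟨2 * (Atri * (2 * c + 4)) + 2 + 12 * (3 * c'), fun L hL => ?_⟩
  have hA : CB (LG Q₀ Γ) (fun L' k => L' = L ∧ Itr L' k) (Atri * (2 * c + 4) * L) :=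
    (CB.of_dbl hF (hc L hL)).mono (by
      rw [mul_assoc]; exact Nat.mul_le_mul_left _ (by nlinarith))
  have hB := hA.shift hF L
  let R : Finset ℤ := (Finset.Ico 0 (2 * (L : ℤ))).filter fun r => ¬ Itr L r ∧ ¬ Itr L (r - L)
  have hRc : R.card ≤ 12 := by
    have : R ⊆ ([0, 1, 2, L - 3, L - 2, L - 1, L, L + 1, L + 2, 2 * L - 3, 2 * L - 2, 2 * L - 1] : List ℤ).toFinset := by
      intro r hr
      simp only [R, Finset.mem_filter, Finset.mem_Ico] at hr
      obtain ⟨⟨h1, h2⟩, h3, h4⟩ := hr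
      rw [Itr, Int.emod_eq_of_lt h1 h2] at h3
      simp only [List.toFinset_cons, List.toFinset_nil, Finset.mem_insert]
      by_cases h5 : r < L
      · omega
      · rw [Itr, Int.emod_eq_of_lt (by omega) (by omega)] at h4
        omega
    exact (Finset.card_le_card this).trans (List.toFinset_card_le _)
  have hC : CB (LG Q₀ Γ) (fun L' k => ∃ r ∈ R, L' = L ∧ (k - r) % (2 * L) = 0) (R.card * (c' * (3 * L))) := by
    refine CB.or_finset R (fun r hr => (hc' L hL r).mono ?_) ?_
    · simp only [R, Finset.mem_filter, Finset.mem_Ico] at hr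
      exact Nat.mul_le_mul_left _ (by omega)
    · rintro r hr r' hr' L' k hL' ⟨-, h1⟩ ⟨-, h2⟩
      simp only [R, Finset.mem_filter, Finset.mem_Ico] at hr hr'
      have h3 : (r - r') % (2 * L) = 0 := by
        rw [show r - r' = (k - r') - (k - r) by ring, Int.sub_emod, h1, h2]; simp
      by_contra hne
      obtain ⟨d, hd⟩ := Int.dvd_of_emod_eq_zero h3
      rcases lt_trichotomy d 0 with h | h | h
      · nlinarith
      · subst h; omega
      · nlinarith
  have key : ∀ k : ℤ, Itr L k ∨ Itr L (k - L) ∨ ∃ r ∈ R, (k - r) % (2 * L) = 0 := by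
    intro k
    by_cases h1 : Itr L k
    · exact .inl h1
    by_cases h2 : Itr L (k - L)
    · exact .inr (.inl h2)
    refine .inr (.inr ⟨k % (2 * L), ?_, by simp⟩)
    simp only [R, Finset.mem_filter, Finset.mem_Ico]
    refine ⟨⟨Int.emod_nonneg _ (by omega), Int.emod_lt_of_pos _ (by omega)⟩, ?_, ?_⟩
    · rwa [Itr, Int.emod_emod_of_dvd _ dvd_rfl]
    · rwa [Itr, Int.emod_sub_emod]
  have hdAB : ∀ k : ℤ, Itr L k → Itr L (k - L) → False := by
    rintro k ⟨h1, h2⟩ ⟨h3, h4⟩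
    have h5 := Int.emod_nonneg k (show 2 * (L : ℤ) ≠ 0 by omega)
    have : (k - L) % (2 * L) = k % (2 * L) + L := by
      rw [← Int.emod_sub_emod, ← Int.add_emod_right, Int.emod_eq_of_lt (by omega) (by omega)]; ring
    omega
  have hdR : ∀ k r : ℤ, r ∈ R → (k - r) % (2 * L) = 0 → ¬ Itr L k ∧ ¬ Itr L (k - L) := by
    intro k r hr h
    simp only [R, Finset.mem_filter, Finset.mem_Ico] at hr
    have e : k % (2 * L) = r % (2 * L) := (Int.emod_eq_emod_iff_emod_sub_eq_zero).2 h
    have e' : (k - L) % (2 * L) = (r - L) % (2 * L) := by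
      rw [← Int.emod_sub_emod, e, Int.emod_sub_emod]
    exact ⟨by rw [Itr, e]; exact hr.2.1, by rw [Itr, e']; exact hr.2.2⟩
  refine (((hA.or_disjoint hB ?_).or_disjoint hC ?_).congr fun L' k hL' => ?_).mono ?_
  · rintro L' k - ⟨rfl, h1⟩ ⟨-, h2⟩
    exact hdAB k h1 h2
  · rintro L' k - (⟨rfl, h1⟩ | ⟨rfl, h1⟩) ⟨r, hr, -, h2⟩
    · exact (hdR k r hr h2).1 h1
    · exact (hdR k r hr h2).2 h1
  · constructor
    · rintro ((⟨h, -⟩ | ⟨h, -⟩) | ⟨r, -, h, -⟩) <;> exact h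
    · rintro rfl
      rcases key k with h | h | ⟨r, h, h'⟩
      · exact .inl (.inl ⟨rfl, h⟩)
      · exact .inl (.inr ⟨rfl, h⟩)
      · exact .inr ⟨r, h, rfl, h'⟩
  · have : R.card * (c' * (3 * L)) ≤ 12 * (c' * (3 * L)) := Nat.mul_le_mul_right _ hRc
    simp only [Int.natAbs_natCast]
    have e : (2 * (Atri * (2 * c + 4)) + 2 + 12 * (3 * c')) * L =
      2 * (Atri * (2 * c + 4) * L) + 2 * L + 12 * (c' * (3 * L)) := by ring
    omega

end Sigma

section
variable {A Q Γ : Type} [DecidableEq A]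

/-- One step of the machine `δ` on a tape read through the address map `ad`. -/
def gstep (δ : HeadStep Q Γ) (ad : ℤ → A) (z : (A → Γ) × ℤ × Q) : (A → Γ) × ℤ × Q :=
  match δ z.2.2 (z.1 (ad z.2.1)) with
  | Sum.inl r => (Function.update z.1 (ad z.2.1) r.2, z.2.1, r.1)
  | Sum.inr r => (z.1, z.2.1 + r.1, r.2)

theorem gstep_inl {δ : HeadStep Q Γ} {ad : ℤ → A} {Λ : A → Γ} {k : ℤ} {q : Q} {r : Q × Γ}
    (h : δ q (Λ (ad k)) = Sum.inl r) :
    gstep δ ad (Λ, k, q) = (Function.update Λ (ad k) r.2, k, r.1) := by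
  simp [gstep, h]

theorem gstep_inr {δ : HeadStep Q Γ} {ad : ℤ → A} {Λ : A → Γ} {k : ℤ} {q : Q} {r : ℤ × Q}
    (h : δ q (Λ (ad k)) = Sum.inr r) : gstep δ ad (Λ, k, q) = (Λ, k + r.1, r.2) := by
  simp [gstep, h]

end

section
variable {Q Γ : Type}

/-- The address of a position of the cyclic tape. -/
def rad (s L : ℤ) (ℓ : ℕ) (t : ZMod ℓ) : ℤ × Bool := addr s L (t.val : ℤ)

/-- The cyclic tape of a conveyor belt. -/
def ring (s L : ℤ) (ℓ : ℕ) (z : (ℤ × Bool → Γ) × ℤ × Q) : ZMod ℓ → TSym Q Γ := fun t =>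
  if t = (z.2.1 : ZMod ℓ) then Sum.inr (z.2.2, z.1 (rad s L ℓ t))
  else Sum.inl (z.1 (rad s L ℓ t))

variable {s L : ℤ} {ℓ : ℕ}

theorem rad_cast (hL : 1 ≤ L) (hℓ : (ℓ : ℤ) = 2 * L) (k : ℤ) :
    rad s L ℓ (k : ZMod ℓ) = addr s L k := by
  have : NeZero ℓ := ⟨by rintro rfl; simp at hℓ; omega⟩
  rw [rad, ZMod.val_intCast, hℓ, addr_emod]

theorem rad_inj (hL : 1 ≤ L) (hℓ : (ℓ : ℤ) = 2 * L) {t : ZMod ℓ} {k : ℤ}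
    (h : rad s L ℓ t = addr s L k) : t = (k : ZMod ℓ) := by
  have : NeZero ℓ := ⟨by rintro rfl; simp at hℓ; omega⟩
  have h1 := addr_inj hL h
  rw [← hℓ] at h1
  have h2 := (ZMod.intCast_eq_intCast_iff' _ _ _).2 h1
  simpa using h2

theorem ring_amoh (z : (ℤ × Bool → Γ) × ℤ × Q) : AtMostOneHeadC (ring s L ℓ z) := by
  intro i j hi hj
  by_cases h1 : i = (z.2.1 : ZMod ℓ)
  · by_cases h2 : j = (z.2.1 : ZMod ℓ)
    · rw [h1, h2]
    · simp [ring, h2] at hj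
  · simp [ring, h1] at hi

theorem stepC_ring {δ : HeadStep Q Γ} (hδ : ∀ q a r, δ q a = Sum.inr r → r.1 = 1 ∨ r.1 = -1)
    (hL : 1 ≤ L) (hℓ : (ℓ : ℤ) = 2 * L) (z : (ℤ × Bool → Γ) × ℤ × Q) :
    stepC δ ℓ (ring s L ℓ z) = ring s L ℓ (gstep δ (addr s L) z) := by
  obtain ⟨Λ, k, q⟩ := z
  have : NeZero ℓ := ⟨by rintro rfl; simp at hℓ; omega⟩
  have : Fact (1 < ℓ) := ⟨by omega⟩
  funext t
  rcases hr : δ q (Λ (addr s L k)) with ⟨q', b⟩ | ⟨d, q'⟩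
  · rw [gstep_inl hr]
    have hno : ∀ u d, arrivesAs δ (ring s L ℓ (Λ, k, q) u) d = none := by
      intro u d
      by_cases hu : u = (k : ZMod ℓ)
      · simp [ring, hu, rad_cast hL hℓ, arrivesAs, hr]
      · simp [ring, hu, arrivesAs]
    by_cases ht : t = (k : ZMod ℓ)
    · simp [stepC, ring, ht, rad_cast hL hℓ, localStep, hr]
    · have h1 : ring s L ℓ (Λ, k, q) t = Sum.inl (Λ (rad s L ℓ t)) := by simp [ring, ht]
      simp only [stepC, h1, localStep, hno]
      have h2 : rad s L ℓ t ≠ addr s L k := fun h => ht (rad_inj hL hℓ h)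
      simp [ring, ht, h2]
  · rw [gstep_inr hr]
    have hd := hδ _ _ _ hr
    have hno : ∀ u d', arrivesAs δ (ring s L ℓ (Λ, k, q) u) d' =
        if u = (k : ZMod ℓ) ∧ d = d' then some q' else none := by
      intro u d'
      by_cases hu : u = (k : ZMod ℓ)
      · simp [ring, hu, rad_cast hL hℓ, arrivesAs, hr]
      · simp [ring, hu, arrivesAs]
    by_cases ht : t = (k : ZMod ℓ)
    · have h3 : ¬ (d : ZMod ℓ) = 0 := by
        rcases hd with h | h <;> simp only at h <;> simp [h]
      simp [stepC, ring, ht, rad_cast hL hℓ, localStep, hr, h3]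
    · have h1 : ring s L ℓ (Λ, k, q) t = Sum.inl (Λ (rad s L ℓ t)) := by simp [ring, ht]
      simp only [stepC, h1, localStep, hno]
      rcases hd with h | h <;> simp only at h <;> subst h
      · by_cases h5 : t - 1 = (k : ZMod ℓ)
        · have h6 : t = (k : ZMod ℓ) + 1 := by rw [← h5]; ring
          simp [ring, h6]
        · have h6 : ¬ t = (k : ZMod ℓ) + 1 := fun h => h5 (by rw [h]; ring)
          simp [ring, h6, h5]
      · by_cases h5 : t + 1 = (k : ZMod ℓ)
        · have h6 : t = (k : ZMod ℓ) + (-1) := by rw [← h5]; ring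
          simp [ring, h6]
        · have h6 : ¬ t = (k : ZMod ℓ) + (-1) := fun h => h5 (by rw [h]; ring)
          simp [ring, h6, h5]

theorem stepC_ring_iterate {δ : HeadStep Q Γ} (hδ : ∀ q a r, δ q a = Sum.inr r → r.1 = 1 ∨ r.1 = -1)
    (hL : 1 ≤ L) (hℓ : (ℓ : ℤ) = 2 * L) (n : ℕ) (z : (ℤ × Bool → Γ) × ℤ × Q) :
    (stepC δ ℓ)^[n] (ring s L ℓ z) = ring s L ℓ ((gstep δ (addr s L))^[n] z) := by
  induction n generalizing z with
  | zero => rfl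
  | succ n ih => rw [Function.iterate_succ_apply, Function.iterate_succ_apply, stepC_ring hδ hL hℓ, ih]

/-- The run only changes letters of the block. -/
theorem gstep_outside {δ : HeadStep Q Γ} (hL : 1 ≤ L) (n : ℕ) (z : (ℤ × Bool → Γ) × ℤ × Q) (c : ℤ × Bool)
    (hc : c.1 < s ∨ s + L ≤ c.1) : ((gstep δ (addr s L))^[n] z).1 c = z.1 c := by
  induction n generalizing z with
  | zero => rfl
  | succ n ih =>
    rw [Function.iterate_succ_apply, ih]
    obtain ⟨Λ, k, q⟩ := z
    rcases hr : δ q (Λ (addr s L k)) with r | r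
    · rw [gstep_inl hr]
      have : c ≠ addr s L k := by
        rintro rfl
        have := addr_fst_mem (s := s) hL k
        omega
      simp [this]
    · rw [gstep_inr hr]

theorem ring_inj (hL : 1 ≤ L) (hℓ : (ℓ : ℤ) = 2 * L) {z z' : (ℤ × Bool → Γ) × ℤ × Q}
    (h : ring s L ℓ z = ring s L ℓ z') : z.2.1 % (2 * L) = z'.2.1 % (2 * L) ∧ z.2.2 = z'.2.2 ∧
      ∀ k, z.1 (addr s L k) = z'.1 (addr s L k) := by
  have h0 := congrFun h (z.2.1 : ZMod ℓ)
  have hk : (z.2.1 : ZMod ℓ) = (z'.2.1 : ZMod ℓ) := by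
    by_contra hne
    simp [ring, hne] at h0
  refine ⟨?_, ?_, fun k => ?_⟩
  · rw [← hℓ]; exact (ZMod.intCast_eq_intCast_iff' _ _ _).1 hk
  · simp [ring, hk] at h0; exact h0.1
  · have h1 := congrFun h (k : ZMod ℓ)
    by_cases h2 : (k : ZMod ℓ) = (z'.2.1 : ZMod ℓ)
    · simp only [ring, hk, h2, if_true, rad_cast hL hℓ] at h1
      simp only [Sum.inr.injEq, Prod.mk.injEq] at h1
      have h3 : addr s L k = addr s L z'.2.1 := by
        rw [← rad_cast (ℓ := ℓ) hL hℓ, h2, rad_cast hL hℓ]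
      rw [h3]; exact h1.2
    · simp only [ring, hk, h2, if_false, rad_cast hL hℓ, Sum.inl.injEq] at h1
      exact h1

end

section
variable {Q₀ Γ : Type} [DecidableEq Q₀] [Fintype Q₀] {s L : ℤ} {ℓ : ℕ} {ε : ℤ → Bool}

/-- The configuration of a machine state on a conveyor belt. -/
def cz (s L : ℤ) (ε : ℤ → Bool) (z : (ℤ × Bool → Γ) × ℤ × DecQ Q₀) : Cf Q₀ Γ := cfg s L ε z.1 z.2.1 z.2.2

theorem cz_eq_of_ring (hL : 1 ≤ L) (hℓ : (ℓ : ℤ) = 2 * L) {z z' : (ℤ × Bool → Γ) × ℤ × DecQ Q₀}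
    (h : ring s L ℓ z = ring s L ℓ z') (ho : ∀ c : ℤ × Bool, c.1 < s ∨ s + L ≤ c.1 → z.1 c = z'.1 c) :
    cz s L ε z = cz s L ε z' := by
  obtain ⟨h1, h2, h3⟩ := ring_inj hL hℓ h
  have h4 : z.1 = z'.1 := by
    funext c
    by_cases hc : c.1 < s ∨ s + L ≤ c.1
    · exact ho c hc
    · push Not at hc
      obtain ⟨j, _ | _⟩ := c
      · have := h3 (s + 2 * L - 1 - j)
        rw [addr_of_bot (by simp at hc; omega) (by simp at hc; omega)] at this
        simpa using this
      · have := h3 (j - s)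
        rw [addr_of_top (by simp at hc; omega) (by simp at hc; omega)] at this
        simpa using this
  rw [cz, cz, h2, h4, cfg_congr _ _ _ _ _ h1]

theorem unfoldBlock_cz (hL : 1 ≤ L) (z : (ℤ × Bool → Γ) × ℤ × DecQ Q₀) {e : ℤ} (he : e = s + L - 1) :
    unfoldBlock (cz s L ε z) s e = ring s L _ z := by
  obtain ⟨Λ, k, q⟩ := z
  have hl : (((e - s + 1).toNat : ℕ) : ℤ) = L := by omega
  have hl2 : ((2 * (e - s + 1).toNat : ℕ) : ℤ) = 2 * L := by push_cast; omega
  have : NeZero (2 * (e - s + 1).toNat) := ⟨by omega⟩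
  funext t
  have h0 := ZMod.val_lt t
  have hkey : t = (k : ZMod _) ↔ rad s L _ t = addr s L k :=
    ⟨fun h => by rw [h, rad_cast hL hl2], rad_inj hL hl2⟩
  have e1 := addr_fst_mem (s := s) hL k
  unfold unfoldBlock ring
  simp only [hkey]
  by_cases ht : t.val < (e - s + 1).toNat
  · have hr : rad s L _ t = (s + (t.val : ℤ), true) := addr_of_top (by omega) (by omega)
    rw [if_pos ht, hr]
    simp only [cz, cfg, scfg]
    rcases addr s L k with ⟨i, _ | _⟩ <;> by_cases h : s + (t.val : ℤ) = i <;>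
      simp [-ZMod.natCast_val, h, BSym.topSym]
  · have hr : rad s L _ t = (e - ((t.val - (e - s + 1).toNat : ℕ) : ℤ), false) := by
      rw [rad, addr_of_bot (by omega) (by omega)]
      congr 1
      omega
    rw [if_neg ht, hr]
    simp only [cz, cfg, scfg]
    rcases addr s L k with ⟨i, _ | _⟩ <;> by_cases h : e - ((t.val - (e - s + 1).toNat : ℕ) : ℤ) = i <;>
      simp [-ZMod.natCast_val, h, BSym.botSym]

/-- The permutation `B` of belt configurations corresponds to the permutation `π` of cyclic tapes. -/
def Corr (π : Equiv.Perm (CConf (DecQ Q₀) Γ ℓ)) (B : Equiv.Perm (Cf Q₀ Γ)) : Prop :=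
  ∀ s L ε z, Val s L ε → ∃ z', B (cz s L ε z) = cz s L ε z' ∧
    (∀ c : ℤ × Bool, c.1 < s ∨ s + L ≤ c.1 → z'.1 c = z.1 c) ∧
    ((ℓ : ℤ) = 2 * L → π ⟨ring s L ℓ z, ring_amoh z⟩ = ⟨ring s L ℓ z', ring_amoh z'⟩)

theorem Corr.mul {π π' : Equiv.Perm (CConf (DecQ Q₀) Γ ℓ)} {B B' : Equiv.Perm (Cf Q₀ Γ)} (h : Corr π B)
    (h' : Corr π' B') : Corr (π * π') (B * B') := by
  intro s L ε z hv
  obtain ⟨z', a1, a2, a3⟩ := h' s L ε z hv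
  obtain ⟨z'', b1, b2, b3⟩ := h s L ε z' hv
  refine ⟨z'', by rw [Equiv.Perm.mul_apply, a1, b1], fun c hc => by rw [b2 c hc, a2 c hc], fun hℓ => ?_⟩
  rw [Equiv.Perm.mul_apply, a3 hℓ, b3 hℓ]

theorem Corr.gate {π : Equiv.Perm (CConf (DecQ Q₀) Γ ℓ)} {g : Equiv.Perm (DecQ Q₀ × Γ)}
    (h : IsUnaryGate g π) : Corr π (gateP g) := by
  rintro s L ε ⟨Λ, k, q⟩ hv
  refine ⟨(Function.update Λ (addr s L k) (g (q, Λ (addr s L k))).2, k, (g (q, Λ (addr s L k))).1),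
    scfg_gate .., fun c hc => ?_, fun hℓ => ?_⟩
  · have : c ≠ addr s L k := by
      rintro rfl
      have := addr_fst_mem (s := s) hv.one_le k
      omega
    simp [this]
  · refine Subtype.ext (funext fun t => ?_)
    rw [h]
    by_cases ht : t = (k : ZMod ℓ)
    · simp [ring, ht, gateApply, rad_cast hv.one_le hℓ]
    · have h2 : rad s L ℓ t ≠ addr s L k := fun h => ht (rad_inj hv.one_le hℓ h)
      simp [ring, ht, gateApply, h2]

theorem ring_move {π : Equiv.Perm (CConf (DecQ Q₀) Γ ℓ)} {q' : DecQ Q₀} (h : IsMoveGate q' π)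
    (hL : 1 ≤ L) (hℓ : (ℓ : ℤ) = 2 * L) (Λ : ℤ × Bool → Γ) (k : ℤ) (q : DecQ Q₀) :
    π ⟨ring s L ℓ (Λ, k, q), ring_amoh _⟩ =
      ⟨ring s L ℓ (Λ, if q = q' then k + 1 else k, q), ring_amoh _⟩ := by
  have : NeZero ℓ := ⟨by rintro rfl; simp at hℓ; omega⟩
  have : Fact (1 < ℓ) := ⟨by omega⟩
  obtain ⟨h1, h2⟩ := h ⟨ring s L ℓ (Λ, k, q), ring_amoh _⟩
  split_ifs with hq
  · subst hq
    refine Subtype.ext (funext fun t => ?_)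
    rw [h2 (k : ZMod ℓ) (Λ (rad s L ℓ k)) (by simp [ring])]
    by_cases ht : t = (k : ZMod ℓ) + 1
    · simp [ring, ht, tapeLetter]
    · by_cases ht' : t = (k : ZMod ℓ)
      · simp [ring, ht']
      · simp [ring, ht, ht']
  · apply h1
    intro i a hi
    by_cases ht : i = (k : ZMod ℓ)
    · simp [ring, ht] at hi
      exact hq hi.1
    · simp [ring, ht] at hi

theorem Corr.move {π : Equiv.Perm (CConf (DecQ Q₀) Γ ℓ)} {q' : DecQ Q₀} (h : IsMoveGate q' π) :
    Corr π (moveP q') := by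
  rintro s L ε ⟨Λ, k, q⟩ hv
  exact ⟨(Λ, if q = q' then k + 1 else k, q), cfg_move hv Λ k q q', fun _ _ => rfl, fun hℓ => ring_move h hv.one_le hℓ ..⟩

theorem Corr.move_inv {π : Equiv.Perm (CConf (DecQ Q₀) Γ ℓ)} {q' : DecQ Q₀} (h : IsMoveGate q' π⁻¹) :
    Corr π (moveP q')⁻¹ := by
  rintro s L ε ⟨Λ, k, q⟩ hv
  refine ⟨(Λ, if q = q' then k - 1 else k, q), ?_, fun _ _ => rfl, fun hℓ => ?_⟩
  · rw [Equiv.Perm.inv_eq_iff_eq]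
    show _ = moveP q' (cfg s L ε Λ (if q = q' then k - 1 else k) q)
    rw [cfg_move hv]
    split_ifs <;> simp [cz]
  · have h1 := ring_move (s := s) h hv.one_le hℓ Λ (if q = q' then k - 1 else k) q
    rw [Equiv.Perm.inv_eq_iff_eq] at h1
    rw [h1]
    refine congrArg π (Subtype.ext ?_)
    split_ifs <;> simp

theorem isUnaryGate_inv {π : Equiv.Perm (CConf (DecQ Q₀) Γ ℓ)} {g : Equiv.Perm (DecQ Q₀ × Γ)}
    (h : IsUnaryGate g π⁻¹) : IsUnaryGate g⁻¹ π := by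
  intro w i
  have h1 := h (π w) i
  rw [Equiv.Perm.inv_def, Equiv.symm_apply_apply] at h1
  rw [h1]
  rcases (π w).1 i with a | a <;> simp [gateApply]

theorem gateP_inv (g : Equiv.Perm (DecQ Q₀ × Γ)) : gateP g⁻¹ = (gateP g)⁻¹ := rfl

theorem exists_corr {π : Equiv.Perm (CConf (DecQ Q₀) Γ ℓ)} {c : ℕ} (h : NB (TMGens (DecQ Q₀) Γ ℓ) π c) :
    ∃ B : Equiv.Perm (Cf Q₀ Γ), NB (BG Q₀ Γ) B c ∧ Corr π B ∧ Corr π⁻¹ B⁻¹ := by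
  obtain ⟨w, hw, h1, rfl⟩ := h
  suffices hs : ∃ B : Equiv.Perm (Cf Q₀ Γ), NB (BG Q₀ Γ) B w.length ∧ Corr w.prod B ∧ Corr w.prod⁻¹ B⁻¹ by
    obtain ⟨B, hB, hc⟩ := hs
    exact ⟨B, hB.mono hw, hc⟩
  clear hw
  induction w with
  | nil =>
    exact ⟨1, NB.one _, fun s L ε z hv => ⟨z, rfl, fun _ _ => rfl, fun _ => rfl⟩,
      fun s L ε z hv => ⟨z, rfl, fun _ _ => rfl, fun _ => rfl⟩⟩
  | cons x w ih =>
    obtain ⟨B, hB, hc, hi⟩ := ih fun y hy => h1 y (List.mem_cons_of_mem _ hy)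
    have hx : ∃ B' : Equiv.Perm (Cf Q₀ Γ), NB (BG Q₀ Γ) B' 1 ∧ Corr x B' ∧ Corr x⁻¹ B'⁻¹ := by
      rcases h1 x List.mem_cons_self with (⟨g, hg⟩ | ⟨q, hq⟩) | (⟨g, hg⟩ | ⟨q, hq⟩)
      · exact ⟨_, NB.of_mem (.inl ⟨g, rfl⟩), Corr.gate hg,
          gateP_inv g ▸ Corr.gate (isUnaryGate_inv (by rwa [inv_inv]))⟩
      · exact ⟨_, NB.of_mem (.inr (.inr (.inr (.inl ⟨q, rfl⟩)))), Corr.move hq,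
          Corr.move_inv (by rwa [inv_inv])⟩
      · exact ⟨_, NB.of_mem (.inl ⟨g⁻¹, rfl⟩), Corr.gate (isUnaryGate_inv hg),
          gateP_inv g⁻¹ ▸ Corr.gate (by rwa [inv_inv])⟩
      · exact ⟨_, (NB.of_mem (.inr (.inr (.inr (.inl ⟨q, rfl⟩))))).inv, Corr.move_inv hq,
          by rw [inv_inv]; exact Corr.move hq⟩
    obtain ⟨B', hB', hc', hi'⟩ := hx
    refine ⟨B' * B, (hB'.mul hB).mono (by simp; omega), ?_, ?_⟩
    · rw [List.prod_cons]
      exact hc'.mul hc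
    · rw [List.prod_cons, mul_inv_rev, mul_inv_rev]
      exact hi.mul hi'

end

section
variable {Q₀ Γ : Type}

/-- The swap of the two ducks. -/
def dk : Equiv.Perm PP := Equiv.prodCongr (Equiv.swap 0 1) (Equiv.refl _)

theorem dk_apply (z : PP) : dk z = (Equiv.swap 0 1 z.1, z.2) := rfl

theorem dk_dk (z : PP) : dk (dk z) = z := by simp [dk_apply]

theorem dk_mem : dk ∈ alternatingGroup PP := by
  rw [Equiv.Perm.mem_alternatingGroup]; decide

/-- The properties of the decorated symmetrized machine which are used. -/
structure DSpec (δ : HeadStep (DecQ Q₀) Γ) : Prop where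
  dir : ∀ q a r, δ q a = Sum.inr r → r.1 = 1 ∨ r.1 = -1
  stL : ∀ q a r, δ q a = Sum.inl r → r.1.2 = q.2
  stR : ∀ q a r, δ q a = Sum.inr r → r.2.2 = q.2
  ghL : ∀ q a r (g : Bool × Fin 3), δ q a = Sum.inl r →
    δ (q.1, q.2.1, g) a = Sum.inl ((r.1.1, r.1.2.1, g), r.2)
  ghR : ∀ q a r (g : Bool × Fin 3), δ q a = Sum.inr r →
    δ (q.1, q.2.1, g) a = Sum.inr (r.1, (r.2.1, r.2.2.1, g))
  revL : ∀ q a r, δ q a = Sum.inl r → δ (r.1.1, dk r.1.2) r.2 = Sum.inl ((q.1, dk q.2), a)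
  revR : ∀ q a r, δ q a = Sum.inr r → ∀ b, δ (r.2.1, dk r.2.2) b = Sum.inr (-r.1, (q.1, dk q.2))

theorem transFun_inl {M : TMach Q₀ Γ} {h : CompleteDet M} {q : Q₀} {a : Γ} {r : Q₀ × Γ} :
    transFun M h q a = Sum.inl r ↔ Sum.inr (q, a, r.1, r.2) ∈ M.Δ := by
  have hs := (h q a).choose_spec
  unfold transFun
  rcases hc : (h q a).choose with ⟨p, d, p'⟩ | ⟨p, b, p', b'⟩
  · rw [hc] at hs
    have hu := fun y h1 h2 => hs.2 y ⟨h1, h2⟩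
    simp only [reduceCtorEq, false_iff]
    intro hm
    have := hu _ hm ⟨rfl, rfl⟩
    simp at this
  · rw [hc] at hs
    have hu := fun y h1 h2 => hs.2 y ⟨h1, h2⟩
    obtain ⟨⟨h1, rfl, rfl⟩, -⟩ := hs
    simp only [Sum.inl.injEq]
    constructor
    · rintro rfl; exact h1
    · intro hm
      have := hu _ hm ⟨rfl, rfl⟩
      simp at this
      ext <;> simp [this]

theorem transFun_inr {M : TMach Q₀ Γ} {h : CompleteDet M} {q : Q₀} {a : Γ} {r : ℤ × Q₀} :
    transFun M h q a = Sum.inr r ↔ Sum.inl (q, r.1, r.2) ∈ M.Δ := by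
  have hs := (h q a).choose_spec
  unfold transFun
  rcases hc : (h q a).choose with ⟨p, d, p'⟩ | ⟨p, b, p', b'⟩
  · rw [hc] at hs
    have hu := fun y h1 h2 => hs.2 y ⟨h1, h2⟩
    obtain ⟨⟨h1, rfl⟩, -⟩ := hs
    simp only [Sum.inr.injEq]
    constructor
    · rintro rfl; exact h1
    · intro hm
      have := hu _ hm rfl
      simp at this
      ext <;> simp [this]
  · rw [hc] at hs
    have hu := fun y h1 h2 => hs.2 y ⟨h1, h2⟩
    simp only [reduceCtorEq, false_iff]
    intro hm
    have := hu _ hm rfl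
    simp at this

theorem reverse_inr {M : TMach Q₀ Γ} {q q' : Q₀} {a b : Γ} :
    Sum.inr (q', b, q, a) ∈ M.reverse.Δ ↔ Sum.inr (q, a, q', b) ∈ M.Δ := by
  constructor
  · rintro ⟨t, ht, h⟩
    rcases t with ⟨_, _, _⟩ | ⟨_, _, _, _⟩ <;> simp [revTrans] at h
    obtain ⟨rfl, rfl, rfl, rfl⟩ := h
    exact ht
  · exact fun h => ⟨_, h, rfl⟩

theorem reverse_inl {M : TMach Q₀ Γ} {q q' : Q₀} {d : ℤ} :
    Sum.inl (q', -d, q) ∈ M.reverse.Δ ↔ Sum.inl (q, d, q') ∈ M.Δ := by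
  constructor
  · rintro ⟨t, ht, h⟩
    rcases t with ⟨_, _, _⟩ | ⟨_, _, _, _⟩ <;> simp [revTrans] at h
    obtain ⟨rfl, rfl, rfl⟩ := h
    exact ht
  · exact fun h => ⟨_, h, rfl⟩

theorem decSymStep_inl {M : TMach Q₀ Γ} {h₁ : CompleteDet M} {h₂ : CompleteDet M.reverse} {q : DecQ Q₀} {a : Γ}
    {r : DecQ Q₀ × Γ} : decSymStep M h₁ h₂ q a = Sum.inl r ↔ r.1.2 = q.2 ∧
      (if q.2.1 = 0 then Sum.inr (q.1, a, r.1.1, r.2) ∈ M.Δ else Sum.inr (r.1.1, r.2, q.1, a) ∈ M.Δ) := by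
  obtain ⟨⟨p, dg⟩, b⟩ := r
  have key : (if q.2.1 = 0 then Sum.inr (q.1, a, p, b) ∈ M.Δ else Sum.inr (p, b, q.1, a) ∈ M.Δ) ↔
      (if q.2.1 = 0 then transFun M h₁ q.1 a else transFun M.reverse h₂ q.1 a) = Sum.inl (p, b) := by
    split_ifs
    · rw [transFun_inl]
    · rw [transFun_inl, reverse_inr]
  simp only [key]
  unfold decSymStep
  rcases (if q.2.1 = 0 then transFun M h₁ q.1 a else transFun M.reverse h₂ q.1 a) with ⟨p', b'⟩ | ⟨d, p'⟩
  · simp only [Sum.inl.injEq, Prod.mk.injEq]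
    constructor
    · rintro ⟨⟨rfl, rfl⟩, rfl⟩; simp
    · rintro ⟨rfl, rfl, rfl⟩; simp
  · simp

theorem decSymStep_inr {M : TMach Q₀ Γ} {h₁ : CompleteDet M} {h₂ : CompleteDet M.reverse} {q : DecQ Q₀} {a : Γ}
    {r : ℤ × DecQ Q₀} : decSymStep M h₁ h₂ q a = Sum.inr r ↔ r.2.2 = q.2 ∧
      (if q.2.1 = 0 then Sum.inl (q.1, r.1, r.2.1) ∈ M.Δ else Sum.inl (r.2.1, -r.1, q.1) ∈ M.Δ) := by
  obtain ⟨d, p, dg⟩ := r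
  have key : (if q.2.1 = 0 then Sum.inl (q.1, d, p) ∈ M.Δ else Sum.inl (p, -d, q.1) ∈ M.Δ) ↔
      (if q.2.1 = 0 then transFun M h₁ q.1 a else transFun M.reverse h₂ q.1 a) = Sum.inr (d, p) := by
    split_ifs
    · rw [transFun_inr]
    · rw [transFun_inr, ← reverse_inl, neg_neg]
  simp only [key]
  unfold decSymStep
  rcases (if q.2.1 = 0 then transFun M h₁ q.1 a else transFun M.reverse h₂ q.1 a) with ⟨p', b'⟩ | ⟨d', p'⟩
  · simp
  · simp only [Sum.inr.injEq, Prod.mk.injEq]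
    constructor
    · rintro ⟨rfl, rfl, rfl⟩; simp
    · rintro ⟨rfl, rfl, rfl⟩; simp

theorem dspec (M : TMach Q₀ Γ) (h₁ : CompleteDet M) (h₂ : CompleteDet M.reverse) :
    DSpec (decSymStep M h₁ h₂) where
  dir q a r h := by
    rw [decSymStep_inr] at h
    split_ifs at h
    · exact M.dir_mem _ _ _ h.2
    · have := M.dir_mem _ _ _ h.2
      omega
  stL q a r h := (decSymStep_inl.1 h).1
  stR q a r h := (decSymStep_inr.1 h).1
  ghL q a r g h := by
    rw [decSymStep_inl] at h ⊢
    exact ⟨by simp [h.1], h.2⟩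
  ghR q a r g h := by
    rw [decSymStep_inr] at h ⊢
    exact ⟨by simp [h.1], h.2⟩
  revL q a r h := by
    rw [decSymStep_inl] at h ⊢
    obtain ⟨h1, h2⟩ := h
    refine ⟨by simp [h1], ?_⟩
    rcases Fin.exists_fin_two.1 ⟨q.2.1, rfl⟩ with h3 | h3 <;> simp [h3, dk_apply, h1] at h2 ⊢ <;> exact h2
  revR q a r h b := by
    rw [decSymStep_inr] at h ⊢
    obtain ⟨h1, h2⟩ := h
    refine ⟨by simp [h1], ?_⟩
    rcases Fin.exists_fin_two.1 ⟨q.2.1, rfl⟩ with h3 | h3 <;> simp [h3, dk_apply, h1] at h2 ⊢ <;> exact h2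

end

section
variable {A B Q₀ Γ : Type} [DecidableEq A] [DecidableEq B] {δ : HeadStep (DecQ Q₀) Γ}

/-- Applying a function of ducks and ghosts to a machine state. -/
def pz (h : PP → PP) (z : (A → Γ) × ℤ × DecQ Q₀) : (A → Γ) × ℤ × DecQ Q₀ :=
  (z.1, z.2.1, (z.2.2.1, h z.2.2.2))

theorem gstep_dk (hδ : DSpec δ) (ad : ℤ → A) (z : (A → Γ) × ℤ × DecQ Q₀) :
    gstep δ ad (pz dk (gstep δ ad z)) = pz dk z := by
  obtain ⟨Λ, k, q⟩ := z
  rcases hr : δ q (Λ (ad k)) with r | r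
  · rw [gstep_inl hr, pz, gstep_inl (r := ((q.1, dk q.2), Λ (ad k))) (by simpa using hδ.revL _ _ _ hr)]
    simp [pz]
  · rw [gstep_inr hr, pz, gstep_inr (hδ.revR _ _ _ hr _)]
    simp [pz]

theorem run_dk (hδ : DSpec δ) (ad : ℤ → A) (n : ℕ) (z : (A → Γ) × ℤ × DecQ Q₀) :
    (gstep δ ad)^[n] (pz dk ((gstep δ ad)^[n] z)) = pz dk z := by
  induction n generalizing z with
  | zero => rfl
  | succ n ih => rw [Function.iterate_succ_apply, Function.iterate_succ_apply', gstep_dk hδ, ih]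

/-- The machine run followed by the duck swap. -/
def Jz (δ : HeadStep (DecQ Q₀) Γ) (ad : ℤ → A) (n : ℕ) (z : (A → Γ) × ℤ × DecQ Q₀) :
    (A → Γ) × ℤ × DecQ Q₀ := pz dk ((gstep δ ad)^[n] z)

theorem Jz_Jz (hδ : DSpec δ) (ad : ℤ → A) (n : ℕ) (z : (A → Γ) × ℤ × DecQ Q₀) :
    Jz δ ad n (Jz δ ad n z) = z := by
  rw [Jz, Jz, run_dk hδ]
  simp [pz, dk_dk]

theorem gstep_st (hδ : DSpec δ) (ad : ℤ → A) (z : (A → Γ) × ℤ × DecQ Q₀) :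
    (gstep δ ad z).2.2.2 = z.2.2.2 := by
  obtain ⟨Λ, k, q⟩ := z
  rcases hr : δ q (Λ (ad k)) with r | r
  · rw [gstep_inl hr]; exact hδ.stL q _ r hr
  · rw [gstep_inr hr]; exact hδ.stR q _ r hr

theorem run_st (hδ : DSpec δ) (ad : ℤ → A) (n : ℕ) (z : (A → Γ) × ℤ × DecQ Q₀) :
    ((gstep δ ad)^[n] z).2.2.2 = z.2.2.2 := by
  induction n generalizing z with
  | zero => rfl
  | succ n ih => rw [Function.iterate_succ_apply, ih, gstep_st hδ]

theorem Jz_st (hδ : DSpec δ) (ad : ℤ → A) (n : ℕ) (z : (A → Γ) × ℤ × DecQ Q₀) :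
    (Jz δ ad n z).2.2.2 = dk z.2.2.2 := by
  rw [Jz, pz, run_st hδ]

/-- A function of ghosts as a function of ducks and ghosts. -/
def gf (f : Bool × Fin 3 → Bool × Fin 3) (z : PP) : PP := (z.1, f z.2)

theorem gstep_gf (hδ : DSpec δ) (ad : ℤ → A) (f : Bool × Fin 3 → Bool × Fin 3) (z : (A → Γ) × ℤ × DecQ Q₀) :
    gstep δ ad (pz (gf f) z) = pz (gf f) (gstep δ ad z) := by
  obtain ⟨Λ, k, q⟩ := z
  rcases hr : δ q (Λ (ad k)) with r | r
  · rw [gstep_inl hr, pz, gstep_inl (q := (q.1, gf f q.2)) (hδ.ghL _ _ _ (f q.2.2) hr)]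
    simp [pz, gf, hδ.stL _ _ _ hr]
  · rw [gstep_inr hr, pz, gstep_inr (q := (q.1, gf f q.2)) (hδ.ghR _ _ _ (f q.2.2) hr)]
    simp [pz, gf, hδ.stR _ _ _ hr]

theorem run_gf (hδ : DSpec δ) (ad : ℤ → A) (f : Bool × Fin 3 → Bool × Fin 3) (n : ℕ)
    (z : (A → Γ) × ℤ × DecQ Q₀) :
    (gstep δ ad)^[n] (pz (gf f) z) = pz (gf f) ((gstep δ ad)^[n] z) := by
  induction n generalizing z with
  | zero => rfl
  | succ n ih => rw [Function.iterate_succ_apply, Function.iterate_succ_apply, gstep_gf hδ, ih]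

theorem Jz_gf (hδ : DSpec δ) (ad : ℤ → A) (f : Bool × Fin 3 → Bool × Fin 3) (n : ℕ)
    (z : (A → Γ) × ℤ × DecQ Q₀) : Jz δ ad n (pz (gf f) z) = pz (gf f) (Jz δ ad n z) := by
  rw [Jz, run_gf hδ]; rfl

/-- Renaming addresses. -/
def ez (e : A ≃ B) (c : ℤ) (h : PP → PP) (z : (A → Γ) × ℤ × DecQ Q₀) : (B → Γ) × ℤ × DecQ Q₀ :=
  (z.1 ∘ e.symm, z.2.1 + c, (z.2.2.1, h z.2.2.2))

theorem gstep_ez (hδ : DSpec δ) {ad : ℤ → A} {ad' : ℤ → B} {e : A ≃ B} {c : ℤ}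
    (he : ∀ k, ad' (k + c) = e (ad k)) (f : Bool × Fin 3 → Bool × Fin 3) (z : (A → Γ) × ℤ × DecQ Q₀) :
    gstep δ ad' (ez e c (gf f) z) = ez e c (gf f) (gstep δ ad z) := by
  obtain ⟨Λ, k, q⟩ := z
  rcases hr : δ q (Λ (ad k)) with r | r
  · rw [gstep_inl hr, ez, gstep_inl (by simpa [he, gf] using hδ.ghL _ _ _ (f q.2.2) hr)]
    simp only [ez, gf, hδ.stL _ _ _ hr, he]
    simp only [Prod.mk.injEq, and_true]
    funext x
    simp [Function.update_apply, Equiv.symm_apply_eq]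
  · rw [gstep_inr hr, ez, gstep_inr (by simpa [he, gf] using hδ.ghR _ _ _ (f q.2.2) hr)]
    simp [ez, gf, hδ.stR _ _ _ hr]
    ring

theorem Jz_ez (hδ : DSpec δ) {ad : ℤ → A} {ad' : ℤ → B} {e : A ≃ B} {c : ℤ}
    (he : ∀ k, ad' (k + c) = e (ad k)) (f : Bool × Fin 3 → Bool × Fin 3) (n : ℕ)
    (z : (A → Γ) × ℤ × DecQ Q₀) : Jz δ ad' n (ez e c (gf f) z) = ez e c (gf f) (Jz δ ad n z) := by
  have : (gstep δ ad')^[n] (ez e c (gf f) z) = ez e c (gf f) ((gstep δ ad)^[n] z) := by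
    induction n generalizing z with
    | zero => rfl
    | succ n ih => rw [Function.iterate_succ_apply, Function.iterate_succ_apply, gstep_ez hδ he, ih]
  rw [Jz, this]; rfl

/-- Runs depend only on the addresses of the window they visit. -/
theorem run_window {ad ad' : ℤ → A} {m : ℤ} (z : (A → Γ) × ℤ × DecQ Q₀) (n : ℕ)
    (hw : ∀ j, |j - z.2.1| ≤ m → ad j = ad' j)
    (hd : ∀ t < n, |((gstep δ ad)^[t] z).2.1 - z.2.1| ≤ m) :
    (gstep δ ad)^[n] z = (gstep δ ad')^[n] z := by
  induction n with
  | zero => rfl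
  | succ n ih =>
    have h1 := ih fun t ht => hd t (by omega)
    rw [Function.iterate_succ_apply', Function.iterate_succ_apply', ← h1]
    have h2 := hw _ (hd n (by omega))
    simp only [gstep, h2]

end

section
variable {Q Γ : Type}

/-- The bi-infinite tape of a machine state. -/
def line (z : (ℤ → Γ) × ℤ × Q) : ℤ → TSym Q Γ := fun i =>
  if i = z.2.1 then Sum.inr (z.2.2, z.1 i) else Sum.inl (z.1 i)

theorem line_amoh (z : (ℤ → Γ) × ℤ × Q) : AtMostOneHeadZ (line z) := by
  intro i j hi hj
  by_cases h1 : i = z.2.1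
  · by_cases h2 : j = z.2.1
    · rw [h1, h2]
    · simp [line, h2] at hj
  · simp [line, h1] at hi

theorem stepZ_line {δ : HeadStep Q Γ} (hδ : ∀ q a r, δ q a = Sum.inr r → r.1 = 1 ∨ r.1 = -1)
    (z : (ℤ → Γ) × ℤ × Q) : stepZ δ (line z) = line (gstep δ id z) := by
  obtain ⟨Λ, k, q⟩ := z
  funext t
  rcases hr : δ q (Λ k) with ⟨q', b⟩ | ⟨d, q'⟩
  · rw [gstep_inl (by simpa using hr)]
    have hno : ∀ u d, arrivesAs δ (line (Λ, k, q) u) d = none := by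
      intro u d
      by_cases hu : u = k
      · simp [line, hu, arrivesAs, hr]
      · simp [line, hu, arrivesAs]
    by_cases ht : t = k
    · simp [stepZ, line, ht, localStep, hr]
    · have h1 : line (Λ, k, q) t = Sum.inl (Λ t) := by simp [line, ht]
      simp only [stepZ, h1, localStep, hno]
      simp [line, ht]
  · rw [gstep_inr (by simpa using hr)]
    have hd := hδ _ _ _ hr
    have hno : ∀ u d', arrivesAs δ (line (Λ, k, q) u) d' =
        if u = k ∧ d = d' then some q' else none := by
      intro u d'
      by_cases hu : u = k
      · simp [line, hu, arrivesAs, hr]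
      · simp [line, hu, arrivesAs]
    by_cases ht : t = k
    · have h3 : ¬ d = 0 := by
        rcases hd with h | h <;> simp only at h <;> simp [h]
      simp [stepZ, line, ht, localStep, hr, h3]
    · have h1 : line (Λ, k, q) t = Sum.inl (Λ t) := by simp [line, ht]
      simp only [stepZ, h1, localStep, hno]
      rcases hd with h | h <;> simp only at h <;> subst h
      · by_cases h5 : t - 1 = k
        · have h6 : t = k + 1 := by omega
          simp [line, h6]
        · have h6 : ¬ t = k + 1 := by omega
          simp [line, h6, h5]
      · by_cases h5 : t + 1 = k
        · have h6 : t = k + (-1) := by omega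
          simp [line, h6]
        · have h6 : ¬ t = k + (-1) := by omega
          simp [line, h6, h5]

theorem stepZ_line_iterate {δ : HeadStep Q Γ} (hδ : ∀ q a r, δ q a = Sum.inr r → r.1 = 1 ∨ r.1 = -1)
    (n : ℕ) (z : (ℤ → Γ) × ℤ × Q) : (stepZ δ)^[n] (line z) = line ((gstep δ id)^[n] z) := by
  induction n generalizing z with
  | zero => rfl
  | succ n ih => rw [Function.iterate_succ_apply, Function.iterate_succ_apply, stepZ_line hδ, ih]

theorem exists_visit {f : ℕ → ℤ} (hf : ∀ t, |f (t + 1) - f t| ≤ 1) (n : ℕ) (i : ℤ)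
    (h1 : min (f 0) (f n) ≤ i) (h2 : i ≤ max (f 0) (f n)) : ∃ t ≤ n, f t = i := by
  induction n with
  | zero => exact ⟨0, le_rfl, by simp at h1 h2; omega⟩
  | succ n ih =>
    by_cases h3 : i = f (n + 1)
    · exact ⟨n + 1, le_rfl, h3.symm⟩
    · have := hf n
      rw [abs_le] at this
      obtain ⟨t, ht, h⟩ := ih (by omega) (by omega)
      exact ⟨t, by omega, h⟩

theorem gstep_move {A : Type} [DecidableEq A] {δ : HeadStep Q Γ}
    (hδ : ∀ q a r, δ q a = Sum.inr r → r.1 = 1 ∨ r.1 = -1) (ad : ℤ → A) (z : (A → Γ) × ℤ × Q) :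
    |(gstep δ ad z).2.1 - z.2.1| ≤ 1 := by
  obtain ⟨Λ, k, q⟩ := z
  rcases hr : δ q (Λ (ad k)) with r | r
  · rw [gstep_inl hr]; simp
  · rw [gstep_inr hr]
    rcases hδ _ _ _ hr with h | h <;> simp [h]

end

section
variable {Q₀ Γ : Type}

theorem transFun_dir {M : TMach Q₀ Γ} {h : CompleteDet M} (q : Q₀) (a : Γ) (r : ℤ × Q₀)
    (hr : transFun M h q a = Sum.inr r) : r.1 = 1 ∨ r.1 = -1 := M.dir_mem _ _ _ (transFun_inr.1 hr)

/-- The state of `y` is a copy of that of `z` on the window of radius `m` around `k₀`. -/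
def Coup (ad : ℤ → ℤ × Bool) (k₀ m : ℤ) (z : (ℤ × Bool → Γ) × ℤ × DecQ Q₀) (y : (ℤ → Γ) × ℤ × Q₀) : Prop :=
  z.2.2.2.1 = 0 ∧ y.2.1 = z.2.1 ∧ y.2.2 = z.2.2.1 ∧ ∀ j, |j - k₀| ≤ m → z.1 (ad j) = y.1 j

theorem Coup.step {M : TMach Q₀ Γ} {h₁ : CompleteDet M} {h₂ : CompleteDet M.reverse} {ad : ℤ → ℤ × Bool}
    {k₀ m : ℤ} (hi : ∀ j j', |j - k₀| ≤ m → |j' - k₀| ≤ m → ad j = ad j' → j = j')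
    {z : (ℤ × Bool → Γ) × ℤ × DecQ Q₀} {y : (ℤ → Γ) × ℤ × Q₀} (h : Coup ad k₀ m z y) (hz : |z.2.1 - k₀| ≤ m) :
    Coup ad k₀ m (gstep (decSymStep M h₁ h₂) ad z) (gstep (transFun M h₁) id y) := by
  obtain ⟨Λ, k, q⟩ := z
  obtain ⟨Λ', k', q'⟩ := y
  obtain ⟨a1, a2, a3, a4⟩ := h
  simp only at a1 a2 a3 a4 hz
  subst a2 a3
  have hk := a4 k' hz
  rcases hr : transFun M h₁ q.1 (Λ' k') with r | r
  · have e := gstep_inl (δ := transFun M h₁) (ad := id) (Λ := Λ') (k := k') (q := q.1) (r := r) (by simpa using hr)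
    have hr' : decSymStep M h₁ h₂ q (Λ (ad k')) = Sum.inl ((r.1, q.2), r.2) := by
      rw [decSymStep_inl]
      simp only [a1, if_true, true_and, hk]
      exact transFun_inl.1 hr
    rw [gstep_inl hr', e]
    refine ⟨a1, rfl, rfl, fun j hj => ?_⟩
    by_cases h : j = k'
    · simp [h]
    · have : ad j ≠ ad k' := fun hh => h (hi _ _ hj hz hh)
      simp [this, h, a4 j hj]
  · have e := gstep_inr (δ := transFun M h₁) (ad := id) (Λ := Λ') (k := k') (q := q.1) (r := r) (by simpa using hr)
    have hr' : decSymStep M h₁ h₂ q (Λ (ad k')) = Sum.inr (r.1, (r.2, q.2)) := by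
      rw [decSymStep_inr]
      simp only [a1, if_true, true_and]
      exact transFun_inr.1 hr
    rw [gstep_inr hr', e]
    exact ⟨a1, rfl, rfl, a4⟩

/-- Runs of length `n` on belts of length at least `m + 2` move the head by at most `m`. -/
def Disp (δ : HeadStep (DecQ Q₀) Γ) (n : ℕ) (m : ℤ) : Prop :=
  ∀ s L z, m + 2 ≤ L → ∀ t ≤ n, |((gstep δ (addr s L))^[t] z).2.1 - z.2.1| ≤ m

theorem disp_of_move {M : TMach Q₀ Γ} {h₁ : CompleteDet M} {h₂ : CompleteDet M.reverse} {n : ℕ} {m : ℤ}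
    (hm : 0 ≤ m)
    (hb : ∀ x : ℤ → TSym Q₀ Γ, AtMostOneHeadZ x → ∀ l r : ℤ,
        (∀ i : ℤ, l ≤ i → i ≤ r → ∃ t : ℕ, t ≤ n ∧ (((stepZ (transFun M h₁))^[t] x) i).isRight = true) →
        r - l ≤ m) : Disp (decSymStep M h₁ h₂) n m := by
  have hδ := dspec M h₁ h₂
  have key : ∀ (s L : ℤ) (z : (ℤ × Bool → Γ) × ℤ × DecQ Q₀), m + 2 ≤ L → z.2.2.2.1 = 0 → ∀ t ≤ n,
      |((gstep (decSymStep M h₁ h₂) (addr s L))^[t] z).2.1 - z.2.1| ≤ m := by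
    intro s L z hL hz t
    induction t using Nat.strong_induction_on with
    | _ t ih =>
      intro ht
      set y : (ℤ → Γ) × ℤ × Q₀ := (fun j => z.1 (addr s L j), z.2.1, z.2.2.1) with hy
      have hi : ∀ j j', |j - z.2.1| ≤ m → |j' - z.2.1| ≤ m → addr s L j = addr s L j' → j = j' := by
        intro j j' h1 h2 h
        have h3 := addr_inj (by omega) h
        rw [abs_le] at h1 h2
        rw [Int.emod_eq_emod_iff_emod_sub_eq_zero] at h3
        obtain ⟨c, hc⟩ := Int.dvd_of_emod_eq_zero h3
        have : c = 0 := by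
          by_contra hne
          rcases lt_or_gt_of_ne hne with h | h
          · nlinarith
          · nlinarith
        subst this
        omega
      have hc : ∀ t' ≤ t, Coup (addr s L) z.2.1 m ((gstep (decSymStep M h₁ h₂) (addr s L))^[t'] z)
          ((gstep (transFun M h₁) id)^[t'] y) := by
        intro t'
        induction t' with
        | zero => exact fun _ => ⟨hz, rfl, rfl, fun j _ => rfl⟩
        | succ t' ih' =>
          intro h
          rw [Function.iterate_succ_apply', Function.iterate_succ_apply']
          exact (ih' (by omega)).step hi (ih t' (by omega) (by omega))
      have hf : ∀ t', |((gstep (transFun M h₁) id)^[t' + 1] y).2.1 - ((gstep (transFun M h₁) id)^[t'] y).2.1| ≤ 1 := by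
        intro t'
        rw [Function.iterate_succ_apply']
        exact gstep_move transFun_dir _ _
      have h0 : ((gstep (transFun M h₁) id)^[0] y).2.1 = z.2.1 := rfl
      have h1 := (hc t le_rfl).2.1
      have h2 := hb (line y) (line_amoh _) (min z.2.1 ((gstep (transFun M h₁) id)^[t] y).2.1)
        (max z.2.1 ((gstep (transFun M h₁) id)^[t] y).2.1) (by
          intro i hi1 hi2
          obtain ⟨t', ht', h⟩ := exists_visit (f := fun t => ((gstep (transFun M h₁) id)^[t] y).2.1) hf t i hi1 hi2
          refine ⟨t', by omega, ?_⟩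
          rw [stepZ_line_iterate transFun_dir]
          simp [line, h])
      rw [h1] at h2
      rw [abs_le]
      omega
  intro s L z hL t ht
  rcases Fin.exists_fin_two.1 ⟨z.2.2.2.1, rfl⟩ with h | h
  · exact key s L z hL h t ht
  · have h1 := key s L (pz dk ((gstep (decSymStep M h₁ h₂) (addr s L))^[t] z)) hL
      (by simp [pz, run_st hδ, dk_apply, h]) t ht
    rw [run_dk hδ] at h1
    rw [abs_sub_comm]
    exact h1

variable {δ : HeadStep (DecQ Q₀) Γ}

theorem Disp.Jz {n : ℕ} {m : ℤ} (hd : Disp δ n m) {s L : ℤ} (z : (ℤ × Bool → Γ) × ℤ × DecQ Q₀)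
    (hL : m + 2 ≤ L) : |(Jz δ (addr s L) n z).2.1 - z.2.1| ≤ m := hd s L z hL n le_rfl

end
open scoped commutatorElement

section
variable {Q₀ Γ : Type} [DecidableEq Q₀] [Fintype Q₀]

/-- A machine state on a belt: letters, head position, head state. -/
abbrev St (Q₀ Γ : Type) : Type := (ℤ × Bool → Γ) × ℤ × DecQ Q₀

/-- `E` acts as `T` on belts of length `ω`. -/
def On (ω : ℤ) (E : Equiv.Perm (Cf Q₀ Γ)) (T : ℤ → St Q₀ Γ → St Q₀ Γ) : Prop :=
  ∀ s ε z, Val s ω ε → E (cz s ω ε z) = cz s ω ε (T s z)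

/-- `E` fixes the belts of length other than `ω`. -/
def Off (ω : ℤ) (E : Equiv.Perm (Cf Q₀ Γ)) : Prop :=
  ∀ s L ε z, L ≠ ω → Val s L ε → E (cz s L ε z) = cz s L ε z

/-- `E` preserves every belt. -/
def Keeps (E : Equiv.Perm (Cf Q₀ Γ)) : Prop :=
  ∀ s L ε z, Val s L ε → ∃ z', E (cz s L ε z) = cz s L ε z'

variable {ω : ℤ} {E E' : Equiv.Perm (Cf Q₀ Γ)} {T T' : ℤ → St Q₀ Γ → St Q₀ Γ}

theorem On.mul (h : On ω E T) (h' : On ω E' T') : On ω (E * E') (fun s z => T s (T' s z)) :=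
  fun s ε z hv => by rw [Equiv.Perm.mul_apply, h' s ε z hv, h s ε _ hv]

theorem On.inv (h : On ω E T) (hT : ∀ s z, T s (T' s z) = z) : On ω E⁻¹ T' :=
  fun s ε z hv => by rw [Equiv.Perm.inv_eq_iff_eq, h s ε _ hv, hT]

theorem On.congr (h : On ω E T) (hT : ∀ s z, T s z = T' s z) : On ω E T' :=
  fun s ε z hv => by rw [h s ε z hv, hT]

theorem Off.mul (h : Off ω E) (h' : Off ω E') : Off ω (E * E') :=
  fun s L ε z hL hv => by rw [Equiv.Perm.mul_apply, h' s L ε z hL hv, h s L ε _ hL hv]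

theorem Off.inv (h : Off ω E) : Off ω E⁻¹ :=
  fun s L ε z hL hv => by rw [Equiv.Perm.inv_eq_iff_eq, h s L ε _ hL hv]

theorem Off.conj (h : Off ω E) (hg : Keeps E') : Off ω (E'⁻¹ * E * E') := by
  intro s L ε z hL hv
  obtain ⟨z', hz⟩ := hg s L ε z hv
  rw [Equiv.Perm.mul_apply, Equiv.Perm.mul_apply, hz, h s L ε z' hL hv, ← hz, Equiv.Perm.inv_def,
    Equiv.symm_apply_apply]

theorem cz_gt (h : Equiv.Perm PP) (s L : ℤ) (ε : ℤ → Bool) (z : St Q₀ Γ) :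
    gt h (cz s L ε z) = cz s L ε (pz h z) := cfg_gt ..

theorem keeps_gt (h : Equiv.Perm PP) : Keeps (gt h : Equiv.Perm (Cf Q₀ Γ)) :=
  fun s L ε z _ => ⟨_, cz_gt ..⟩

theorem on_gt (h : Equiv.Perm PP) : On ω (gt h : Equiv.Perm (Cf Q₀ Γ)) (fun _ => pz h) :=
  fun s ε z _ => cz_gt ..

theorem Off.of_ctrl {χ : ℤ → ℤ → Prop} {h : Equiv.Perm PP} (hE : IsCtrl E (ctl χ h)) (hχ : ∀ L k, χ L k → L = ω) :
    Off ω E := by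
  intro s L ε z hL hv
  have := hE s L ε z.1 z.2.1 z.2.2 hv
  rw [ctl, if_neg fun h => hL (hχ _ _ h)] at this
  exact this

open Classical in
theorem On.of_ctrl {χ : ℤ → ℤ → Prop} {h : Equiv.Perm PP} (hE : IsCtrl E (ctl χ h)) :
    On ω E (fun _ z => if χ ω z.2.1 then pz h z else z) := by
  intro s ε z hv
  have := hE s ω ε z.1 z.2.1 z.2.2 hv
  rw [ctl] at this
  rw [cz, this]
  dsimp only
  split_ifs <;> rfl

/-- The permutation `π` runs the machine for `n` steps on belts of length `ω` with head of duck `0`. -/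
structure PiSpec (δ : HeadStep (DecQ Q₀) Γ) (n : ℕ) (ω : ℤ) (π : Equiv.Perm (Cf Q₀ Γ)) : Prop where
  keeps : Keeps π
  keeps_inv : Keeps π⁻¹
  on : On ω π (fun s z => if z.2.2.2.1 = 0 then (gstep δ (addr s ω))^[n] z else z)

theorem exists_piSpec {δ : HeadStep (DecQ Q₀) Γ} (hδ : DSpec δ) {n : ℕ} {L c : ℕ} (hL : 1 ≤ L)
    {π : Equiv.Perm (CConf (DecQ Q₀) Γ (2 * L))}
    (hπ : π ∈ Subgroup.closure (TMGens (DecQ Q₀) Γ (2 * L)))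
    (hw : ∀ w : CConf (DecQ Q₀) Γ (2 * L),
          ((∃ (i : ZMod (2 * L)) (q₀ : Q₀) (g : Bool × Fin 3) (a : Γ),
              w.1 i = Sum.inr ((q₀, (0 : Fin 2), g), a)) →
            (π w).1 = (stepC δ (2 * L))^[n] w.1) ∧
          ((∀ (i : ZMod (2 * L)) (q₀ : Q₀) (g : Bool × Fin 3) (a : Γ),
              w.1 i ≠ Sum.inr ((q₀, (0 : Fin 2), g), a)) → π w = w))
    (hc : wordNorm (TMGens (DecQ Q₀) Γ (2 * L)) π ≤ c) :
    ∃ B : Equiv.Perm (Cf Q₀ Γ), NB (BG Q₀ Γ) B c ∧ PiSpec δ n L B := by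
  obtain ⟨B, h1, h2, h3⟩ := exists_corr ((NB_wordNorm_of_mem_closure hπ).mono hc)
  refine ⟨B, h1, ⟨?_, ?_, ?_⟩⟩
  · intro s L ε z hv
    obtain ⟨z', h, _⟩ := h2 s L ε z hv
    exact ⟨z', h⟩
  · intro s L ε z hv
    obtain ⟨z', h, _⟩ := h3 s L ε z hv
    exact ⟨z', h⟩
  · intro s ε z hv
    have hL' : (1 : ℤ) ≤ L := by exact_mod_cast hL
    have hℓ : ((2 * L : ℕ) : ℤ) = 2 * (L : ℤ) := by push_cast; rfl
    obtain ⟨z', h, ho, hr⟩ := h2 s L ε z hv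
    have hr := hr hℓ
    rw [h]
    obtain ⟨w1, w2⟩ := hw ⟨ring s L (2 * L) z, ring_amoh z⟩
    rw [hr] at w1 w2
    dsimp only
    split_ifs with hz
    · refine cz_eq_of_ring hL' hℓ ?_ fun c hc => ?_
      · have e := w1 ⟨(z.2.1 : ZMod (2 * L)), z.2.2.1, z.2.2.2.2, z.1 (rad s L (2 * L) z.2.1), by
          obtain ⟨Λ, k, q, d, g⟩ := z
          simp only at hz
          subst hz
          simp [ring]⟩
        rw [stepC_ring_iterate hδ.dir hL' hℓ] at e
        exact e
      · rw [ho c hc, gstep_outside hL' n z c hc]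
    · refine cz_eq_of_ring hL' hℓ (congrArg Subtype.val (w2 fun i q₀ g a hi => hz ?_)) ho
      simp only [ring] at hi
      split_ifs at hi
      simp only [Sum.inr.injEq, Prod.mk.injEq] at hi
      rw [hi.1]

end

section
variable {Q₀ Γ : Type} [DecidableEq Q₀] [Fintype Q₀]
variable {ω : ℤ} {E E' : Equiv.Perm (Cf Q₀ Γ)} {T T' : ℤ → St Q₀ Γ → St Q₀ Γ}
variable {δ : HeadStep (DecQ Q₀) Γ} {n : ℕ} {π : Equiv.Perm (Cf Q₀ Γ)}

theorem pz_dk_dk (z : St Q₀ Γ) : pz dk (pz dk z) = z := by simp [pz, dk_dk]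

theorem run_eq (ad : ℤ → ℤ × Bool) (z : St Q₀ Γ) : (gstep δ ad)^[n] z = pz dk (Jz δ ad n z) := by
  rw [Jz, pz_dk_dk]

theorem duck_dk (z : St Q₀ Γ) : (pz dk z).2.2.2.1 = 0 ↔ ¬ z.2.2.2.1 = 0 := by
  have : ∀ u : PP, (dk u).1 = 0 ↔ ¬ u.1 = 0 := by decide
  exact this _

theorem duck_Jz (hδ : DSpec δ) (ad : ℤ → ℤ × Bool) (z : St Q₀ Γ) :
    (Jz δ ad n z).2.2.2.1 = 0 ↔ ¬ z.2.2.2.1 = 0 := by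
  have : ∀ u : PP, (dk u).1 = 0 ↔ ¬ u.1 = 0 := by decide
  rw [Jz_st hδ]
  exact this _

theorem PiSpec.on' (h : PiSpec δ n ω π) :
    On ω π (fun s z => if z.2.2.2.1 = 0 then pz dk (Jz δ (addr s ω) n z) else z) :=
  h.on.congr fun s z => by rw [run_eq]

theorem PiSpec.on_inv (hδ : DSpec δ) (h : PiSpec δ n ω π) :
    On ω π⁻¹ (fun s z => if z.2.2.2.1 = 0 then Jz δ (addr s ω) n (pz dk z) else z) := by
  refine h.on'.inv fun s z => ?_
  by_cases hz : z.2.2.2.1 = 0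
  · have h1 := (duck_Jz (n := n) hδ (addr s ω) (pz dk z)).2 (by rw [duck_dk]; simpa using hz)
    rw [if_pos hz, if_pos h1, Jz_Jz hδ, pz_dk_dk]
  · rw [if_neg hz, if_neg hz]

/-- The machine involution on belts of length `ω`. -/
theorem PiSpec.exists_J (hδ : DSpec δ) (h : PiSpec δ n ω π) {F : Set (Equiv.Perm (Cf Q₀ Γ))} {c c' : ℕ}
    (hc : NB F π c) (hσ : CB F (fun L _ => L = ω) c') :
    ∃ J, NB F J (c' + 2 * c) ∧ On ω J (fun s z => Jz δ (addr s ω) n z) ∧ Off ω J := by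
  obtain ⟨E, h1, h2⟩ := hσ dk dk_mem
  refine ⟨π⁻¹ * E * π, h1.conj' hc, (((h.on_inv hδ).mul (On.of_ctrl h2)).mul h.on').congr fun s z => ?_,
    (Off.of_ctrl h2 fun _ _ h => h).conj h.keeps⟩
  rw [if_pos rfl]
  have h1 := duck_Jz (n := n) hδ (addr s ω) z
  by_cases hz : z.2.2.2.1 = 0
  · rw [if_pos hz, pz_dk_dk, if_neg (by simpa [h1] using hz)]
  · rw [if_neg hz, if_pos ((duck_dk _).2 hz), pz_dk_dk]

/-! ### Conditional ghost permutations -/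

/-- The ghost permutation `f` on duck `0`. -/
def dg (f : Equiv.Perm (Bool × Fin 3)) : Equiv.Perm PP where
  toFun z := (z.1, if z.1 = 0 then f z.2 else z.2)
  invFun z := (z.1, if z.1 = 0 then f.symm z.2 else z.2)
  left_inv z := Prod.ext rfl (by by_cases h : z.1 = 0 <;> simp [h])
  right_inv z := Prod.ext rfl (by by_cases h : z.1 = 0 <;> simp [h])

open Classical in
/-- Apply the ghost permutation `f` to duck `0` if `P` holds. -/
noncomputable def gz (P : ℤ → St Q₀ Γ → Prop) (f : Equiv.Perm (Bool × Fin 3)) (s : ℤ) (z : St Q₀ Γ) : St Q₀ Γ :=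
  if z.2.2.2.1 = 0 ∧ P s z then pz (gf f) z else z

/-- The condition `P` does not depend on the ghost. -/
def GInv (P : ℤ → St Q₀ Γ → Prop) : Prop :=
  ∀ (f : Equiv.Perm (Bool × Fin 3)) s z, P s (pz (gf f) z) ↔ P s z

theorem gz_pos {P : ℤ → St Q₀ Γ → Prop} {f : Equiv.Perm (Bool × Fin 3)} {s : ℤ} {z : St Q₀ Γ}
    (h : z.2.2.2.1 = 0) (h' : P s z) : gz P f s z = pz (gf f) z := if_pos ⟨h, h'⟩

theorem gz_neg {P : ℤ → St Q₀ Γ → Prop} {f : Equiv.Perm (Bool × Fin 3)} {s : ℤ} {z : St Q₀ Γ}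
    (h : ¬ (z.2.2.2.1 = 0 ∧ P s z)) : gz P f s z = z := if_neg h

theorem gz_duck (P : ℤ → St Q₀ Γ → Prop) (f : Equiv.Perm (Bool × Fin 3)) (s : ℤ) (z : St Q₀ Γ) :
    (gz P f s z).2.2.2.1 = z.2.2.2.1 := by
  rw [gz]
  split_ifs <;> rfl

theorem pz_gf_mul (f g : Equiv.Perm (Bool × Fin 3)) (z : St Q₀ Γ) :
    pz (gf f) (pz (gf g) z) = pz (gf ⇑(f * g)) z := rfl

theorem pz_gf_one (z : St Q₀ Γ) : pz (gf ⇑(1 : Equiv.Perm (Bool × Fin 3))) z = z := rfl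

theorem On.gz_inv {P : ℤ → St Q₀ Γ → Prop} {f : Equiv.Perm (Bool × Fin 3)} (hP : GInv P)
    (h : On ω E (gz P f)) : On ω E⁻¹ (gz P f⁻¹) := by
  refine h.inv fun s z => ?_
  by_cases hz : z.2.2.2.1 = 0 ∧ P s z
  · rw [gz_pos (z := z) hz.1 hz.2, gz_pos (z := pz (gf ⇑f⁻¹) z) hz.1 ((hP ..).2 hz.2),
      pz_gf_mul, mul_inv_cancel, pz_gf_one]
  · rw [gz_neg (z := z) hz, gz_neg hz]

theorem On.gz_comm {P P' : ℤ → St Q₀ Γ → Prop} {f f' : Equiv.Perm (Bool × Fin 3)} (hP : GInv P)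
    (hP' : GInv P') (h : On ω E (gz P f)) (h' : On ω E' (gz P' f')) :
    On ω ⁅E, E'⁆ (gz (fun s z => P s z ∧ P' s z) ⁅f, f'⁆) := by
  refine (((h.mul h').mul (h.gz_inv hP)).mul (h'.gz_inv hP')).congr fun s z => ?_
  by_cases hz : z.2.2.2.1 = 0
  · have hd : ∀ (g : Equiv.Perm (Bool × Fin 3)), (pz (gf g) z).2.2.2.1 = 0 := fun _ => hz
    have p1 : P s z → ∀ f g : Equiv.Perm (Bool × Fin 3), gz P f s (pz (gf g) z) = pz (gf ⇑(f * g)) z :=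
      fun h f g => gz_pos (hd g) ((hP ..).2 h)
    have p2 : ¬ P s z → ∀ f g : Equiv.Perm (Bool × Fin 3), gz P f s (pz (gf g) z) = pz (gf g) z :=
      fun h f g => gz_neg fun hh => h ((hP ..).1 hh.2)
    have p1' : P' s z → ∀ f g : Equiv.Perm (Bool × Fin 3), gz P' f s (pz (gf g) z) = pz (gf ⇑(f * g)) z :=
      fun h f g => gz_pos (hd g) ((hP' ..).2 h)
    have p2' : ¬ P' s z → ∀ f g : Equiv.Perm (Bool × Fin 3), gz P' f s (pz (gf g) z) = pz (gf g) z :=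
      fun h f g => gz_neg fun hh => h ((hP' ..).1 hh.2)
    nth_rewrite 1 [← pz_gf_one z]
    by_cases h1 : P s z <;> by_cases h2 : P' s z
    · rw [p1' h2, p1 h1, p1' h2, p1 h1, gz_pos hz ⟨h1, h2⟩, commutatorElement_def, mul_one, mul_assoc, mul_assoc]
    · rw [p2' h2, p1 h1, p2' h2, p1 h1, gz_neg fun h => h2 h.2.2, mul_one, mul_inv_cancel, pz_gf_one]
    · rw [p1' h2, p2 h1, p1' h2, p2 h1, gz_neg fun h => h1 h.2.1, mul_one, mul_inv_cancel, pz_gf_one]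
    · rw [p2' h2, p2 h1, p2' h2, p2 h1, gz_neg fun h => h1 h.2.1, pz_gf_one]
  · rw [gz_neg (z := z) (f := f'⁻¹) fun h => hz h.1, gz_neg (z := z) (f := f⁻¹) fun h => hz h.1,
      gz_neg (z := z) (f := f') fun h => hz h.1, gz_neg (z := z) (f := f) fun h => hz h.1,
      gz_neg fun h => hz h.1]

theorem On.gz_of_ctrl {K : ℤ → Prop} {f : Equiv.Perm (Bool × Fin 3)}
    (hE : IsCtrl E (ctl (fun L k => L = ω ∧ K k) (dg f))) : On ω E (gz (fun _ z => K z.2.1) f) := by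
  refine (On.of_ctrl hE).congr fun s z => ?_
  by_cases h : K z.2.1
  · rw [if_pos ⟨rfl, h⟩]
    by_cases hz : z.2.2.2.1 = 0
    · rw [gz_pos hz h]
      simp [pz, dg, gf, hz]
    · rw [gz_neg fun h => hz h.1]
      have : dg f z.2.2.2 = z.2.2.2 := Prod.ext rfl (by simp [dg, hz])
      simp [pz, this]
  · rw [if_neg fun hh => h hh.2, gz_neg fun hh => h hh.2]

theorem PiSpec.gz_conj (hδ : DSpec δ) (h : PiSpec δ n ω π) {K : ℤ → Prop} {f : Equiv.Perm (Bool × Fin 3)}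
    (hE : On ω E (gz (fun _ z => K z.2.1) f)) :
    On ω (π * E * π⁻¹) (gz (fun s z => K (Jz δ (addr s ω) n (pz dk z)).2.1) f) := by
  refine ((h.on'.mul hE).mul (h.on_inv hδ)).congr fun s z => ?_
  simp only [gz_duck]
  by_cases hz : z.2.2.2.1 = 0
  · have h1 := (duck_Jz (n := n) hδ (addr s ω) (pz dk z)).2 (by rw [duck_dk]; simpa using hz)
    rw [if_pos hz, if_pos h1]
    by_cases hk : K (Jz δ (addr s ω) n (pz dk z)).2.1
    · rw [gz_pos h1 hk, gz_pos hz hk, Jz_gf hδ, Jz_Jz hδ]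
      have : ∀ u : PP, dk (gf f (dk u)) = gf f u := by
        intro u
        simp [dk_apply, gf]
      simp [pz, this]
    · rw [gz_neg fun h => hk h.2, gz_neg fun h => hk h.2, Jz_Jz hδ, pz_dk_dk]
  · rw [if_neg hz, gz_neg fun h => hz h.1, if_neg hz, gz_neg fun h => hz h.1]

/-- The three-cycle of ghosts used to realize the lane swap as a commutator. -/
def gAl : Equiv.Perm (Bool × Fin 3) := Equiv.swap (true, 1) (true, 2) * Equiv.swap (true, 2) (false, 1)

/-- The double transposition of ghosts used to realize the lane swap as a commutator. -/
def gBe : Equiv.Perm (Bool × Fin 3) := Equiv.swap (true, 1) (false, 2) * Equiv.swap (true, 2) (false, 1)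

/-- The lane swap `1 ↔ 2`. -/
def gSw : Equiv.Perm (Bool × Fin 3) := Equiv.swap (true, 1) (true, 2) * Equiv.swap (false, 1) (false, 2)

/-- The duck swap on lane `1`. -/
def dk1 : Equiv.Perm PP where
  toFun z := if z.2.2 = 1 then dk z else z
  invFun z := if z.2.2 = 1 then dk z else z
  left_inv := by decide
  right_inv := by decide

theorem comm_gAl_gBe : ⁅gAl, gBe⁆ = gSw := by decide

theorem dg_gAl_mem : dg gAl ∈ alternatingGroup PP := by
  rw [Equiv.Perm.mem_alternatingGroup]; decide

theorem dg_gBe_mem : dg gBe ∈ alternatingGroup PP := by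
  rw [Equiv.Perm.mem_alternatingGroup]; decide

open Classical in
/-- The machine involution on belts of length `ω`, lanes `1` and `2`, for the pairs whose duck-`0`
member has head position in `K₀` and whose duck-`1` member has head position in `K₁`. -/
noncomputable def JF (δ : HeadStep (DecQ Q₀) Γ) (n : ℕ) (ω : ℤ) (K₀ K₁ : ℤ → Prop) (s : ℤ) (z : St Q₀ Γ) : St Q₀ Γ :=
  if z.2.2.2.2.2 ≠ 0 ∧ ((z.2.2.2.1 = 0 ∧ K₀ z.2.1 ∧ K₁ (Jz δ (addr s ω) n z).2.1) ∨
    (¬ z.2.2.2.1 = 0 ∧ K₁ z.2.1 ∧ K₀ (Jz δ (addr s ω) n z).2.1)) then Jz δ (addr s ω) n z else z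

theorem PiSpec.exists_JF (hδ : DSpec δ) (h : PiSpec δ n ω π) {F : Set (Equiv.Perm (Cf Q₀ Γ))} (hF : BG Q₀ Γ ⊆ F)
    {c c₀ c₁ : ℕ} (hc : NB F π c) {K₀ K₁ : ℤ → Prop} (h₀ : CB F (fun L k => L = ω ∧ K₀ k) c₀)
    (h₁ : CB F (fun L k => L = ω ∧ K₁ k) c₁) :
    ∃ J, NB F J (8 * c₀ + 8 * c₁ + 18 * c + 6) ∧ On ω J (JF δ n ω K₀ K₁) ∧ Off ω J := by
  classical
  obtain ⟨A, a1, a2⟩ := h₁ _ dg_gAl_mem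
  obtain ⟨B, b1, b2⟩ := h₀ _ dg_gBe_mem
  have hA := On.gz_of_ctrl a2
  have hB := h.gz_conj hδ (On.gz_of_ctrl b2)
  have g1 : GInv (Q₀ := Q₀) (Γ := Γ) (fun _ z => K₁ z.2.1) := fun _ _ _ => Iff.rfl
  have g2 : GInv (Q₀ := Q₀) (Γ := Γ) (fun s z => K₀ (Jz δ (addr s ω) n (pz dk z)).2.1) := by
    intro f s z
    have : pz dk (pz (gf f) z) = pz (gf f) (pz dk z) := rfl
    beta_reduce
    rw [this, Jz_gf hδ]
    rfl
  have hE := hA.gz_comm g1 g2 hB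
  rw [comm_gAl_gBe] at hE
  set E₁ := ⁅A, π * B * π⁻¹⁆ with hE₁
  have oA : Off ω A := Off.of_ctrl a2 fun _ _ h => h.1
  have oB : Off ω (π * B * π⁻¹) := by
    have := (Off.of_ctrl b2 fun _ _ h => h.1 : Off ω B).conj h.keeps_inv
    rwa [inv_inv] at this
  have oE : Off ω E₁ := ((oA.mul oB).mul oA.inv).mul oB.inv
  set W := E₁ * ((gt dk)⁻¹ * E₁ * gt dk) with hW
  have oW : Off ω W := oE.mul (oE.conj (keeps_gt _))
  have idk : (gt dk : Equiv.Perm (Cf Q₀ Γ))⁻¹ = gt dk := by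
    rw [gt_inv]; exact congrArg gt (by decide)
  have idk1 : (gt dk1 : Equiv.Perm (Cf Q₀ Γ))⁻¹ = gt dk1 := by
    rw [gt_inv]; exact congrArg gt (by decide)
  set Z : ℤ → St Q₀ Γ → Prop := fun s z => K₁ z.2.1 ∧
    K₀ (Jz δ (addr s ω) n (if z.2.2.2.1 = 0 then pz dk z else z)).2.1 with hZ
  have onW : On ω W (fun s z => if Z s z then pz (gf gSw) z else z) := by
    rw [hW, idk]
    refine (hE.mul (((on_gt dk).mul hE).mul (on_gt dk))).congr fun s z => ?_
    have hdd := duck_dk z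
    by_cases hz : z.2.2.2.1 = 0
    · have h1 : ¬ (pz dk z).2.2.2.1 = 0 := by rw [hdd]; simpa using hz
      rw [gz_neg (z := pz dk z) fun h => h1 h.1, pz_dk_dk]
      simp only [gz, hz, true_and, if_true, hZ]
    · have h1 := hdd.2 hz
      have h2 : pz dk (pz (gf gSw) (pz dk z)) = pz (gf gSw) z := by
        have : ∀ u : PP, dk (gf gSw (dk u)) = gf gSw u := by decide
        simp [pz, this]
      have h3 : ¬ (pz (gf gSw) z).2.2.2.1 = 0 := hz
      have h5 : Z s z ↔ K₁ z.2.1 ∧ K₀ (Jz δ (addr s ω) n z).2.1 := by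
        simp only [hZ, hz, if_false]
      by_cases h4 : K₁ z.2.1 ∧ K₀ (Jz δ (addr s ω) n z).2.1
      · rw [gz_pos (z := pz dk z) h1 (by rw [pz_dk_dk]; exact h4), h2, gz_neg fun h => h3 h.1, if_pos (h5.2 h4)]
      · rw [gz_neg (z := pz dk z) (fun h => h4 (by have := h.2; rwa [pz_dk_dk] at this)), pz_dk_dk,
          gz_neg fun h => hz h.1, if_neg (mt h5.1 h4)]
  have Z1 : ∀ s z, Z s (pz (gf gSw) z) ↔ Z s z := by
    intro s z
    have h1 : (pz (gf gSw) z).2.2.2.1 = z.2.2.2.1 := rfl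
    simp only [hZ, h1]
    split_ifs
    · have : pz dk (pz (gf gSw) z) = pz (gf gSw) (pz dk z) := rfl
      rw [this, Jz_gf hδ]
      rfl
    · rw [Jz_gf hδ]
      rfl
  have Z2 : ∀ s z, Z s (pz dk z) ↔ Z s z := by
    intro s z
    have hdd := duck_dk z
    have h1 : (pz dk z).2.1 = z.2.1 := rfl
    simp only [hZ, h1]
    by_cases hz : z.2.2.2.1 = 0
    · rw [if_neg (by rw [hdd]; simpa using hz), if_pos hz]
    · rw [if_pos (hdd.2 hz), if_neg hz, pz_dk_dk]
  have Z3 : ∀ s z, Z s (pz dk1 z) ↔ Z s z := by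
    intro s z
    by_cases h : z.2.2.2.2.2 = 1
    · have : pz dk1 z = pz dk z := by simp [pz, dk1, h]
      rw [this, Z2]
    · have : pz dk1 z = z := by simp [pz, dk1, h]
      rw [this]
  set Y := W * ((gt dk1)⁻¹ * W * gt dk1) with hY
  have onY : On ω Y (fun s z => if Z s z ∧ z.2.2.2.2.2 ≠ 0 then pz dk z else z) := by
    rw [hY, idk1]
    refine (onW.mul (((on_gt dk1).mul onW).mul (on_gt dk1))).congr fun s z => ?_
    have c1 : ∀ u : PP, u.2.2 ≠ 0 → gf gSw (dk1 (gf gSw (dk1 u))) = dk u := by decide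
    have c2 : ∀ u : PP, ¬ u.2.2 ≠ 0 → gf gSw (dk1 (gf gSw (dk1 u))) = u := by decide
    have c3 : ∀ u : PP, dk1 (dk1 u) = u := by decide
    by_cases hz : Z s z
    · have h1 := (Z3 s z).2 hz
      have h2 := (Z1 s _).2 h1
      have h3 := (Z3 s _).2 h2
      simp only [h1, if_true, h3, hz, true_and]
      split_ifs with h4
      · simp [pz, c1 _ h4]
      · simp [pz, c2 _ h4]
    · have h1 := mt (Z3 s z).1 hz
      have h2 : pz dk1 (pz dk1 z) = z := by simp [pz, c3]
      simp only [h1, if_false, h2, hz, false_and]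
  have oY : Off ω Y := oW.mul (oW.conj (keeps_gt _))
  have nE : NB F E₁ (2 * c₁ + 2 * (c₀ + 2 * c)) := a1.comm (b1.conj hc)
  have nG : ∀ g, NB F (gt g) 1 := fun g => NB.of_mem (hF (BG_gt g))
  have nW := nE.mul (nE.conj' (nG dk))
  have nY := nW.mul (nW.conj' (nG dk1))
  refine ⟨π⁻¹ * Y * π, (nY.conj' hc).mono (by omega), (((h.on_inv hδ).mul onY).mul h.on').congr fun s z => ?_,
    oY.conj h.keeps⟩
  have h1 := duck_Jz (n := n) hδ (addr s ω) z
  have hl : ∀ u : PP, (dk u).2.2 = u.2.2 := by decide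
  by_cases hz : z.2.2.2.1 = 0
  · have h1' : ¬ (Jz δ (addr s ω) n z).2.2.2.1 = 0 := by rw [h1]; simpa using hz
    have h2 : (pz dk (Jz δ (addr s ω) n z)).2.2.2.1 = 0 := (duck_dk _).2 h1'
    have h3 : (pz dk (Jz δ (addr s ω) n z)).2.2.2.2.2 = z.2.2.2.2.2 := by
      show (dk (Jz δ (addr s ω) n z).2.2.2).2.2 = _
      rw [Jz_st hδ, hl, hl]
    have h4 : (pz dk (Jz δ (addr s ω) n z)).2.1 = (Jz δ (addr s ω) n z).2.1 := rfl
    have h5 : Z s (pz dk (Jz δ (addr s ω) n z)) ↔ K₁ (Jz δ (addr s ω) n z).2.1 ∧ K₀ z.2.1 := by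
      simp only [hZ, h2, if_true, h4, pz_dk_dk, Jz_Jz hδ]
    simp only [hz, if_true, JF, h5, h3]
    by_cases hc : (K₁ (Jz δ (addr s ω) n z).2.1 ∧ K₀ z.2.1) ∧ z.2.2.2.2.2 ≠ 0
    · rw [if_pos hc, pz_dk_dk, if_neg h1', if_pos (by tauto)]
    · rw [if_neg hc, if_pos h2, pz_dk_dk, Jz_Jz hδ, if_neg (by tauto)]
  · have h5 : Z s z ↔ K₁ z.2.1 ∧ K₀ (Jz δ (addr s ω) n z).2.1 := by
      simp only [hZ, hz, if_false]
    simp only [hz, if_false, JF, h5]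
    by_cases hc : (K₁ z.2.1 ∧ K₀ (Jz δ (addr s ω) n z).2.1) ∧ z.2.2.2.2.2 ≠ 0
    · rw [if_pos hc, if_pos ((duck_dk _).2 hz), pz_dk_dk, if_pos (by tauto)]
    · rw [if_neg hc, if_neg hz, if_neg (by tauto)]

end
open scoped commutatorElement

section
variable {Q₀ Γ : Type} [DecidableEq Q₀] [Fintype Q₀]
variable {δ : HeadStep (DecQ Q₀) Γ} {n : ℕ}

/-- The condition `P` on the end positions of a run, read in the direction given by the duck. -/
def Sel (δ : HeadStep (DecQ Q₀) Γ) (n : ℕ) (P : ℤ → ℤ → ℤ → Prop) (s L : ℤ) (z : St Q₀ Γ) : Prop :=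
  (z.2.2.2.1 = 0 ∧ P L z.2.1 (Jz δ (addr s L) n z).2.1) ∨
    (¬ z.2.2.2.1 = 0 ∧ P L (Jz δ (addr s L) n z).2.1 z.2.1)

theorem Sel_Jz (hδ : DSpec δ) (P : ℤ → ℤ → ℤ → Prop) (s L : ℤ) (z : St Q₀ Γ) :
    Sel δ n P s L (Jz δ (addr s L) n z) ↔ Sel δ n P s L z := by
  simp only [Sel, Jz_Jz hδ, duck_Jz hδ]
  tauto

theorem lane_Jz (hδ : DSpec δ) (ad : ℤ → ℤ × Bool) (z : St Q₀ Γ) :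
    (Jz δ ad n z).2.2.2.2.2 = z.2.2.2.2.2 := by rw [Jz_st hδ]; rfl

/-- On belts longer than `Lm`, `G` acts as the machine run on lane `0` when the end positions satisfy `P`, and
trivially on lane `2`. -/
structure Fam (δ : HeadStep (DecQ Q₀) Γ) (n : ℕ) (Lm : ℤ) (G : Equiv.Perm (Cf Q₀ Γ)) (P : ℤ → ℤ → ℤ → Prop) :
    Prop where
  pos : ∀ s L ε z, Lm < L → Val s L ε → z.2.2.2.2.2 = 0 → Sel δ n P s L z →
    G (cz s L ε z) = cz s L ε (Jz δ (addr s L) n z)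
  neg : ∀ s L ε z, Lm < L → Val s L ε → z.2.2.2.2.2 = 0 → ¬ Sel δ n P s L z → G (cz s L ε z) = cz s L ε z
  two : ∀ s L ε z, Lm < L → Val s L ε → z.2.2.2.2.2 = 2 → G (cz s L ε z) = cz s L ε z

variable {Lm : ℤ} {G G' : Equiv.Perm (Cf Q₀ Γ)} {P P' : ℤ → ℤ → ℤ → Prop}

theorem Fam.one : Fam δ n Lm (1 : Equiv.Perm (Cf Q₀ Γ)) (fun _ _ _ => False) where
  pos s L ε z _ _ _ h := by simp [Sel] at h
  neg s L ε z _ _ _ _ := rfl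
  two s L ε z _ _ _ := rfl

theorem Fam.mul (hδ : DSpec δ) (h : Fam δ n Lm G P) (h' : Fam δ n Lm G' P')
    (hd : ∀ L k k', Lm < L → P L k k' → P' L k k' → False) :
    Fam δ n Lm (G * G') (fun L k k' => P L k k' ∨ P' L k k') := by
  have hor : ∀ s L z, Sel δ n (fun L k k' => P L k k' ∨ P' L k k') s L z ↔ Sel δ n P s L z ∨ Sel δ n P' s L z := by
    intro s L z; simp only [Sel]; tauto
  refine ⟨fun s L ε z hL hv hz hs => ?_, fun s L ε z hL hv hz hs => ?_, fun s L ε z hL hv hz => ?_⟩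
  · rw [Equiv.Perm.mul_apply]
    by_cases h2 : Sel δ n P' s L z
    · rw [h'.pos s L ε z hL hv hz h2, h.neg s L ε _ hL hv (by rw [lane_Jz hδ, hz])]
      rw [Sel_Jz hδ]
      simp only [Sel] at h2 ⊢
      rintro (h1 | h1) <;> rcases h2 with h2 | h2
      · exact hd _ _ _ hL h1.2 h2.2
      · exact h2.1 h1.1
      · exact h1.1 h2.1
      · exact hd _ _ _ hL h1.2 h2.2
    · rw [h'.neg s L ε z hL hv hz h2, h.pos s L ε _ hL hv hz (((hor _ _ _).1 hs).resolve_right h2)]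
  · rw [hor, not_or] at hs
    rw [Equiv.Perm.mul_apply, h'.neg s L ε z hL hv hz hs.2, h.neg s L ε z hL hv hz hs.1]
  · rw [Equiv.Perm.mul_apply, h'.two s L ε z hL hv hz, h.two s L ε z hL hv hz]

theorem Fam.congr (h : Fam δ n Lm G P) (hP : ∀ s L z, Lm < L → (Sel δ n P s L z ↔ Sel δ n P' s L z)) :
    Fam δ n Lm G P' where
  pos s L ε z hL hv hz hs := h.pos s L ε z hL hv hz ((hP s L z hL).2 hs)
  neg s L ε z hL hv hz hs := h.neg s L ε z hL hv hz (fun h' => hs ((hP s L z hL).1 h'))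
  two := h.two

theorem Fam.finset (hδ : DSpec δ) {ι : Type*} [DecidableEq ι] (R : Finset ι) {F : Set (Equiv.Perm (Cf Q₀ Γ))}
    {H : Subgroup (Equiv.Perm (Cf Q₀ Γ))} {c : ℕ}
    {P : ι → ℤ → ℤ → ℤ → Prop} (h : ∀ r ∈ R, ∃ G, NB F G c ∧ G ∈ H ∧ Fam δ n Lm G (P r))
    (hd : ∀ r ∈ R, ∀ r' ∈ R, ∀ L k k', P r L k k' → P r' L k k' → r = r') :
    ∃ G, NB F G (R.card * c) ∧ G ∈ H ∧ Fam δ n Lm G (fun L k k' => ∃ r ∈ R, P r L k k') := by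
  induction R using Finset.induction_on with
  | empty => exact ⟨1, NB.one _, one_mem _, Fam.one.congr fun s L z _ => by simp [Sel]⟩
  | insert r R hr ih =>
    obtain ⟨G, h1, h2, h3⟩ := ih (fun r' hr' => h r' (Finset.mem_insert_of_mem hr'))
      fun r hr r' hr' => hd r (Finset.mem_insert_of_mem hr) r' (Finset.mem_insert_of_mem hr')
    obtain ⟨G', h1', h2', h3'⟩ := h r (Finset.mem_insert_self _ _)
    refine ⟨G' * G, (h1'.mul h1).mono ?_, mul_mem h2' h2, (h3'.mul hδ h3 ?_).congr fun s L z _ => ?_⟩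
    · rw [Finset.card_insert_of_notMem hr]; linarith
    · rintro L k k' _ a ⟨r', b, d⟩
      rw [hd r (Finset.mem_insert_self _ _) r' (Finset.mem_insert_of_mem b) _ _ _ a d] at hr
      exact hr b
    · simp only [Finset.exists_mem_insert]

/-- `E` acts as the machine run when the belt length and the state satisfy `χ`, and trivially otherwise. -/
structure Acts (δ : HeadStep (DecQ Q₀) Γ) (n : ℕ) (χ : ℤ → PP → Prop) (E : Equiv.Perm (Cf Q₀ Γ)) : Prop where
  pos : ∀ s L ε z, Val s L ε → χ L z.2.2.2 → E (cz s L ε z) = cz s L ε (Jz δ (addr s L) n z)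
  neg : ∀ s L ε z, Val s L ε → ¬ χ L z.2.2.2 → E (cz s L ε z) = cz s L ε z

variable {χ χ' : ℤ → PP → Prop} {E E' : Equiv.Perm (Cf Q₀ Γ)}

theorem Acts.mul (hδ : DSpec δ) (h : Acts δ n χ E) (h' : Acts δ n χ' E')
    (hd : ∀ L u, χ L (dk u) → χ' L u → False) :
    Acts δ n (fun L u => χ L u ∨ χ' L u) (E * E') := by
  refine ⟨fun s L ε z hv hz => ?_, fun s L ε z hv hz => ?_⟩
  · rw [Equiv.Perm.mul_apply]
    by_cases h2 : χ' L z.2.2.2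
    · rw [h'.pos s L ε z hv h2, h.neg s L ε _ hv]
      rw [Jz_st hδ]
      exact fun h1 => hd _ _ h1 h2
    · rw [h'.neg s L ε z hv h2, h.pos s L ε z hv (hz.resolve_right h2)]
  · rw [not_or] at hz
    rw [Equiv.Perm.mul_apply, h'.neg s L ε z hv hz.2, h.neg s L ε z hv hz.1]

theorem Acts.congr (h : Acts δ n χ E) (hχ : ∀ L u, 1 ≤ L → (χ L u ↔ χ' L u)) : Acts δ n χ' E where
  pos s L ε z hv hz := h.pos s L ε z hv ((hχ _ _ hv.one_le).2 hz)
  neg s L ε z hv hz := h.neg s L ε z hv fun h' => hz ((hχ _ _ hv.one_le).1 h')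

/-- A permutation of ghosts as a permutation of ducks and ghosts. -/
def gp (f : Equiv.Perm (Bool × Fin 3)) : Equiv.Perm PP := Equiv.prodCongr (Equiv.refl _) f

theorem gp_coe (f : Equiv.Perm (Bool × Fin 3)) : ⇑(gp f) = gf f := rfl

theorem gp_inv (f : Equiv.Perm (Bool × Fin 3)) : (gp f)⁻¹ = gp f⁻¹ := rfl

theorem Acts.conj (hδ : DSpec δ) (h : Acts δ n χ E) (f : Equiv.Perm (Bool × Fin 3)) :
    Acts δ n (fun L u => χ L (gp f u)) ((gt (gp f))⁻¹ * E * gt (gp f)) := by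
  refine ⟨fun s L ε z hv hz => ?_, fun s L ε z hv hz => ?_⟩
  · rw [Equiv.Perm.mul_apply, Equiv.Perm.mul_apply, cz_gt, h.pos s L ε _ hv hz, gt_inv, cz_gt, gp_coe, Jz_gf hδ,
      gp_inv, gp_coe, pz_gf_mul, inv_mul_cancel, pz_gf_one]
  · rw [Equiv.Perm.mul_apply, Equiv.Perm.mul_apply, cz_gt, h.neg s L ε _ hv hz, gt_inv, cz_gt, gp_coe,
      gp_inv, gp_coe, pz_gf_mul, inv_mul_cancel, pz_gf_one]

/-- The swap of the lanes `0` and `2` with sign `+`. -/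
def g02 : Equiv.Perm (Bool × Fin 3) := Equiv.swap (true, 0) (true, 2)

theorem gp_g02_mem : gp g02 ∈ alternatingGroup PP := by
  rw [Equiv.Perm.mem_alternatingGroup]; decide

theorem gp_g02_ne : ∀ u : PP, gp g02 u ≠ u ↔ u.2 = (true, 0) ∨ u.2 = (true, 2) := by decide

theorem Fam.acts (hδ : DSpec δ) (h : Fam δ n Lm G (fun _ _ _ => True)) (hG : G ∈ OHG Q₀ Γ)
    {V : Equiv.Perm (Cf Q₀ Γ)} (hV : IsCtrl V (ctl (fun L _ => Lm < L) (gp g02))) :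
    Acts δ n (fun L u => Lm < L ∧ (u.2 = (true, 0) ∨ u.2 = (true, 2))) ⁅G, V⁆ := by
  have hsel : ∀ s L z, Sel δ n (fun _ _ _ => True) s L z := fun s L z => by simp only [Sel, and_true]; exact em _
  have hVl : ∀ s L ε z, Val s L ε → Lm < L → V (cz s L ε z) = cz s L ε (pz (gf g02) z) := by
    intro s L ε z hv hL
    have := hV s L ε z.1 z.2.1 z.2.2 hv
    rw [ctl, if_pos hL] at this
    exact this
  have hVs : ∀ s L ε z, Val s L ε → ¬ Lm < L → V (cz s L ε z) = cz s L ε z := by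
    intro s L ε z hv hL
    have := hV s L ε z.1 z.2.1 z.2.2 hv
    rw [ctl, if_neg hL] at this
    exact this
  have hgg : ∀ z : St Q₀ Γ, pz (gf g02) (pz (gf g02) z) = z := fun z => by
    rw [pz_gf_mul, show g02 * g02 = 1 by decide, pz_gf_one]
  have hVi : ∀ s L ε z, Val s L ε → Lm < L → V⁻¹ (cz s L ε z) = cz s L ε (pz (gf g02) z) := by
    intro s L ε z hv hL
    rw [Equiv.Perm.inv_eq_iff_eq, hVl _ _ _ _ hv hL, hgg]
  have hlane : ∀ (u : PP), u.2 = (true, 0) → (gf g02 u).2 = (true, 2) := by decide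
  have hlane' : ∀ (u : PP), u.2 = (true, 2) → (gf g02 u).2 = (true, 0) := by decide
  have hVm : ∀ s L ε z, Val s L ε → (V (cz s L ε z) ≠ cz s L ε z ↔
      Lm < L ∧ (z.2.2.2.2 = (true, 0) ∨ z.2.2.2.2 = (true, 2))) := by
    intro s L ε z hv
    by_cases hL : Lm < L
    · rw [hVl _ _ _ _ hv hL, ← gp_g02_ne, and_iff_right hL, not_iff_not]
      constructor
      · intro h
        exact congrArg Prod.snd (cfg_q_inj h)
      · intro h
        have : pz (gf g02) z = z := by
          rw [← gp_coe]
          exact Prod.ext rfl (Prod.ext rfl (Prod.ext rfl h))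
        rw [this]
    · simp [hVs _ _ _ _ hv hL, hL]
  refine ⟨fun s L ε z hv hz => ?_, fun s L ε z hv hz => ?_⟩
  · obtain ⟨hL, hz⟩ := hz
    simp only [commutatorElement_def, Equiv.Perm.mul_apply]
    rw [hVi _ _ _ _ hv hL]
    rcases hz with hz | hz
    · have e : G⁻¹ (cz s L ε (pz (gf g02) z)) = cz s L ε (pz (gf g02) z) := by
        rw [Equiv.Perm.inv_eq_iff_eq, h.two _ _ _ _ hL hv]
        exact congrArg Prod.snd (hlane _ hz)
      rw [e, hVl _ _ _ _ hv hL, hgg, h.pos _ _ _ _ hL hv (congrArg Prod.snd hz) (hsel _ _ _)]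
    · have e : G⁻¹ (cz s L ε (pz (gf g02) z)) = cz s L ε (pz (gf g02) (Jz δ (addr s L) n z)) := by
        rw [Equiv.Perm.inv_eq_iff_eq, ← Jz_gf hδ, h.pos _ _ _ _ hL hv _ (hsel _ _ _), Jz_Jz hδ]
        rw [lane_Jz hδ]
        exact congrArg Prod.snd (hlane' _ hz)
      rw [e, hVl _ _ _ _ hv hL, hgg, h.two _ _ _ _ hL hv]
      rw [lane_Jz hδ]
      exact congrArg Prod.snd hz
  · have hy := (not_iff_not.2 (hVm s L ε z hv)).2 hz
    rw [not_not] at hy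
    obtain ⟨s', L', ε', Λ', k', q', hv', hw⟩ : OH (G⁻¹ (cz s L ε z)) :=
      ((inv_mem hG : G⁻¹ ∈ OHG Q₀ Γ) _).2 ⟨_, _, _, _, _, _, hv, rfl⟩
    have hw : G⁻¹ (cz s L ε z) = cz s' L' ε' (Λ', k', q') := hw
    have hw' : cz s L ε z = G (cz s' L' ε' (Λ', k', q')) := (Equiv.Perm.inv_eq_iff_eq).1 hw
    have key : V (cz s' L' ε' (Λ', k', q')) = cz s' L' ε' (Λ', k', q') := by
      by_contra hne
      have hne' := (hVm _ _ _ _ hv').1 hne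
      have : ∃ z', cz s L ε z = cz s' L' ε' z' ∧ z'.2.2.2.2 = q'.2.2 := by
        rcases hne'.2 with hq | hq
        · refine ⟨_, hw'.trans (h.pos _ _ _ _ hne'.1 hv' (congrArg Prod.snd hq) (hsel _ _ _)), ?_⟩
          rw [Jz_st hδ]; rfl
        · exact ⟨_, hw'.trans (h.two _ _ _ _ hne'.1 hv' (congrArg Prod.snd hq)), rfl⟩
      obtain ⟨z', e1, e2⟩ := this
      rw [e1] at hy
      refine (hVm s' L' ε' z' hv').2 ⟨hne'.1, ?_⟩ hy
      rw [e2]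
      exact hne'.2
    have hyi : V⁻¹ (cz s L ε z) = cz s L ε z := by rw [Equiv.Perm.inv_eq_iff_eq, hy]
    simp only [commutatorElement_def, Equiv.Perm.mul_apply]
    rw [hyi, hw, key, ← hw']

/-- The ghost swap carrying sign `-` to sign `+`. -/
def gsg : Equiv.Perm (Bool × Fin 3) := Equiv.prodCongr (Equiv.swap true false) (Equiv.refl _)

/-- A ghost permutation carrying lane `1` to the lanes `0` and `2` of sign `+`. -/
def gmid : Equiv.Perm (Bool × Fin 3) := Equiv.swap (true, 1) (true, 0) * Equiv.swap (false, 1) (true, 2)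

theorem gcover : ∀ u : PP, ((u.2 = (true, 0) ∨ u.2 = (true, 2)) ∨
    ((gp gsg u).2 = (true, 0) ∨ (gp gsg u).2 = (true, 2))) ∨
    ((gp gmid u).2 = (true, 0) ∨ (gp gmid u).2 = (true, 2)) := by decide

theorem Fam.exists_long (hδ : DSpec δ) {F : Set (Equiv.Perm (Cf Q₀ Γ))} (hF : BG Q₀ Γ ⊆ F) {c c' : ℕ}
    (h : Fam δ n Lm G (fun _ _ _ => True)) (hc : NB F G c) (hG : G ∈ OHG Q₀ Γ) (hV : CB F (fun L _ => Lm < L) c') :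
    ∃ J, NB F J (6 * c + 6 * c' + 4) ∧ Acts δ n (fun L _ => Lm < L) J := by
  obtain ⟨V, h1, h2⟩ := hV _ gp_g02_mem
  have hA := h.acts hδ hG h2
  have hg : ∀ f, NB F (gt (gp f)) 1 := fun f => NB.of_mem (hF (BG_gt _))
  refine ⟨⁅G, V⁆ * ((gt (gp gsg))⁻¹ * ⁅G, V⁆ * gt (gp gsg)) * ((gt (gp gmid))⁻¹ * ⁅G, V⁆ * gt (gp gmid)),
    ((((hc.comm h1).mul ((hc.comm h1).conj' (hg _)))).mul ((hc.comm h1).conj' (hg _))).mono (by omega),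
    (((hA.mul hδ (hA.conj hδ gsg) ?_).mul hδ (hA.conj hδ gmid) ?_).congr fun L u _ => ?_)⟩
  · have : ∀ u : PP, ((dk u).2 = (true, 0) ∨ (dk u).2 = (true, 2)) →
      ((gp gsg u).2 = (true, 0) ∨ (gp gsg u).2 = (true, 2)) → False := by decide
    exact fun L u h1 h2 => this u h1.2 h2.2
  · have : ∀ u : PP, (((dk u).2 = (true, 0) ∨ (dk u).2 = (true, 2)) ∨
        ((gp gsg (dk u)).2 = (true, 0) ∨ (gp gsg (dk u)).2 = (true, 2))) →
      ((gp gmid u).2 = (true, 0) ∨ (gp gmid u).2 = (true, 2)) → False := by decide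
    exact fun L u h1 h2 => this u (h1.imp And.right And.right) h2.2
  · have := gcover u
    tauto

end
open scoped commutatorElement

section
variable {Q₀ Γ : Type} [DecidableEq Q₀] [Fintype Q₀]
variable {δ : HeadStep (DecQ Q₀) Γ} {n : ℕ}

theorem kap_OHG {a b : Fin 3} (hab : a ≠ b) (Δ : Fin 2 → Bool) : kap a b Δ ∈ OHG Q₀ Γ :=
  mem_OHG_of
    (fun x hx => hx.of_hd ((kap_spec hab _).1.isLoc.fine x hx.fine) ((kap_spec hab _).1.hd_none hx.fine))
    (fun x hx => hx.of_hd ((kap_spec hab _).2.1.isLoc.fine x hx.fine) ((kap_spec hab _).2.1.hd_none hx.fine))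

theorem OHG_refl {g : Equiv.Perm (Cf Q₀ Γ)} (h : g ∈ OHG Q₀ Γ) : reflP * g * reflP⁻¹ ∈ OHG Q₀ Γ := by
  have hr : (reflP : Equiv.Perm (Cf Q₀ Γ)) ∈ OHG Q₀ Γ :=
    mem_OHG_of (fun x hx => hx.refl) fun x hx => by rw [reflP_inv]; exact hx.refl
  exact mul_mem (mul_mem hr h) (inv_mem hr)

theorem OHG_swap {g : Equiv.Perm (Cf Q₀ Γ)} (h : g ∈ OHG Q₀ Γ) : swapP * g * swapP⁻¹ ∈ OHG Q₀ Γ := by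
  have hs : ∀ x : Cf Q₀ Γ, OH x → OH (swapP x) := by
    rintro x ⟨s, L, ε, Λ, k, q, hv, rfl⟩
    rw [cfg_swap hv.one_le]
    exact ⟨_, _, _, _, _, _, hv, rfl⟩
  have hr : (swapP : Equiv.Perm (Cf Q₀ Γ)) ∈ OHG Q₀ Γ :=
    mem_OHG_of hs fun x hx => by rw [swapP_inv]; exact hs x hx
  exact mul_mem (mul_mem hr h) (inv_mem hr)

theorem kam_OHG {a b : Fin 3} (hab : a ≠ b) (Δ : Fin 2 → Bool) : kam a b Δ ∈ OHG Q₀ Γ :=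
  OHG_refl (kap_OHG hab Δ)

theorem IsCtrl.OHG {E : Equiv.Perm (Cf Q₀ Γ)} {f : ℤ → ℤ → Equiv.Perm PP} (h : IsCtrl E f) : E ∈ OHG Q₀ Γ := by
  refine mem_OHG_of ?_ ?_
  · rintro x ⟨s, L, ε, Λ, k, q, hv, rfl⟩
    exact ⟨_, _, _, _, _, _, hv, h _ _ _ _ _ _ hv⟩
  · rintro x ⟨s, L, ε, Λ, k, q, hv, rfl⟩
    exact ⟨_, _, _, _, _, _, hv, h.inv _ _ _ _ _ _ hv⟩

/-- The move of the heads of duck `1`. -/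
noncomputable def rhoD : Equiv.Perm (Cf Q₀ Γ) :=
  ((Finset.univ.filter fun q : DecQ Q₀ => ¬ q.2.1 = 0).toList.map fun q => (moveP q : Equiv.Perm (Cf Q₀ Γ))).prod

/-- The shift of the position for heads of duck `1`. -/
def dsh (d : ℤ) (q : DecQ Q₀) : ℤ := if q.2.1 = 0 then 0 else d

theorem cfg_rhoD {s L : ℤ} {ε : ℤ → Bool} (hv : Val s L ε) (Λ : ℤ × Bool → Γ) (k : ℤ) (q : DecQ Q₀) :
    rhoD (cfg s L ε Λ k q) = cfg s L ε Λ (k + dsh 1 q) q := by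
  rw [rhoD, cfg_moves hv Λ k q _ (Finset.nodup_toList _)]
  congr 1
  by_cases h : q.2.1 = 0 <;> simp [h, dsh]

theorem cfg_rhoD_zpow {s L : ℤ} {ε : ℤ → Bool} (hv : Val s L ε) (Λ : ℤ × Bool → Γ) (k j : ℤ) (q : DecQ Q₀) :
    (rhoD ^ j : Equiv.Perm (Cf Q₀ Γ)) (cfg s L ε Λ k q) = cfg s L ε Λ (k + dsh j q) q := by
  have e : ∀ i, dsh (i + 1) q = dsh 1 q + dsh i q := by
    intro i; simp only [dsh]; split_ifs <;> ring
  induction j using Int.induction_on generalizing k with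
  | zero => simp [dsh]
  | succ n ih => rw [zpow_add_one, Equiv.Perm.mul_apply, cfg_rhoD hv, ih, e, add_assoc]
  | pred n ih =>
    rw [zpow_sub_one, Equiv.Perm.mul_apply]
    have : (rhoD : Equiv.Perm (Cf Q₀ Γ))⁻¹ (cfg s L ε Λ k q) = cfg s L ε Λ (k - dsh 1 q) q := by
      rw [Equiv.Perm.inv_eq_iff_eq, cfg_rhoD hv]; congr 1; ring
    rw [this, ih]
    have e' := e (-(n : ℤ) - 1)
    rw [sub_add_cancel] at e'
    congr 1; omega

theorem rhoD_zpow_OHG (j : ℤ) : (rhoD ^ j : Equiv.Perm (Cf Q₀ Γ)) ∈ OHG Q₀ Γ := by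
  have : ∀ j : ℤ, ∀ x : Cf Q₀ Γ, OH x → OH ((rhoD ^ j : Equiv.Perm (Cf Q₀ Γ)) x) := by
    rintro j x ⟨s, L, ε, Λ, k, q, hv, rfl⟩
    exact ⟨_, _, _, _, _, _, hv, cfg_rhoD_zpow hv _ _ _ _⟩
  exact mem_OHG_of (this j) (by rw [← zpow_neg]; exact this _)

theorem rhoD_NB : ∃ c, ∀ j : ℤ, NB (LG Q₀ Γ) (rhoD ^ j) (j.natAbs * c) := by
  refine ⟨_, fun j => NB.zpow (NB.list_prod (c := 1) ?_) j⟩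
  intro g hg
  rw [List.mem_map] at hg
  obtain ⟨q, -, rfl⟩ := hg
  exact NB.of_mem (BG_LG (.inr (.inr (.inr (.inl ⟨q, rfl⟩)))))

/-- Change of the position and the lane of a machine state. -/
def tr (c : ℤ) (l : Fin 3) (z : St Q₀ Γ) : St Q₀ Γ := (z.1, z.2.1 + c, wl z.2.2 l)

theorem tr_lane (c : ℤ) (l : Fin 3) (z : St Q₀ Γ) : (tr c l z).2.2.2.2.2 = l := rfl
theorem Disp.Jz_tr {m : ℤ} (hδ : DSpec δ) (hd : Disp δ n m) {s L s' L' : ℤ} (hL : m + 2 ≤ L) (c : ℤ) (l : Fin 3)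
    (z : St Q₀ Γ) (hw : ∀ j, |j - z.2.1| ≤ m → addr s L j = addr s' L' (j + c)) :
    BD.Jz δ (addr s' L') n (tr c l z) = tr c l (BD.Jz δ (addr s L) n z) := by
  have h1 : BD.Jz δ (addr s L) n z = BD.Jz δ (fun j => addr s' L' (j + c)) n z := by
    rw [BD.Jz, BD.Jz, run_window z n hw fun t ht => hd s L z hL t ht.le]
  have h2 := Jz_ez hδ (e := Equiv.refl _) (ad := fun j => addr s' L' (j + c)) (ad' := addr s' L') (c := c)
    (fun k => rfl) (fun u => (u.1, l)) n z
  rw [h1]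
  exact h2

variable {ω Lm : ℤ} {J Φ : Equiv.Perm (Cf Q₀ Γ)} {K₀ K₁ : ℤ → Prop}

theorem JF_pos {s : ℤ} {z : St Q₀ Γ} (h : z.2.2.2.2.2 ≠ 0) (h' : Sel δ n (fun _ k k' => K₀ k ∧ K₁ k') s ω z) :
    JF δ n ω K₀ K₁ s z = Jz δ (addr s ω) n z := by
  refine if_pos ⟨h, h'.imp id ?_⟩
  rintro ⟨h1, h2, h3⟩
  exact ⟨h1, h3, h2⟩

theorem JF_neg {s : ℤ} {z : St Q₀ Γ} (h : z.2.2.2.2.2 = 0 ∨ ¬ Sel δ n (fun _ k k' => K₀ k ∧ K₁ k') s ω z) :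
    JF δ n ω K₀ K₁ s z = z := by
  refine if_neg ?_
  rintro ⟨h1, h2⟩
  refine (h.resolve_left h1) (h2.imp id ?_)
  rintro ⟨h1, h2, h3⟩
  exact ⟨h1, h3, h2⟩

theorem JF_OHG (hδ : DSpec δ) (h : On ω J (JF δ n ω K₀ K₁)) (h' : Off ω J) : J ∈ OHG Q₀ Γ := by
  have hJ : ∀ s z, JF δ n ω K₀ K₁ s (JF δ n ω K₀ K₁ s z) = z := by
    intro s z
    by_cases hz : z.2.2.2.2.2 = 0 ∨ ¬ Sel δ n (fun _ k k' => K₀ k ∧ K₁ k') s ω z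
    · rw [JF_neg hz, JF_neg hz]
    · push Not at hz
      rw [JF_pos hz.1 hz.2, JF_pos _ ((Sel_Jz hδ _ _ _ _).2 hz.2), Jz_Jz hδ]
      rw [lane_Jz hδ]; exact hz.1
  have hi := h.inv hJ
  refine mem_OHG_of ?_ ?_
  · rintro x ⟨s, L, ε, Λ, k, q, hv, rfl⟩
    by_cases hL : L = ω
    · subst hL
      exact ⟨_, _, _, _, _, _, hv, h s ε (Λ, k, q) hv⟩
    · exact ⟨_, _, _, _, _, _, hv, h' s L ε (Λ, k, q) hL hv⟩
  · rintro x ⟨s, L, ε, Λ, k, q, hv, rfl⟩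
    by_cases hL : L = ω
    · subst hL
      exact ⟨_, _, _, _, _, _, hv, hi s ε (Λ, k, q) hv⟩
    · exact ⟨_, _, _, _, _, _, hv, h'.inv s L ε (Λ, k, q) hL hv⟩

theorem Fam.of_enter (hδ : DSpec δ) (hω : ω ≤ Lm) (h : On ω J (JF δ n ω K₀ K₁)) (h' : Off ω J)
    {P : ℤ → ℤ → ℤ → Prop}
    (hpos : ∀ s L ε z, Lm < L → Val s L ε → z.2.2.2.2.2 = 0 → z.2.2.2.1 = 0 → Sel δ n P s L z →
      ∃ σ η z₁, Val σ ω η ∧ z₁.2.2.2.2.2 ≠ 0 ∧ Sel δ n (fun _ k k' => K₀ k ∧ K₁ k') σ ω z₁ ∧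
        Φ (cz s L ε z) = cz σ ω η z₁ ∧
        Φ (cz s L ε (Jz δ (addr s L) n z)) = cz σ ω η (Jz δ (addr σ ω) n z₁))
    (hneg : ∀ s L ε z, Lm < L → Val s L ε → z.2.2.2.2.2 = 0 → ¬ Sel δ n P s L z →
      Φ (cz s L ε z) = cz s L ε z ∨ ∃ σ η z₁, Val σ ω η ∧
        ¬ Sel δ n (fun _ k k' => K₀ k ∧ K₁ k') σ ω z₁ ∧ Φ (cz s L ε z) = cz σ ω η z₁)
    (htwo : ∀ s L ε z, Lm < L → Val s L ε → z.2.2.2.2.2 = 2 →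
      Φ (cz s L ε z) = cz s L ε z ∨ ∃ s' L' ε' z', Val s' L' ε' ∧ z'.2.2.2.2.2 = 0 ∧
        Φ (cz s L ε z) = cz s' L' ε' z') :
    Fam δ n Lm (Φ⁻¹ * J * Φ) P := by
  have hfix : ∀ s L ε z, Lm < L → Val s L ε → Φ (cz s L ε z) = cz s L ε z → (Φ⁻¹ * J * Φ) (cz s L ε z) = cz s L ε z := by
    intro s L ε z hL hv e
    rw [Equiv.Perm.mul_apply, Equiv.Perm.mul_apply, e, h' s L ε z (by omega) hv, Equiv.Perm.inv_eq_iff_eq, e]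
  have hfix' : ∀ x y, Φ x = y → J y = y → (Φ⁻¹ * J * Φ) x = x := by
    intro x y e e'
    rw [Equiv.Perm.mul_apply, Equiv.Perm.mul_apply, e, e', Equiv.Perm.inv_eq_iff_eq, e]
  refine ⟨fun s L ε z hL hv hz hs => ?_, fun s L ε z hL hv hz hs => ?_, fun s L ε z hL hv hz => ?_⟩
  · have key : ∃ σ η z₁, Val σ ω η ∧ z₁.2.2.2.2.2 ≠ 0 ∧ Sel δ n (fun _ k k' => K₀ k ∧ K₁ k') σ ω z₁ ∧
        Φ (cz s L ε z) = cz σ ω η z₁ ∧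
        Φ (cz s L ε (Jz δ (addr s L) n z)) = cz σ ω η (Jz δ (addr σ ω) n z₁) := by
      by_cases hk : z.2.2.2.1 = 0
      · exact hpos s L ε z hL hv hz hk hs
      · obtain ⟨σ, η, z₁, a1, a2, a3, a4, a5⟩ := hpos s L ε (Jz δ (addr s L) n z) hL hv
          (by rw [lane_Jz hδ, hz]) ((duck_Jz hδ _ _).2 hk) ((Sel_Jz hδ _ _ _ _).2 hs)
        rw [Jz_Jz hδ] at a5
        refine ⟨σ, η, _, a1, ?_, (Sel_Jz hδ _ _ _ _).2 a3, a5, ?_⟩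
        · rwa [lane_Jz hδ]
        · rw [Jz_Jz hδ]; exact a4
    obtain ⟨σ, η, z₁, a1, a2, a3, a4, a5⟩ := key
    rw [Equiv.Perm.mul_apply, Equiv.Perm.mul_apply, a4, h σ η z₁ a1, JF_pos a2 a3, Equiv.Perm.inv_eq_iff_eq, a5]
  · rcases hneg s L ε z hL hv hz hs with e | ⟨σ, η, z₁, a1, a2, a3⟩
    · exact hfix s L ε z hL hv e
    · exact hfix' _ _ a3 (by rw [h σ η z₁ a1, JF_neg (.inr a2)])
  · rcases htwo s L ε z hL hv hz with e | ⟨s', L', ε', z', a1, a2, a3⟩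
    · exact hfix s L ε z hL hv e
    · refine hfix' _ _ a3 ?_
      by_cases hL' : L' = ω
      · subst hL'
        rw [h s' ε' z' a1, JF_neg (.inl a2)]
      · exact h' s' L' ε' z' hL' a1

end
open scoped commutatorElement

section
variable {Q₀ Γ : Type} [DecidableEq Q₀] [Fintype Q₀]
variable {δ : HeadStep (DecQ Q₀) Γ} {n : ℕ}

/-- Both ducks. -/
abbrev dT : Fin 2 → Bool := fun _ => true

/-- Cutting the window of radius `a` around a head in lane `1`. -/
noncomputable def psiD (Q₀ Γ : Type) [DecidableEq Q₀] [Fintype Q₀] (a : ℤ) : Equiv.Perm (Cf Q₀ Γ) :=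
  (rhoP ^ a * kam 2 1 dT * (rhoP ^ a)⁻¹) * ((rhoP ^ a)⁻¹ * kap 1 2 dT * rhoP ^ a)

theorem psiD_lane0 (a : ℤ) {s L : ℤ} {ε : ℤ → Bool} (hv : Val s L ε) (Λ : ℤ × Bool → Γ) (k : ℤ) {q : DecQ Q₀}
    (hq : q.2.2.2 = 0) : psiD Q₀ Γ a (cfg s L ε Λ k q) = cfg s L ε Λ k q := by
  simp only [psiD, Equiv.Perm.mul_apply, ← zpow_neg]
  rw [cfg_rho_zpow hv, kap_fix (by decide) hv Λ (by rw [hq]; exact fun _ _ => ⟨fun h => by simp at h, fun h => by simp at h⟩),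
    cfg_rho_zpow hv, cfg_rho_zpow hv,
    kam_fix (by decide) hv Λ (by rw [hq]; exact fun _ _ => ⟨fun h => by simp at h, fun h => by simp at h⟩),
    cfg_rho_zpow hv]
  congr 1; ring

theorem psiD_val {a : ℤ} (ha : 0 ≤ a) {s L : ℤ} {ε : ℤ → Bool} (hv : Val s L ε) {k : ℤ}
    (h0 : a + 3 ≤ k) (h1 : k < L - (a + 3)) :
    Val (s + (k - a)) (2 * a + 1) (cutL s (k - a) (cutR s L (k + a) ε)) := by
  have := (hv.cutR (k := k + a) (by omega) (by omega)).cutL (k := k - a) (by omega) (by omega)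
  rwa [show k + a + 1 - (k - a) = 2 * a + 1 by ring] at this

theorem psiD_act {a : ℤ} (ha : 0 ≤ a) {s L : ℤ} {ε : ℤ → Bool} (hv : Val s L ε) (Λ : ℤ × Bool → Γ) {k : ℤ} (q : DecQ Q₀)
    (h0 : a + 3 ≤ k) (h1 : k < L - (a + 3)) : psiD Q₀ Γ a (cfg s L ε Λ k (wl q 1)) =
      cfg (s + (k - a)) (2 * a + 1) (cutL s (k - a) (cutR s L (k + a) ε)) Λ a (wl q 1) := by
  have hv' := hv.cutR (k := k + a) (by omega) (by omega)
  simp only [psiD, Equiv.Perm.mul_apply, ← zpow_neg]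
  rw [cfg_rho_zpow hv, kap_act (a := 1) (b := 2) (Δ := dT) (q := wl q 1) (by decide) hv Λ (by omega) (by omega) rfl rfl, cfg_rho_zpow hv',
    cfg_rho_zpow hv', show k + a + -a + -a = k - a by ring,
    kam_act (a := 2) (b := 1) (Δ := dT) (q := ((wl q 1).1, (wl q 1).2.1, (wl q 1).2.2.1, 2)) (by decide) hv' Λ (by omega) (by omega) rfl rfl, show k + a + 1 - (k - a) = 2 * a + 1 by ring,
    cfg_rho_zpow (psiD_val ha hv h0 h1), zero_add]
  rfl

theorem rhoP_zpow_OHG (j : ℤ) : (rhoP ^ j : Equiv.Perm (Cf Q₀ Γ)) ∈ OHG Q₀ Γ := zpow_mem rhoP_OHG j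

theorem psiD_OHG (a : ℤ) : psiD Q₀ Γ a ∈ OHG Q₀ Γ :=
  have h := rhoP_zpow_OHG (Q₀ := Q₀) (Γ := Γ) a
  mul_mem (mul_mem (mul_mem h (kam_OHG (by decide) _)) (inv_mem h))
    (mul_mem (mul_mem (inv_mem h) (kap_OHG (by decide) _)) h)

theorem psiD_NB (a : ℤ) : NB (LG Q₀ Γ) (psiD Q₀ Γ a) (4 * a.natAbs + 2) :=
  (((NB.of_mem (kam_LG (by decide) _)).conj (NB_rho BG_LG a)).mul
    ((NB.of_mem (kap_LG (by decide) _)).conj' (NB_rho BG_LG a))).mono (by omega)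

/-- The head is on the top track at distance more than `h` from the ends. -/
def Deep (h L k : ℤ) : Prop := Top L k ∧ Top L (k - -h) ∧ Top L (k - h)

theorem CB.deep {F : Set (Equiv.Perm (Cf Q₀ Γ))} (hF : BG Q₀ Γ ⊆ F) :
    ∃ c, ∀ h : ℤ, CB F (Deep h) (c * (h.natAbs + 1)) := by
  have ht : ∀ j : ℤ, C1 F (fun L k => Top L (k - j)) dbl (1 + 2 * j.natAbs) :=
    fun j => (CB.top hF).shift hF j dbl dbl_mem
  refine ⟨Atri * (2 * (Atri * 10) + 10), fun h => ?_⟩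
  refine ((((CB.top hF).and hF (ht (-h))).and hF (ht h)).congr fun L k _ => ?_).mono ?_
  · rw [Deep, and_assoc]
  · rw [Int.natAbs_neg]
    nlinarith [Nat.zero_le (Atri * Atri * h.natAbs), Nat.zero_le (Atri * Atri), Nat.zero_le (Atri * h.natAbs)]

theorem Deep_iff {h L : ℤ} (h0 : 0 ≤ h) (hL : 2 * h ≤ L) (hL1 : 1 ≤ L) (k : ℤ) :
    Deep h L k ↔ h ≤ k % (2 * L) ∧ k % (2 * L) < L - h := by
  have h1 := Int.emod_nonneg k (show 2 * L ≠ 0 by omega)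
  have h2 := Int.emod_lt_of_pos k (show 0 < 2 * L by omega)
  have e1 : (k - -h) % (2 * L) = (k % (2 * L) - -h) % (2 * L) := by simp
  have e2 : (k - h) % (2 * L) = (k % (2 * L) - h) % (2 * L) := by simp
  simp only [Deep, Top, e1, e2]
  generalize k % (2 * L) = r at *
  by_cases c1 : r < L
  · rw [Int.emod_eq_of_lt (a := r - -h) (by omega) (by omega)]
    by_cases c2 : h ≤ r
    · rw [Int.emod_eq_of_lt (a := r - h) (by omega) (by omega)]
      omega
    · rw [show (r - h) % (2 * L) = r - h + 2 * L by
        rw [← Int.add_emod_right, Int.emod_eq_of_lt (by omega) (by omega)]]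
      omega
  · omega

theorem lsw01_lane0 : ∀ z : PP, z.2.2 = 0 → lsw 0 1 dT z = (z.1, z.2.1, 1) := by decide
theorem lsw01_ne : ∀ z : PP, z.2.2 ≠ 0 → lsw 0 1 dT z = z ∨ (lsw 0 1 dT z).2.2 = 0 := by decide

/-- Conjugating a controlled lane swap by a permutation which fixes lane `0` sends lane `2` to itself or to lane `0`. -/
theorem conj_two {Ψ C : Equiv.Perm (Cf Q₀ Γ)} {χ : ℤ → ℤ → Prop} (hC : IsCtrl C (ctl χ (lsw 0 1 dT)))
    (hΨ : Ψ ∈ OHG Q₀ Γ)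
    (h0 : ∀ s L ε z, Val s L ε → z.2.2.2.2.2 = 0 → Ψ (cz s L ε z) = cz s L ε z)
    {s L : ℤ} {ε : ℤ → Bool} {z : St Q₀ Γ} (hv : Val s L ε) (hz : z.2.2.2.2.2 = 2) :
    (Ψ * C * Ψ⁻¹) (cz s L ε z) = cz s L ε z ∨ ∃ s' L' ε' z', Val s' L' ε' ∧ z'.2.2.2.2.2 = 0 ∧
        (Ψ * C * Ψ⁻¹) (cz s L ε z) = cz s' L' ε' z' := by
  obtain ⟨s', L', ε', Λ', k', q', hv', hw⟩ : OH (Ψ⁻¹ (cz s L ε z)) :=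
      ((inv_mem hΨ : Ψ⁻¹ ∈ OHG Q₀ Γ) _).2 ⟨_, _, _, _, _, _, hv, rfl⟩
  have hw : Ψ⁻¹ (cz s L ε z) = cz s' L' ε' (Λ', k', q') := hw
  have hw' : cz s L ε z = Ψ (cz s' L' ε' (Λ', k', q')) := (Equiv.Perm.inv_eq_iff_eq).1 hw
  have hq : q'.2.2.2 ≠ 0 := by
    intro hq
    rw [h0 _ _ _ _ hv' hq] at hw'
    have e : gt dbl (cz s L ε z) = cz s L ε z := by
      rw [cz_gt]
      congr 1
      exact Prod.ext rfl (Prod.ext rfl (Prod.ext rfl (dbl_lane _ (by rw [hz]; decide))))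
    rw [hw', cz_gt] at e
    exact dbl_lane0 _ hq (congrArg Prod.snd (cfg_q_inj e))
  have hc := hC s' L' ε' Λ' k' q' hv'
  rw [Equiv.Perm.mul_apply, Equiv.Perm.mul_apply, hw]
  rw [ctl] at hc
  have hid : C (cfg s' L' ε' Λ' k' q') = cfg s' L' ε' Λ' k' q' →
      Ψ (C (cz s' L' ε' (Λ', k', q'))) = cz s L ε z := fun h => by
    rw [hw']; exact congrArg Ψ h
  by_cases hχ : χ L' k'
  · rw [if_pos hχ] at hc
    rcases lsw01_ne _ hq with e | e
    · rw [e] at hc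
      exact .inl (hid hc)
    · right
      refine ⟨s', L', ε', (Λ', k', (q'.1, lsw 0 1 dT q'.2)), hv', e, ?_⟩
      rw [cz, hc]
      exact h0 s' L' ε' (Λ', k', (q'.1, lsw 0 1 dT q'.2)) hv' e
  · rw [if_neg hχ] at hc
    exact .inl (hid hc)

/-- The entrance to the window of radius `a`. -/
theorem exists_enterD : ∃ c, ∀ a : ℕ, ∃ Φ : Equiv.Perm (Cf Q₀ Γ), NB (LG Q₀ Γ) Φ (c * (a + 1)) ∧ Φ ∈ OHG Q₀ Γ ∧
    (∀ s L ε Λ k q, Val s L ε → 2 * (a + 3) ≤ L → q.2.2.2 = 0 →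
      (k % (2 * L) < a + 3 ∨ L - (a + 3) ≤ k % (2 * L)) → Φ (cfg s L ε Λ k q) = cfg s L ε Λ k q) ∧
    (∀ s L ε Λ k q, Val s L ε → 2 * (a + 3) ≤ L → q.2.2.2 = 0 → a + 3 ≤ k % (2 * L) → k % (2 * L) < L - (a + 3) →
      Φ (cfg s L ε Λ k q) = cfg (s + (k % (2 * L) - a)) (2 * a + 1)
        (cutL s (k % (2 * L) - a) (cutR s L (k % (2 * L) + a) ε)) Λ a (wl q 1)) ∧
    (∀ s L ε z, Val s L ε → z.2.2.2.2.2 = 2 →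
      Φ (cz s L ε z) = cz s L ε z ∨ ∃ s' L' ε' z', Val s' L' ε' ∧ z'.2.2.2.2.2 = 0 ∧
        Φ (cz s L ε z) = cz s' L' ε' z') := by
  obtain ⟨c, hc⟩ := CB.deep (BG_LG (Q₀ := Q₀) (Γ := Γ))
  refine ⟨4 * c + 8, fun a => ?_⟩
  obtain ⟨C, h1, h2⟩ := hc (a + 3) (lsw 0 1 dT) (lsw_mem _ _ _)
  have hinv : ∀ s L ε Λ k q, Val s L ε → q.2.2.2 = 0 → (psiD Q₀ Γ a)⁻¹ (cfg s L ε Λ k q) = cfg s L ε Λ k q := by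
    intro s L ε Λ k q hv hq
    rw [Equiv.Perm.inv_eq_iff_eq, psiD_lane0 _ hv _ _ hq]
  refine ⟨psiD Q₀ Γ a * C * (psiD Q₀ Γ a)⁻¹, (h1.conj (psiD_NB _)).mono ?_,
    mul_mem (mul_mem (psiD_OHG _) h2.OHG) (inv_mem (psiD_OHG _)), ?_, ?_, ?_⟩
  · rw [show ((a : ℤ) + 3).natAbs = a + 3 by omega, Int.natAbs_natCast]
    nlinarith [Nat.zero_le (c * a)]
  · intro s L ε Λ k q hv hL hq hk
    rw [Equiv.Perm.mul_apply, Equiv.Perm.mul_apply, hinv _ _ _ _ _ _ hv hq, h2 _ _ _ _ _ _ hv, ctl, if_neg]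
    · exact psiD_lane0 _ hv _ _ hq
    · rw [Deep_iff (by omega) hL hv.one_le]; omega
  · intro s L ε Λ k q hv hL hq hk hk'
    rw [Equiv.Perm.mul_apply, Equiv.Perm.mul_apply, hinv _ _ _ _ _ _ hv hq, h2 _ _ _ _ _ _ hv, ctl, if_pos]
    · rw [lsw01_lane0 _ hq, cfg_congr s L ε Λ (k' := k % (2 * L)) _ (by simp)]
      exact psiD_act (by omega) hv Λ q hk hk'
    · rw [Deep_iff (by omega) hL hv.one_le]; omega
  · intro s L ε z hv hz
    exact conj_two h2 (psiD_OHG _) (fun s L ε z hv hz => psiD_lane0 _ hv _ _ hz) hv hz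

end
open scoped commutatorElement

section
variable {Q₀ Γ : Type} [DecidableEq Q₀] [Fintype Q₀]
variable {δ : HeadStep (DecQ Q₀) Γ} {n : ℕ}

theorem eq_zero_of_emod {x M : ℤ} (h : x % M = 0) (h1 : -M < x) (h2 : x < M) : x = 0 :=
  Int.eq_zero_of_abs_lt_dvd (Int.dvd_of_emod_eq_zero h) (abs_lt.2 ⟨h1, h2⟩)

/-- The window of radius `a` around a deep position `κ` of the long belt. -/
theorem addr_deep {s L a κ k j i : ℤ} (h0 : a + 3 ≤ κ) (h1 : κ < L - (a + 3)) (hκ : k % (2 * L) = κ)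
    (hj : j = k + i) (hi : |i| ≤ a) : addr s L j = addr (s + (κ - a)) (2 * a + 1) (a + i) := by
  rw [abs_le] at hi
  rw [addr_congr (s := s) (L := L) (k' := κ + i) (by rw [hj, ← hκ, Int.emod_add_emod]), addr_of_top (by omega) (by omega),
    addr_of_top (by omega) (by omega)]
  congr 1; ring

theorem dsh_Jz (hδ : DSpec δ) (ad : ℤ → ℤ × Bool) (d : ℤ) (z : St Q₀ Γ) :
    dsh d (Jz δ ad n z).2.2 = if z.2.2.2.1 = 0 then d else 0 := by
  have h := duck_Jz (n := n) hδ ad z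
  rw [dsh]
  by_cases hz : z.2.2.2.1 = 0
  · rw [if_pos hz, if_neg fun e => h.1 e hz]
  · rw [if_neg hz, if_pos (h.2 hz)]

/-- The run on lane `0` of long belts when the head starts deep in the top track and is displaced by `d`. -/
theorem exists_deep : ∃ C, ∀ (δ : HeadStep (DecQ Q₀) Γ) (n m a c : ℕ) (π : Equiv.Perm (Cf Q₀ Γ)) (d : ℤ), DSpec δ →
    Disp δ n m → 2 * m + 10 ≤ a → PiSpec δ n (2 * a + 1) π → NB (LG Q₀ Γ) π c → |d| ≤ m →
    ∃ G, NB (LG Q₀ Γ) G (C * (a + c + 1)) ∧ G ∈ OHG Q₀ Γ ∧ Fam δ n (2 * a + 5) G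
      (fun L k k' => k' - k = d ∧ a + 3 ≤ k % (2 * L) ∧ k % (2 * L) < L - (a + 3)) := by
  obtain ⟨c₁, hc₁⟩ := exists_enterD (Q₀ := Q₀) (Γ := Γ)
  obtain ⟨c₂, hc₂⟩ := CB.lenAt (BG_LG (Q₀ := Q₀) (Γ := Γ))
  obtain ⟨c₃, hc₃⟩ := rhoD_NB (Q₀ := Q₀) (Γ := Γ)
  refine ⟨64 * c₂ + 2 * c₁ + 4 * c₃ + 24, fun δ n m a c π d hδ hD ha hπ hc hd => ?_⟩
  obtain ⟨Φ, f1, f2, f3, f4, f5⟩ := hc₁ a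
  have hk₀ := hc₂ (2 * a + 1) (by omega) a
  have hk₁ := hc₂ (2 * a + 1) (by omega) (a + d)
  push_cast at hk₀ hk₁
  obtain ⟨J, j1, j2, j3⟩ := hπ.exists_JF hδ BG_LG hc hk₀ hk₁
  have hdm := abs_le.1 hd
  have fix : ∀ s L ε (z : St Q₀ Γ), Val s L ε → 2 * ((a : ℤ) + 3) ≤ L → z.2.2.2.2.2 = 0 →
      ¬ ((a : ℤ) + 3 ≤ (z.2.1 - dsh d z.2.2) % (2 * L) ∧ (z.2.1 - dsh d z.2.2) % (2 * L) < L - (a + 3)) →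
      (rhoD ^ d * Φ * (rhoD ^ d)⁻¹ : Equiv.Perm (Cf Q₀ Γ)) (cz s L ε z) = cz s L ε z := by
    intro s L ε z hv hL hz hk
    rw [Equiv.Perm.mul_apply, Equiv.Perm.mul_apply, cz, ← zpow_neg, cfg_rhoD_zpow hv,
      show z.2.1 + dsh (-d) z.2.2 = z.2.1 - dsh d z.2.2 by simp only [dsh]; split_ifs <;> ring,
      f3 _ _ _ _ _ _ hv hL hz (by omega), cfg_rhoD_zpow hv]
    congr 1; ring
  have act : ∀ s L ε (z : St Q₀ Γ), Val s L ε → 2 * ((a : ℤ) + 3) ≤ L → z.2.2.2.2.2 = 0 → ∀ κ,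
      (z.2.1 - dsh d z.2.2) % (2 * L) = κ → (a : ℤ) + 3 ≤ κ → κ < L - (a + 3) →
      (rhoD ^ d * Φ * (rhoD ^ d)⁻¹ : Equiv.Perm (Cf Q₀ Γ)) (cz s L ε z) = cz (s + (κ - a)) (2 * a + 1)
        (cutL s (κ - a) (cutR s L (κ + a) ε)) (tr (a + dsh d z.2.2 - z.2.1) 1 z) := by
    intro s L ε z hv hL hz κ hκ h0 h1
    rw [Equiv.Perm.mul_apply, Equiv.Perm.mul_apply, cz, ← zpow_neg, cfg_rhoD_zpow hv,
      show z.2.1 + dsh (-d) z.2.2 = z.2.1 - dsh d z.2.2 by simp only [dsh]; split_ifs <;> ring,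
      f4 _ _ _ _ _ _ hv hL hz (by omega) (by omega), hκ, cfg_rhoD_zpow (psiD_val (by omega) hv h0 h1)]
    rw [cz, tr]
    congr 1
    show (a : ℤ) + dsh d z.2.2 = z.2.1 + (a + dsh d z.2.2 - z.2.1)
    ring
  have win : ∀ s L (z : St Q₀ Γ), 2 * ((a : ℤ) + 3) ≤ L → ∀ κ,
      (z.2.1 - dsh d z.2.2) % (2 * L) = κ → (a : ℤ) + 3 ≤ κ → κ < L - (a + 3) →
      Jz δ (addr (s + (κ - a)) (2 * a + 1)) n (tr (a + dsh d z.2.2 - z.2.1) 1 z) =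
        tr (a + dsh d z.2.2 - z.2.1) 1 (Jz δ (addr s L) n z) := by
    intro s L z hL κ hκ h0 h1
    refine hD.Jz_tr hδ (by omega) _ _ _ fun j hj => ?_
    rw [abs_le] at hj
    have hs : |dsh d z.2.2| ≤ m := by
      rw [dsh]; split_ifs
      · simp
      · exact hd
    rw [abs_le] at hs
    rw [addr_deep (i := j - z.2.1 + dsh d z.2.2) h0 h1 hκ (by ring) (abs_le.2 (by omega))]
    congr 1; ring
  refine ⟨(rhoD ^ d * Φ * (rhoD ^ d)⁻¹)⁻¹ * J * (rhoD ^ d * Φ * (rhoD ^ d)⁻¹),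
    (j1.conj' (f1.conj (hc₃ d))).mono ?_, ?_, Fam.of_enter hδ (by omega) j2 j3 ?_ ?_ ?_⟩
  · have e1 : ((a : ℤ)).natAbs ≤ a := by omega
    have e2 : ((a : ℤ) + d).natAbs ≤ 2 * a := by omega
    have e3 : d.natAbs ≤ a := by omega
    have m1 := Nat.mul_le_mul_left c₂ (Nat.add_le_add_left e1 (2 * a + 1))
    have m2 := Nat.mul_le_mul_left c₂ (Nat.add_le_add_left e2 (2 * a + 1))
    have m3 := Nat.mul_le_mul_right c₃ e3
    nlinarith [Nat.zero_le (c₂ * a), Nat.zero_le (c₂ * c), Nat.zero_le (c₁ * c), Nat.zero_le (c₃ * c), Nat.zero_le (c₃ * a)]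
  · have hΦ := mul_mem (mul_mem (rhoD_zpow_OHG d) f2) (inv_mem (rhoD_zpow_OHG d))
    exact mul_mem (mul_mem (inv_mem hΦ) (JF_OHG hδ j2 j3)) hΦ
  · intro s L ε z hL hv hz hk hs
    obtain ⟨h1, h2, h3⟩ : (Jz δ (addr s L) n z).2.1 - z.2.1 = d ∧ _ := by
      rcases hs with ⟨-, h⟩ | ⟨h, -⟩
      · exact h
      · exact absurd hk h
    have e0 : dsh d z.2.2 = 0 := if_pos hk
    have e1 : dsh d (Jz δ (addr s L) n z).2.2 = d := by rw [dsh_Jz hδ, if_pos hk]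
    have w := win s L z (by omega) _ rfl (by rwa [e0, sub_zero]) (by rwa [e0, sub_zero])
    refine ⟨_, _, _, psiD_val (by omega) hv h2 h3, ?_, ?_, act s L ε z hv (by omega) hz _ (by rw [e0, sub_zero]) h2 h3, ?_⟩
    · rw [tr_lane]; decide
    · refine .inl ⟨hk, ?_, ?_⟩
      · simp only [tr, e0]; ring_nf; simp
      · rw [e0, sub_zero] at w
        rw [e0, w]
        simp only [tr]
        rw [show (Jz δ (addr s L) n z).2.1 + (a + 0 - z.2.1) - (a + d) = 0 by linarith]
        simp
    · rw [act s L ε _ hv (by omega) (by rw [lane_Jz hδ, hz]) _ (by rw [e1, ← h1, sub_sub_cancel]) h2 h3]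
      rw [e0, sub_zero] at w
      rw [e0, w, e1]
      congr 2; linarith
  · intro s L ε z hL hv hz hs
    by_cases hk : (a : ℤ) + 3 ≤ (z.2.1 - dsh d z.2.2) % (2 * L) ∧ (z.2.1 - dsh d z.2.2) % (2 * L) < L - (a + 3)
    · right
      refine ⟨_, _, _, psiD_val (by omega) hv hk.1 hk.2, ?_, act s L ε z hv (by omega) hz _ rfl hk.1 hk.2⟩
      intro hs'
      have hJ := hD.Jz (s := s) (L := L) z (by omega)
      rw [abs_le] at hJ
      rw [Sel, win s L z (by omega) _ rfl hk.1 hk.2] at hs'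
      simp only [tr] at hs'
      rcases hs' with ⟨h1, -, h2⟩ | ⟨h1, h2, -⟩
      · have e0 : dsh d z.2.2 = 0 := if_pos h1
        rw [e0] at h2 hk
        have := eq_zero_of_emod h2 (by omega) (by omega)
        rw [sub_zero] at hk
        exact hs (.inl ⟨h1, by omega, hk⟩)
      · have e0 : dsh d z.2.2 = d := if_neg h1
        rw [e0] at h2 hk
        have := eq_zero_of_emod h2 (by omega) (by omega)
        have e : z.2.1 - d = (Jz δ (addr s L) n z).2.1 := by linarith
        rw [e] at hk
        exact hs (.inr ⟨h1, by omega, hk⟩)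
    · exact .inl (fix s L ε z hv (by omega) hz hk)
  · intro s L ε z hL hv hz
    rw [Equiv.Perm.mul_apply, Equiv.Perm.mul_apply, cz, ← zpow_neg, cfg_rhoD_zpow hv]
    rcases f5 s L ε (z.1, z.2.1 + dsh (-d) z.2.2, z.2.2) hv hz with e | ⟨s', L', ε', z', a1, a2, a3⟩
    · left
      rw [cz] at e
      rw [e, cfg_rhoD_zpow hv]
      congr 1
      simp only [dsh]; split_ifs <;> ring
    · right
      rw [cz] at a3
      refine ⟨s', L', ε', (z'.1, z'.2.1 + dsh d z'.2.2, z'.2.2), a1, a2, ?_⟩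
      rw [a3, cz, cfg_rhoD_zpow a1]
      rfl

/-- The run on lane `0` of long belts when the head starts deep in the top track. -/
theorem exists_deepTop : ∃ C, ∀ (δ : HeadStep (DecQ Q₀) Γ) (n m a c : ℕ) (π : Equiv.Perm (Cf Q₀ Γ)), DSpec δ →
    Disp δ n m → 2 * m + 10 ≤ a → PiSpec δ n (2 * a + 1) π → NB (LG Q₀ Γ) π c →
    ∃ G, NB (LG Q₀ Γ) G ((2 * m + 1) * (C * (a + c + 1))) ∧ G ∈ OHG Q₀ Γ ∧ Fam δ n (2 * a + 5) G
      (fun L k _ => a + 3 ≤ k % (2 * L) ∧ k % (2 * L) < L - (a + 3)) := by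
  obtain ⟨C, hC⟩ := exists_deep (Q₀ := Q₀) (Γ := Γ)
  refine ⟨C, fun δ n m a c π hδ hD ha hπ hc => ?_⟩
  obtain ⟨G, h1, h2, h3⟩ := Fam.finset (H := OHG Q₀ Γ) hδ (Finset.Icc (-(m : ℤ)) m)
    (fun d hd => hC δ n m a c π d hδ hD ha hπ hc (abs_le.2 (Finset.mem_Icc.1 hd)))
    (fun r _ r' _ L k k' h h' => h.1.symm.trans h'.1)
  refine ⟨G, h1.mono (le_of_eq ?_), h2, h3.congr fun s L z hL => ?_⟩
  · rw [Int.card_Icc]; congr 1; omega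
  · have hJ := abs_le.1 (hD.Jz (s := s) (L := L) z (by omega))
    simp only [Sel, Finset.mem_Icc]
    refine or_congr (and_congr_right fun _ => ⟨fun ⟨_, _, _, h⟩ => h, fun h => ⟨_, ?_, rfl, h⟩⟩)
      (and_congr_right fun _ => ⟨fun ⟨_, _, _, h⟩ => h, fun h => ⟨_, ?_, rfl, h⟩⟩) <;> omega

end
open scoped commutatorElement

section
variable {α : Type*} {u : Equiv.Perm α} {X : ℕ → Equiv.Perm α} {x y : α}

theorem sweep_fix {m : ℕ} (h : ∀ t < m, ((u ^ t)⁻¹ * X t * u ^ t) x = x) : sweep u X m x = x := by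
  induction m with
  | zero => rfl
  | succ m ih =>
    rw [sweep, Equiv.Perm.mul_apply, h m (by omega)]
    exact ih fun t ht => h t (by omega)

theorem sweep_act {m t₀ : ℕ} (h₀ : t₀ < m) (h : ((u ^ t₀)⁻¹ * X t₀ * u ^ t₀) x = y)
    (h₁ : ∀ t < m, t₀ < t → ((u ^ t)⁻¹ * X t * u ^ t) x = x)
    (h₂ : ∀ t < t₀, ((u ^ t)⁻¹ * X t * u ^ t) y = y) : sweep u X m x = y := by
  induction m with
  | zero => omega
  | succ m ih =>
    rw [sweep, Equiv.Perm.mul_apply]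
    rcases Nat.lt_succ_iff_lt_or_eq.1 h₀ with h' | rfl
    · rw [h₁ m (by omega) h']
      exact ih h' fun t ht => h₁ t (by omega)
    · rw [h]
      exact sweep_fix h₂
end

section
variable {Q₀ Γ : Type} [DecidableEq Q₀] [Fintype Q₀]
variable {δ : HeadStep (DecQ Q₀) Γ} {n : ℕ}

theorem addr_near {s L ω i : ℤ} (hω : ω ≤ L) (h0 : -ω ≤ i) (h1 : i < ω) : addr s L i = addr s ω i := by
  by_cases hi : 0 ≤ i
  · rw [addr_of_top hi (by omega), addr_of_top hi h1]
  · rw [← addr_congr s L (k := i + 2 * L) (by simp), ← addr_congr s ω (k := i + 2 * ω) (by simp),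
      addr_of_bot (by omega) (by omega), addr_of_bot (by omega) (by omega)]
    congr 1; ring

/-- Cutting the belt at distance `b` to the right of a head in lane `2`. -/
noncomputable def psiN (Q₀ Γ : Type) [DecidableEq Q₀] [Fintype Q₀] (b : ℤ) : Equiv.Perm (Cf Q₀ Γ) :=
  (rhoP ^ b)⁻¹ * kap 2 1 dT * rhoP ^ b

theorem psiN_psiN (b : ℤ) {s L : ℤ} {ε : ℤ → Bool} (hv : Val s L ε) (Λ : ℤ × Bool → Γ) (k : ℤ) (q : DecQ Q₀) :
    (psiN Q₀ Γ b)⁻¹ (cfg s L ε Λ k q) = psiN Q₀ Γ b (cfg s L ε Λ k q) := by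
  simp only [psiN, mul_inv_rev, Equiv.Perm.mul_apply, inv_inv]
  congr 1
  rw [cfg_rho_zpow hv, kap_inv_apply (by decide) (hv.fine _ _ _)]

theorem psiN_fix (b : ℤ) {s L : ℤ} {ε : ℤ → Bool} (hv : Val s L ε) (Λ : ℤ × Bool → Γ) (k : ℤ) {q : DecQ Q₀}
    (h : (q.2.2.2 = 1 → (k + b) % (2 * L) ≠ L - 1) ∧ (q.2.2.2 = 2 → ¬ (k + b) % (2 * L) + 3 < L)) :
    psiN Q₀ Γ b (cfg s L ε Λ k q) = cfg s L ε Λ k q := by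
  simp only [psiN, Equiv.Perm.mul_apply, ← zpow_neg]
  rw [cfg_rho_zpow hv, kap_fix (by decide) hv Λ fun _ _ => h, cfg_rho_zpow hv]
  congr 1; ring

theorem psiN_act (b : ℤ) {s L : ℤ} {ε : ℤ → Bool} (hv : Val s L ε) (Λ : ℤ × Bool → Γ) (k : ℤ) {q : DecQ Q₀}
    (hq : q.2.2.2 = 2) (h0 : 0 ≤ k + b) (h1 : k + b + 3 < L) :
    psiN Q₀ Γ b (cfg s L ε Λ k q) = cfg s (k + b + 1) (cutR s L (k + b) ε) Λ k (wl q 1) := by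
  simp only [psiN, Equiv.Perm.mul_apply, ← zpow_neg]
  rw [cfg_rho_zpow hv, kap_act (by decide) hv Λ h0 h1 rfl hq, cfg_rho_zpow (hv.cutR h0 (by omega))]
  rw [wl]
  congr 1; ring

theorem lsw02_lane0 : ∀ z : PP, z.2.2 = 0 → lsw 0 2 dT z = (z.1, z.2.1, 2) := by decide
theorem lsw02_lane1 : ∀ z : PP, z.2.2 = 1 → lsw 0 2 dT z = z := by decide

/-- The entrance to the initial segment of length `b + 1` at belt position zero. -/
theorem exists_enterN₀ : ∃ c, ∀ b : ℕ, ∃ Φ : Equiv.Perm (Cf Q₀ Γ), NB (LG Q₀ Γ) Φ (c * (b + 1)) ∧ Φ ∈ OHG Q₀ Γ ∧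
    (∀ s L ε Λ k q, Val s L ε → b + 3 < L → q.2.2.2 = 0 → k % (2 * L) = 0 →
      Φ (cfg s L ε Λ k q) = cfg s (b + 1) (cutR s L b ε) Λ 0 (wl q 1)) ∧
    (∀ s L ε Λ k q, Val s L ε → q.2.2.2 = 0 → k % (2 * L) ≠ 0 → Φ (cfg s L ε Λ k q) = cfg s L ε Λ k q) ∧
    (∀ s ε Λ (k : ℤ) q, Val s (b + 1) ε → q.2.2.2 = 1 → k % (2 * (b + 1)) ≠ 0 →
      Φ (cfg s (b + 1) ε Λ k q) = cfg s (b + 1) ε Λ k q) ∧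
    (∀ s L ε Λ k q, Val s L ε → b + 3 < L → q.2.2.2 = 2 → Φ (cfg s L ε Λ k q) = cfg s L ε Λ k q) := by
  refine ⟨Atri * 12 + 4 + 2, fun b => ?_⟩
  obtain ⟨C, h1, h2⟩ := CB.pos0 (BG_LG (Q₀ := Q₀) (Γ := Γ)) (lsw 0 2 dT) (lsw_mem _ _ _)
  have hΨ : NB (LG Q₀ Γ) (psiN Q₀ Γ b) (1 + 2 * b) :=
    (NB.of_mem (kap_LG (by decide) _)).conj' (NB_rho BG_LG b)
  have hO : psiN Q₀ Γ b ∈ OHG Q₀ Γ :=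
    mul_mem (mul_mem (inv_mem (rhoP_zpow_OHG _)) (kap_OHG (by decide) _)) (rhoP_zpow_OHG _)
  have hneg : ∀ s L ε Λ k q, Val s L ε → k % (2 * L) ≠ 0 → C (cfg s L ε Λ k q) = cfg s L ε Λ k q := by
    intro s L ε Λ k q hv hk
    rw [h2 _ _ _ _ _ _ hv, ctl, if_neg hk]; rfl
  have hone : ∀ s L ε Λ k q, Val s L ε → q.2.2.2 = 1 → C (cfg s L ε Λ k q) = cfg s L ε Λ k q := by
    intro s L ε Λ k q hv hq
    rw [h2 _ _ _ _ _ _ hv, ctl]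
    split_ifs
    · rw [lsw02_lane1 _ hq]
    · rfl
  have h0 : ∀ s L ε Λ k q, Val s L ε → q.2.2.2 = 0 → psiN Q₀ Γ b (cfg s L ε Λ k q) = cfg s L ε Λ k q := by
    intro s L ε Λ k q hv hq
    refine psiN_fix _ hv _ _ ⟨fun h => ?_, fun h => ?_⟩ <;> simp [hq] at h
  have key : ∀ x, C ((psiN Q₀ Γ b)⁻¹ x) = (psiN Q₀ Γ b)⁻¹ x → (psiN Q₀ Γ b * C * (psiN Q₀ Γ b)⁻¹) x = x := by
    intro x hx
    rw [Equiv.Perm.mul_apply, Equiv.Perm.mul_apply, hx, Equiv.Perm.inv_def, Equiv.apply_symm_apply]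
  refine ⟨psiN Q₀ Γ b * C * (psiN Q₀ Γ b)⁻¹, (h1.conj hΨ).mono ?_, mul_mem (mul_mem hO h2.OHG) (inv_mem hO),
    ?_, ?_, ?_, ?_⟩
  · nlinarith [Nat.zero_le (Atri * 12 * b)]
  · intro s L ε Λ k q hv hL hq hk
    rw [Equiv.Perm.mul_apply, Equiv.Perm.mul_apply, psiN_psiN _ hv, h0 _ _ _ _ _ _ hv hq, h2 _ _ _ _ _ _ hv, ctl,
      if_pos hk, lsw02_lane0 _ hq, cfg_congr s L ε Λ (k' := 0) _ (by simpa using hk),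
      psiN_act (q := (q.1, q.2.1, q.2.2.1, 2)) _ hv _ _ rfl (by omega) (by omega), zero_add]
    rfl
  · intro s L ε Λ k q hv hq hk
    refine key _ ?_
    rw [psiN_psiN _ hv, h0 _ _ _ _ _ _ hv hq, hneg _ _ _ _ _ _ hv hk]
  · intro s ε Λ k q hv hq hk
    refine key _ ?_
    rw [psiN_psiN _ hv, psiN_fix _ hv, hone _ _ _ _ _ _ hv hq]
    refine ⟨fun _ e => hk ?_, fun h => by simp [hq] at h⟩
    rw [show ((b : ℤ) + 1 - 1) = b % (2 * (b + 1)) by rw [Int.emod_eq_of_lt] <;> omega,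
      Int.emod_eq_emod_iff_emod_sub_eq_zero, add_sub_cancel_right] at e
    exact e
  · intro s L ε Λ k q hv hL hq
    refine key _ ?_
    rw [psiN_psiN _ hv]
    have e1 : (k + b) % (2 * L) % (2 * L) = (k + b) % (2 * L) := by simp
    by_cases hc : (k + b) % (2 * L) + 3 < L
    · have hn := Int.emod_nonneg (k + b) (show 2 * L ≠ 0 by omega)
      rw [cfg_congr s L ε Λ (k' := (k + b) % (2 * L) - b) _ (by rw [Int.emod_sub_emod, add_sub_cancel_right]),
        psiN_act _ hv _ _ hq (by rwa [sub_add_cancel]) (by rwa [sub_add_cancel])]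
      refine hone _ _ _ _ _ _ ?_ rfl
      rw [sub_add_cancel]
      exact hv.cutR hn (by omega)
    · rw [psiN_fix _ hv _ _ ⟨fun h => by simp [hq] at h, fun _ => hc⟩]
      refine hneg _ _ _ _ _ _ hv fun hk => hc ?_
      rw [← Int.emod_add_emod, hk, zero_add, Int.emod_eq_of_lt (by omega) (by omega)]
      exact hL

/-- The entrance to the initial segment of length `b + 1` at belt positions in `[-w, w)`. -/
theorem exists_enterN : ∃ c, ∀ b w : ℕ, w ≤ b → 1 ≤ w → ∃ Φ : Equiv.Perm (Cf Q₀ Γ),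
    NB (LG Q₀ Γ) Φ (c * (b + 1) ^ 2) ∧ Φ ∈ OHG Q₀ Γ ∧
    (∀ s L ε z c, Val s L ε → b + 3 < L → z.2.2.2.2.2 = 0 → c % (2 * L) = 0 → -w ≤ z.2.1 + c → z.2.1 + c < w →
      Φ (cz s L ε z) = cz s (b + 1) (cutR s L b ε) (tr c 1 z)) ∧
    (∀ s L ε z, Val s L ε → b + 3 < L → z.2.2.2.2.2 = 0 →
      (∀ c, c % (2 * L) = 0 → -w ≤ z.2.1 + c → z.2.1 + c < w → False) → Φ (cz s L ε z) = cz s L ε z) ∧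
    (∀ s L ε z, Val s L ε → b + 3 < L → z.2.2.2.2.2 = 2 → Φ (cz s L ε z) = cz s L ε z) := by
  obtain ⟨c, hc⟩ := exists_enterN₀ (Q₀ := Q₀) (Γ := Γ)
  refine ⟨2 * c + 8, fun b w hw hw1 => ?_⟩
  obtain ⟨Φ, f1, f2, f3, f4, f5, f6⟩ := hc b
  -- the conjugate of the sweep and its factors
  set S := sweep (rhoP : Equiv.Perm (Cf Q₀ Γ)) (fun _ => Φ) (2 * w) with hS
  have hconj : ∀ s L ε Λ k (q : DecQ Q₀) s' L' ε' k' q', Val s L ε → Val s' L' ε' →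
      S (cfg s L ε Λ (k - (w - 1)) q) = cfg s' L' ε' Λ (k' - (w - 1)) q' →
      (rhoP ^ ((w : ℤ) - 1) * S * (rhoP ^ ((w : ℤ) - 1))⁻¹ : Equiv.Perm (Cf Q₀ Γ)) (cfg s L ε Λ k q) =
        cfg s' L' ε' Λ k' q' := by
    intro s L ε Λ k q s' L' ε' k' q' hv hv' h
    rw [Equiv.Perm.mul_apply, Equiv.Perm.mul_apply, ← zpow_neg, cfg_rho_zpow hv, ← sub_eq_add_neg, h, cfg_rho_zpow hv']
    congr 1; ring
  have hfac : ∀ (t : ℕ) s L ε Λ k (q : DecQ Q₀) s' L' ε' k' q', Val s L ε → Val s' L' ε' →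
      Φ (cfg s L ε Λ (k + t) q) = cfg s' L' ε' Λ (k' + t) q' →
      ((rhoP ^ t)⁻¹ * Φ * rhoP ^ t : Equiv.Perm (Cf Q₀ Γ)) (cfg s L ε Λ k q) = cfg s' L' ε' Λ k' q' := by
    intro t s L ε Λ k q s' L' ε' k' q' hv hv' h
    rw [Equiv.Perm.mul_apply, Equiv.Perm.mul_apply, ← zpow_natCast, ← zpow_neg, cfg_rho_zpow hv, h, cfg_rho_zpow hv']
    congr 1; ring
  have hfix : ∀ (t : ℕ) s L ε Λ k (q : DecQ Q₀), Val s L ε →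
      Φ (cfg s L ε Λ (k + t) q) = cfg s L ε Λ (k + t) q →
      ((rhoP ^ t)⁻¹ * Φ * rhoP ^ t : Equiv.Perm (Cf Q₀ Γ)) (cfg s L ε Λ k q) = cfg s L ε Λ k q :=
    fun t s L ε Λ k q hv h => hfac t s L ε Λ k q s L ε k q hv hv h
  refine ⟨rhoP ^ ((w : ℤ) - 1) * S * (rhoP ^ ((w : ℤ) - 1))⁻¹,
    ((NB.sweep (NB.of_mem (BG_LG BG_rho)) (fun _ => f1) _).conj (NB_rho BG_LG _)).mono ?_, ?_, ?_, ?_, ?_⟩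
  · rw [show ((w : ℤ) - 1).natAbs = w - 1 by omega]
    have e1 : 2 * w * (2 * 1 + c * (b + 1)) ≤ 2 * b * (2 * 1 + c * (b + 1)) := Nat.mul_le_mul_right _ (by omega)
    nlinarith [Nat.zero_le (c * b), Nat.zero_le b, Nat.sub_le w 1]
  · have hS' : ∀ m, sweep (rhoP : Equiv.Perm (Cf Q₀ Γ)) (fun _ => Φ) m ∈ OHG Q₀ Γ := by
      intro m
      induction m with
      | zero => exact one_mem _
      | succ m ih =>
        have := pow_mem (rhoP_OHG (Q₀ := Q₀) (Γ := Γ)) m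
        exact mul_mem ih (mul_mem (mul_mem (inv_mem this) f2) this)
    exact mul_mem (mul_mem (rhoP_zpow_OHG _) (hS' _)) (inv_mem (rhoP_zpow_OHG _))
  · intro s L ε z c hv hL hz hc h0 h1
    have hv' := hv.cutR (k := b) (by omega) (by omega)
    refine hconj _ _ _ _ _ _ _ _ _ _ _ hv hv' ?_
    obtain ⟨t₀, ht₀⟩ := Int.eq_ofNat_of_zero_le (show 0 ≤ (w : ℤ) - 1 - (z.2.1 + c) by omega)
    refine sweep_act (t₀ := t₀) (by omega) (hfac _ _ _ _ _ _ _ _ _ _ _ _ hv hv' ?_) ?_ ?_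
    · rw [f3 _ _ _ _ _ _ hv hL hz]
      · have : (tr c 1 z).2.1 = z.2.1 + c := rfl
        rw [this]
        congr 1; omega
      · rw [← ht₀, ← Int.dvd_iff_emod_eq_zero] at *
        rw [show z.2.1 - (w - 1) + ((w : ℤ) - 1 - (z.2.1 + c)) = -c by ring]
        exact (dvd_neg).2 hc
    · intro t ht htt
      refine hfix t _ _ _ _ _ _ hv (f4 _ _ _ _ _ _ hv hz fun e => ?_)
      have : (z.2.1 - (w - 1) + t + c) % (2 * L) = 0 := by rw [← Int.emod_add_emod, e, zero_add, hc]
      have := eq_zero_of_emod this (by omega) (by omega)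
      omega
    · intro t ht
      refine hfix t _ _ _ _ _ _ hv' (f5 _ _ _ _ _ hv' rfl fun e => ?_)
      have e' : (tr c 1 z).2.1 = z.2.1 + c := rfl
      have := eq_zero_of_emod e (by omega) (by omega)
      omega
  · intro s L ε z hv hL hz hc
    refine hconj s L ε z.1 z.2.1 z.2.2 s L ε z.2.1 z.2.2 hv hv (sweep_fix fun t ht => hfix t _ _ _ _ _ _ hv ?_)
    refine f4 _ _ _ _ _ _ hv hz fun e => hc (-(z.2.1 - (w - 1) + t)) ?_ (by omega) (by omega)
    rw [← Int.dvd_iff_emod_eq_zero] at *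
    exact (dvd_neg).2 e
  · intro s L ε z hv hL hz
    exact hconj s L ε z.1 z.2.1 z.2.2 s L ε z.2.1 z.2.2 hv hv (sweep_fix fun t ht => hfix t _ _ _ _ _ _ hv
      (f6 _ _ _ _ _ _ hv hL hz))

/-- The run on lane `0` of long belts when the head starts near the left end. -/
theorem exists_nearLeft : ∃ C, ∀ (δ : HeadStep (DecQ Q₀) Γ) (n m a c : ℕ) (π : Equiv.Perm (Cf Q₀ Γ)), DSpec δ →
    Disp δ n m → 2 * m + 10 ≤ a → PiSpec δ n (2 * a + 1) π → NB (LG Q₀ Γ) π c →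
    ∃ G, NB (LG Q₀ Γ) G (C * ((a + 1) ^ 2 + c)) ∧ G ∈ OHG Q₀ Γ ∧ Fam δ n (2 * a + 5) G
      (fun L k _ => (k + (a + 3)) % (2 * L) < 2 * (a + 3)) := by
  obtain ⟨c₁, hc₁⟩ := exists_enterN (Q₀ := Q₀) (Γ := Γ)
  obtain ⟨c₂, hc₂⟩ := CB.lenAt (BG_LG (Q₀ := Q₀) (Γ := Γ))
  obtain ⟨c₃, hc₃⟩ := CB.len (Q₀ := Q₀) (Γ := Γ)
  refine ⟨8 * c₁ + 200 * c₂ + 16 * c₃ + 24, fun δ n m a c π hδ hD ha hπ hc => ?_⟩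
  obtain ⟨Φ, f1, f2, f3, f4, f5⟩ := hc₁ (2 * a) (a + 3 + m) (by omega) (by omega)
  have hk₀ : CB (LG Q₀ Γ) (fun L k => L = 2 * (a : ℤ) + 1 ∧ (k + (a + 3)) % (2 * (2 * (a : ℤ) + 1)) < 2 * (a + 3))
      ((2 * a + 6) * (c₂ * (2 * a + 1 + (a + 3)))) := by
    have := CB.or_finset (F := LG Q₀ Γ) (Finset.Ico (-((a : ℤ) + 3)) (a + 3))
      (χ := fun r L k => L = ((2 * a + 1 : ℕ) : ℤ) ∧ (k - r) % (2 * ((2 * a + 1 : ℕ) : ℤ)) = 0)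
      (c := c₂ * (2 * a + 1 + (a + 3)))
      (fun r hr => (hc₂ (2 * a + 1) (by omega) r).mono (Nat.mul_le_mul_left _ (by rw [Finset.mem_Ico] at hr; omega))) ?_
    · refine (this.congr fun L k _ => ?_).mono (le_of_eq ?_)
      · push_cast
        have g0 := Int.emod_nonneg (k + (a + 3)) (show 2 * (2 * (a : ℤ) + 1) ≠ 0 by omega)
        constructor
        · rintro ⟨r, hr, h1, h2⟩
          rw [Finset.mem_Ico] at hr
          refine ⟨h1, ?_⟩
          have e : (k + (a + 3)) % (2 * (2 * (a : ℤ) + 1)) = r + (a + 3) := by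
            rw [show k + ((a : ℤ) + 3) = (k - r) + (r + (a + 3)) by ring, ← Int.emod_add_emod, h2, zero_add,
              Int.emod_eq_of_lt (by omega) (by omega)]
          omega
        · rintro ⟨h1, h2⟩
          refine ⟨(k + (a + 3)) % (2 * (2 * (a : ℤ) + 1)) - (a + 3), by rw [Finset.mem_Ico]; omega, h1, ?_⟩
          rw [← Int.emod_eq_emod_iff_emod_sub_eq_zero, Int.emod_sub_emod, add_sub_cancel_right]
      · rw [Int.card_Ico]; congr 1; omega
    · rintro r hr r' hr' L k _ ⟨_, h1⟩ ⟨_, h2⟩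
      rw [Finset.mem_Ico] at hr hr'
      push_cast at h1 h2
      have : (r' - r) % (2 * (2 * (a : ℤ) + 1)) = 0 := by
        rw [← Int.dvd_iff_emod_eq_zero] at *
        have := dvd_sub h1 h2
        rwa [show k - r - (k - r') = r' - r by ring] at this
      have := eq_zero_of_emod this (by omega) (by omega)
      omega
  have hk₁ : CB (LG Q₀ Γ) (fun L k => L = 2 * (a : ℤ) + 1 ∧ True) (c₃ * (2 * a + 1)) :=
    (hc₃ (2 * a + 1) (by omega)).congr fun L k _ => by push_cast; simp
  obtain ⟨J, j1, j2, j3⟩ := hπ.exists_JF hδ BG_LG hc hk₀ (K₁ := fun _ => True) hk₁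
  push_cast at f3 f4 f5
  have win : ∀ s L (z : St Q₀ Γ) (c : ℤ), 2 * ((a : ℤ) + 3) ≤ L → c % (2 * L) = 0 →
      -(a + 3 + m) ≤ z.2.1 + c → z.2.1 + c < a + 3 + m →
      Jz δ (addr s (2 * a + 1)) n (tr c 1 z) = tr c 1 (Jz δ (addr s L) n z) := by
    intro s L z c hL hc h0 h1
    refine hD.Jz_tr hδ (by omega) _ _ _ fun j hj => ?_
    rw [abs_le] at hj
    rw [← addr_near (L := L) (ω := 2 * a + 1) (i := j + c) (by omega) (by omega) (by omega)]
    refine addr_congr _ _ ?_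
    rw [← Int.add_emod_emod, hc, add_zero]
  refine ⟨Φ⁻¹ * J * Φ, (j1.conj' f1).mono ?_, mul_mem (mul_mem (inv_mem f2) (JF_OHG hδ j2 j3)) f2,
    Fam.of_enter hδ (by omega) j2 j3 ?_ ?_ ?_⟩
  · nlinarith [Nat.zero_le (c₂ * a), Nat.zero_le (c₂ * c), Nat.zero_le (c₁ * c), Nat.zero_le (c₃ * c), Nat.zero_le (c₃ * a),
      Nat.zero_le (c₁ * a), Nat.zero_le (c₁ * a ^ 2), Nat.zero_le (c₂ * a ^ 2), Nat.zero_le (c₃ * a ^ 2)]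
  · intro s L ε z hL hv hz hk hs
    have hs : (z.2.1 + (a + 3)) % (2 * L) < 2 * ((a : ℤ) + 3) := by
      rcases hs with ⟨-, h⟩ | ⟨h, -⟩
      · exact h
      · exact absurd hk h
    have g0 := Int.emod_nonneg (z.2.1 + (a + 3)) (show 2 * L ≠ 0 by omega)
    obtain ⟨c, hc, hc'⟩ : ∃ c, c % (2 * L) = 0 ∧ z.2.1 + c + (a + 3) = (z.2.1 + (a + 3)) % (2 * L) :=
      ⟨(z.2.1 + (a + 3)) % (2 * L) - (z.2.1 + (a + 3)),
        by rw [← Int.emod_eq_emod_iff_emod_sub_eq_zero]; simp, by ring⟩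
    have hJ := abs_le.1 (hD.Jz (s := s) (L := L) z (by omega))
    refine ⟨s, _, tr c 1 z, hv.cutR (k := 2 * a) (by omega) (by omega), by rw [tr_lane]; decide, .inl ⟨hk, ?_, trivial⟩,
      f3 s L ε z c hv (by omega) hz hc (by omega) (by omega), ?_⟩
    · show (z.2.1 + c + (a + 3)) % (2 * (2 * (a : ℤ) + 1)) < 2 * (a + 3)
      rw [hc', Int.emod_eq_of_lt g0 (by omega)]
      exact hs
    · rw [f3 s L ε _ c hv (by omega) (by rw [lane_Jz hδ, hz]) hc (by omega) (by omega),
        win s L z c (by omega) hc (by omega) (by omega)]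
  · intro s L ε z hL hv hz hs
    by_cases hc : ∃ c, c % (2 * L) = 0 ∧ -((a : ℤ) + 3 + m) ≤ z.2.1 + c ∧ z.2.1 + c < a + 3 + m
    · right
      obtain ⟨c, hc, h0, h1⟩ := hc
      refine ⟨s, _, tr c 1 z, hv.cutR (k := 2 * a) (by omega) (by omega), ?_, f3 s L ε z c hv (by omega) hz hc h0 h1⟩
      intro hs'
      have hJ := abs_le.1 (hD.Jz (s := s) (L := L) z (by omega))
      have key : ∀ k : ℤ, -(2 * m) ≤ k + c + (a + 3) → k + c + (a + 3) < 2 * (a + 3) + 2 * m →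
          (k + c + (a + 3)) % (2 * (2 * (a : ℤ) + 1)) < 2 * (a + 3) → (k + (a + 3)) % (2 * L) < 2 * (a + 3) := by
        intro k g0 g1 g2
        have e : (k + (a + 3)) % (2 * L) = (k + c + (a + 3)) % (2 * L) := by
          rw [show k + c + ((a : ℤ) + 3) = k + (a + 3) + c by ring, ← Int.add_emod_emod (k + (a + 3)), hc, add_zero]
        by_cases g : 0 ≤ k + c + ((a : ℤ) + 3)
        · rw [Int.emod_eq_of_lt g (by omega)] at g2
          rwa [e, Int.emod_eq_of_lt g (by omega)]
        · rw [← Int.add_emod_right, Int.emod_eq_of_lt (by omega) (by omega)] at g2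
          omega
      rw [Sel, win s L z c (by omega) hc h0 h1] at hs'
      simp only [tr] at hs'
      rcases hs' with ⟨h2, h3, -⟩ | ⟨h2, h3, -⟩
      · exact hs (.inl ⟨h2, key _ (by omega) (by omega) h3⟩)
      · exact hs (.inr ⟨h2, key _ (by omega) (by omega) h3⟩)
    · exact .inl (f4 s L ε z hv (by omega) hz fun c g0 g1 g2 => hc ⟨c, g0, g1, g2⟩)
  · exact fun s L ε z hL hv hz => .inl (f5 s L ε z hv (by omega) hz)

end
open scoped commutatorElement

section
variable {Q₀ Γ : Type} [DecidableEq Q₀] [Fintype Q₀]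
variable {δ : HeadStep (DecQ Q₀) Γ} {n : ℕ}

/-- The effect of a half-turn of the belt on addresses. -/
def turnE : ℤ × Bool ≃ ℤ × Bool := Equiv.prodCongr (Equiv.neg ℤ) Equiv.boolNot

def negSgn (g : Bool × Fin 3) : Bool × Fin 3 := (!g.1, g.2)

/-- The effect of a half-turn of a belt of length `L` on head runs. -/
def turnZ (L : ℤ) (z : St Q₀ Γ) : St Q₀ Γ := ez turnE L (gf negSgn) z

theorem addr_turn {s L : ℤ} (hL : 1 ≤ L) (k : ℤ) : addr (-(s + L - 1)) L (k + L) = turnE (addr s L k) := by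
  have e : (k + L) % (2 * L) = (k % (2 * L) + L) % (2 * L) := by simp
  rw [← addr_emod, e, addr_emod]
  rcases exists_addr (s := s) hL k with ⟨h1, h2, h3⟩ | ⟨h1, h2, h3⟩
  · rw [h3, addr_of_bot (by omega) (by omega)]
    simp [turnE]; ring
  · rw [h3, show k % (2 * L) + L = (k % (2 * L) - L) + 2 * L by ring, addr_add_period,
      addr_of_top (by omega) (by omega)]
    simp [turnE]; ring

theorem cz_turn {s L : ℤ} (hL : 1 ≤ L) (ε : ℤ → Bool) (z : St Q₀ Γ) :
    reflP (swapP (cz s L ε z)) = cz (-(s + L - 1)) L (fun j => !ε (-j)) (turnZ L z) := by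
  rw [cz, cfg_swap hL, cfg_refl hL, cz, turnZ, ez]
  rw [show L - 1 - (-1 - z.2.1) = z.2.1 + L by ring]
  rfl

theorem Sel_turn (hδ : DSpec δ) (P : ℤ → ℤ → ℤ → Prop) {s L : ℤ} (hL : 1 ≤ L) (z : St Q₀ Γ) :
    Sel δ n P (-(s + L - 1)) L (turnZ L z) ↔ Sel δ n (fun L k k' => P L (k + L) (k' + L)) s L z := by
  unfold Sel turnZ
  rw [Jz_ez hδ (addr_turn hL)]
  rfl

variable {Lm : ℤ} {G : Equiv.Perm (Cf Q₀ Γ)} {P : ℤ → ℤ → ℤ → Prop}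

/-- Conjugation by the half-turn of every belt. -/
theorem Fam.turn (hδ : DSpec δ) (hm : 0 ≤ Lm) (h : Fam δ n Lm G P) :
    Fam δ n Lm (swapP * (reflP * G * reflP⁻¹) * swapP⁻¹) (fun L k k' => P L (k + L) (k' + L)) := by
  have key : ∀ s L ε (z z' : St Q₀ Γ), Lm < L →
      G (cz (-(s + L - 1)) L (fun j => !ε (-j)) (turnZ L z)) =
        cz (-(s + L - 1)) L (fun j => !ε (-j)) (turnZ L z') →
      (swapP * (reflP * G * reflP⁻¹) * swapP⁻¹ : Equiv.Perm (Cf Q₀ Γ)) (cz s L ε z) = cz s L ε z' := by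
    intro s L ε z z' hL he
    rw [← cz_turn (by omega), ← cz_turn (by omega)] at he
    simp only [Equiv.Perm.mul_apply, reflP_inv, swapP_inv]
    rw [he, reflP_reflP, swapP_swapP]
  refine ⟨fun s L ε z hL hv hz hs => ?_, fun s L ε z hL hv hz hs => ?_, fun s L ε z hL hv hz => ?_⟩
  · apply key s L ε z _ hL
    rw [h.pos _ L _ (turnZ L z) hL hv.refl hz ((Sel_turn hδ P (by omega) z).2 hs), turnZ,
      Jz_ez hδ (addr_turn (by omega))]
    rfl
  · apply key s L ε z _ hL
    exact h.neg _ L _ (turnZ L z) hL hv.refl hz (fun h' => hs ((Sel_turn hδ P (by omega) z).1 h'))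
  · apply key s L ε z _ hL
    exact h.two _ L _ (turnZ L z) hL hv.refl hz

theorem emod_turn {k L : ℤ} (hL : 1 ≤ L) :
    (k % (2 * L) < L ∧ (k + L) % (2 * L) = k % (2 * L) + L) ∨
      (L ≤ k % (2 * L) ∧ (k + L) % (2 * L) = k % (2 * L) - L) := by
  have h0 := Int.emod_nonneg k (show 2 * L ≠ 0 by omega)
  have h1 := Int.emod_lt_of_pos k (show 0 < 2 * L by omega)
  rw [← Int.emod_add_emod]
  rcases lt_or_ge (k % (2 * L)) L with h | h
  · exact Or.inl ⟨h, Int.emod_eq_of_lt (by omega) (by omega)⟩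
  · refine Or.inr ⟨h, ?_⟩
    rw [show k % (2 * L) + L = k % (2 * L) - L + 2 * L by ring, Int.add_emod_right,
      Int.emod_eq_of_lt (by omega) (by omega)]

theorem emod_near {k L h : ℤ} (h1 : 1 ≤ h) (hL : 2 * h ≤ L) :
    (k + h) % (2 * L) < 2 * h ↔ k % (2 * L) < h ∨ 2 * L - h ≤ k % (2 * L) := by
  have h0 := Int.emod_nonneg k (show 2 * L ≠ 0 by omega)
  have h1 := Int.emod_lt_of_pos k (show 0 < 2 * L by omega)
  rw [← Int.emod_add_emod]
  rcases lt_or_ge (k % (2 * L)) (2 * L - h) with h' | h'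
  · rw [Int.emod_eq_of_lt (by omega) (by omega)]
    omega
  · rw [show k % (2 * L) + h = k % (2 * L) + h - 2 * L + 2 * L by ring, Int.add_emod_right,
      Int.emod_eq_of_lt (by omega) (by omega)]
    omega

theorem exists_famAll : ∃ C, ∀ (δ : HeadStep (DecQ Q₀) Γ) (n m a c : ℕ) (π : Equiv.Perm (Cf Q₀ Γ)),
    DSpec δ → Disp δ n m → 2 * m + 10 ≤ a → PiSpec δ n (2 * a + 1) π → NB (LG Q₀ Γ) π c →
    ∃ G, NB (LG Q₀ Γ) G (C * ((2 * m + 1) * (a + c + 1) + (a + 1) ^ 2)) ∧ G ∈ OHG Q₀ Γ ∧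
      Fam δ n (2 * a + 5) G (fun _ _ _ => True) := by
  obtain ⟨C₁, h₁⟩ := exists_deepTop (Q₀ := Q₀) (Γ := Γ)
  obtain ⟨C₂, h₂⟩ := exists_nearLeft (Q₀ := Q₀) (Γ := Γ)
  refine ⟨2 * C₁ + 2 * C₂, fun δ n m a c π hδ hd ha hπ hc => ?_⟩
  obtain ⟨D, hD, hDo, hDf⟩ := h₁ δ n m a c π hδ hd ha hπ hc
  obtain ⟨N, hN, hNo, hNf⟩ := h₂ δ n m a c π hδ hd ha hπ hc
  have hD' := (hD.refl_LG).swap_LG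
  have hN' := (hN.refl_LG).swap_LG
  have hf := ((hDf.mul hδ (hDf.turn hδ (by omega)) ?_).mul hδ
    (hNf.mul hδ (hNf.turn hδ (by omega)) ?_) ?_)
  · refine ⟨_, ((hD.mul hD').mul (hN.mul hN')).mono ?_,
      mul_mem (mul_mem hDo (OHG_swap (OHG_refl hDo))) (mul_mem hNo (OHG_swap (OHG_refl hNo))), hf.congr ?_⟩
    · have : c ≤ (2 * m + 1) * (a + c + 1) := by nlinarith
      nlinarith [Nat.zero_le C₁, Nat.zero_le C₂, Nat.mul_le_mul_left C₂ this, Nat.zero_le (C₁ * (a + 1) ^ 2)]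
    · intro s L z hL
      have : ∀ k : ℤ, ((↑a + 3 ≤ k % (2 * L) ∧ k % (2 * L) < L - (↑a + 3)) ∨
          (↑a + 3 ≤ (k + L) % (2 * L) ∧ (k + L) % (2 * L) < L - (↑a + 3))) ∨
          ((k + (↑a + 3)) % (2 * L) < 2 * (↑a + 3) ∨ (k + L + (↑a + 3)) % (2 * L) < 2 * (↑a + 3)) := by
        intro k
        rw [emod_near (by omega) (by omega), emod_near (by omega) (by omega)]
        have := emod_turn (k := k) (L := L) (by omega)
        have h0 := Int.emod_nonneg k (show 2 * L ≠ 0 by omega)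
        have h1 := Int.emod_lt_of_pos k (show 0 < 2 * L by omega)
        omega
      simp only [Sel, this, and_true]
  · intro L k _ hL h h'
    have := emod_turn (k := k) (L := L) (by omega)
    omega
  · intro L k _ hL h h'
    rw [emod_near (by omega) (by omega)] at h h'
    have := emod_turn (k := k) (L := L) (by omega)
    have h0 := Int.emod_nonneg k (show 2 * L ≠ 0 by omega)
    have h1 := Int.emod_lt_of_pos k (show 0 < 2 * L by omega)
    omega
  · intro L k _ hL h h'
    rw [emod_near (by omega) (by omega), emod_near (by omega) (by omega)] at h'
    have := emod_turn (k := k) (L := L) (by omega)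
    have h0 := Int.emod_nonneg k (show 2 * L ≠ 0 by omega)
    omega

theorem exists_longActs : ∃ C, ∀ (δ : HeadStep (DecQ Q₀) Γ) (n m a c : ℕ) (π : Equiv.Perm (Cf Q₀ Γ)),
    DSpec δ → Disp δ n m → 2 * m + 10 ≤ a → PiSpec δ n (2 * a + 1) π → NB (LG Q₀ Γ) π c →
    ∃ J, NB (LG Q₀ Γ) J (C * ((2 * m + 1) * (a + c + 1) + (a + 1) ^ 2)) ∧
      Acts δ n (fun L _ => 2 * a + 5 < L) J := by
  obtain ⟨C₁, h₁⟩ := exists_famAll (Q₀ := Q₀) (Γ := Γ)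
  obtain ⟨C₂, h₂⟩ := CB.len (Q₀ := Q₀) (Γ := Γ)
  have hF := BG_LG (Q₀ := Q₀) (Γ := Γ)
  refine ⟨6 * C₁ + 6 * (25 * C₂ + 1) + 4, fun δ n m a c π hδ hd ha hπ hc => ?_⟩
  obtain ⟨G, hG, hGo, hGf⟩ := h₁ δ n m a c π hδ hd ha hπ hc
  have hV : CB (LG Q₀ Γ) (fun L _ => 2 * (a : ℤ) + 5 < L) (25 * C₂ * (a + 1) ^ 2 + 1) := by
    refine (((CB.or_finset (Finset.Icc 1 (2 * a + 5)) (χ := fun r L _ => L = ((r : ℕ) : ℤ)) (c := C₂ * (2 * a + 5))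
      (fun r hr => ?_) ?_).not hF).congr fun L k hL => ?_).mono ?_
    · rw [Finset.mem_Icc] at hr
      exact (h₂ r hr.1).mono (Nat.mul_le_mul_left _ hr.2)
    · intro r _ r' _ L k _ h h'
      omega
    · constructor
      · intro h
        by_contra h'
        exact h ⟨L.toNat, Finset.mem_Icc.2 (by omega), by omega⟩
      · rintro h ⟨r, hr, rfl⟩
        rw [Finset.mem_Icc] at hr
        omega
    · simp only [Nat.card_Icc, Nat.add_sub_cancel]
      have : (2 * a + 5) * (2 * a + 5) ≤ 25 * (a + 1) ^ 2 := by nlinarith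
      nlinarith [Nat.mul_le_mul_left C₂ this]
  obtain ⟨J, hJ, hJa⟩ := hGf.exists_long hδ hF hG hGo hV
  refine ⟨J, hJ.mono ?_, hJa⟩
  have : 1 ≤ (a + 1) ^ 2 := Nat.one_le_pow _ _ (by omega)
  nlinarith [Nat.zero_le (C₂ * ((2 * m + 1) * (a + c + 1))), Nat.zero_le ((2 * m + 1) * (a + c + 1))]

theorem exists_shortActs : ∃ C, ∀ (δ : HeadStep (DecQ Q₀) Γ) (n b c : ℕ), DSpec δ →
    (∀ L : ℕ, 1 ≤ L → L ≤ b → ∃ π, PiSpec δ n L π ∧ NB (LG Q₀ Γ) π c) →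
    ∃ J, NB (LG Q₀ Γ) J (b * (C * b + 2 * c)) ∧ Acts δ n (fun L _ => L ≤ b) J := by
  obtain ⟨C, hC⟩ := CB.len (Q₀ := Q₀) (Γ := Γ)
  refine ⟨C, fun δ n b c hδ h => ?_⟩
  suffices hk : ∀ k ≤ b, ∃ J, NB (LG Q₀ Γ) J (k * (C * b + 2 * c)) ∧ Acts δ n (fun L _ => L ≤ k) J from hk b le_rfl
  intro k hk
  induction k with
  | zero => exact ⟨1, NB.one _, ⟨fun s L ε z hv hz => by have := hv.one_le; simp at hz; omega, fun _ _ _ _ _ _ => rfl⟩⟩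
  | succ k ih =>
    obtain ⟨J, hJ, hJa⟩ := ih (by omega)
    obtain ⟨π, hπ, hc⟩ := h (k + 1) (by omega) hk
    obtain ⟨E, hE, hon, hoff⟩ := hπ.exists_J hδ hc (hC (k + 1) (by omega))
    have hEa : Acts δ n (fun L _ => L = ((k + 1 : ℕ) : ℤ)) E :=
      ⟨fun s L ε z hv hz => by subst hz; exact hon s ε z hv, fun s L ε z hv hz => hoff s L ε z hz hv⟩
    refine ⟨J * E, (hJ.mul hE).mono ?_, (hJa.mul hδ hEa fun L _ h h' => ?_).congr fun L _ _ => ?_⟩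
    · nlinarith [Nat.mul_le_mul_left C hk]
    · omega
    · push_cast; omega

/-- On one-head configurations, the power of the belt machine has a short expression. -/
theorem exists_belt_run : ∃ C, ∀ (δ : HeadStep (DecQ Q₀) Γ) (n m c : ℕ), DSpec δ → Disp δ n m →
    (∀ L : ℕ, 1 ≤ L → L ≤ 4 * m + 25 → ∃ π, PiSpec δ n L π ∧ NB (LG Q₀ Γ) π c) →
    ∃ E, NB (LG Q₀ Γ) E (C * ((m + 1) * (m + c + 1))) ∧
      ∀ s L ε z, Val s L ε → E (cz s L ε z) = cz s L ε ((gstep δ (addr s L))^[n] z) := by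
  obtain ⟨C₁, h₁⟩ := exists_longActs (Q₀ := Q₀) (Γ := Γ)
  obtain ⟨C₂, h₂⟩ := exists_shortActs (Q₀ := Q₀) (Γ := Γ)
  refine ⟨200 * C₁ + 625 * C₂ + 51, fun δ n m c hδ hd h => ?_⟩
  obtain ⟨π, hπ, hc⟩ := h (2 * (2 * m + 10) + 1) (by omega) (by omega)
  obtain ⟨J, hJ, hJa⟩ := h₁ δ n m (2 * m + 10) c π hδ hd le_rfl (by exact_mod_cast hπ) hc
  obtain ⟨S, hS, hSa⟩ := h₂ δ n (4 * m + 25) c hδ h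
  have hA := (hJa.mul hδ hSa fun L _ h h' => by push_cast at h h'; omega)
  refine ⟨gt dk * (J * S), ((NB.of_mem (BG_LG (BG_gt dk))).mul (hJ.mul hS)).mono ?_, fun s L ε z hv => ?_⟩
  · generalize hX : (m + 1) * (m + c + 1) = X
    have a1 : (2 * m + 1) * (2 * m + 10 + c + 1) + (2 * m + 10 + 1) ^ 2 ≤ 200 * X := by nlinarith
    have a2 : (4 * m + 25) * (4 * m + 25) ≤ 625 * X := by nlinarith
    have a3 : (4 * m + 25) * c ≤ 25 * X := by nlinarith
    have a4 : 1 ≤ X := by nlinarith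
    nlinarith [Nat.mul_le_mul_left C₁ a1, Nat.mul_le_mul_left C₂ a2]
  · rw [Equiv.Perm.mul_apply, hA.pos s L ε z hv (by push_cast; omega), cz_gt, run_eq]

end
open scoped commutatorElement

section
variable {Q₀ Γ : Type} [DecidableEq Q₀] [Fintype Q₀]
variable {δ : HeadStep (DecQ Q₀) Γ} {n : ℕ}

theorem addr_mem {s L : ℤ} (hL : 1 ≤ L) (k : ℤ) : s ≤ (addr s L k).1 ∧ (addr s L k).1 < s + L := by
  rcases exists_addr (s := s) hL k with ⟨h1, h2, h3⟩ | ⟨h1, h2, h3⟩ <;> rw [h3] <;> constructor <;> simp <;> omega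

theorem IsBlock.eq_of_mem {x : Cf Q₀ Γ} {s e s' e' j : ℤ} (h : IsBlock x s e) (h' : IsBlock x s' e')
    (h1 : s ≤ j) (h2 : j ≤ e) (h3 : s' ≤ j) (h4 : j ≤ e') : s = s' ∧ e = e' := by
  obtain ⟨-, a1, a2, a3⟩ := h
  obtain ⟨-, b1, b2, b3⟩ := h'
  constructor
  · by_contra hne
    rcases lt_or_gt_of_ne hne with hlt | hlt
    · exact a3 (s' - 1) (by omega) (by omega) b1
    · exact b3 (s - 1) (by omega) (by omega) a1
  · by_contra hne
    rcases lt_or_gt_of_ne hne with hlt | hlt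
    · exact b3 e (by omega) hlt a2
    · exact a3 e' (by omega) hlt b2

variable {E : Equiv.Perm (Cf Q₀ Γ)} {c : ℕ}

theorem fix_of_headless (hE : NB (LG Q₀ Γ) E c)
    (hr : ∀ s L ε z, Val s L ε → E (cz s L ε z) = cz s L ε ((gstep δ (addr s L))^[n] z))
    {x : Cf Q₀ Γ} (hx : Fine x) {s e : ℤ} (hb : IsBlock x s e) (hh : ¬ BlockHasHead x s e) (j : ℤ) (h1 : s ≤ j)
    (h2 : j ≤ e) : E x j = x j := by
  obtain ⟨y, hy, hxy, hu, hyb, hloc⟩ := exists_component_isolated hx hb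
  rw [hloc E (hE.mem_subgroup (H := LocG GW) fun _ => LG_loc) j h1 h2, hxy j h1 h2]
  by_cases hn : ∃ i, hd (y i) ≠ none
  · obtain ⟨i, hi⟩ := hn
    obtain ⟨s', e', hb', i1, i2⟩ := hy.exists_block i
    obtain ⟨ε, Λ, k, q, hv, hc⟩ := exists_cfg_of_block hy hb' i1 i2 hi fun j hj => by
      by_contra h
      exact hj (hu j i h hi)
    have hj : j < s' ∨ e' < j := by
      by_contra! hj
      obtain ⟨rfl, rfl⟩ := IsBlock.eq_of_mem hyb hb' h1 h2 hj.1 hj.2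
      exact hh ⟨i, i1, i2, by rw [isHead_iff, hxy i i1 i2]; exact hi⟩
    have hL := hv.one_le
    have hc' : y = cz s' (e' - s' + 1) ε (Λ, k, q) := hc
    rw [hc', hr _ _ _ _ hv]
    have o1 := gstep_outside (s := s') (δ := δ) hL n (Λ, k, q) (j, true) (by simp; omega)
    have o2 := gstep_outside (s := s') (δ := δ) hL n (Λ, k, q) (j, false) (by simp; omega)
    have m1 := addr_mem (s := s') hL ((Λ, k, q) : St Q₀ Γ).2.1
    have m2 := addr_mem (s := s') hL ((gstep δ (addr s' (e' - s' + 1)))^[n] (Λ, k, q)).2.1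
    unfold cz cfg scfg
    rw [if_neg (by omega), if_neg (by omega), if_neg (by omega), if_neg (by omega), o1, o2]
  · push Not at hn
    rw [mem_HFix.1 (hE.mem_subgroup (H := HFix Q₀ Γ) fun _ => LG_HFix) y hn]

theorem run_of_headed (hE : NB (LG Q₀ Γ) E c)
    (hr : ∀ s L ε z, Val s L ε → E (cz s L ε z) = cz s L ε ((gstep δ (addr s L))^[n] z))
    {x : Cf Q₀ Γ} (hx : Fine x) {s e : ℤ} (hb : IsBlock x s e) (hh : BlockHasHead x s e) :
    ∃ ε z, ∀ j, s ≤ j → j ≤ e → x j = cz s (e - s + 1) ε z j ∧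
      E x j = cz s (e - s + 1) ε ((gstep δ (addr s (e - s + 1)))^[n] z) j := by
  obtain ⟨y, hy, hxy, hu, hyb, hloc⟩ := exists_component_isolated hx hb
  obtain ⟨i, i1, i2, hi⟩ := hh
  rw [isHead_iff, hxy i i1 i2] at hi
  obtain ⟨ε, Λ, k, q, hv, hc⟩ := exists_cfg_of_block hy hyb i1 i2 hi fun j hj => by
    by_contra h
    exact hj (hu j i h hi)
  have hc' : y = cz s (e - s + 1) ε (Λ, k, q) := hc
  refine ⟨ε, (Λ, k, q), fun j h1 h2 => ⟨by rw [hxy j h1 h2, hc'], ?_⟩⟩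
  rw [hloc E (hE.mem_subgroup (H := LocG GW) fun _ => LG_loc) j h1 h2, hc', hr _ _ _ _ hv]

theorem plus_cz {s L : ℤ} (ε : ℤ → Bool) (z : St Q₀ Γ) {j : ℤ} (h1 : s ≤ j) (h2 : j < s + L) :
    (cz s L ε z j).plusOrHead = true ↔ j ≤ (addr s L z.2.1).1 := by
  rw [plusOrHead_iff, cz, cfg, hd_scfg, sg_scfg, bit]
  by_cases h : j = (addr s L z.2.1).1
  · simp [← h]
  · rw [if_neg h, if_neg h, if_pos (by omega)]
    simp; omega

theorem minus_cz {s L : ℤ} (ε : ℤ → Bool) (z : St Q₀ Γ) {j : ℤ} (h1 : s ≤ j) (h2 : j < s + L) :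
    (cz s L ε z j).minusOrHead = true ↔ (addr s L z.2.1).1 ≤ j := by
  rw [minusOrHead_iff, cz, cfg, hd_scfg, sg_scfg, bit]
  by_cases h : j = (addr s L z.2.1).1
  · simp [← h]
  · rw [if_neg h, if_neg h, if_pos (by omega)]
    simp

theorem unfoldBlock_congr {x y : Cf Q₀ Γ} {s e : ℤ} (hse : s ≤ e) (h : ∀ j, s ≤ j → j ≤ e → x j = y j) :
    unfoldBlock x s e = unfoldBlock y s e := by
  funext t
  have : NeZero (2 * (e - s + 1).toNat) := ⟨by omega⟩
  have ht := ZMod.val_lt t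
  unfold unfoldBlock
  split_ifs with h'
  · rw [h _ (by omega) (by omega)]
  · rw [h _ (by omega) (by omega)]

theorem actsAsBeltPower_of_run (hδ : DSpec δ) (hE : NB (LG Q₀ Γ) E c)
    (hr : ∀ s L ε z, Val s L ε → E (cz s L ε z) = cz s L ε ((gstep δ (addr s L))^[n] z))
    {x : Cf Q₀ Γ} (hx : AllFiniteBlocks x) : ActsAsBeltPower δ n x (E x) := by
  have hf := fine_of_allFiniteBlocks hx
  have ends : ∀ s e, IsBlock x s e → (E x s).plusOrHead = true ∧ (E x e).minusOrHead = true := by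
    intro s e hb
    have hse := hb.1
    by_cases hh : BlockHasHead x s e
    · obtain ⟨ε, z, h⟩ := run_of_headed hE hr hf hb hh
      rw [(h s le_rfl hse).2, (h e hse le_rfl).2, plus_cz _ _ (by omega) (by omega),
        minus_cz _ _ (by omega) (by omega)]
      have := addr_mem (s := s) (L := e - s + 1) (by omega) ((gstep δ (addr s (e - s + 1)))^[n] z).2.1
      omega
    · rw [fix_of_headless hE hr hf hb hh s le_rfl hse, fix_of_headless hE hr hf hb hh e hse le_rfl]
      have := hb.2.1.2
      rw [sub_add_cancel] at this
      exact ⟨this, hb.2.2.1.1⟩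
  intro s e hb
  have hse := hb.1
  refine ⟨fix_of_headless hE hr hf hb, fun hh => ?_⟩
  obtain ⟨ε, z, h⟩ := run_of_headed hE hr hf hb hh
  have hL : 1 ≤ e - s + 1 := by omega
  refine ⟨⟨hse, ?_, ?_, fun j h1 h2 hc => ?_⟩, ?_, fun j k h1 h2 h3 h4 hk a b sg hj => ?_⟩
  · obtain ⟨s', e', hb', a1, a2⟩ := hx (s - 1)
    have : e' = s - 1 := by
      by_contra hne
      exact hb'.2.2.2 (s - 1) a1 (by omega) hb.2.1
    refine ⟨this ▸ (ends _ _ hb').2, ?_⟩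
    rw [sub_add_cancel]
    exact (ends _ _ hb).1
  · obtain ⟨s', e', hb', a1, a2⟩ := hx (e + 1)
    have : s' = e + 1 := by
      by_contra hne
      exact hb'.2.2.2 e (by omega) (by omega) hb.2.2.1
    exact ⟨(ends _ _ hb).2, this ▸ (ends _ _ hb').1⟩
  · rw [cutAfter, (h j h1 h2.le).2, (h (j + 1) (by omega) (by omega)).2, plus_cz _ _ (by omega) (by omega),
      minus_cz _ _ (by omega) (by omega)] at hc
    omega
  · rw [unfoldBlock_congr hse fun j h1 h2 => (h j h1 h2).2, unfoldBlock_congr hse fun j h1 h2 => (h j h1 h2).1,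
      unfoldBlock_cz hL _ (by omega), unfoldBlock_cz hL _ (by omega),
      stepC_ring_iterate hδ.dir hL (by push_cast; omega)]
  · rw [isHead_iff, (h k h3 h4).2, cz, cfg, hd_scfg] at hk
    have hk' : k = (addr s (e - s + 1) ((gstep δ (addr s (e - s + 1)))^[n] z).2.1).1 := by
      by_contra hne
      rw [if_neg hne] at hk
      exact hk rfl
    rw [(h j h1 h2).2, cz, cfg, scfg, ← hk'] at hj
    by_cases hjk : j = k
    · rw [if_pos hjk] at hj
      split_ifs at hj
    · rw [if_neg hjk, if_pos (by omega)] at hj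
      injection hj with _ _ hj
      rw [← hj, decide_eq_true_iff]

end

theorem cost_bound {C C' K l : ℝ} {m c p : ℕ} (hC : 0 < C) (hC' : 0 < C') (hK : 0 < K) (hl : 1 ≤ l)
    (hm : (m : ℝ) ≤ C * l + C' + 1) (hc : (c : ℝ) ≤ K * (8 * m + 50) ^ p + 1) :
    ((m : ℝ) + 1) * (m + c + 1) ≤
      ((C + C' + 2) * (C + C' + 3) + (C + C' + 2) * K * (50 * (C + C' + 2)) ^ p) * (l ^ (p + 1) + l ^ 2) := by
  set A := C + C' + 2 with hA
  have hm' : (m : ℝ) + 1 ≤ A * l := by nlinarith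
  have hm0 : (0 : ℝ) ≤ m := Nat.cast_nonneg m
  have h1 : (8 * (m : ℝ) + 50) ^ p ≤ (50 * A) ^ p * l ^ p := by
    rw [← mul_pow]
    exact pow_le_pow_left₀ (by positivity) (by nlinarith) p
  have h2 : (m : ℝ) + c + 1 ≤ (A + 1) * l + K * ((50 * A) ^ p * l ^ p) := by nlinarith
  have hA0 : 0 < A := by positivity
  have h3 : (0 : ℝ) ≤ l ^ p := by positivity
  have h4 : (0 : ℝ) ≤ (50 * A) ^ p := by positivity
  calc ((m : ℝ) + 1) * (m + c + 1) ≤ (A * l) * ((A + 1) * l + K * ((50 * A) ^ p * l ^ p)) :=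
        mul_le_mul hm' h2 (by positivity) (by positivity)
    _ = A * (A + 1) * l ^ 2 + A * K * (50 * A) ^ p * l ^ (p + 1) := by ring
    _ ≤ _ := by
        have e1 : 0 ≤ A * (A + 1) * l ^ (p + 1) := by positivity
        have e2 : 0 ≤ A * K * (50 * A) ^ p * l ^ 2 := by positivity
        have e3 : C + C' + 3 = A + 1 := by rw [hA]; ring
        rw [e3]
        nlinarith

end BD

/-- **Lemma.** Let `M₀` be a complete deterministic reversible Turing machine and `M` its
decorated symmetrized version.  Assume: (i) the moving-head action of `M₀` has infinite
order; (ii) the movement function of `M₀` satisfies `m(n) ≤ C·log₂ n + C'`; (iii) for some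
`p ≥ 1` and `K > 0`, for every `ℓ ≥ 2` and `n`, the permutation of `C_ℓ` applying
`(T_{ℓ,M})^n` on duck `d_→` and fixing everything else lies in `G_ℓ` with word norm
`≤ K·ℓ^p`.  Then there is `K' > 0` such that for all `n ≥ 2`, the automorphism `(f_M)^n`
belongs to `G_* ≤ Aut(Σ^ℤ)` with word norm at most `K'·((log₂ n)^(p+1) + (log₂ n)²)`. -/
theorem belt_distortion_of_finitary_distortion
    (Q₀ Γ : Type) [Fintype Q₀] [Fintype Γ] [DecidableEq Q₀] [DecidableEq Γ]
    (M₀ : TMach Q₀ Γ) (h₁ : CompleteDet M₀) (h₂ : CompleteDet M₀.reverse)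
    -- (i) the moving-head action of `M₀` has infinite order
    (hinf : ∀ n : ℕ, 1 ≤ n → ∃ x : ℤ → TSym Q₀ Γ, AtMostOneHeadZ x ∧
      (stepZ (transFun M₀ h₁))^[n] x ≠ x)
    -- (ii) logarithmic movement: any interval fully visited within `n` steps has length
    -- at most `C·log₂ n + C'`
    (hmove : ∃ C C' : ℝ, 0 < C ∧ 0 < C' ∧ ∀ n : ℕ, 1 ≤ n →
      ∀ x : ℤ → TSym Q₀ Γ, AtMostOneHeadZ x → ∀ l r : ℤ,
        (∀ i : ℤ, l ≤ i → i ≤ r → ∃ t : ℕ, t ≤ n ∧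
          (((stepZ (transFun M₀ h₁))^[t] x) i).isRight = true) →
        ((r - l + 1 : ℤ) : ℝ) ≤ C * Real.logb 2 n + C')
    -- (iii) finitary distortion of the decorated symmetrized machine on cyclic tapes
    (p : ℕ) (hp : 1 ≤ p) (K : ℝ) (hK : 0 < K)
    (hcyc : ∀ ℓ : ℕ, 2 ≤ ℓ → ∀ n : ℕ,
      ∃ π : Equiv.Perm (CConf (DecQ Q₀) Γ ℓ),
        π ∈ Subgroup.closure (TMGens (DecQ Q₀) Γ ℓ) ∧
        (∀ w : CConf (DecQ Q₀) Γ ℓ,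
          ((∃ (i : ZMod ℓ) (q₀ : Q₀) (g : Bool × Fin 3) (a : Γ),
              w.1 i = Sum.inr ((q₀, (0 : Fin 2), g), a)) →
            (π w).1 = (stepC (decSymStep M₀ h₁ h₂) ℓ)^[n] w.1) ∧
          ((∀ (i : ZMod ℓ) (q₀ : Q₀) (g : Bool × Fin 3) (a : Γ),
              w.1 i ≠ Sum.inr ((q₀, (0 : Fin 2), g), a)) → π w = w)) ∧
        (wordNorm (TMGens (DecQ Q₀) Γ ℓ) π : ℝ) ≤ K * (ℓ : ℝ) ^ p) :
    -- conclusion: `(f_M)^n ∈ G_*` with word norm `O((log n)^(p+1) + (log n)²)`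
    ∃ K' : ℝ, 0 < K' ∧ ∀ n : ℕ, 2 ≤ n →
      ∃ π : Equiv.Perm (ℤ → BSym (DecQ Q₀) Γ),
        π ∈ Subgroup.closure (BeltGensStar (DecQ Q₀) Γ decSgn decSetSgn) ∧
        (∀ x : ℤ → BSym (DecQ Q₀) Γ, AllFiniteBlocks x →
          ActsAsBeltPower (decSymStep M₀ h₁ h₂) n x (π x)) ∧
        (wordNorm (BeltGensStar (DecQ Q₀) Γ decSgn decSetSgn) π : ℝ) ≤
          K' * ((Real.logb 2 n) ^ (p + 1) + (Real.logb 2 n) ^ 2) := by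
  obtain ⟨C, C', hC, hC', hmv⟩ := hmove
  obtain ⟨c₀, hc₀⟩ := BD.exists_belt_run (Q₀ := Q₀) (Γ := Γ)
  obtain ⟨c₁, hc₁⟩ := BD.exists_LG_bound (Q₀ := Q₀) (Γ := Γ)
  set A := (C + C' + 2) * (C + C' + 3) + (C + C' + 2) * K * (50 * (C + C' + 2)) ^ p with hA
  refine ⟨c₀ * c₁ * A + 1, by positivity, fun n hn => ?_⟩
  have hδ := BD.dspec M₀ h₁ h₂
  set l := Real.logb 2 n with hl
  have hl1 : 1 ≤ l := by
    rw [hl, Real.le_logb_iff_rpow_le (by norm_num) (by positivity), Real.rpow_one]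
    exact_mod_cast hn
  set m := ⌈C * l + C'⌉₊ with hm
  set c := ⌈K * (8 * (m : ℝ) + 50) ^ p⌉₊ with hc
  have hmle : C * l + C' ≤ m := Nat.le_ceil _
  have hd : BD.Disp (decSymStep M₀ h₁ h₂) n m := by
    refine BD.disp_of_move (by omega) fun x hx i r h => ?_
    have := (hmv n (by omega) x hx i r h).trans hmle
    have : r - i + 1 ≤ (m : ℤ) := by exact_mod_cast this
    omega
  obtain ⟨E, hE, hr⟩ := hc₀ _ n m c hδ hd fun L hL hLm => by
    obtain ⟨π, hπ, hw, hcost⟩ := hcyc (2 * L) (by omega) n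
    have hle : wordNorm (TMGens (DecQ Q₀) Γ (2 * L)) π ≤ c := by
      have : (wordNorm (TMGens (DecQ Q₀) Γ (2 * L)) π : ℝ) ≤ c := by
        refine hcost.trans (le_trans ?_ (Nat.le_ceil _))
        refine mul_le_mul_of_nonneg_left (pow_le_pow_left₀ (by positivity) ?_ p) hK.le
        have : (L : ℝ) ≤ 4 * m + 25 := by exact_mod_cast hLm
        push_cast
        linarith
      exact_mod_cast this
    obtain ⟨B, hB, hBs⟩ := BD.exists_piSpec hδ hL hπ hw hle
    exact ⟨B, hBs, hB.subset BD.BG_LG⟩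
  have hN := hE.trans hc₁
  refine ⟨E, hN.mem_closure, fun x hx => BD.actsAsBeltPower_of_run hδ hE hr hx, ?_⟩
  have hb := BD.cost_bound (m := m) (c := c) (p := p) hC hC' hK hl1 (Nat.ceil_lt_add_one (by positivity)).le
    (Nat.ceil_lt_add_one (by positivity)).le
  have hw : (wordNorm (BeltGensStar (DecQ Q₀) Γ decSgn decSetSgn) E : ℝ) ≤
      c₀ * ((m + 1) * (m + c + 1)) * c₁ := by exact_mod_cast hN.wordNorm_le
  have h0 : (0 : ℝ) ≤ c₀ * c₁ := by positivity
  have hS : 0 ≤ l ^ (p + 1) + l ^ 2 := by positivity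
  nlinarith [mul_le_mul_of_nonneg_left hb h0]
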